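/- Let n ≥ 2, 1 < p < ∞ and 1 < 𝔭 < n. Fix pairwise distinct unit vectors ξ₁, …, ξ_m ∈ S^{n-1} that are not contained in any closed hemisphere, and positive numbers c₁, …, c_m. Then there exists a unique ỹ ∈ [0,∞)^m with ((𝔭−1)/(n−𝔭))·Σ_{i=1}^m c_i ỹ_i^p = 1 such that for every y ∈ [0,∞)^m with ((𝔭−1)/(n−𝔭))·Σ_{i=1}^m c_i y_i^p = 1 one has C_𝔭(P(y)) ≤ C_𝔭(P(ỹ)), and equality C_𝔭(P(y)) = C_𝔭(P(ỹ)) holds only when y = ỹ. -/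

import Mathlib

open MeasureTheory Metric Set Filter
open scoped RealInnerProductSpace Pointwise

/-- The electrostatic `𝔭`-capacity of a set `E ⊆ ℝⁿ`:
`C_𝔭(E) = inf { ∫ |∇u|^𝔭 : u ∈ C_c^∞(ℝⁿ), u ≥ 1 on E }`. -/
noncomputable def pCap (n : ℕ) (𝔭 : ℝ) (E : Set (EuclideanSpace ℝ (Fin n))) : ℝ :=
  sInf { c : ℝ | ∃ u : EuclideanSpace ℝ (Fin n) → ℝ,
    ContDiff ℝ (⊤ : ℕ∞) u ∧ HasCompactSupport u ∧ (∀ x ∈ E, 1 ≤ u x) ∧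
    c = ∫ x, ‖fderiv ℝ u x‖ ^ 𝔭 }

/-- The Aleksandrov body (Wulff shape) of a function, via its values on unit vectors. -/
def wulff {n : ℕ} (f : EuclideanSpace ℝ (Fin n) → ℝ) : Set (EuclideanSpace ℝ (Fin n)) :=
  { x | ∀ ξ : EuclideanSpace ℝ (Fin n), ‖ξ‖ = 1 → ⟪x, ξ⟫ ≤ f ξ }

/-- The support function `h_K(x) = sup { ⟪x, y⟫ : y ∈ K }`. -/
noncomputable def suppFn {n : ℕ} (K : Set (EuclideanSpace ℝ (Fin n)))
    (x : EuclideanSpace ℝ (Fin n)) : ℝ :=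
  sSup ((fun y => ⟪x, y⟫) '' K)

/-- Two sets are dilates if one is a positive scalar multiple of the other. -/
def AreDilates {n : ℕ} (A B : Set (EuclideanSpace ℝ (Fin n))) : Prop :=
  ∃ c : ℝ, 0 < c ∧ A = c • B

/-- A convex body: a compact convex set with nonempty interior. -/
def IsConvexBody {n : ℕ} (K : Set (EuclideanSpace ℝ (Fin n))) : Prop :=
  IsCompact K ∧ Convex ℝ K ∧ (interior K).Nonempty

/-- The `L_p` sum of two convex bodies, defined as the Wulff shape of
`(h_K^p + h_L^p)^{1/p}`. -/
noncomputable def lpSum {n : ℕ} (p : ℝ) (K L : Set (EuclideanSpace ℝ (Fin n))) :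
    Set (EuclideanSpace ℝ (Fin n)) :=
  wulff (fun ξ => (suppFn K ξ ^ p + suppFn L ξ ^ p) ^ (1 / p))

/-- The polytope `P(y) = ⋂ᵢ { x : ⟪x, ξᵢ⟫ ≤ yᵢ }`. -/
def polyP {n m : ℕ} (ξ : Fin m → EuclideanSpace ℝ (Fin n)) (y : Fin m → ℝ) :
    Set (EuclideanSpace ℝ (Fin n)) :=
  ⋂ i, { x | ⟪x, ξ i⟫ ≤ y i }

section SPartA
open MeasureTheory Metric Set Filter
open scoped RealInnerProductSpace Pointwise Topology ENNReal NNReal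

namespace PB
set_option linter.unusedSectionVars false

section VecA
variable {F : Type*} [NormedAddCommGroup F] [InnerProductSpace ℝ F]

/-- the `p`-duality map -/
noncomputable def AA (p : ℝ) (a : F) : F := ‖a‖ ^ (p - 2) • a

lemma AA_zero (p : ℝ) : AA p (0 : F) = 0 := by simp [AA]

lemma AA_inner_self {p : ℝ} (hp : 1 < p) (a : F) : ⟪AA p a, a⟫ = ‖a‖ ^ p := by
  by_cases h : a = 0
  · subst h; simp [AA, Real.zero_rpow (by linarith : p ≠ 0)]
  · have h' : 0 < ‖a‖ := norm_pos_iff.mpr h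
    rw [AA, real_inner_smul_left, real_inner_self_eq_norm_sq, ← Real.rpow_natCast,
      ← Real.rpow_add h']
    norm_num

lemma norm_AA {p : ℝ} (hp : 1 < p) (a : F) : ‖AA p a‖ = ‖a‖ ^ (p - 1) := by
  by_cases h : a = 0
  · subst h; simp [AA, Real.zero_rpow (by linarith : p - 1 ≠ 0)]
  · have h' : 0 < ‖a‖ := norm_pos_iff.mpr h
    rw [AA, norm_smul, Real.norm_of_nonneg (by positivity), ← Real.rpow_add_one h'.ne']
    congr 1; ring

lemma AA_smul {p : ℝ} (t : ℝ) (ht : 0 ≤ t) (hp : 1 < p) (a : F) :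
    AA p (t • a) = t ^ (p - 1) • AA p a := by
  rcases ht.eq_or_lt with h | h
  · subst h; simp [AA_zero, Real.zero_rpow (by linarith : p - 1 ≠ 0)]
  · rw [AA, AA, norm_smul, Real.norm_of_nonneg ht, Real.mul_rpow ht (norm_nonneg _), smul_smul,
      smul_smul]
    congr 1
    have : t ^ (p - 1) = t ^ (p - 2) * t := by
      rw [← Real.rpow_add_one h.ne']; congr 1; ring
    rw [this]; ring

lemma AA_neg (p : ℝ) (a : F) : AA p (-a) = -AA p a := by simp [AA]

lemma continuous_AA {p : ℝ} (hp : 1 < p) : Continuous (AA p : F → F) := by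
  rw [continuous_iff_continuousAt]
  intro a
  by_cases h : a = 0
  · subst h
    rw [ContinuousAt, AA_zero, tendsto_zero_iff_norm_tendsto_zero]
    simp_rw [norm_AA hp]
    have : Continuous fun x : F => ‖x‖ ^ (p - 1) :=
      continuous_norm.rpow_const (fun _ => Or.inr (by linarith))
    have h2 := this.tendsto 0
    simpa [Real.zero_rpow (by linarith : p - 1 ≠ 0)] using h2
  · unfold AA
    exact (continuousAt_id.norm.rpow_const (Or.inl (by simpa using h))).smul continuousAt_id

lemma AA_inner_le {p : ℝ} (hp : 1 < p) (a b : F) : ⟪AA p a, b⟫ ≤ ‖a‖ ^ (p - 1) * ‖b‖ := by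
  rw [← norm_AA hp]; exact real_inner_le_norm _ _

lemma abs_AA_inner_le {p : ℝ} (hp : 1 < p) (a b : F) : |⟪AA p a, b⟫| ≤ ‖a‖ ^ (p - 1) * ‖b‖ := by
  rw [← norm_AA hp]; exact abs_real_inner_le_norm _ _

lemma AA_young {p : ℝ} (hp : 1 < p) (a b : F) :
    p * ⟪AA p a, b⟫ ≤ (p - 1) * ‖a‖ ^ p + ‖b‖ ^ p := by
  have h1 := AA_inner_le hp a b
  have hc : (p / (p - 1)).HolderConjugate p := (Real.HolderConjugate.conjExponent hp).symm
  have h2 := Real.young_inequality_of_nonneg (a := ‖a‖ ^ (p - 1)) (b := ‖b‖) (by positivity)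
    (norm_nonneg _) hc
  rw [← Real.rpow_mul (norm_nonneg _)] at h2
  have h3 : (p - 1) * (p / (p - 1)) = p := by field_simp [(by linarith : p - 1 ≠ 0)]
  rw [h3] at h2
  have h4 : p * (‖a‖ ^ p / (p / (p - 1)) + ‖b‖ ^ p / p) = (p - 1) * ‖a‖ ^ p + ‖b‖ ^ p := by
    have : p - 1 ≠ 0 := by linarith
    field_simp
  rw [← h4]
  exact mul_le_mul_of_nonneg_left (h1.trans h2) (by linarith)

lemma norm_rpow_convex {p : ℝ} (hp : 1 < p) (a b : F) :
    ‖a‖ ^ p + p * ⟪AA p a, b - a⟫ ≤ ‖b‖ ^ p := by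
  have := AA_young hp a b
  rw [inner_sub_right, AA_inner_self hp]
  linarith

lemma AA_mono {p : ℝ} (hp : 1 < p) (a b : F) : 0 ≤ ⟪AA p a - AA p b, a - b⟫ := by
  have h1 := norm_rpow_convex hp a b
  have h2 := norm_rpow_convex hp b a
  have : ⟪AA p a - AA p b, a - b⟫ = - ⟪AA p a, b - a⟫ - ⟪AA p b, a - b⟫ := by
    simp only [inner_sub_left, inner_sub_right]; ring
  rw [this]
  nlinarith

lemma AA_strict {p : ℝ} (hp : 1 < p) (a b : F) (h : ⟪AA p a - AA p b, a - b⟫ ≤ 0) : a = b := by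
  have e1 : ⟪AA p a - AA p b, a - b⟫ = ‖a‖ ^ p + ‖b‖ ^ p - ⟪AA p a, b⟫ - ⟪AA p b, a⟫ := by
    simp only [inner_sub_left, inner_sub_right, AA_inner_self hp]; ring
  have i1 := AA_inner_le hp a b
  have i2 := AA_inner_le hp b a
  have ha : ‖a‖ ^ p = ‖a‖ ^ (p - 1) * ‖a‖ := by
    rcases (norm_nonneg a).eq_or_lt with h | h
    · rw [← h]; simp [Real.zero_rpow (by linarith : p ≠ 0)]
    · rw [← Real.rpow_add_one h.ne']; congr 1; ring
  have hb : ‖b‖ ^ p = ‖b‖ ^ (p - 1) * ‖b‖ := by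
    rcases (norm_nonneg b).eq_or_lt with h | h
    · rw [← h]; simp [Real.zero_rpow (by linarith : p ≠ 0)]
    · rw [← Real.rpow_add_one h.ne']; congr 1; ring
  have hle : (‖a‖ ^ (p - 1) - ‖b‖ ^ (p - 1)) * (‖a‖ - ‖b‖) ≤ 0 := by nlinarith
  have hnn : ‖a‖ = ‖b‖ := by
    rcases lt_trichotomy ‖a‖ ‖b‖ with h | h | h
    · have := Real.rpow_lt_rpow (norm_nonneg _) h (by linarith : 0 < p - 1)
      nlinarith
    · exact h
    · have := Real.rpow_lt_rpow (norm_nonneg _) h (by linarith : 0 < p - 1)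
      nlinarith
  have : ⟪AA p a - AA p b, a - b⟫ = ‖a‖ ^ (p - 2) * ‖a - b‖ ^ 2 := by
    rw [AA, AA, ← hnn, ← smul_sub, real_inner_smul_left, real_inner_self_eq_norm_sq]
  rw [this] at h
  by_contra hab
  have h1 : 0 < ‖a - b‖ := norm_pos_iff.mpr (sub_ne_zero.mpr hab)
  have h2 : 0 < ‖a‖ := by
    rcases (norm_nonneg a).eq_or_lt with h | h
    · exfalso; apply hab
      have hb0 : b = 0 := norm_eq_zero.mp (by rw [← hnn]; exact h.symm)
      have ha0 : a = 0 := norm_eq_zero.mp h.symm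
      rw [ha0, hb0]
    · exact h
  have : 0 < ‖a‖ ^ (p - 2) * ‖a - b‖ ^ 2 := by positivity
  linarith

/-- midpoint convexity defect -/
noncomputable def DD (p : ℝ) (a b : F) : ℝ :=
  2⁻¹ * ‖a‖ ^ p + 2⁻¹ * ‖b‖ ^ p - ‖(2⁻¹ : ℝ) • (a + b)‖ ^ p

lemma DD_nonneg {p : ℝ} (hp : 1 < p) (a b : F) : 0 ≤ DD p a b := by
  have h1 := norm_rpow_convex hp ((2⁻¹ : ℝ) • (a + b)) a
  have h2 := norm_rpow_convex hp ((2⁻¹ : ℝ) • (a + b)) b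
  have : a - (2⁻¹ : ℝ) • (a + b) = -(b - (2⁻¹ : ℝ) • (a + b)) := by module
  rw [this, inner_neg_right] at h1
  unfold DD; linarith

lemma DD_eq_zero {p : ℝ} (hp : 1 < p) (a b : F) (h : DD p a b ≤ 0) : a = b := by
  set m := (2⁻¹ : ℝ) • (a + b) with hm
  have h1 := norm_rpow_convex hp m a
  have h2 := norm_rpow_convex hp m b
  have e : a - m = -(b - m) := by rw [hm]; module
  rw [e, inner_neg_right] at h1
  have hD : 2⁻¹ * ‖a‖ ^ p + 2⁻¹ * ‖b‖ ^ p - ‖m‖ ^ p ≤ 0 := h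
  have ea : ‖a‖ ^ p = ‖m‖ ^ p + p * ⟪AA p m, a - m⟫ := by rw [e, inner_neg_right]; linarith
  -- equality in Young
  -- Use the segment: f(a) = f(m) + p <A m, a-m>, use at point mid of m and a
  set q := (2⁻¹ : ℝ) • (a + m) with hq
  have h3 := norm_rpow_convex hp m q
  have h4 := norm_rpow_convex hp q a
  have h5 := norm_rpow_convex hp q m
  have e2 : a - q = -(m - q) := by rw [hq]; module
  have e3 : q - m = (2⁻¹ : ℝ) • (a - m) := by rw [hq]; module
  rw [e2, inner_neg_right] at h4
  have e4 : m - q = -((2⁻¹ : ℝ) • (a - m)) := by rw [hq]; module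
  have h7 : ⟪AA p q - AA p m, q - m⟫ ≤ 0 := by
    have : ⟪AA p q - AA p m, q - m⟫ = ⟪AA p q, q - m⟫ - ⟪AA p m, q - m⟫ := by
      rw [inner_sub_left]
    rw [this, e3]
    rw [e4, inner_neg_right] at h5
    rw [e4, inner_neg_right, neg_neg] at h4
    have e5 : ⟪AA p m, (2⁻¹ : ℝ) • (a - m)⟫ = 2⁻¹ * ⟪AA p m, a - m⟫ := by
      rw [real_inner_smul_right]
    rw [e3, e5] at h3
    rw [e5]
    nlinarith
  have h8 := AA_strict hp q m h7
  have h9 : (2⁻¹ : ℝ) • (a - m) = 0 := by rw [← e3, h8, sub_self]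
  have h10 : a = m := by
    have := (smul_eq_zero.mp h9).resolve_left (by norm_num)
    exact sub_eq_zero.mp this
  have h11 : a - b = (2 : ℝ) • (a - m) := by rw [hm]; module
  rw [← h10, sub_self, smul_zero] at h11
  exact sub_eq_zero.mp h11

lemma DD_smul {p : ℝ} (t : ℝ) (ht : 0 ≤ t) (a b : F) : DD p (t • a) (t • b) = t ^ p * DD p a b := by
  unfold DD
  rw [← smul_add, smul_comm, norm_smul t a, norm_smul t b, norm_smul t ((2⁻¹ : ℝ) • (a + b)),
    Real.norm_of_nonneg ht, Real.mul_rpow ht (norm_nonneg _), Real.mul_rpow ht (norm_nonneg _),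
    Real.mul_rpow ht (norm_nonneg _)]
  ring

lemma continuous_norm_rpow {p : ℝ} (hp : 1 < p) : Continuous fun x : F => ‖x‖ ^ p :=
  continuous_norm.rpow_const (fun _ => Or.inr (by linarith))

lemma DD_unif [FiniteDimensional ℝ F] {p : ℝ} (hp : 1 < p) (ε : ℝ) (hε : 0 < ε) :
    ∃ C : ℝ, 0 ≤ C ∧ ∀ a b : F, ‖a - b‖ ^ p ≤ ε * (‖a‖ ^ p + ‖b‖ ^ p) + C * DD p a b := by
  have : ProperSpace F := FiniteDimensional.proper ℝ F
  have hcD : Continuous fun z : F × F => DD p z.1 z.2 := by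
    unfold DD
    have h := continuous_norm_rpow (F := F) hp
    exact ((continuous_const.mul (h.comp continuous_fst)).add
      (continuous_const.mul (h.comp continuous_snd))).sub
      (h.comp ((continuous_fst.add continuous_snd).const_smul (2⁻¹ : ℝ)))
  have hcd : Continuous fun z : F × F => ‖z.1 - z.2‖ ^ p :=
    (continuous_norm_rpow hp).comp (continuous_fst.sub continuous_snd)
  have hcs : Continuous fun z : F × F => ‖z.1‖ ^ p + ‖z.2‖ ^ p :=
    ((continuous_norm_rpow hp).comp continuous_fst).add ((continuous_norm_rpow hp).comp continuous_snd)
  set S : Set (F × F) := {z | ‖z.1‖ ^ p + ‖z.2‖ ^ p = 1 ∧ ε ≤ ‖z.1 - z.2‖ ^ p} with hS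
  have hp0 : 0 < p := by linarith
  have hb : ∀ z ∈ S, ‖z.1‖ ≤ 1 ∧ ‖z.2‖ ≤ 1 := by
    rintro z ⟨h1, -⟩
    have a1 : 0 ≤ ‖z.1‖ ^ p := by positivity
    have a2 : 0 ≤ ‖z.2‖ ^ p := by positivity
    constructor
    · by_contra! h
      have := Real.one_lt_rpow h hp0
      linarith
    · by_contra! h
      have := Real.one_lt_rpow h hp0
      linarith
  have hSc : IsCompact S := by
    refine Metric.isCompact_of_isClosed_isBounded ?_ ?_
    · exact (isClosed_eq hcs continuous_const).inter (isClosed_le continuous_const hcd)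
    · refine (Metric.isBounded_iff_subset_closedBall 0).mpr ⟨1, fun z hz => ?_⟩
      simp only [mem_closedBall, dist_zero_right]
      exact max_le (hb z hz).1 (hb z hz).2
  have hmin : ∃ d : ℝ, 0 < d ∧ ∀ z ∈ S, d ≤ DD p z.1 z.2 := by
    rcases S.eq_empty_or_nonempty with h | h
    · exact ⟨1, one_pos, by simp [h]⟩
    · obtain ⟨z, hz, hzm⟩ := hSc.exists_isMinOn h hcD.continuousOn
      refine ⟨DD p z.1 z.2, ?_, fun w hw => hzm hw⟩
      by_contra! hle
      have := DD_eq_zero hp _ _ hle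
      have h2 := hz.2
      rw [this, sub_self, norm_zero, Real.zero_rpow hp0.ne'] at h2
      linarith
  obtain ⟨d, hd, hdm⟩ := hmin
  refine ⟨2 ^ p / d, by positivity, fun a b => ?_⟩
  set N := ‖a‖ ^ p + ‖b‖ ^ p with hN
  have hN0 : 0 ≤ N := by positivity
  rcases hN0.eq_or_lt with h0 | hpos
  · have a1 : 0 ≤ ‖a‖ ^ p := by positivity
    have a2 : 0 ≤ ‖b‖ ^ p := by positivity
    have ha : a = 0 := by
      have : ‖a‖ ^ p = 0 := by linarith
      exact norm_eq_zero.mp ((Real.rpow_eq_zero (norm_nonneg _) hp0.ne').mp this)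
    have hb' : b = 0 := by
      have : ‖b‖ ^ p = 0 := by linarith
      exact norm_eq_zero.mp ((Real.rpow_eq_zero (norm_nonneg _) hp0.ne').mp this)
    subst ha; subst hb'
    have := DD_nonneg hp (0 : F) 0
    rw [← h0]; simp [Real.zero_rpow hp0.ne']; positivity
  · -- scale
    set t := N ^ (p⁻¹) with ht
    have htp : 0 < t := by positivity
    have htN : t ^ p = N := by rw [ht, ← Real.rpow_mul hN0, inv_mul_cancel₀ hp0.ne', Real.rpow_one]
    obtain ⟨a', ea⟩ : ∃ a', a = t • a' :=
      ⟨t⁻¹ • a, by rw [smul_smul, mul_inv_cancel₀ htp.ne', one_smul]⟩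
    obtain ⟨b', eb⟩ : ∃ b', b = t • b' :=
      ⟨t⁻¹ • b, by rw [smul_smul, mul_inv_cancel₀ htp.ne', one_smul]⟩
    have hsum : ‖a'‖ ^ p + ‖b'‖ ^ p = 1 := by
      have : N = N * (‖a'‖ ^ p + ‖b'‖ ^ p) := by
        conv_lhs => rw [hN, ea, eb, norm_smul, norm_smul, Real.norm_of_nonneg htp.le,
          Real.mul_rpow htp.le (norm_nonneg _), Real.mul_rpow htp.le (norm_nonneg _), htN]
        ring
      field_simp at this
      linarith
    have e1 : ‖a - b‖ ^ p = N * ‖a' - b'‖ ^ p := by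
      conv_lhs => rw [ea, eb, ← smul_sub, norm_smul, Real.norm_of_nonneg htp.le,
        Real.mul_rpow htp.le (norm_nonneg _), htN]
    have e2 : DD p a b = N * DD p a' b' := by
      conv_lhs => rw [ea, eb, DD_smul t htp.le, htN]
    rw [e1, e2]
    have key : ‖a' - b'‖ ^ p ≤ ε + 2 ^ p / d * DD p a' b' := by
      have hD0 := DD_nonneg hp a' b'
      by_cases hc : ε ≤ ‖a' - b'‖ ^ p
      · have hz : (a', b') ∈ S := ⟨hsum, hc⟩
        have h1 := hdm _ hz
        have h2 := hb _ hz
        have h3 : ‖a' - b'‖ ≤ 2 := (norm_sub_le _ _).trans (by linarith [h2.1, h2.2])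
        have h4 : ‖a' - b'‖ ^ p ≤ 2 ^ p := Real.rpow_le_rpow (norm_nonneg _) h3 hp0.le
        have h5 : (2 : ℝ) ^ p ≤ 2 ^ p / d * DD p a' b' := by
          rw [div_mul_eq_mul_div, le_div_iff₀ hd]
          exact mul_le_mul_of_nonneg_left h1 (by positivity)
        linarith
      · push Not at hc
        have : 0 ≤ 2 ^ p / d * DD p a' b' := by positivity
        linarith
    nlinarith

end VecA
end PB

end SPartA

section SPartB1
open MeasureTheory Metric Set Filter
open scoped RealInnerProductSpace Pointwise Topology ENNReal NNReal

namespace PB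
set_option linter.unusedSectionVars false

/-- Euclidean space -/
abbrev EE (n : ℕ) := EuclideanSpace ℝ (Fin n)

section Grad
variable {F : Type*} [NormedAddCommGroup F] [InnerProductSpace ℝ F] [CompleteSpace F]

lemma norm_grad (f : F → ℝ) (x : F) : ‖gradient f x‖ = ‖fderiv ℝ f x‖ := by
  unfold gradient; simp

lemma grad_of_hasFDerivAt {f : F → ℝ} {x : F} {L : F →L[ℝ] ℝ} {g : F} (h : HasFDerivAt f L x)
    (hg : ∀ y, L y = ⟪g, y⟫) : gradient f x = g := by
  unfold gradient
  rw [h.fderiv]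
  apply ext_inner_right ℝ
  intro y
  rw [InnerProductSpace.toDual_symm_apply, hg]

lemma grad_add {f g : F → ℝ} {x : F} (hf : DifferentiableAt ℝ f x) (hg : DifferentiableAt ℝ g x) :
    gradient (fun y => f y + g y) x = gradient f x + gradient g x :=
  grad_of_hasFDerivAt (hf.hasFDerivAt.add hg.hasFDerivAt)
    (fun y => by simp [inner_add_left, inner_gradient_left])

lemma grad_sub {f g : F → ℝ} {x : F} (hf : DifferentiableAt ℝ f x) (hg : DifferentiableAt ℝ g x) :
    gradient (fun y => f y - g y) x = gradient f x - gradient g x :=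
  grad_of_hasFDerivAt (hf.hasFDerivAt.sub hg.hasFDerivAt)
    (fun y => by simp [inner_sub_left, inner_gradient_left])

lemma grad_const_mul {f : F → ℝ} {x : F} (hf : DifferentiableAt ℝ f x) (c : ℝ) :
    gradient (fun y => c * f y) x = c • gradient f x :=
  grad_of_hasFDerivAt (hf.hasFDerivAt.const_mul c)
    (fun y => by simp [inner_smul_left, inner_gradient_left])

lemma grad_mul {f g : F → ℝ} {x : F} (hf : DifferentiableAt ℝ f x) (hg : DifferentiableAt ℝ g x) :
    gradient (fun y => f y * g y) x = f x • gradient g x + g x • gradient f x :=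
  grad_of_hasFDerivAt (hf.hasFDerivAt.mul hg.hasFDerivAt)
    (fun y => by simp [inner_add_left, inner_smul_left, inner_gradient_left])

lemma grad_comp {f : F → ℝ} {x : F} {θ : ℝ → ℝ} (hf : DifferentiableAt ℝ f x)
    (hθ : DifferentiableAt ℝ θ (f x)) :
    gradient (fun y => θ (f y)) x = deriv θ (f x) • gradient f x :=
  grad_of_hasFDerivAt (hθ.hasDerivAt.comp_hasFDerivAt x hf.hasFDerivAt)
    (fun y => by simp [inner_smul_left, inner_gradient_left])

lemma grad_const_add {f : F → ℝ} {x : F} (c : ℝ) :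
    gradient (fun y => c + f y) x = gradient f x := by
  unfold gradient
  rw [fderiv_const_add]

lemma continuous_grad {f : F → ℝ} (hf : ContDiff ℝ 1 f) : Continuous (gradient f) :=
  (LinearIsometryEquiv.continuous _).comp (hf.continuous_fderiv one_ne_zero)

lemma hasCompactSupport_grad {f : F → ℝ} (hf : HasCompactSupport f) :
    HasCompactSupport (gradient f) := by
  have := hf.fderiv (𝕜 := ℝ)
  exact this.comp_left (g := (InnerProductSpace.toDual ℝ F).symm) (map_zero _)

end Grad

variable {n : ℕ}

/-- compactly supported `C¹` functions -/
structure C1c (f : EE n → ℝ) : Prop where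
  cd : ContDiff ℝ 1 f
  cs : HasCompactSupport f

namespace C1c
variable {f g : EE n → ℝ}

lemma diff (hf : C1c f) (x : EE n) : DifferentiableAt ℝ f x :=
  (hf.cd.differentiable one_ne_zero) x

lemma cont (hf : C1c f) : Continuous f := hf.cd.continuous

lemma contg (hf : C1c f) : Continuous (gradient f) := continuous_grad hf.cd

lemma csg (hf : C1c f) : HasCompactSupport (gradient f) := hasCompactSupport_grad hf.cs

lemma memLp (hf : C1c f) (q : ℝ≥0∞) : MemLp f q volume :=
  hf.cont.memLp_of_hasCompactSupport hf.cs

lemma memLpg (hf : C1c f) (q : ℝ≥0∞) : MemLp (gradient f) q volume :=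
  hf.contg.memLp_of_hasCompactSupport hf.csg

lemma add (hf : C1c f) (hg : C1c g) : C1c (fun x => f x + g x) :=
  ⟨hf.cd.add hg.cd, hf.cs.add hg.cs⟩

lemma const_mul (hf : C1c f) (c : ℝ) : C1c (fun x => c * f x) :=
  ⟨contDiff_const.mul hf.cd, hf.cs.mul_left⟩

lemma sub (hf : C1c f) (hg : C1c g) : C1c (fun x => f x - g x) := by
  have := hf.add (hg.const_mul (-1))
  simpa [sub_eq_add_neg] using this

lemma mul (hf : C1c f) (hg : C1c g) : C1c (fun x => f x * g x) :=
  ⟨hf.cd.mul hg.cd, hf.cs.mul_right⟩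

lemma comp (hf : C1c f) {θ : ℝ → ℝ} (hθ : ContDiff ℝ 1 θ) (h0 : θ 0 = 0) :
    C1c (fun x => θ (f x)) :=
  ⟨hθ.comp hf.cd, hf.cs.comp_left h0⟩

lemma zero : C1c (fun _ : EE n => (0 : ℝ)) := ⟨contDiff_const, HasCompactSupport.zero⟩

end C1c

section Lp
variable {F : Type*} [NormedAddCommGroup F] {p : ℝ}

lemma P_ne_zero (hp : 1 < p) : ENNReal.ofReal p ≠ 0 := by simp; linarith
lemma P_ne_top : ENNReal.ofReal p ≠ ⊤ := ENNReal.ofReal_ne_top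
lemma P_toReal (hp : 1 < p) : (ENNReal.ofReal p).toReal = p := ENNReal.toReal_ofReal (by linarith)
lemma one_le_P (hp : 1 < p) : 1 ≤ ENNReal.ofReal p := by
  rw [← ENNReal.ofReal_one]; exact ENNReal.ofReal_le_ofReal hp.le

lemma int_rpow (hp : 1 < p) {f : EE n → F} (hf : MemLp f (ENNReal.ofReal p) volume) :
    Integrable (fun x => ‖f x‖ ^ p) := by
  have := hf.integrable_norm_rpow (P_ne_zero hp) P_ne_top
  rwa [P_toReal hp] at this

lemma integral_rpow_eq (hp : 1 < p) {f : EE n → F} (hf : MemLp f (ENNReal.ofReal p) volume) :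
    ∫ x, ‖f x‖ ^ p = (eLpNorm f (ENNReal.ofReal p) volume).toReal ^ p := by
  rw [hf.eLpNorm_eq_integral_rpow_norm (P_ne_zero hp) P_ne_top, P_toReal hp]
  have h0 : 0 ≤ ∫ x, ‖f x‖ ^ p := integral_nonneg (fun x => by positivity)
  rw [ENNReal.toReal_ofReal (by positivity), ← Real.rpow_mul h0, inv_mul_cancel₀ (by linarith),
    Real.rpow_one]

lemma eLpNorm_eq_ofReal (hp : 1 < p) {f : EE n → F} (hf : MemLp f (ENNReal.ofReal p) volume) :
    eLpNorm f (ENNReal.ofReal p) volume = ENNReal.ofReal ((∫ x, ‖f x‖ ^ p) ^ p⁻¹) := by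
  rw [hf.eLpNorm_eq_integral_rpow_norm (P_ne_zero hp) P_ne_top, P_toReal hp]

lemma tendsto_eLp_of_int (hp : 1 < p) {f : ℕ → EE n → F}
    (hf : ∀ k, MemLp (f k) (ENNReal.ofReal p) volume)
    (h : Tendsto (fun k => ∫ x, ‖f k x‖ ^ p) atTop (𝓝 0)) :
    Tendsto (fun k => eLpNorm (f k) (ENNReal.ofReal p) volume) atTop (𝓝 0) := by
  have h2 : Tendsto (fun k => ENNReal.ofReal ((∫ x, ‖f k x‖ ^ p) ^ p⁻¹)) atTop (𝓝 0) := by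
    have h3 := h.rpow_const (p := p⁻¹) (Or.inr (by positivity))
    rw [Real.zero_rpow (by positivity)] at h3
    have := ENNReal.tendsto_ofReal h3
    simpa using this
  exact h2.congr (fun k => (eLpNorm_eq_ofReal hp (hf k)).symm)

lemma tendsto_int_of_eLp (hp : 1 < p) {f : ℕ → EE n → F} {g : EE n → F}
    (hf : ∀ k, MemLp (f k) (ENNReal.ofReal p) volume) (hg : MemLp g (ENNReal.ofReal p) volume)
    (h : Tendsto (fun k => eLpNorm (fun x => f k x - g x) (ENNReal.ofReal p) volume) atTop (𝓝 0)) :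
    Tendsto (fun k => ∫ x, ‖f k x‖ ^ p) atTop (𝓝 (∫ x, ‖g x‖ ^ p)) := by
  have h1 : Tendsto (fun k => (eLpNorm (f k) (ENNReal.ofReal p) volume).toReal) atTop
      (𝓝 (eLpNorm g (ENNReal.ofReal p) volume).toReal) := by
    have h2 : Tendsto (fun k => (eLpNorm (fun x => f k x - g x) (ENNReal.ofReal p) volume).toReal)
        atTop (𝓝 0) := by
      have := (ENNReal.tendsto_toReal ENNReal.zero_ne_top).comp h
      simpa [Function.comp_def] using this
    rw [tendsto_iff_dist_tendsto_zero]
    refine squeeze_zero (fun _ => dist_nonneg) (fun k => ?_) h2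
    rw [Real.dist_eq, abs_sub_le_iff]
    have hs : MemLp (fun x => f k x - g x) (ENNReal.ofReal p) volume := (hf k).sub hg
    have a1 : eLpNorm (f k) (ENNReal.ofReal p) volume ≤
        eLpNorm (fun x => f k x - g x) (ENNReal.ofReal p) volume +
        eLpNorm g (ENNReal.ofReal p) volume := by
      have := eLpNorm_add_le hs.1 hg.1 (one_le_P hp)
      refine le_trans (le_of_eq ?_) this
      congr 1; ext x; simp
    have a2 : eLpNorm g (ENNReal.ofReal p) volume ≤
        eLpNorm (f k) (ENNReal.ofReal p) volume +
        eLpNorm (fun x => f k x - g x) (ENNReal.ofReal p) volume := by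
      have := eLpNorm_sub_le (hf k).1 hs.1 (one_le_P hp)
      refine le_trans (le_of_eq ?_) this
      congr 1; ext x; simp
    have b1 := ENNReal.toReal_mono (by finiteness [hs.2.ne, hg.2.ne]) a1
    have b2 := ENNReal.toReal_mono (by finiteness [hs.2.ne, (hf k).2.ne]) a2
    rw [ENNReal.toReal_add hs.2.ne hg.2.ne] at b1
    rw [ENNReal.toReal_add (hf k).2.ne hs.2.ne] at b2
    constructor <;> linarith
  have h3 := h1.rpow_const (p := p) (Or.inr (by linarith))
  rw [integral_rpow_eq hp hg]
  exact h3.congr (fun k => (integral_rpow_eq hp (hf k)).symm)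

/-- dominated convergence in `L^p` -/
lemma tendsto_eLp_dct (hp : 1 < p) {f : ℕ → EE n → F} {g : EE n → ℝ}
    (hf : ∀ k, AEStronglyMeasurable (f k) volume) (hg : MemLp g (ENNReal.ofReal p) volume)
    (hb : ∀ k, ∀ᵐ x, ‖f k x‖ ≤ g x)
    (hl : ∀ᵐ x, Tendsto (fun k => f k x) atTop (𝓝 0)) :
    Tendsto (fun k => eLpNorm (f k) (ENNReal.ofReal p) volume) atTop (𝓝 0) := by
  have hm : ∀ k, MemLp (f k) (ENNReal.ofReal p) volume := fun k =>
    hg.mono (hf k) ((hb k).mono fun x hx => hx.trans (le_abs_self _))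
  apply tendsto_eLp_of_int hp hm
  have h0 : (0 : ℝ) = ∫ _ : EE n, (0 : ℝ) := by simp
  rw [h0]
  refine tendsto_integral_of_dominated_convergence (fun x => ‖g x‖ ^ p)
    (fun k => (int_rpow hp (hm k)).1) (int_rpow hp hg) (fun k => ?_) ?_
  · filter_upwards [hb k] with x hx
    rw [Real.norm_of_nonneg (by positivity)]
    exact Real.rpow_le_rpow (norm_nonneg _) (hx.trans (le_abs_self _)) (by linarith)
  · filter_upwards [hl] with x hx
    have := (hx.norm).rpow_const (p := p) (Or.inr (by linarith))
    simpa [Real.zero_rpow (by linarith : p ≠ 0)] using this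

lemma tendsto_eLp_add (hp : 1 < p) {f g : ℕ → EE n → F}
    (hf : ∀ k, AEStronglyMeasurable (f k) volume) (hg : ∀ k, AEStronglyMeasurable (g k) volume)
    (h1 : Tendsto (fun k => eLpNorm (f k) (ENNReal.ofReal p) volume) atTop (𝓝 0))
    (h2 : Tendsto (fun k => eLpNorm (g k) (ENNReal.ofReal p) volume) atTop (𝓝 0)) :
    Tendsto (fun k => eLpNorm (fun x => f k x + g k x) (ENNReal.ofReal p) volume) atTop (𝓝 0) := by
  have h3 := h1.add h2
  rw [add_zero] at h3
  exact tendsto_of_tendsto_of_tendsto_of_le_of_le tendsto_const_nhds h3 (fun _ => zero_le)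
    (fun k => eLpNorm_add_le (hf k) (hg k) (one_le_P hp))

lemma tendsto_eLp_bdd {F' : Type*} [NormedAddCommGroup F'] {f : ℕ → EE n → F} {g : ℕ → EE n → F'}
    (C : ℝ) (hb : ∀ k, ∀ᵐ x, ‖f k x‖ ≤ C * ‖g k x‖)
    (h : Tendsto (fun k => eLpNorm (g k) (ENNReal.ofReal p) volume) atTop (𝓝 0)) :
    Tendsto (fun k => eLpNorm (f k) (ENNReal.ofReal p) volume) atTop (𝓝 0) := by
  have h3 : Tendsto (fun k => ENNReal.ofReal C * eLpNorm (g k) (ENNReal.ofReal p) volume)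
      atTop (𝓝 0) := by
    have := ENNReal.Tendsto.const_mul (a := ENNReal.ofReal C) h (Or.inr ENNReal.ofReal_ne_top)
    simpa using this
  exact tendsto_of_tendsto_of_tendsto_of_le_of_le tendsto_const_nhds h3 (fun _ => zero_le)
    (fun k => eLpNorm_le_mul_eLpNorm_of_ae_le_mul (hb k) _)

end Lp

/-- approximation of `u` by `C¹_c` functions with gradients converging to `G` in `L^p` -/
structure DSeq (p : ℝ) (f : ℕ → EE n → ℝ) (u : EE n → ℝ) (G : EE n → EE n) : Prop where
  c1 : ∀ k, C1c (f k)
  mem : MemLp G (ENNReal.ofReal p) volume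
  lim : Tendsto (fun k => eLpNorm (fun x => gradient (f k) x - G x) (ENNReal.ofReal p) volume)
    atTop (𝓝 0)
  ae : ∀ᵐ x, Tendsto (fun k => f k x) atTop (𝓝 (u x))

namespace DSeq
variable {p : ℝ} {f g : ℕ → EE n → ℝ} {u v : EE n → ℝ} {G H : EE n → EE n}

lemma const (p : ℝ) {f : EE n → ℝ} (hf : C1c f) : DSeq p (fun _ => f) f (gradient f) where
  c1 _ := hf
  mem := hf.memLpg _
  lim := by simp
  ae := by simp

lemma aesm (h : DSeq p f u G) : AEStronglyMeasurable u volume :=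
  aestronglyMeasurable_of_tendsto_ae atTop (fun k => (h.c1 k).cont.aestronglyMeasurable) h.ae

lemma energy (hp : 1 < p) (h : DSeq p f u G) :
    Tendsto (fun k => ∫ x, ‖gradient (f k) x‖ ^ p) atTop (𝓝 (∫ x, ‖G x‖ ^ p)) :=
  tendsto_int_of_eLp hp (fun k => (h.c1 k).memLpg _) h.mem h.lim

lemma congr (h : DSeq p f u G) (hu : u =ᵐ[volume] v) (hG : G =ᵐ[volume] H) : DSeq p f v H where
  c1 := h.c1
  mem := h.mem.ae_eq hG
  lim := by
    refine h.lim.congr fun k => eLpNorm_congr_ae ?_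
    filter_upwards [hG] with x hx using by rw [hx]
  ae := by filter_upwards [h.ae, hu] with x h1 h2 using by rwa [← h2]

lemma add (hp : 1 < p) (h : DSeq p f u G) (h' : DSeq p g v H) :
    DSeq p (fun k x => f k x + g k x) (fun x => u x + v x) (fun x => G x + H x) where
  c1 k := (h.c1 k).add (h'.c1 k)
  mem := h.mem.add h'.mem
  lim := by
    have := tendsto_eLp_add hp (fun k => ((h.c1 k).contg.aestronglyMeasurable.sub h.mem.1))
      (fun k => ((h'.c1 k).contg.aestronglyMeasurable.sub h'.mem.1)) h.lim h'.lim
    refine this.congr fun k => ?_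
    congr 1; ext1 x
    rw [grad_add ((h.c1 k).diff x) ((h'.c1 k).diff x)]
    simp only [Pi.sub_apply]; abel
  ae := by filter_upwards [h.ae, h'.ae] with x h1 h2 using h1.add h2

lemma const_mul (h : DSeq p f u G) (c : ℝ) :
    DSeq p (fun k x => c * f k x) (fun x => c * u x) (fun x => c • G x) where
  c1 k := (h.c1 k).const_mul c
  mem := h.mem.const_smul c
  lim := by
    refine tendsto_eLp_bdd |c| (fun k => Eventually.of_forall fun x => ?_) h.lim
    rw [grad_const_mul ((h.c1 k).diff x), ← smul_sub, norm_smul, Real.norm_eq_abs]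
  ae := by filter_upwards [h.ae] with x h1 using h1.const_mul c

lemma sub (hp : 1 < p) (h : DSeq p f u G) (h' : DSeq p g v H) :
    DSeq p (fun k x => f k x - g k x) (fun x => u x - v x) (fun x => G x - H x) := by
  have := h.add hp (h'.const_mul (-1))
  simpa [sub_eq_add_neg] using this

lemma comp_gen (hp : 1 < p) (h : DSeq p f u G) {θ : ℝ → ℝ} (hθ : ContDiff ℝ 1 θ) {M : ℝ}
    (hM : ∀ s, |deriv θ s| ≤ M) :
    Tendsto (fun k => eLpNorm (fun x => deriv θ (f k x) • gradient (f k) x - deriv θ (u x) • G x)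
      (ENNReal.ofReal p) volume) atTop (𝓝 0) ∧
    MemLp (fun x => deriv θ (u x) • G x) (ENNReal.ofReal p) volume := by
  have hθc : Continuous (deriv θ) := hθ.continuous_deriv le_rfl
  have hmu : AEStronglyMeasurable (fun x => deriv θ (u x)) volume :=
    hθc.comp_aestronglyMeasurable h.aesm
  have hmk : ∀ k, AEStronglyMeasurable (fun x => deriv θ (f k x)) volume := fun k =>
    (hθc.comp (h.c1 k).cont).aestronglyMeasurable
  have hM0 : 0 ≤ M := (abs_nonneg _).trans (hM 0)
  have hmem : MemLp (fun x => deriv θ (u x) • G x) (ENNReal.ofReal p) volume := by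
    refine (h.mem.norm.const_mul M).mono (hmu.smul h.mem.1) (Eventually.of_forall fun x => ?_)
    rw [norm_smul, Real.norm_eq_abs, norm_mul, norm_norm, Real.norm_of_nonneg hM0]
    exact mul_le_mul_of_nonneg_right (hM _) (norm_nonneg _)
  refine ⟨?_, hmem⟩
  have h1 : Tendsto (fun k => eLpNorm (fun x => deriv θ (f k x) • (gradient (f k) x - G x))
      (ENNReal.ofReal p) volume) atTop (𝓝 0) := by
    refine tendsto_eLp_bdd M (fun k => Eventually.of_forall fun x => ?_) h.lim
    rw [norm_smul, Real.norm_eq_abs]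
    exact mul_le_mul_of_nonneg_right (hM _) (norm_nonneg _)
  have h2 : Tendsto (fun k => eLpNorm (fun x => (deriv θ (f k x) - deriv θ (u x)) • G x)
      (ENNReal.ofReal p) volume) atTop (𝓝 0) := by
    refine tendsto_eLp_dct hp (fun k => ((hmk k).sub hmu).smul h.mem.1)
      (h.mem.norm.const_mul (2 * M)) (fun k => Eventually.of_forall fun x => ?_) ?_
    · rw [norm_smul, Real.norm_eq_abs]
      refine mul_le_mul_of_nonneg_right ?_ (norm_nonneg _)
      have := abs_sub (deriv θ (f k x)) (deriv θ (u x))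
      linarith [hM (f k x), hM (u x)]
    · filter_upwards [h.ae] with x hx
      have h3 := (hθc.tendsto (u x)).comp hx
      have h4 := (h3.sub_const (deriv θ (u x))).smul_const (G x)
      simpa using h4
  have := tendsto_eLp_add hp (fun k => (hmk k).smul ((h.c1 k).contg.aestronglyMeasurable.sub h.mem.1))
    (fun k => ((hmk k).sub hmu).smul h.mem.1) h1 h2
  refine this.congr fun k => ?_
  congr 1; ext1 x
  simp only [Pi.smul_apply', Pi.sub_apply]; module

lemma comp (hp : 1 < p) (h : DSeq p f u G) {θ : ℝ → ℝ} (hθ : ContDiff ℝ 1 θ) (h0 : θ 0 = 0) {M : ℝ}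
    (hM : ∀ s, |deriv θ s| ≤ M) :
    DSeq p (fun k x => θ (f k x)) (fun x => θ (u x)) (fun x => deriv θ (u x) • G x) where
  c1 k := (h.c1 k).comp hθ h0
  mem := (h.comp_gen hp hθ hM).2
  lim := by
    refine (h.comp_gen hp hθ hM).1.congr fun k => ?_
    congr 1; ext1 x
    rw [grad_comp ((h.c1 k).diff x) (hθ.differentiable one_ne_zero _)]
  ae := by filter_upwards [h.ae] with x h1 using (hθ.continuous.tendsto _).comp h1

lemma mul_bdd (hp : 1 < p) (h : DSeq p f u G) {M : ℝ} (hM : ∀ k x, |f k x| ≤ M)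
    {ζ : EE n → ℝ} (hζ : C1c ζ) :
    DSeq p (fun k x => ζ x * f k x) (fun x => ζ x * u x)
      (fun x => ζ x • G x + u x • gradient ζ x) := by
  have huM : ∀ᵐ x, |u x| ≤ M := by
    filter_upwards [h.ae] with x hx
    exact le_of_tendsto hx.abs (Eventually.of_forall fun k => hM k x)
  have hM0 : 0 ≤ M := (abs_nonneg _).trans (hM 0 0)
  obtain ⟨C, hC⟩ := hζ.cont.bounded_above_of_compact_support hζ.cs
  have hC0 : 0 ≤ C := (norm_nonneg _).trans (hC 0)
  have m1 : MemLp (fun x => ζ x • G x) (ENNReal.ofReal p) volume := by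
    refine (h.mem.norm.const_mul C).mono (hζ.cont.aestronglyMeasurable.smul h.mem.1)
      (Eventually.of_forall fun x => ?_)
    rw [norm_smul, norm_mul, norm_norm, Real.norm_of_nonneg hC0]
    exact mul_le_mul_of_nonneg_right (hC _) (norm_nonneg _)
  have m2 : MemLp (fun x => u x • gradient ζ x) (ENNReal.ofReal p) volume := by
    refine ((hζ.memLpg _).norm.const_mul M).mono (h.aesm.smul hζ.contg.aestronglyMeasurable) ?_
    filter_upwards [huM] with x hx
    rw [norm_smul, norm_mul, norm_norm, Real.norm_of_nonneg hM0]
    exact mul_le_mul_of_nonneg_right hx (norm_nonneg _)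
  refine ⟨fun k => hζ.mul (h.c1 k), m1.add m2, ?_, ?_⟩
  · have h1 : Tendsto (fun k => eLpNorm (fun x => ζ x • (gradient (f k) x - G x))
        (ENNReal.ofReal p) volume) atTop (𝓝 0) := by
      refine tendsto_eLp_bdd C (fun k => Eventually.of_forall fun x => ?_) h.lim
      rw [norm_smul]
      exact mul_le_mul_of_nonneg_right (hC _) (norm_nonneg _)
    have h2 : Tendsto (fun k => eLpNorm (fun x => (f k x - u x) • gradient ζ x)
        (ENNReal.ofReal p) volume) atTop (𝓝 0) := by
      refine tendsto_eLp_dct hp (fun k => (((h.c1 k).cont.aestronglyMeasurable).sub h.aesm).smul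
        hζ.contg.aestronglyMeasurable)
        ((hζ.memLpg _).norm.const_mul (2 * M)) (fun k => ?_) ?_
      · filter_upwards [huM] with x hx
        rw [norm_smul, Real.norm_eq_abs]
        refine mul_le_mul_of_nonneg_right ?_ (norm_nonneg _)
        have := abs_sub (f k x) (u x)
        linarith [hM k x]
      · filter_upwards [h.ae] with x hx
        have h4 := (hx.sub_const (u x)).smul_const (gradient ζ x)
        simpa using h4
    have := tendsto_eLp_add hp (fun k => hζ.cont.aestronglyMeasurable.smul
      ((h.c1 k).contg.aestronglyMeasurable.sub h.mem.1))
      (fun k => (((h.c1 k).cont.aestronglyMeasurable).sub h.aesm).smul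
        hζ.contg.aestronglyMeasurable) h1 h2
    refine this.congr fun k => ?_
    congr 1; ext1 x
    rw [grad_mul (hζ.diff x) ((h.c1 k).diff x)]
    simp only [Pi.smul_apply', Pi.sub_apply]; module
  · filter_upwards [h.ae] with x h1 using h1.const_mul _

lemma subseq (h : DSeq p f u G) {φ : ℕ → ℕ} (hφ : StrictMono φ) :
    DSeq p (fun k => f (φ k)) u G where
  c1 k := h.c1 _
  mem := h.mem
  lim := h.lim.comp hφ.tendsto_atTop
  ae := by filter_upwards [h.ae] with x hx using hx.comp hφ.tendsto_atTop

end DSeq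
end PB

end SPartB1

section SPartB2
open MeasureTheory Metric Set Filter
open scoped RealInnerProductSpace Pointwise Topology ENNReal NNReal

namespace PB
set_option linter.unusedSectionVars false
variable {n : ℕ} {p : ℝ}

/-- capacity with `C¹_c` competitors -/
noncomputable def cap (p : ℝ) (K : Set (EE n)) : ℝ :=
  sInf {c : ℝ | ∃ u : EE n → ℝ, C1c u ∧ (∀ x ∈ K, 1 ≤ u x) ∧ c = ∫ x, ‖gradient u x‖ ^ p}

lemma cap_bdd (K : Set (EE n)) :
    BddBelow {c : ℝ | ∃ u : EE n → ℝ, C1c u ∧ (∀ x ∈ K, 1 ≤ u x) ∧ c = ∫ x, ‖gradient u x‖ ^ p} := by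
  refine ⟨0, ?_⟩
  rintro c ⟨u, -, -, rfl⟩
  exact integral_nonneg fun x => by positivity

lemma cap_le {K : Set (EE n)} {u : EE n → ℝ} (hu : C1c u) (h1 : ∀ x ∈ K, 1 ≤ u x) :
    cap p K ≤ ∫ x, ‖gradient u x‖ ^ p := csInf_le (cap_bdd K) ⟨u, hu, h1, rfl⟩

lemma cap_nonneg (K : Set (EE n)) : 0 ≤ cap p K := by
  apply Real.sInf_nonneg
  rintro c ⟨u, -, -, rfl⟩
  exact integral_nonneg fun x => by positivity

/-- smooth cutoff on balls -/
lemma exists_cutoff (x₀ : EE n) {r R : ℝ} (hr : 0 < r) (hR : r < R) :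
    ∃ ζ : EE n → ℝ, ContDiff ℝ (⊤ : ℕ∞) ζ ∧ C1c ζ ∧ (∀ x, 0 ≤ ζ x) ∧ (∀ x, ζ x ≤ 1) ∧
      (∀ x, dist x x₀ ≤ r → ζ x = 1) ∧ (∀ x, R ≤ dist x x₀ → ζ x = 0) ∧
      (∀ x, dist x x₀ < R → 0 < ζ x) ∧ tsupport ζ = closedBall x₀ R := by
  let b : ContDiffBump x₀ := ⟨r, R, hr, hR⟩
  refine ⟨b, b.contDiff, ⟨b.contDiff, b.hasCompactSupport⟩, fun x => b.nonneg, fun x => b.le_one,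
    fun x hx => b.one_of_mem_closedBall hx, fun x hx => b.zero_of_le_dist hx,
    fun x hx => b.pos_of_mem_ball hx, b.tsupport_eq⟩

lemma cap_nonempty {K : Set (EE n)} (hK : Bornology.IsBounded K) :
    {c : ℝ | ∃ u : EE n → ℝ, C1c u ∧ (∀ x ∈ K, 1 ≤ u x) ∧ c = ∫ x, ‖gradient u x‖ ^ p}.Nonempty := by
  obtain ⟨R, hR⟩ := (isBounded_iff_subset_closedBall (0 : EE n)).mp hK
  obtain ⟨ζ, -, h1, -, -, h2, -⟩ := exists_cutoff (0 : EE n) (r := max R 1) (R := max R 1 + 1)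
    (by positivity) (by linarith)
  exact ⟨_, ζ, h1, fun x hx => (h2 x ((mem_closedBall.mp (hR hx)).trans (le_max_left _ _))).ge, rfl⟩

lemma cap_mono {K L : Set (EE n)} (hL : Bornology.IsBounded L) (h : K ⊆ L) : cap p K ≤ cap p L := by
  apply le_csInf (cap_nonempty hL)
  rintro c ⟨u, hu, h1, rfl⟩
  exact cap_le hu fun x hx => h1 x (h hx)

lemma exists_near_cap {K : Set (EE n)} (hK : Bornology.IsBounded K) {ε : ℝ} (hε : 0 < ε) :
    ∃ u : EE n → ℝ, C1c u ∧ (∀ x ∈ K, 1 ≤ u x) ∧ ∫ x, ‖gradient u x‖ ^ p < cap p K + ε := by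
  obtain ⟨c, ⟨u, hu, h1, rfl⟩, hc⟩ := exists_lt_of_csInf_lt (cap_nonempty (p := p) hK)
    (show sInf _ < cap p K + ε by rw [← cap]; linarith)
  exact ⟨u, hu, h1, hc⟩

section Mollify
open scoped Convolution

lemma mollify (hp : 1 < p) {u : EE n → ℝ} (hu : C1c u) :
    ∃ w : ℕ → EE n → ℝ, (∀ k, ContDiff ℝ (⊤ : ℕ∞) (w k)) ∧
      (∀ k x, |w k x - u x| ≤ 1 / ((k : ℝ) + 1)) ∧ DSeq p w u (gradient u) := by
  have huc : UniformContinuous u := hu.cs.uniformContinuous_of_continuous hu.cont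
  have hcf : Continuous (fderiv ℝ u) := hu.cd.continuous_fderiv one_ne_zero
  have hfs : HasCompactSupport (fderiv ℝ u) := hu.cs.fderiv (𝕜 := ℝ)
  have hguc : UniformContinuous (fderiv ℝ u) := hfs.uniformContinuous_of_continuous hcf
  have key : ∀ k : ℕ, ∃ w : EE n → ℝ, ContDiff ℝ (⊤ : ℕ∞) w ∧ C1c w ∧
      (∀ x, |w x - u x| ≤ 1 / ((k : ℝ) + 1)) ∧
      (∀ x, ‖fderiv ℝ w x - fderiv ℝ u x‖ ≤ 1 / ((k : ℝ) + 1)) ∧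
      (Function.support w ⊆ cthickening 1 (tsupport u)) := by
    intro k
    have hε : 0 < 1 / ((k : ℝ) + 1) := by positivity
    obtain ⟨δ1, hδ1, h1⟩ := Metric.uniformContinuous_iff.mp huc _ hε
    obtain ⟨δ2, hδ2, h2⟩ := Metric.uniformContinuous_iff.mp hguc _ hε
    set δ := min (min δ1 δ2) 1 with hδ
    have hδ0 : 0 < δ := by positivity
    let b : ContDiffBump (0 : EE n) := ⟨δ / 2, δ, by positivity, by linarith⟩
    have hbo : b.rOut = δ := rfl
    let w : EE n → ℝ := (b.normed volume ⋆[ContinuousLinearMap.lsmul ℝ ℝ, volume] u)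
    have hli : LocallyIntegrable (b.normed volume) (volume : Measure (EE n)) :=
      (b.continuous_normed).locallyIntegrable
    have hw1 : ContDiff ℝ (⊤ : ℕ∞) w :=
      b.hasCompactSupport_normed.contDiff_convolution_left _ b.contDiff_normed
        hu.cont.locallyIntegrable
    have hw2 : HasCompactSupport w := b.hasCompactSupport_normed.convolution _ hu.cs
    have hder : ∀ x, fderiv ℝ w x =
        (b.normed volume ⋆[ContinuousLinearMap.lsmul ℝ ℝ, volume] (fderiv ℝ u)) x := by
      intro x
      have := hu.cs.hasFDerivAt_convolution_right (ContinuousLinearMap.lsmul ℝ ℝ) hli hu.cd x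
      rw [this.fderiv]
      unfold convolution
      congr 1
    refine ⟨w, hw1, ⟨hw1.of_le (by exact_mod_cast le_top), hw2⟩, fun x => ?_, fun x => ?_, ?_⟩
    · have := b.dist_normed_convolution_le (μ := (volume : Measure (EE n))) (x₀ := x)
        (ε := 1 / ((k : ℝ) + 1)) hu.cont.aestronglyMeasurable (fun y hy => by
          refine (h1 ?_).le
          rw [hbo] at hy
          exact lt_of_lt_of_le hy ((min_le_left _ _).trans (min_le_left _ _)))
      rwa [Real.dist_eq] at this
    · have := b.dist_normed_convolution_le (μ := (volume : Measure (EE n))) (x₀ := x)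
        (ε := 1 / ((k : ℝ) + 1)) hcf.aestronglyMeasurable (fun y hy => by
          refine (h2 ?_).le
          rw [hbo] at hy
          exact lt_of_lt_of_le hy ((min_le_left _ _).trans (min_le_right _ _)))
      rw [hder, ← dist_eq_norm]
      exact this
    · refine (support_convolution_subset_swap _).trans ?_
      rw [b.support_normed_eq, hbo]
      rintro _ ⟨y, hy, z, hz, rfl⟩
      apply mem_cthickening_of_dist_le (y + z) y 1 _ (subset_tsupport _ hy)
      rw [dist_eq_norm, add_sub_cancel_left]
      have : ‖z‖ < δ := by simpa using hz
      exact this.le.trans (min_le_right _ _)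
  choose w hw1 hw2 hw3 hw4 hw5 using key
  refine ⟨w, hw1, hw3, hw2, hu.memLpg _, ?_, ?_⟩
  · have hKc : IsCompact (cthickening 1 (tsupport u)) := hu.cs.isCompact.cthickening
    have hg : ∀ k x, ‖gradient (w k) x - gradient u x‖ = ‖fderiv ℝ (w k) x - fderiv ℝ u x‖ := by
      intro k x
      unfold gradient
      rw [← map_sub, LinearIsometryEquiv.norm_map]
    refine tendsto_eLp_dct hp (g := (cthickening 1 (tsupport u)).indicator fun _ => (1 : ℝ))
      (fun k => ((hw2 k).contg.sub hu.contg).aestronglyMeasurable) ?_ (fun k => ?_) ?_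
    · exact memLp_indicator_const _ hKc.measurableSet _ (Or.inr hKc.measure_lt_top.ne)
    · refine Eventually.of_forall fun x => ?_
      by_cases hx : x ∈ cthickening 1 (tsupport u)
      · rw [indicator_of_mem hx, hg]
        refine (hw4 k x).trans ?_
        rw [div_le_one (by positivity)]
        linarith [(Nat.cast_nonneg k : (0 : ℝ) ≤ k)]
      · rw [indicator_of_notMem hx, hg]
        have hts : tsupport (w k) ⊆ cthickening 1 (tsupport u) :=
          closure_minimal (hw5 k) isClosed_cthickening
        have e1 : fderiv ℝ (w k) x = 0 := by
          have : x ∉ Function.support (fderiv ℝ (w k)) := fun h =>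
            hx (hts (support_fderiv_subset ℝ h))
          simpa using this
        have e2 : fderiv ℝ u x = 0 := by
          have : x ∉ Function.support (fderiv ℝ u) := fun h =>
            hx (self_subset_cthickening _ (support_fderiv_subset ℝ h))
          simpa using this
        rw [e1, e2]; simp
    · refine Eventually.of_forall fun x => ?_
      rw [tendsto_zero_iff_norm_tendsto_zero]
      refine squeeze_zero (fun _ => norm_nonneg _) (fun k => ?_) tendsto_one_div_add_atTop_nhds_zero_nat
      rw [hg]; exact hw4 k x
  · refine Eventually.of_forall fun x => ?_
    rw [tendsto_iff_dist_tendsto_zero]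
    refine squeeze_zero (fun _ => dist_nonneg) (fun k => ?_) tendsto_one_div_add_atTop_nhds_zero_nat
    rw [Real.dist_eq]; exact hw3 k x

end Mollify

lemma pCap_eq_cap (hp : 1 < p) {K : Set (EE n)} (hK : Bornology.IsBounded K) :
    pCap n p K = cap p K := by
  have hb : BddBelow { c : ℝ | ∃ u : EE n → ℝ,
    ContDiff ℝ (⊤ : ℕ∞) u ∧ HasCompactSupport u ∧ (∀ x ∈ K, 1 ≤ u x) ∧
    c = ∫ x, ‖fderiv ℝ u x‖ ^ p } := by
    refine ⟨0, ?_⟩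
    rintro c ⟨u, -, -, -, rfl⟩
    exact integral_nonneg fun x => by positivity
  apply le_antisymm
  · apply le_csInf (cap_nonempty hK)
    rintro c ⟨u, hu, h1, rfl⟩
    obtain ⟨w, hw1, hw2, hw3⟩ := mollify hp hu
    -- competitors (1 + 2/(k+1)) w_k, for k ≥ 1
    have hlim := hw3.energy hp
    have hl2 : Tendsto (fun k : ℕ => ((1 - 1 / ((k : ℝ) + 1))⁻¹) ^ p * ∫ x, ‖gradient (w k) x‖ ^ p)
        atTop (𝓝 (∫ x, ‖gradient u x‖ ^ p)) := by
      have h0 : Tendsto (fun k : ℕ => ((1 - 1 / ((k : ℝ) + 1))⁻¹) ^ p) atTop (𝓝 1) := by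
        have a : Tendsto (fun k : ℕ => (1 - 1 / ((k : ℝ) + 1))⁻¹) atTop (𝓝 ((1 - 0)⁻¹)) :=
          (tendsto_one_div_add_atTop_nhds_zero_nat.const_sub 1).inv₀ (by norm_num)
        have := a.rpow_const (p := p) (Or.inr (by linarith))
        simpa using this
      simpa using h0.mul hlim
    refine ge_of_tendsto hl2 ?_
    filter_upwards [eventually_ge_atTop 1] with k hk
    have hk' : (1 : ℝ) ≤ k := by exact_mod_cast hk
    have hpos : 0 < 1 - 1 / ((k : ℝ) + 1) := by
      rw [sub_pos, div_lt_one (by positivity)]; linarith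
    set c := (1 - 1 / ((k : ℝ) + 1))⁻¹ with hc
    have hc0 : 0 < c := by positivity
    refine csInf_le hb ⟨fun x => c * w k x, contDiff_const.mul (hw1 k), (hw3.c1 k).cs.mul_left,
      fun x hx => ?_, ?_⟩
    · have := (abs_le.mp (hw2 k x)).1
      have h2 : 1 - 1 / ((k : ℝ) + 1) ≤ w k x := by linarith [h1 x hx]
      show 1 ≤ c * w k x
      rw [hc, inv_mul_eq_div, le_div_iff₀ hpos]; linarith
    · rw [← integral_const_mul]
      congr 1; ext1 x
      rw [← norm_grad, grad_const_mul ((hw3.c1 k).diff x), norm_smul, Real.norm_of_nonneg hc0.le,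
        Real.mul_rpow hc0.le (norm_nonneg _)]
  · apply le_csInf
    · obtain ⟨R, hR⟩ := (isBounded_iff_subset_closedBall (0 : EE n)).mp hK
      obtain ⟨ζ, h0, h1, -, -, h2, -⟩ := exists_cutoff (0 : EE n) (r := max R 1) (R := max R 1 + 1)
        (by positivity) (by linarith)
      exact ⟨_, ζ, h0, h1.cs,
        fun x hx => (h2 x ((mem_closedBall.mp (hR hx)).trans (le_max_left _ _))).ge, rfl⟩
    · rintro c ⟨u, hu, hs, h1, rfl⟩
      have hu1 : C1c u := ⟨hu.of_le (by exact_mod_cast le_top), hs⟩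
      have := cap_le (p := p) hu1 h1
      simpa [norm_grad] using this

/-- Sobolev exponent -/
noncomputable def pst (n : ℕ) (p : ℝ) : ℝ := n * p / (n - p)

lemma pst_gt (hp : 1 < p) (hpn : p < n) : 1 < pst n p := by
  unfold pst
  rw [lt_div_iff₀ (by linarith)]
  nlinarith

lemma sobolev (hp : 1 < p) (hpn : p < n) : ∃ C : ℝ≥0, ∀ f : EE n → ℝ, C1c f →
    eLpNorm f (ENNReal.ofReal (pst n p)) volume ≤
      C * eLpNorm (gradient f) (ENNReal.ofReal p) volume := by
  refine ⟨eLpNormLESNormFDerivOfEqInnerConst (volume : Measure (EE n)) (p.toNNReal : ℝ), ?_⟩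
  intro f hf
  have hst := pst_gt hp hpn
  have h := eLpNorm_le_eLpNorm_fderiv_of_eq_inner (volume : Measure (EE n)) hf.cd hf.cs
    (p := p.toNNReal) (p' := (pst n p).toNNReal) (by
      rw [← NNReal.coe_le_coe, Real.coe_toNNReal _ (by linarith)]; simpa using hp.le)
    (by rw [finrank_euclideanSpace_fin]
        have : (0 : ℝ) < n := by linarith
        exact_mod_cast this)
    (by
      rw [finrank_euclideanSpace_fin]
      have h1 : (0 : ℝ) < n := by linarith
      have h2 : (n : ℝ) - p ≠ 0 := by linarith
      have h3 : p ≠ 0 := by linarith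
      rw [NNReal.coe_inv, Real.coe_toNNReal _ (by linarith), Real.coe_toNNReal _ (by linarith), pst]
      field_simp)
  refine h.trans (le_of_eq ?_)
  congr 1
  exact eLpNorm_congr_norm_ae (Eventually.of_forall fun x => (norm_grad f x).symm)

lemma eLp_complete {F : Type*} [NormedAddCommGroup F] [CompleteSpace F] {q : ℝ≥0∞} (hq : 1 ≤ q)
    {f : ℕ → EE n → F} (hf : ∀ k, MemLp (f k) q volume)
    (hc : ∀ ε : ℝ, 0 < ε → ∃ N, ∀ j, N ≤ j → ∀ k, N ≤ k →
      eLpNorm (fun x => f j x - f k x) q volume ≤ ENNReal.ofReal ε) :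
    ∃ g : EE n → F, MemLp g q volume ∧
      Tendsto (fun k => eLpNorm (fun x => f k x - g x) q volume) atTop (𝓝 0) := by
  have : Fact (1 ≤ q) := ⟨hq⟩
  have hcs : CauchySeq (fun k => (hf k).toLp (f k)) := by
    rw [Metric.cauchySeq_iff]
    intro ε hε
    obtain ⟨N, hN⟩ := hc (ε / 2) (by positivity)
    refine ⟨N, fun j hj k hk => ?_⟩
    rw [dist_eq_norm, ← MemLp.toLp_sub, Lp.norm_toLp]
    calc _ ≤ (ENNReal.ofReal (ε / 2)).toReal := ENNReal.toReal_mono ENNReal.ofReal_ne_top (hN j hj k hk)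
      _ = ε / 2 := ENNReal.toReal_ofReal (by positivity)
      _ < ε := by linarith
  obtain ⟨g, hg⟩ := cauchySeq_tendsto_of_complete hcs
  refine ⟨g, Lp.memLp g, ?_⟩
  have := (Lp.tendsto_Lp_iff_tendsto_eLpNorm'' f hf g (Lp.memLp g)).mp (by simpa using hg)
  exact this

namespace DSeq
variable {f : ℕ → EE n → ℝ} {u v : EE n → ℝ} {G H : EE n → EE n}

/-- zero gradient implies zero function -/
lemma eq_zero (hp : 1 < p) (hpn : p < n) (h : DSeq p f u G) (hG : G =ᵐ[volume] 0) :
    u =ᵐ[volume] 0 := by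
  obtain ⟨C, hC⟩ := sobolev hp hpn
  have h1 : Tendsto (fun k => eLpNorm (gradient (f k)) (ENNReal.ofReal p) volume) atTop (𝓝 0) := by
    refine h.lim.congr fun k => eLpNorm_congr_ae ?_
    filter_upwards [hG] with x hx using by simp [hx]
  have h2 : Tendsto (fun k => eLpNorm (f k - 0) (ENNReal.ofReal (pst n p)) volume) atTop (𝓝 0) := by
    have h3 : Tendsto (fun k => (C : ℝ≥0∞) * eLpNorm (gradient (f k)) (ENNReal.ofReal p) volume)
        atTop (𝓝 0) := by
      have := ENNReal.Tendsto.const_mul (a := (C : ℝ≥0∞)) h1 (Or.inr ENNReal.coe_ne_top)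
      simpa using this
    refine tendsto_of_tendsto_of_tendsto_of_le_of_le tendsto_const_nhds h3 (fun _ => zero_le)
      (fun k => ?_)
    rw [sub_zero]; exact hC _ (h.c1 k)
  have h3 := tendstoInMeasure_of_tendsto_eLpNorm (P_ne_zero (pst_gt hp hpn))
    (fun k => (h.c1 k).cont.aestronglyMeasurable) aestronglyMeasurable_zero h2
  obtain ⟨ns, hns, h4⟩ := h3.exists_seq_tendsto_ae
  filter_upwards [h4, h.ae] with x h5 h6
  exact tendsto_nhds_unique (h6.comp hns.tendsto_atTop) h5

lemma memLp_st (hp : 1 < p) (hpn : p < n) (h : DSeq p f u G) :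
    MemLp u (ENNReal.ofReal (pst n p)) volume := by
  obtain ⟨C, hC⟩ := sobolev hp hpn
  refine ⟨h.aesm, ?_⟩
  obtain ⟨N, hN⟩ := (eventually_atTop.mp
    ((tendsto_order.mp h.lim).2 1 one_pos))
  have hb : ∀ k, N ≤ k → eLpNorm (f k) (ENNReal.ofReal (pst n p)) volume ≤
      C * (1 + eLpNorm G (ENNReal.ofReal p) volume) := by
    intro k hk
    refine (hC _ (h.c1 k)).trans ?_
    gcongr
    have h1 := eLpNorm_add_le (f := fun x => gradient (f k) x - G x) (g := G)
      ((h.c1 k).contg.aestronglyMeasurable.sub h.mem.1) h.mem.1 (one_le_P hp)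
    have h2 : (fun x => gradient (f k) x - G x) + G = gradient (f k) := by ext1 x; simp
    rw [h2] at h1
    refine h1.trans ?_
    gcongr
    exact (hN k hk).le
  have h3 := Lp.eLpNorm_lim_le_liminf_eLpNorm (p := ENNReal.ofReal (pst n p)) (f := f)
    (fun k => (h.c1 k).cont.aestronglyMeasurable) u h.ae
  refine h3.trans_lt ?_
  have h4 : liminf (fun k => eLpNorm (f k) (ENNReal.ofReal (pst n p)) volume) atTop ≤
      C * (1 + eLpNorm G (ENNReal.ofReal p) volume) := by
    apply liminf_le_of_le (by isBoundedDefault)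
    intro b hb'
    obtain ⟨M, hM⟩ := eventually_atTop.mp hb'
    exact (hM (max N M) (le_max_right _ _)).trans (hb _ (le_max_left _ _))
  refine h4.trans_lt ?_
  have := h.mem.2
  exact ENNReal.mul_lt_top ENNReal.coe_lt_top (ENNReal.add_lt_top.mpr ⟨ENNReal.one_lt_top, this⟩)

end DSeq

/-- capacitary potential with approximating sequence -/
structure Pot (p : ℝ) (K : Set (EE n)) (f : ℕ → EE n → ℝ) (u : EE n → ℝ) (G : EE n → EE n) : Prop where
  ds : DSeq p f u G
  ge : ∀ k, ∀ x ∈ K, 1 ≤ f k x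
  en : ∫ x, ‖G x‖ ^ p = cap p K

lemma cauchy_min (hp : 1 < p) {K : Set (EE n)} {f : ℕ → EE n → ℝ}
    (h1 : ∀ k, C1c (f k)) (h2 : ∀ k, ∀ x ∈ K, 1 ≤ f k x)
    (h3 : ∀ k : ℕ, ∫ x, ‖gradient (f k) x‖ ^ p < cap p K + 1 / ((k : ℝ) + 1)) (ε : ℝ) (hε : 0 < ε) :
    ∃ N, ∀ j, N ≤ j → ∀ k, N ≤ k →
      eLpNorm (fun x => gradient (f j) x - gradient (f k) x) (ENNReal.ofReal p) volume ≤ ENNReal.ofReal ε := by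
  have hIntg : ∀ k, Integrable (fun x => ‖gradient (f k) x‖ ^ p) := fun k => int_rpow hp ((h1 k).memLpg _)
  set m := cap p K with hm
  have hm0 : 0 ≤ m := cap_nonneg K
  set ε' := ε ^ p / (2 * (2 * (m + 1))) with hε'
  have hε'0 : 0 < ε' := by positivity
  obtain ⟨C, hC0, hC⟩ := DD_unif (F := EE n) hp ε' hε'0
  obtain ⟨N, hN⟩ := exists_nat_gt (2 * C / ε ^ p)
  refine ⟨N, fun j hj k hk => ?_⟩
  have hsub : MemLp (fun x => gradient (f j) x - gradient (f k) x) (ENNReal.ofReal p) volume :=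
    ((h1 j).memLpg _).sub ((h1 k).memLpg _)
  rw [eLpNorm_eq_ofReal hp hsub]
  apply ENNReal.ofReal_le_ofReal
  have hmid : C1c (fun x => (2⁻¹ : ℝ) * (f j x + f k x)) := ((h1 j).add (h1 k)).const_mul _
  have hgm : ∀ x, gradient (fun x => (2⁻¹ : ℝ) * (f j x + f k x)) x =
      (2⁻¹ : ℝ) • (gradient (f j) x + gradient (f k) x) := by
    intro x
    rw [grad_const_mul (((h1 j).add (h1 k)).diff x), grad_add ((h1 j).diff x) ((h1 k).diff x)]
  have hmc : m ≤ ∫ x, ‖(2⁻¹ : ℝ) • (gradient (f j) x + gradient (f k) x)‖ ^ p := by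
    have := cap_le (p := p) hmid (fun x hx => by linarith [h2 j x hx, h2 k x hx])
    simpa only [hgm] using this
  have hmi : Integrable (fun x => ‖(2⁻¹ : ℝ) • (gradient (f j) x + gradient (f k) x)‖ ^ p) := by
    have := int_rpow hp (hmid.memLpg (ENNReal.ofReal p))
    simpa only [hgm] using this
  have hbj := h3 j
  have hbk := h3 k
  have hNj : 1 / ((j : ℝ) + 1) ≤ 1 / ((N : ℝ) + 1) := by
    apply one_div_le_one_div_of_le (by positivity)
    have : (N : ℝ) ≤ j := by exact_mod_cast hj
    linarith
  have hNk : 1 / ((k : ℝ) + 1) ≤ 1 / ((N : ℝ) + 1) := by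
    apply one_div_le_one_div_of_le (by positivity)
    have : (N : ℝ) ≤ k := by exact_mod_cast hk
    linarith
  have hN1 : 1 / ((N : ℝ) + 1) ≤ 1 := by
    rw [div_le_one (by positivity)]; linarith [(Nat.cast_nonneg N : (0 : ℝ) ≤ N)]
  have hDi : Integrable (fun x => DD p (gradient (f j) x) (gradient (f k) x)) := by
    unfold DD
    exact (((hIntg j).const_mul _).add ((hIntg k).const_mul _)).sub hmi
  have hDint : ∫ x, DD p (gradient (f j) x) (gradient (f k) x) ≤ 1 / ((N : ℝ) + 1) := by
    have i1 : Integrable (fun x => ‖gradient (f j) x‖ ^ p / 2 + ‖gradient (f k) x‖ ^ p / 2) :=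
      ((hIntg j).div_const 2).add ((hIntg k).div_const 2)
    have e1 : ∫ x, DD p (gradient (f j) x) (gradient (f k) x) =
        ∫ x, ((‖gradient (f j) x‖ ^ p / 2 + ‖gradient (f k) x‖ ^ p / 2) -
          ‖(2⁻¹ : ℝ) • (gradient (f j) x + gradient (f k) x)‖ ^ p) := by
      congr 1; ext1 x; unfold DD; ring
    rw [e1, integral_sub i1 hmi, integral_add ((hIntg j).div_const 2) ((hIntg k).div_const 2),
      integral_div, integral_div]
    linarith
  have hfin : ∫ x, ‖gradient (f j) x - gradient (f k) x‖ ^ p ≤ ε ^ p := by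
    calc ∫ x, ‖gradient (f j) x - gradient (f k) x‖ ^ p
        ≤ ∫ x, (ε' * (‖gradient (f j) x‖ ^ p + ‖gradient (f k) x‖ ^ p) +
            C * DD p (gradient (f j) x) (gradient (f k) x)) :=
          integral_mono (int_rpow hp hsub) ((((hIntg j).add (hIntg k)).const_mul _).add (hDi.const_mul _))
            (fun x => hC _ _)
      _ = ε' * ((∫ x, ‖gradient (f j) x‖ ^ p) + ∫ x, ‖gradient (f k) x‖ ^ p) +
            C * ∫ x, DD p (gradient (f j) x) (gradient (f k) x) := by
          have i2 : Integrable (fun x => ε' * (‖gradient (f j) x‖ ^ p + ‖gradient (f k) x‖ ^ p)) :=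
            ((hIntg j).add (hIntg k)).const_mul _
          rw [integral_add i2 (hDi.const_mul _), integral_const_mul,
            integral_const_mul, integral_add (hIntg j) (hIntg k)]
      _ ≤ ε' * (2 * (m + 1)) + C * (1 / ((N : ℝ) + 1)) := by
          gcongr; linarith
      _ ≤ ε ^ p / 2 + ε ^ p / 2 := by
          apply add_le_add
          · rw [hε']; field_simp; rfl
          · rw [mul_one_div, div_le_iff₀ (by positivity)]
            rw [div_lt_iff₀ (by positivity)] at hN
            nlinarith [Real.rpow_pos_of_pos hε p]
      _ = ε ^ p := by ring
  calc (∫ x, ‖gradient (f j) x - gradient (f k) x‖ ^ p) ^ p⁻¹ ≤ (ε ^ p) ^ p⁻¹ :=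
        Real.rpow_le_rpow (integral_nonneg fun x => by positivity) hfin (by positivity)
    _ = ε := by rw [← Real.rpow_mul hε.le, mul_inv_cancel₀ (by linarith), Real.rpow_one]

/-- existence of capacitary potentials -/
lemma exists_pot (hp : 1 < p) (hpn : p < n) {K : Set (EE n)} (hK : Bornology.IsBounded K) :
    ∃ f u G, Pot p K f u G := by
  have hseq : ∀ k : ℕ, ∃ u : EE n → ℝ, C1c u ∧ (∀ x ∈ K, 1 ≤ u x) ∧
      ∫ x, ‖gradient u x‖ ^ p < cap p K + 1 / ((k : ℝ) + 1) :=
    fun k => exists_near_cap hK (by positivity)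
  choose f h1 h2 h3 using hseq
  have hC := cauchy_min hp h1 h2 h3
  obtain ⟨G, hG, hGl⟩ := eLp_complete (one_le_P hp) (fun k => (h1 k).memLpg (ENNReal.ofReal p)) hC
  obtain ⟨S, hS⟩ := sobolev (n := n) hp hpn
  have hC2 : ∀ ε : ℝ, 0 < ε → ∃ N, ∀ j, N ≤ j → ∀ k, N ≤ k →
      eLpNorm (fun x => f j x - f k x) (ENNReal.ofReal (pst n p)) volume ≤ ENNReal.ofReal ε := by
    intro ε hε
    obtain ⟨N, hN⟩ := hC (ε / (S + 1)) (by positivity)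
    refine ⟨N, fun j hj k hk => ?_⟩
    refine (hS _ ((h1 j).sub (h1 k))).trans ?_
    have e : gradient (fun x => f j x - f k x) = fun x => gradient (f j) x - gradient (f k) x := by
      ext1 x; exact grad_sub ((h1 j).diff x) ((h1 k).diff x)
    rw [e]
    calc (S : ℝ≥0∞) * eLpNorm (fun x => gradient (f j) x - gradient (f k) x) (ENNReal.ofReal p) volume
        ≤ S * ENNReal.ofReal (ε / (S + 1)) := by gcongr; exact hN j hj k hk
      _ = ENNReal.ofReal (S * (ε / (S + 1))) := by
          rw [ENNReal.ofReal_mul (by positivity), ENNReal.ofReal_coe_nnreal]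
      _ ≤ ENNReal.ofReal ε := by
          apply ENNReal.ofReal_le_ofReal
          rw [mul_div_assoc', div_le_iff₀ (by positivity)]
          nlinarith [S.coe_nonneg]
  obtain ⟨u, hu, hul⟩ := eLp_complete (one_le_P (pst_gt hp hpn))
    (fun k => (h1 k).memLp (ENNReal.ofReal (pst n p))) hC2
  have h4 := tendstoInMeasure_of_tendsto_eLpNorm (P_ne_zero (pst_gt hp hpn))
    (fun k => (h1 k).cont.aestronglyMeasurable) hu.1 hul
  obtain ⟨ns, hns, h5⟩ := h4.exists_seq_tendsto_ae
  have hds : DSeq p (fun k => f (ns k)) u G :=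
    ⟨fun k => h1 _, hG, hGl.comp hns.tendsto_atTop, h5⟩
  refine ⟨fun k => f (ns k), u, G, hds, fun k => h2 _, ?_⟩
  refine tendsto_nhds_unique (hds.energy hp) ?_
  have h6 : Tendsto (fun k => ∫ x, ‖gradient (f k) x‖ ^ p) atTop (𝓝 (cap p K)) := by
    refine tendsto_of_tendsto_of_tendsto_of_le_of_le tendsto_const_nhds
      (h := fun k : ℕ => cap p K + 1 / ((k : ℝ) + 1)) ?_ (fun k => cap_le (h1 k) (h2 k))
      (fun k => (h3 k).le)
    have := tendsto_one_div_add_atTop_nhds_zero_nat (𝕜 := ℝ)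
    simpa using this.const_add (cap p K)
  exact h6.comp hns.tendsto_atTop

end PB

end SPartB2

section SPartB3
open MeasureTheory Metric Set Filter
open scoped RealInnerProductSpace Pointwise Topology ENNReal NNReal
namespace PB
set_option linter.unusedSectionVars false

variable {n : ℕ} {p : ℝ}

lemma abs_AA_young (hp : 1 < p) (a b : EE n) : |⟪AA p a, b⟫| ≤ ‖a‖ ^ p + ‖b‖ ^ p := by
  have h1 := AA_young hp a b
  have h2 := AA_young hp a (-b)
  rw [inner_neg_right, norm_neg] at h2
  have h3 : 0 ≤ ‖a‖ ^ p := by positivity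
  have h4 : 0 ≤ ‖b‖ ^ p := by positivity
  rw [abs_le]
  constructor <;> nlinarith

lemma abs_AA_young_t (hp : 1 < p) (a b : EE n) {t : ℝ} (ht : 0 < t) :
    |⟪AA p a, b⟫| ≤ t ^ p * ‖a‖ ^ p + (t ^ (1 - p)) ^ p * ‖b‖ ^ p := by
  have h := abs_AA_young hp (t • a) (t ^ (1 - p) • b)
  rw [AA_smul t ht.le hp, inner_smul_left, inner_smul_right, norm_smul, norm_smul,
    Real.mul_rpow (norm_nonneg _) (norm_nonneg _), Real.mul_rpow (norm_nonneg _) (norm_nonneg _),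
    Real.norm_of_nonneg ht.le, Real.norm_of_nonneg (by positivity)] at h
  have e : (t ^ (p - 1) : ℝ) * (t ^ (1 - p) * ⟪AA p a, b⟫) = ⟪AA p a, b⟫ := by
    rw [← mul_assoc, ← Real.rpow_add ht]; simp
  simpa [e] using h

lemma aesm_AA (hp : 1 < p) {G : EE n → EE n} (hG : AEStronglyMeasurable G volume) :
    AEStronglyMeasurable (fun x => AA p (G x)) volume :=
  (continuous_AA hp).comp_aestronglyMeasurable hG

lemma int_AA (hp : 1 < p) {G Φ : EE n → EE n} (hG : MemLp G (ENNReal.ofReal p) volume)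
    (hΦ : MemLp Φ (ENNReal.ofReal p) volume) : Integrable (fun x => ⟪AA p (G x), Φ x⟫) := by
  refine ((int_rpow hp hG).add (int_rpow hp hΦ)).mono' ((aesm_AA hp hG.1).inner hΦ.1) ?_
  exact Eventually.of_forall fun x => abs_AA_young hp _ _

lemma DSeq.tendsto_AA (hp : 1 < p) {G : EE n → EE n} (hG : MemLp G (ENNReal.ofReal p) volume)
    {φ : ℕ → EE n → ℝ} {v : EE n → ℝ} {Φ : EE n → EE n} (h : DSeq p φ v Φ) :
    Tendsto (fun k => ∫ x, ⟪AA p (G x), gradient (φ k) x⟫) atTop (𝓝 (∫ x, ⟪AA p (G x), Φ x⟫)) := by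
  have hm : ∀ k, MemLp (fun x => gradient (φ k) x - Φ x) (ENNReal.ofReal p) volume :=
    fun k => ((h.c1 k).memLpg _).sub h.mem
  have hl : Tendsto (fun k => ∫ x, ‖gradient (φ k) x - Φ x‖ ^ p) atTop (𝓝 0) := by
    have := tendsto_int_of_eLp hp hm (g := fun _ => (0 : EE n)) MemLp.zero (by simpa using h.lim)
    simpa [Real.zero_rpow (by linarith : p ≠ 0)] using this
  rw [Metric.tendsto_atTop]
  intro ε hε
  set I := ∫ x, ‖G x‖ ^ p with hI
  have hI0 : 0 ≤ I := integral_nonneg fun x => by positivity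
  obtain ⟨t, ht, htI⟩ : ∃ t : ℝ, 0 < t ∧ t ^ p * I < ε / 2 := by
    have : Tendsto (fun t : ℝ => t ^ p * I) (𝓝[>] 0) (𝓝 (0 ^ p * I)) :=
      ((Real.continuousAt_rpow_const 0 p (Or.inr (by linarith))).tendsto.mul_const I).mono_left
        nhdsWithin_le_nhds
    rw [Real.zero_rpow (by linarith), zero_mul] at this
    obtain ⟨t, h1, h2⟩ := ((this.eventually (gt_mem_nhds (half_pos hε))).and
      self_mem_nhdsWithin).exists
    exact ⟨t, h2, h1⟩
  set D := (t ^ (1 - p)) ^ p with hD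
  have hD0 : 0 < D := by positivity
  obtain ⟨N, hN⟩ := (Metric.tendsto_atTop.mp hl) (ε / 2 / D) (by positivity)
  refine ⟨N, fun k hk => ?_⟩
  have hNk := hN k hk
  rw [Real.dist_eq, sub_zero, abs_of_nonneg (integral_nonneg fun x => by positivity),
    lt_div_iff₀ hD0] at hNk
  rw [Real.dist_eq, ← integral_sub (int_AA hp hG ((h.c1 k).memLpg _)) (int_AA hp hG h.mem)]
  have i1 : Integrable (fun x => t ^ p * ‖G x‖ ^ p) := (int_rpow hp hG).const_mul _
  have i2 : Integrable (fun x => D * ‖gradient (φ k) x - Φ x‖ ^ p) := (int_rpow hp (hm k)).const_mul _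
  calc |∫ x, (⟪AA p (G x), gradient (φ k) x⟫ - ⟪AA p (G x), Φ x⟫)|
      ≤ ∫ x, (t ^ p * ‖G x‖ ^ p + D * ‖gradient (φ k) x - Φ x‖ ^ p) := by
        have i12 : Integrable (fun x => t ^ p * ‖G x‖ ^ p + D * ‖gradient (φ k) x - Φ x‖ ^ p) :=
          i1.add i2
        rw [← Real.norm_eq_abs]
        refine norm_integral_le_of_norm_le i12 ?_
        refine Eventually.of_forall fun x => ?_
        rw [← inner_sub_right]
        exact abs_AA_young_t hp _ _ ht
    _ = t ^ p * I + D * ∫ x, ‖gradient (φ k) x - Φ x‖ ^ p := by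
        rw [integral_add i1 i2, integral_const_mul, integral_const_mul]
    _ < ε := by linarith

/-- the Euler Lagrange inequality -/
lemma Pot.EL (hp : 1 < p) {K : Set (EE n)} {f : ℕ → EE n → ℝ} {u : EE n → ℝ} {G : EE n → EE n}
    (h : Pot p K f u G) {φ : ℕ → EE n → ℝ} {v : EE n → ℝ} {Φ : EE n → EE n} (hφ : DSeq p φ v Φ)
    {s : ℝ} (hs : 0 < s) (h1 : ∀ k, ∀ x ∈ K, 1 ≤ f k x + s * φ k x) :
    0 ≤ ∫ x, ⟪AA p (G x), Φ x⟫ := by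
  have key : ∀ σ : ℝ, 0 < σ → σ ≤ s → 0 ≤ ∫ x, ⟪AA p (G x + σ • Φ x), Φ x⟫ := by
    intro σ h0 hσ
    have hd := h.ds.add hp (hφ.const_mul σ)
    have hc : cap p K ≤ ∫ x, ‖G x + σ • Φ x‖ ^ p := by
      refine ge_of_tendsto' (hd.energy hp) fun k => cap_le (hd.c1 k) fun x hx => ?_
      have a1 := h.ge k x hx
      have a2 := h1 k x hx
      have : f k x + σ * φ k x = (1 - σ / s) * f k x + σ / s * (f k x + s * φ k x) := by
        field_simp; ring
      rw [this]
      have b1 : σ / s ≤ 1 := (div_le_one hs).mpr hσ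
      have b2 : 0 ≤ σ / s := by positivity
      nlinarith
    have i1 := int_rpow hp hd.mem
    have i2 := int_AA hp hd.mem hφ.mem
    have i3 : Integrable (fun x => ‖G x + σ • Φ x‖ ^ p + -(p * σ) * ⟪AA p (G x + σ • Φ x), Φ x⟫) :=
      i1.add (i2.const_mul _)
    have hm : ∫ x, (‖G x + σ • Φ x‖ ^ p + -(p * σ) * ⟪AA p (G x + σ • Φ x), Φ x⟫) ≤
        ∫ x, ‖G x‖ ^ p := by
      refine integral_mono i3 (int_rpow hp h.ds.mem) fun x => ?_
      have := norm_rpow_convex hp (G x + σ • Φ x) (G x)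
      rw [show G x - (G x + σ • Φ x) = -(σ • Φ x) by abel, inner_neg_right, inner_smul_right] at this
      simp only
      linarith
    rw [integral_add i1 (i2.const_mul _), integral_const_mul, h.en] at hm
    have h5 : 0 ≤ p * σ * ∫ x, ⟪AA p (G x + σ • Φ x), Φ x⟫ := by linarith
    exact nonneg_of_mul_nonneg_right h5 (by positivity)
  have hlim : Tendsto (fun k : ℕ => ∫ x, ⟪AA p (G x + (s * (1 / ((k : ℝ) + 1))) • Φ x), Φ x⟫) atTop
      (𝓝 (∫ x, ⟪AA p (G x), Φ x⟫)) := by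
    have hb : MemLp (fun x => ‖G x‖ + s * ‖Φ x‖) (ENNReal.ofReal p) volume :=
      h.ds.mem.norm.add (hφ.mem.norm.const_mul s)
    have ib : Integrable (fun x => ‖‖G x‖ + s * ‖Φ x‖‖ ^ p + ‖Φ x‖ ^ p) :=
      (int_rpow hp hb).add (int_rpow hp hφ.mem)
    have im : ∀ k : ℕ, AEStronglyMeasurable
        (fun x => ⟪AA p (G x + (s * (1 / ((k : ℝ) + 1))) • Φ x), Φ x⟫) volume := fun k =>
      (aesm_AA hp (h.ds.add hp (hφ.const_mul _)).mem.1).inner hφ.mem.1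
    refine tendsto_integral_of_dominated_convergence _ im ib (fun k => ?_) ?_
    · refine Eventually.of_forall fun x => ?_
      refine (abs_AA_young hp _ _).trans ?_
      gcongr
      rw [Real.norm_of_nonneg (by positivity)]
      refine (norm_add_le _ _).trans ?_
      gcongr
      rw [norm_smul, Real.norm_of_nonneg (by positivity)]
      gcongr
      have : 1 / ((k : ℝ) + 1) ≤ 1 := by
        rw [div_le_one (by positivity)]; linarith [(Nat.cast_nonneg k : (0 : ℝ) ≤ k)]
      nlinarith
    · refine Eventually.of_forall fun x => ?_
      have t0 : Tendsto (fun k : ℕ => s * (1 / ((k : ℝ) + 1))) atTop (𝓝 (s * 0)) :=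
        tendsto_one_div_add_atTop_nhds_zero_nat.const_mul s
      have t1 : Tendsto (fun k : ℕ => G x + (s * (1 / ((k : ℝ) + 1))) • Φ x) atTop (𝓝 (G x)) := by
        simpa using (t0.smul_const (Φ x)).const_add (G x)
      exact (((continuous_AA hp).tendsto _).comp t1).inner tendsto_const_nhds
  refine ge_of_tendsto' hlim fun k => key _ (by positivity) ?_
  have : 1 / ((k : ℝ) + 1) ≤ 1 := by
    rw [div_le_one (by positivity)]; linarith [(Nat.cast_nonneg k : (0 : ℝ) ≤ k)]
  nlinarith

/-- squared positive part -/
lemma hasDerivAt_mp2 (s : ℝ) : HasDerivAt (fun s : ℝ => max s 0 ^ 2) (2 * max s 0) s := by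
  rcases lt_trichotomy s 0 with h | h | h
  · rw [max_eq_right h.le, mul_zero]
    refine (hasDerivAt_const s (0 : ℝ)).congr_of_eventuallyEq ?_
    filter_upwards [gt_mem_nhds h] with t ht
    simp [max_eq_right (le_of_lt ht)]
  · subst h
    simp only [max_self, mul_zero]
    rw [hasDerivAt_iff_isLittleO]
    simp only [max_self, sub_zero, smul_zero]
    have : (fun x : ℝ => max x 0 ^ 2 - 0 ^ 2) =O[𝓝 0] fun x => x ^ 2 := by
      refine Asymptotics.IsBigO.of_bound 1 (Eventually.of_forall fun x => ?_)
      simp only [Real.norm_eq_abs, one_mul]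
      rw [abs_of_nonneg (by simp), abs_of_nonneg (by positivity)]
      rcases le_total x 0 with h | h
      · rw [max_eq_right h]; nlinarith
      · rw [max_eq_left h]; nlinarith
    refine this.trans_isLittleO ?_
    have := Asymptotics.isLittleO_pow_id (𝕜 := ℝ) (n := 2) (by norm_num)
    simpa using this
  · rw [max_eq_left h.le]
    have := (hasDerivAt_pow 2 s)
    simp only [Nat.cast_ofNat, Nat.add_one_sub_one, pow_one] at this
    refine this.congr_of_eventuallyEq ?_
    filter_upwards [lt_mem_nhds h] with t ht
    simp [max_eq_left (le_of_lt ht)]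

lemma contDiff_mp2 : ContDiff ℝ 1 (fun s : ℝ => max s 0 ^ 2) := by
  rw [contDiff_one_iff_deriv]
  refine ⟨fun s => (hasDerivAt_mp2 s).differentiableAt, ?_⟩
  rw [show deriv (fun s : ℝ => max s 0 ^ 2) = fun s => 2 * max s 0 from
    funext fun s => (hasDerivAt_mp2 s).deriv]
  fun_prop

/-- bounded positive test nonlinearity -/
noncomputable def th (s : ℝ) : ℝ := max s 0 ^ 2 / (1 + s ^ 2)

lemma hasDerivAt_th (s : ℝ) : HasDerivAt th (2 * max s 0 / (1 + s ^ 2) ^ 2) s := by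
  have h1 : HasDerivAt (fun s : ℝ => 1 + s ^ 2) (2 * s) s := by
    simpa using (hasDerivAt_pow 2 s).const_add 1
  have h := (hasDerivAt_mp2 s).div h1 (by positivity)
  have e : 2 * max s 0 / (1 + s ^ 2) ^ 2 =
      (2 * max s 0 * (1 + s ^ 2) - max s 0 ^ 2 * (2 * s)) / (1 + s ^ 2) ^ 2 := by
    congr 1
    rcases le_total s 0 with h | h
    · rw [max_eq_right h]; ring
    · rw [max_eq_left h]; ring
  rw [e]
  exact h

lemma deriv_th (s : ℝ) : deriv th s = 2 * max s 0 / (1 + s ^ 2) ^ 2 := (hasDerivAt_th s).deriv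

lemma contDiff_th : ContDiff ℝ 1 th := by
  unfold th
  exact contDiff_mp2.div (by fun_prop) (fun s => by positivity)

lemma deriv_th_nonneg (s : ℝ) : 0 ≤ deriv th s := by rw [deriv_th]; positivity

lemma abs_deriv_th (s : ℝ) : |deriv th s| ≤ 2 := by
  rw [abs_of_nonneg (deriv_th_nonneg s), deriv_th, div_le_iff₀ (by positivity)]
  rcases le_total s 0 with h | h
  · rw [max_eq_right h]; simp; positivity
  · rw [max_eq_left h]; nlinarith [sq_nonneg (s - 1), sq_nonneg s, sq_nonneg (s ^ 2)]

lemma th_zero : th 0 = 0 := by simp [th]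
lemma th_nonneg (s : ℝ) : 0 ≤ th s := by unfold th; positivity
lemma th_of_nonpos {s : ℝ} (h : s ≤ 0) : th s = 0 := by simp [th, max_eq_right h]
lemma deriv_th_of_nonpos {s : ℝ} (h : s ≤ 0) : deriv th s = 0 := by simp [deriv_th, max_eq_right h]
lemma deriv_th_pos {s : ℝ} (h : 0 < s) : 0 < deriv th s := by
  rw [deriv_th, max_eq_left h.le]; positivity
lemma th_pos {s : ℝ} (h : 0 < s) : 0 < th s := by
  unfold th; rw [max_eq_left h.le]; positivity
lemma th_le_one (s : ℝ) : th s ≤ 1 := by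
  unfold th
  rw [div_le_one (by positivity)]
  rcases le_total s 0 with h | h
  · rw [max_eq_right h]; nlinarith [sq_nonneg s]
  · rw [max_eq_left h]; linarith
lemma th_le {s : ℝ} (h : 0 ≤ s) : th s ≤ s := by
  unfold th
  rw [div_le_iff₀ (by positivity), max_eq_left h]
  nlinarith [sq_nonneg (s - 1), mul_nonneg h (sq_nonneg s), mul_nonneg h (sq_nonneg (s-1))]
lemma nonpos_of_th {s : ℝ} (h : th s = 0) : s ≤ 0 := by
  by_contra hs; push Not at hs; exact (th_pos hs).ne' h

end PB

end SPartB3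

section SPartC1
open MeasureTheory Metric Set Filter
open scoped RealInnerProductSpace Pointwise Topology ENNReal NNReal
namespace PB
set_option linter.unusedSectionVars false

variable {n : ℕ} {p : ℝ}

/-- similarity -/
noncomputable def Tm (b : EE n) (s : ℝ) (O : EE n ≃ₗᵢ[ℝ] EE n) (x : EE n) : EE n := b + s • O x

section Tm
variable {b : EE n} {s : ℝ} {O : EE n ≃ₗᵢ[ℝ] EE n}

lemma Tm_cd : ContDiff ℝ 1 (Tm b s O) := by
  unfold Tm
  have h : ContDiff ℝ 1 (fun x => s • O x) := O.contDiff.const_smul s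
  exact contDiff_const.add h

lemma Tm_cont : Continuous (Tm b s O) := Tm_cd.continuous

lemma Tm_inv (hs : s ≠ 0) (x : EE n) : Tm (-(s⁻¹ • O.symm b)) s⁻¹ O.symm (Tm b s O x) = x := by
  unfold Tm
  simp only [map_add, map_smul, LinearIsometryEquiv.symm_apply_apply, smul_add, smul_smul,
    inv_mul_cancel₀ hs, one_smul]
  abel

lemma Tm_inv' (hs : s ≠ 0) (x : EE n) : Tm b s O (Tm (-(s⁻¹ • O.symm b)) s⁻¹ O.symm x) = x := by
  unfold Tm
  simp only [map_add, map_smul, map_neg, LinearIsometryEquiv.apply_symm_apply, smul_add, smul_smul,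
    mul_inv_cancel₀ hs, one_smul, smul_neg]
  abel

lemma Tm_inj (hs : s ≠ 0) : Function.Injective (Tm b s O) :=
  Function.LeftInverse.injective (Tm_inv hs)

lemma Tm_dist (hs : 0 < s) (x y : EE n) : dist (Tm b s O x) (Tm b s O y) = s * dist x y := by
  unfold Tm
  rw [dist_add_left, dist_smul₀, LinearIsometryEquiv.dist_map, Real.norm_of_nonneg hs.le]

lemma Tm_emb (hs : s ≠ 0) : MeasurableEmbedding (Tm b s O) :=
  Tm_cont.measurableEmbedding (Tm_inj hs)

lemma Tm_map (hs : 0 < s) : Measure.map (Tm b s O) volume = ENNReal.ofReal ((s ^ n)⁻¹) • (volume : Measure (EE n)) := by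
  have h1 : Tm b s O = (fun x => b + x) ∘ (fun x => s • x) ∘ O := rfl
  rw [h1, ← Measure.map_map (measurable_const_add b) ((measurable_const_smul s).comp O.continuous.measurable),
    ← Measure.map_map (measurable_const_smul s) O.continuous.measurable, O.measurePreserving.map_eq,
    Measure.map_addHaar_smul volume hs.ne', Measure.map_smul, map_add_left_eq_self]
  simp [abs_of_pos hs]

lemma Tm_integral {F : Type*} [NormedAddCommGroup F] [NormedSpace ℝ F] (hs : 0 < s) (g : EE n → F) :
    ∫ x, g (Tm b s O x) = (s ^ n)⁻¹ • ∫ x, g x := by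
  rw [← (Tm_emb hs.ne').integral_map, Tm_map hs, integral_smul_measure,
    ENNReal.toReal_ofReal (by positivity)]

lemma Tm_eLp {F : Type*} [NormedAddCommGroup F] (hs : 0 < s) (g : EE n → F) :
    eLpNorm (fun x => g (Tm b s O x)) (ENNReal.ofReal p) volume =
    (ENNReal.ofReal ((s ^ n)⁻¹)) ^ (1 / (ENNReal.ofReal p).toReal) * eLpNorm g (ENNReal.ofReal p) volume := by
  have := (Tm_emb (b := b) (O := O) hs.ne').eLpNorm_map_measure (μ := volume) (g := g) (p := ENNReal.ofReal p)
  rw [Tm_map hs, eLpNorm_smul_measure_of_ne_top P_ne_top] at this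
  simpa [Function.comp_def] using this.symm

lemma Tm_qmp (hs : 0 < s) : Measure.QuasiMeasurePreserving (Tm b s O) volume volume := by
  refine ⟨Tm_cont.measurable, ?_⟩
  rw [Tm_map hs]
  exact Measure.smul_absolutelyContinuous

lemma Tm_memLp {F : Type*} [NormedAddCommGroup F] (hs : 0 < s) {g : EE n → F}
    (hg : MemLp g (ENNReal.ofReal p) volume) :
    MemLp (fun x => g (Tm b s O x)) (ENNReal.ofReal p) volume := by
  refine ⟨hg.1.comp_quasiMeasurePreserving (Tm_qmp hs), ?_⟩
  rw [Tm_eLp hs]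
  exact ENNReal.mul_lt_top (ENNReal.rpow_lt_top_of_nonneg (by positivity) ENNReal.ofReal_ne_top) hg.2

lemma Tm_grad {f : EE n → ℝ} (hf : C1c f) (x : EE n) :
    gradient (fun x => f (Tm b s O x)) x = s • O.symm (gradient f (Tm b s O x)) := by
  have h1 : HasFDerivAt (Tm b s O) (s • (O.toContinuousLinearEquiv : EE n →L[ℝ] EE n)) x := by
    unfold Tm
    exact ((O.toContinuousLinearEquiv : EE n →L[ℝ] EE n).hasFDerivAt.const_smul s).const_add b
  refine grad_of_hasFDerivAt ((hf.diff (Tm b s O x)).hasFDerivAt.comp x h1) (fun y => ?_)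
  simp only [ContinuousLinearMap.comp_apply, _root_.smul_apply,
    map_smul, inner_smul_left, smul_eq_mul]
  rw [← O.inner_map_map, O.apply_symm_apply, inner_gradient_left]
  rfl

lemma C1c.tr {f : EE n → ℝ} (hf : C1c f) (hs : 0 < s) : C1c (fun x => f (Tm b s O x)) := by
  refine ⟨hf.cd.comp Tm_cd, ?_⟩
  refine HasCompactSupport.intro (K := Tm (-(s⁻¹ • O.symm b)) s⁻¹ O.symm '' tsupport f)
    (hf.cs.isCompact.image Tm_cont) fun x hx => ?_
  refine image_eq_zero_of_notMem_tsupport fun h => hx ⟨_, h, Tm_inv hs.ne' x⟩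

lemma DSeq.tr {f : ℕ → EE n → ℝ} {u : EE n → ℝ} {G : EE n → EE n} (h : DSeq p f u G) (hs : 0 < s) :
    DSeq p (fun k x => f k (Tm b s O x)) (fun x => u (Tm b s O x))
      (fun x => s • O.symm (G (Tm b s O x))) where
  c1 k := (h.c1 k).tr hs
  mem := by
    have h1 := Tm_memLp (b := b) (O := O) hs h.mem
    have h2 := (O.symm.toContinuousLinearEquiv : EE n →L[ℝ] EE n).comp_memLp' h1
    exact h2.const_smul s
  lim := by
    refine tendsto_eLp_bdd s (g := fun k x => gradient (f k) (Tm b s O x) - G (Tm b s O x))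
      (fun k => Eventually.of_forall fun x => ?_) ?_
    · rw [Tm_grad (h.c1 k), ← smul_sub, ← map_sub, norm_smul, Real.norm_of_nonneg hs.le,
        O.symm.norm_map]
    · have h1 := h.lim
      have h2 := ENNReal.Tendsto.const_mul (a := (ENNReal.ofReal ((s ^ n)⁻¹)) ^ (1 / (ENNReal.ofReal p).toReal))
        h1 (Or.inr (ENNReal.rpow_ne_top_of_nonneg (by positivity) ENNReal.ofReal_ne_top))
      rw [mul_zero] at h2
      refine h2.congr fun k => ?_
      exact (Tm_eLp (p := p) (b := b) (O := O) hs (fun x => gradient (f k) x - G x)).symm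
  ae := (Tm_qmp hs).ae h.ae

lemma Tm_energy (hs : 0 < s) (G : EE n → EE n) :
    ∫ x, ‖s • O.symm (G (Tm b s O x))‖ ^ p = s ^ p * (s ^ n)⁻¹ * ∫ x, ‖G x‖ ^ p := by
  have : ∀ x, ‖s • O.symm (G (Tm b s O x))‖ ^ p = s ^ p * ‖G (Tm b s O x)‖ ^ p := fun x => by
    rw [norm_smul, O.symm.norm_map, Real.norm_of_nonneg hs.le, Real.mul_rpow hs.le (norm_nonneg _)]
  simp only [this]
  rw [integral_const_mul, Tm_integral hs (fun x => ‖G x‖ ^ p), smul_eq_mul, mul_assoc]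

lemma cap_tr_le (hs : 0 < s) {K : Set (EE n)} (hK : Bornology.IsBounded K) :
    cap p (Tm b s O ⁻¹' K) ≤ s ^ p * (s ^ n)⁻¹ * cap p K := by
  have : 0 < s ^ p * (s ^ n)⁻¹ := by positivity
  rw [← div_le_iff₀' this]
  refine le_csInf (cap_nonempty hK) ?_
  rintro c ⟨u, hu, h1, rfl⟩
  rw [div_le_iff₀' this, ← Tm_energy (b := b) (O := O) hs]
  simp only [← Tm_grad hu]
  exact cap_le (hu.tr hs) fun x hx => h1 _ hx

lemma bdd_preim (hs : 0 < s) {K : Set (EE n)} (hK : Bornology.IsBounded K) :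
    Bornology.IsBounded (Tm b s O ⁻¹' K) := by
  obtain ⟨R, hR⟩ := Metric.isBounded_iff.mp hK
  refine Metric.isBounded_iff.mpr ⟨s⁻¹ * R, fun x hx y hy => ?_⟩
  have := hR hx hy
  rw [Tm_dist hs] at this
  rw [← div_eq_inv_mul, le_div_iff₀' hs]
  exact this

lemma cap_tr (hs : 0 < s) {K : Set (EE n)} (hK : Bornology.IsBounded K) :
    cap p (Tm b s O ⁻¹' K) = s ^ p * (s ^ n)⁻¹ * cap p K := by
  refine le_antisymm (cap_tr_le hs hK) ?_
  have h := cap_tr_le (p := p) (b := -(s⁻¹ • O.symm b)) (O := O.symm) (inv_pos.mpr hs) (bdd_preim (b := b) (O := O) hs hK)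
  have e : Tm (-(s⁻¹ • O.symm b)) s⁻¹ O.symm ⁻¹' (Tm b s O ⁻¹' K) = K := by
    ext x; simp only [mem_preimage, Tm_inv' hs.ne']
  rw [e, Real.inv_rpow hs.le, inv_pow, inv_inv] at h
  have h1 : 0 < s ^ p := by positivity
  have h2 : 0 < s ^ n := by positivity
  have : s ^ p * (s ^ n)⁻¹ * cap p K ≤ s ^ p * (s ^ n)⁻¹ * ((s ^ p)⁻¹ * s ^ n * cap p (Tm b s O ⁻¹' K)) := by
    gcongr
  refine this.trans_eq ?_
  field_simp

lemma Pot.tr {K : Set (EE n)} {f : ℕ → EE n → ℝ} {u : EE n → ℝ} {G : EE n → EE n}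
    (h : Pot p K f u G) (hK : Bornology.IsBounded K) (hs : 0 < s) :
    Pot p (Tm b s O ⁻¹' K) (fun k x => f k (Tm b s O x)) (fun x => u (Tm b s O x))
      (fun x => s • O.symm (G (Tm b s O x))) where
  ds := h.ds.tr hs
  ge k x hx := h.ge k _ hx
  en := by rw [Tm_energy hs, h.en, cap_tr hs hK]

end Tm

end PB

end SPartC1

section SPartC2
open MeasureTheory Metric Set Filter
open scoped RealInnerProductSpace Pointwise Topology ENNReal NNReal
namespace PB
set_option linter.unusedSectionVars false

variable {n : ℕ} {p : ℝ}

/-- nonnegative integrand with nonpositive integral vanishes -/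
lemma ae_zero_of_int {F : EE n → ℝ} (hF : Integrable F) (h0 : ∀ᵐ x, 0 ≤ F x) (h1 : ∫ x, F x ≤ 0) :
    ∀ᵐ x, F x = 0 := by
  have h2 : ∫ x, F x = 0 := le_antisymm h1 (integral_nonneg_of_ae h0)
  exact (integral_eq_zero_iff_of_nonneg_ae h0 hF).mp h2

lemma compareH (hp : 1 < p) (hpn : p < n) {K L : Set (EE n)} {f g : ℕ → EE n → ℝ} {u v : EE n → ℝ}
    {G W : EE n → EE n} (h : Pot p K f u G) (h' : Pot p L g v W) {H : Set (EE n)}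
    (hH : MeasurableSet H)
    (hφ : ∀ k, C1c (H.indicator fun x => th (f k x - g k x)))
    (hgr : ∀ k x, gradient (H.indicator fun x => th (f k x - g k x)) x =
      H.indicator (fun x => deriv th (f k x - g k x) • (gradient (f k) x - gradient (g k) x)) x)
    (hKL : K ∩ H ⊆ L) : ∀ᵐ x, x ∈ H → u x ≤ v x := by
  have hd := (h.ds.sub hp h'.ds).comp hp contDiff_th th_zero abs_deriv_th
  set Φ : EE n → EE n := H.indicator (fun x => deriv th (u x - v x) • (G x - W x)) with hΦ
  have hD : DSeq p (fun k => H.indicator fun x => th (f k x - g k x))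
      (H.indicator fun x => th (u x - v x)) Φ := by
    refine ⟨hφ, hd.mem.indicator hH, ?_, ?_⟩
    · refine tendsto_eLp_bdd 1 (fun k => Eventually.of_forall fun x => ?_) hd.lim
      rw [hgr, hΦ, one_mul]
      by_cases hx : x ∈ H
      · simp only [indicator_of_mem hx]
        rw [grad_comp (((h.ds.c1 k).sub (h'.ds.c1 k)).diff x)
          ((contDiff_th.differentiable one_ne_zero) _), grad_sub ((h.ds.c1 k).diff x) ((h'.ds.c1 k).diff x)]
      · simp [indicator_of_notMem hx]
    · filter_upwards [hd.ae] with x hx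
      by_cases hxH : x ∈ H
      · simpa only [indicator_of_mem hxH] using hx
      · simp only [indicator_of_notMem hxH]; exact tendsto_const_nhds
  have e1 : 0 ≤ ∫ x, ⟪AA p (W x), Φ x⟫ := by
    refine h'.EL hp hD one_pos fun k x hx => ?_
    have : 0 ≤ H.indicator (fun x => th (f k x - g k x)) x := indicator_nonneg (fun _ _ => th_nonneg _) _
    linarith [h'.ge k x hx]
  have e2 : 0 ≤ ∫ x, ⟪AA p (G x), (-1 : ℝ) • Φ x⟫ := by
    refine h.EL hp (hD.const_mul (-1)) one_pos fun k x hx => ?_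
    by_cases hxH : x ∈ H
    · have a1 := h'.ge k x (hKL ⟨hx, hxH⟩)
      have a2 := h.ge k x hx
      simp only [indicator_of_mem hxH]
      rcases le_total (f k x - g k x) 0 with h3 | h3
      · rw [th_of_nonpos h3]; linarith
      · linarith [th_le h3]
    · simp only [indicator_of_notMem hxH]; linarith [h.ge k x hx]
  have i1 := int_AA hp h'.ds.mem hD.mem
  have i2 := int_AA hp h.ds.mem hD.mem
  have e3 : ∫ x, ⟪AA p (G x) - AA p (W x), Φ x⟫ ≤ 0 := by
    simp only [inner_sub_left]
    rw [integral_sub i2 i1]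
    simp only [inner_smul_right, neg_mul, one_mul, integral_neg] at e2
    linarith
  have e4 : ∀ x, 0 ≤ ⟪AA p (G x) - AA p (W x), Φ x⟫ := by
    intro x
    by_cases hxH : x ∈ H
    · simp only [hΦ, indicator_of_mem hxH, inner_smul_right]
      exact mul_nonneg (deriv_th_nonneg _) (AA_mono hp _ _)
    · simp [hΦ, indicator_of_notMem hxH]
  have i3 : Integrable (fun x => ⟪AA p (G x) - AA p (W x), Φ x⟫) := by
    simp only [inner_sub_left]; exact i2.sub i1
  have e5 := ae_zero_of_int i3
    (Eventually.of_forall e4) e3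
  have e6 : Φ =ᵐ[volume] 0 := by
    filter_upwards [e5] with x hx
    by_cases hxH : x ∈ H
    · simp only [hΦ, indicator_of_mem hxH, inner_smul_right, Pi.zero_apply] at hx ⊢
      rcases mul_eq_zero.mp hx with h3 | h3
      · rw [h3, zero_smul]
      · rw [AA_strict hp _ _ h3.le, sub_self, smul_zero]
    · simp [hΦ, indicator_of_notMem hxH]
  filter_upwards [hD.eq_zero hp hpn e6] with x hx hxH
  rw [indicator_of_mem hxH] at hx
  linarith [nonpos_of_th hx]

lemma Pot.mono (hp : 1 < p) (hpn : p < n) {K L : Set (EE n)} {f g : ℕ → EE n → ℝ} {u v : EE n → ℝ}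
    {G W : EE n → EE n} (h : Pot p K f u G) (h' : Pot p L g v W) (hKL : K ⊆ L) :
    ∀ᵐ x, u x ≤ v x := by
  have := compareH hp hpn h h' MeasurableSet.univ
    (fun k => by
      simp only [indicator_univ]; exact ((h.ds.c1 k).sub (h'.ds.c1 k)).comp contDiff_th th_zero)
    (fun k x => by
      simp only [indicator_univ]
      rw [grad_comp (((h.ds.c1 k).sub (h'.ds.c1 k)).diff x)
          ((contDiff_th.differentiable one_ne_zero) _), grad_sub ((h.ds.c1 k).diff x) ((h'.ds.c1 k).diff x)])
    (by simpa using hKL)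
  filter_upwards [this] with x hx using hx trivial

lemma Pot.nonneg (hp : 1 < p) (hpn : p < n) {K : Set (EE n)} {f : ℕ → EE n → ℝ} {u : EE n → ℝ}
    {G : EE n → EE n} (h : Pot p K f u G) : ∀ᵐ x, 0 ≤ u x := by
  have hd := (h.ds.const_mul (-1)).comp hp contDiff_th th_zero abs_deriv_th
  have e1 := h.EL hp hd one_pos fun k x hx => by
    have := th_nonneg (-1 * f k x); linarith [h.ge k x hx]
  have e2 : ∀ x, ⟪AA p (G x), deriv th (-1 * u x) • (-1 : ℝ) • G x⟫ =
      -(deriv th (-1 * u x) * ‖G x‖ ^ p) := fun x => by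
    rw [inner_smul_right, inner_smul_right, AA_inner_self hp]; ring
  have i := int_AA hp h.ds.mem hd.mem
  simp only [e2] at e1 i
  rw [integral_neg] at e1
  have e3 := ae_zero_of_int (by simpa using i.neg) (Eventually.of_forall fun x =>
    mul_nonneg (deriv_th_nonneg (-1 * u x)) (by positivity : 0 ≤ ‖G x‖ ^ p)) (by linarith)
  have e6 : (fun x => deriv th (-1 * u x) • (-1 : ℝ) • G x) =ᵐ[volume] 0 := by
    filter_upwards [e3] with x hx
    rcases mul_eq_zero.mp hx with h3 | h3
    · simp only [h3, zero_smul, Pi.zero_apply]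
    · rw [Real.rpow_eq_zero (norm_nonneg _) (by linarith), norm_eq_zero] at h3
      simp [h3]
  filter_upwards [hd.eq_zero hp hpn e6] with x hx
  linarith [nonpos_of_th hx]

lemma Pot.le_one (hp : 1 < p) (hpn : p < n) {K : Set (EE n)} {f : ℕ → EE n → ℝ} {u : EE n → ℝ}
    {G : EE n → EE n} (h : Pot p K f u G) : ∀ᵐ x, u x ≤ 1 := by
  have hder : ∀ s, HasDerivAt (fun s => th (s - 1)) (deriv th (s - 1)) s := fun s => by
    rw [deriv_th]; exact (hasDerivAt_th (s - 1)).comp_sub_const s 1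
  have hc : ContDiff ℝ 1 (fun s => th (s - 1)) := contDiff_th.comp (contDiff_id.sub contDiff_const)
  have hd := h.ds.comp hp hc (th_of_nonpos (by norm_num)) (M := 2)
    (fun s => by rw [(hder s).deriv]; exact abs_deriv_th _)
  simp only [(hder _).deriv] at hd
  have e1 := h.EL hp (hd.const_mul (-1)) one_pos fun k x hx => by
    have h1 := h.ge k x hx
    have := th_le (by linarith : 0 ≤ f k x - 1); linarith
  have e2 : ∀ x, ⟪AA p (G x), (-1 : ℝ) • deriv th (u x - 1) • G x⟫ =
      -(deriv th (u x - 1) * ‖G x‖ ^ p) := fun x => by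
    rw [inner_smul_right, inner_smul_right, AA_inner_self hp]; ring
  have i := int_AA hp h.ds.mem (hd.const_mul (-1)).mem
  simp only [e2] at e1 i
  rw [integral_neg] at e1
  have e3 := ae_zero_of_int (by simpa using i.neg) (Eventually.of_forall fun x =>
    mul_nonneg (deriv_th_nonneg (u x - 1)) (by positivity : 0 ≤ ‖G x‖ ^ p)) (by linarith)
  have e6 : (fun x => deriv th (u x - 1) • G x) =ᵐ[volume] 0 := by
    filter_upwards [e3] with x hx
    rcases mul_eq_zero.mp hx with h3 | h3
    · simp only [h3, zero_smul, Pi.zero_apply]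
    · rw [Real.rpow_eq_zero (norm_nonneg _) (by linarith), norm_eq_zero] at h3
      simp [h3]
  filter_upwards [hd.eq_zero hp hpn e6] with x hx
  linarith [nonpos_of_th hx]

/-- weak supersolution -/
lemma Pot.super (hp : 1 < p) {K : Set (EE n)} {f : ℕ → EE n → ℝ} {u : EE n → ℝ}
    {G : EE n → EE n} (h : Pot p K f u G) {φ : ℕ → EE n → ℝ} {v : EE n → ℝ} {Φ : EE n → EE n}
    (hφ : DSeq p φ v Φ) (h0 : ∀ k x, 0 ≤ φ k x) : 0 ≤ ∫ x, ⟪AA p (G x), Φ x⟫ :=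
  h.EL hp hφ one_pos fun k x hx => by linarith [h.ge k x hx, h0 k x]

/-- weak subsolution off `K` -/
lemma Pot.sub (hp : 1 < p) {K : Set (EE n)} {f : ℕ → EE n → ℝ} {u : EE n → ℝ}
    {G : EE n → EE n} (h : Pot p K f u G) {φ : ℕ → EE n → ℝ} {v : EE n → ℝ} {Φ : EE n → EE n}
    (hφ : DSeq p φ v Φ) (h0 : ∀ k, ∀ x ∈ K, φ k x = 0) : ∫ x, ⟪AA p (G x), Φ x⟫ ≤ 0 := by
  have := h.EL hp (hφ.const_mul (-1)) one_pos fun k x hx => by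
    rw [h0 k x hx]; linarith [h.ge k x hx]
  simp only [inner_smul_right, neg_mul, one_mul, integral_neg] at this
  linarith

end PB

end SPartC2

section SPartE1
open MeasureTheory Metric Set Filter
open scoped RealInnerProductSpace Pointwise Topology ENNReal NNReal
namespace PB
set_option linter.unusedSectionVars false

variable {n : ℕ} {p : ℝ}

lemma hull_att {f : EE n → ℝ} (hne : ∃ (g : EE n) (c : ℝ), ∀ y, ⟪g, y⟫ + c ≤ f y)
    (hb : ∀ x, ∃ B, ∀ y ∈ closedBall x 1, f y ≤ B) (x : EE n) :
    ∃ (g : EE n) (s : ℝ), (∀ y, s + ⟪g, y - x⟫ ≤ f y) ∧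
      ∀ (g' : EE n) (s' : ℝ), (∀ y, s' + ⟪g', y - x⟫ ≤ f y) → s' ≤ s := by
  obtain ⟨g0, c0, h0⟩ := hne
  obtain ⟨B, hB⟩ := hb x
  set s0 := ⟪g0, x⟫ + c0 with hs0
  set S : Set (EE n × ℝ) := {z | (∀ y, z.2 + ⟪z.1, y - x⟫ ≤ f y) ∧ s0 ≤ z.2} with hS
  have hcl : IsClosed S := by
    have e : S = (⋂ y, {z : EE n × ℝ | z.2 + ⟪z.1, y - x⟫ ≤ f y}) ∩ {z : EE n × ℝ | s0 ≤ z.2} := by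
      ext z; simp [hS]
    rw [e]
    refine (isClosed_iInter fun y => isClosed_le ?_ continuous_const).inter
      (isClosed_le continuous_const continuous_snd)
    exact continuous_snd.add (continuous_fst.inner continuous_const)
  have hsub : S ⊆ closedBall (0 : EE n) (max (B - s0) 0) ×ˢ Icc s0 (f x) := by
    rintro ⟨g, s⟩ ⟨h1, h2⟩
    simp only at h1 h2
    refine ⟨?_, h2, by simpa using h1 x⟩
    rw [mem_closedBall_zero_iff]
    by_cases hg : g = 0
    · simp [hg]
    · have hg' : 0 < ‖g‖ := norm_pos_iff.mpr hg
      have h3 := h1 (x + ‖g‖⁻¹ • g)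
      have h4 := hB (x + ‖g‖⁻¹ • g) (by
        rw [mem_closedBall, dist_eq_norm, add_sub_cancel_left, norm_smul, norm_inv, norm_norm,
          inv_mul_cancel₀ hg'.ne'])
      rw [add_sub_cancel_left, inner_smul_right, real_inner_self_eq_norm_sq, sq, ← mul_assoc,
        inv_mul_cancel₀ hg'.ne', one_mul] at h3
      exact le_max_of_le_left (by linarith)
  have hc : IsCompact S := ((isCompact_closedBall _ _).prod isCompact_Icc).of_isClosed_subset hcl hsub
  have hn : S.Nonempty := ⟨(g0, s0), fun y => by
    have := h0 y
    simp only [hs0, inner_sub_right]; linarith, le_rfl⟩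
  obtain ⟨⟨g, s⟩, hm, hmax⟩ := hc.exists_isMaxOn hn continuous_snd.continuousOn
  refine ⟨g, s, hm.1, fun g' s' h' => ?_⟩
  by_cases hs : s0 ≤ s'
  · exact hmax (show (g', s') ∈ S from ⟨h', hs⟩)
  · exact (not_le.mp hs).le.trans hm.2

lemma hull_exists {f : EE n → ℝ} {A : ℝ} (hA : 0 ≤ A)
    (hne : ∃ (g : EE n) (c : ℝ), ∀ y, ⟪g, y⟫ + c ≤ f y)
    (hb : ∀ x, ∃ B, ∀ y ∈ closedBall x 1, f y ≤ B)
    (hsc : ∀ x h, f (x + h) + f (x - h) - 2 * f x ≤ 2 * A * ‖h‖ ^ 2) :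
    ∃ (F : EE n → ℝ) (l : EE n → EE n), (∀ x, F x ≤ f x) ∧
      (∀ x y, F x + ⟪l x, y - x⟫ ≤ F y) ∧
      (∀ x g s, (∀ y, s + ⟪g, y - x⟫ ≤ f y) → s ≤ F x) ∧
      (∀ x h, F (x + h) ≤ F x + ⟪l x, h⟫ + 2 * A * ‖h‖ ^ 2) ∧
      (∀ x y, ‖l x - l y‖ ≤ 4 * A * ‖x - y‖) := by
  choose l F h1 h2 using hull_att hne hb
  have hle : ∀ x, F x ≤ f x := fun x => by simpa using h1 x x
  have hsup : ∀ x y, F x + ⟪l x, y - x⟫ ≤ F y := fun x y => by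
    refine h2 y (l x) _ fun z => ?_
    have := h1 x z
    simp only [inner_sub_right] at this ⊢
    linarith
  have hmid : ∀ x h, F (x + h) + F (x - h) - 2 * F x ≤ 2 * A * ‖h‖ ^ 2 := by
    intro x h
    have := h2 x ((1 / 2 : ℝ) • (l (x + h) + l (x - h)))
      ((F (x + h) + F (x - h)) / 2 - A * ‖h‖ ^ 2) fun z => by
        have a1 := hsup (x + h) (z + h)
        have a2 := hsup (x - h) (z - h)
        have a3 := hle (z + h)
        have a4 := hle (z - h)
        have a5 := hsc z h
        rw [add_sub_add_right_eq_sub] at a1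
        rw [sub_sub_sub_cancel_right] at a2
        rw [inner_smul_left, inner_add_left]
        simp only [map_div₀, map_one, map_ofNat]
        linarith
    linarith
  have hup : ∀ x h, F (x + h) ≤ F x + ⟪l x, h⟫ + 2 * A * ‖h‖ ^ 2 := fun x h => by
    have a1 := hmid x h
    have a2 := hsup x (x - h)
    rw [sub_sub_cancel_left, inner_neg_right] at a2
    linarith
  refine ⟨F, l, hle, hsup, h2, hup, fun x y => ?_⟩
  refine le_of_forall_pos_le_add fun ε hε => ?_
  by_cases hg : l x - l y = 0
  · rw [hg, norm_zero]; positivity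
  have hg' : 0 < ‖l x - l y‖ := norm_pos_iff.mpr hg
  set t := ‖x - y‖ + ε / (4 * A + 1) with ht
  have ht0 : 0 < t := by positivity
  set e := (t * ‖l x - l y‖⁻¹) • (l x - l y) with he
  have hen : ‖e‖ = t := by
    rw [he, norm_smul, norm_mul, norm_inv, norm_norm, Real.norm_of_nonneg ht0.le, mul_assoc,
      inv_mul_cancel₀ hg'.ne', mul_one]
  have hin : ⟪l x - l y, e⟫ = t * ‖l x - l y‖ := by
    rw [he, inner_smul_right, real_inner_self_eq_norm_sq]; field_simp
  have b1 := hup y e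
  have b2 := hsup x (y + e)
  have b3 := hup x (y - x)
  rw [add_sub_cancel] at b3
  have b4 : ‖y - x‖ ≤ t := by
    rw [norm_sub_rev, ht]; have : 0 ≤ ε / (4 * A + 1) := by positivity
    linarith
  have b5 : ‖y - x‖ ^ 2 ≤ t ^ 2 := by gcongr
  rw [hen] at b1
  rw [inner_sub_left] at hin
  rw [add_sub_right_comm, inner_add_right] at b2
  have b6 : t * ‖l x - l y‖ ≤ t * (4 * A * t) := by
    have : 2 * A * ‖y - x‖ ^ 2 ≤ 2 * A * t ^ 2 := by gcongr
    nlinarith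
  have b7 := le_of_mul_le_mul_left b6 ht0
  refine b7.trans ?_
  rw [ht, mul_add]
  have : 4 * A * (ε / (4 * A + 1)) ≤ ε := by
    rw [mul_div_assoc', div_le_iff₀ (by positivity)]; nlinarith
  linarith

/-- second order expansion of a function with gradient `l`, differentiable at `x` -/
lemma taylor_two {F : EE n → ℝ} {l : EE n → EE n} {A : ℝ}
    (h1 : ∀ x y, F x + ⟪l x, y - x⟫ ≤ F y)
    (h2 : ∀ x h, F (x + h) ≤ F x + ⟪l x, h⟫ + 2 * A * ‖h‖ ^ 2) {x : EE n} {D : EE n →L[ℝ] EE n}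
    (hD : HasFDerivAt l D x) {ε : ℝ} (hε : 0 < ε) :
    ∀ᶠ h in 𝓝 (0 : EE n), |F (x + h) - F x - ⟪l x, h⟫ - 1 / 2 * ⟪D h, h⟫| ≤ ε * ‖h‖ ^ 2 := by
  have hF : ∀ y, HasFDerivAt F (innerSL ℝ (l y)) y := by
    intro y
    rw [hasFDerivAt_iff_isLittleO_nhds_zero, Asymptotics.isLittleO_iff]
    intro c hc
    have : ∀ᶠ h : EE n in 𝓝 0, 2 * |A| * ‖h‖ < c := by
      have : Tendsto (fun h : EE n => 2 * |A| * ‖h‖) (𝓝 0) (𝓝 (2 * |A| * ‖(0 : EE n)‖)) :=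
        (continuous_const.mul continuous_norm).tendsto _
      rw [norm_zero, mul_zero] at this
      exact this.eventually (gt_mem_nhds hc)
    filter_upwards [this] with h hh
    have a1 := h1 y (y + h)
    have a2 := h2 y h
    rw [add_sub_cancel_left] at a1
    rw [Real.norm_eq_abs, innerSL_apply_apply, abs_of_nonneg (by linarith)]
    have : 2 * A * ‖h‖ ^ 2 ≤ 2 * |A| * ‖h‖ * ‖h‖ := by
      rw [sq, mul_assoc _ ‖h‖ ‖h‖]; gcongr; exact le_abs_self A
    nlinarith [norm_nonneg h]
  rw [hasFDerivAt_iff_isLittleO_nhds_zero, Asymptotics.isLittleO_iff] at hD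
  obtain ⟨r, hr, hball⟩ := Metric.eventually_nhds_iff.mp (hD hε)
  refine Metric.eventually_nhds_iff.mpr ⟨r, hr, fun h hh => ?_⟩
  have hder : ∀ t : ℝ, HasDerivAt (fun t : ℝ => F (x + t • h) - t * ⟪l x, h⟫ - t ^ 2 * (1 / 2 * ⟪D h, h⟫))
      (⟪l (x + t • h), h⟫ - ⟪l x, h⟫ - t * ⟪D h, h⟫) t := by
    intro t
    have a1 : HasDerivAt (fun t : ℝ => x + t • h) h t := by
      simpa using ((hasDerivAt_id t).smul_const h).const_add x
    have a2 := (hF (x + t • h)).comp_hasDerivAt t a1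
    have a3 := (hasDerivAt_id t).mul_const ⟪l x, h⟫
    have a4 := ((hasDerivAt_id t).pow 2).mul_const (1 / 2 * ⟪D h, h⟫)
    refine ((a2.sub a3).sub a4).congr_deriv ?_
    rw [innerSL_apply_apply]; norm_num; ring
  have hmv := Convex.norm_image_sub_le_of_norm_hasDerivWithin_le (s := Icc (0 : ℝ) 1) (C := ε * ‖h‖ ^ 2)
    (fun t _ => (hder t).hasDerivWithinAt) (fun t ht => by
      have hth : ‖t • h‖ ≤ ‖h‖ := by
        rw [norm_smul, Real.norm_of_nonneg ht.1]; exact mul_le_of_le_one_left (norm_nonneg _) ht.2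
      have := hball (y := t • h) (by rw [dist_zero_right] at hh ⊢; exact hth.trans_lt hh)
      have e : ⟪l (x + t • h), h⟫ - ⟪l x, h⟫ - t * ⟪D h, h⟫ = ⟪l (x + t • h) - l x - D (t • h), h⟫ := by
        simp only [inner_sub_left, map_smul, inner_smul_left]; simp
      rw [e, Real.norm_eq_abs]
      calc _ ≤ ‖l (x + t • h) - l x - D (t • h)‖ * ‖h‖ := abs_real_inner_le_norm _ _
        _ ≤ (ε * ‖h‖) * ‖h‖ := by gcongr; exact this.trans (by gcongr)
        _ = _ := by ring) (convex_Icc 0 1) (left_mem_Icc.mpr zero_le_one) (right_mem_Icc.mpr zero_le_one)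
  simp only [one_smul, zero_smul, add_zero, Real.norm_eq_abs] at hmv
  rw [sub_zero, abs_one, mul_one] at hmv
  convert hmv using 2
  ring

end PB

end SPartE1

section SPartE2
open MeasureTheory Metric Set Filter
open scoped RealInnerProductSpace Pointwise Topology ENNReal NNReal
namespace PB
set_option linter.unusedSectionVars false

variable {n : ℕ} {p : ℝ}

lemma exists_min_of_lsc {X : Type*} [PseudoMetricSpace X] [ProperSpace X] {φ : X → ℝ}
    (h : LowerSemicontinuous φ) (x0 : X) (hb : Bornology.IsBounded {x | φ x ≤ φ x0}) :
    ∃ x, ∀ y, φ x ≤ φ y := by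
  have hc : IsCompact {x | φ x ≤ φ x0} :=
    Metric.isCompact_of_isClosed_isBounded (h.isClosed_preimage (φ x0)) hb
  obtain ⟨x, hx, hmin⟩ := (h.lowerSemicontinuousOn _).exists_isMinOn ⟨x0, le_refl (φ x0)⟩ hc
  refine ⟨x, fun y => ?_⟩
  by_cases hy : φ y ≤ φ x0
  · exact hmin hy
  · exact (show φ x ≤ φ x0 from hx).trans (not_le.mp hy).le

/-- Lipschitz images of null sets cannot cover a ball. -/
lemma null_contact {S : EE n × EE n → EE n × EE n → Prop} {δ C : ℝ} (hδ : 0 < δ)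
    (hex : ∀ q ∈ ball (0 : EE n × EE n) δ, ∃ X, S q X)
    (hL : ∀ q X q' X', S q X → S q' X' → dist q q' ≤ C * dist X X')
    {N0 N1 : Set (EE n)} (h0 : volume N0 = 0) (h1 : volume N1 = 0) :
    ∃ q ∈ ball (0 : EE n × EE n) δ, ∃ X, S q X ∧ X.1 ∉ N0 ∧ X.2 ∉ N1 := by
  by_contra hcon
  push Not at hcon
  choose! X hX using hex
  set T := X '' ball (0 : EE n × EE n) δ with hT
  have hTN : T ⊆ N0 ×ˢ univ ∪ univ ×ˢ N1 := by
    rintro _ ⟨q, hq, rfl⟩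
    by_cases h : (X q).1 ∈ N0
    · exact Or.inl ⟨h, trivial⟩
    · exact Or.inr ⟨trivial, hcon q hq (X q) (hX q hq) h⟩
  have hvol : (volume : Measure (EE n × EE n)) T = 0 := by
    refine measure_mono_null hTN ?_
    rw [measure_union_null_iff]
    constructor
    · rw [Measure.volume_eq_prod, Measure.prod_prod, h0, zero_mul]
    · rw [Measure.volume_eq_prod, Measure.prod_prod, h1, mul_zero]
  have hinv : ∀ Y ∈ T, ∃ q, q ∈ ball (0 : EE n × EE n) δ ∧ X q = Y := fun Y ⟨q, hq, e⟩ => ⟨q, hq, e⟩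
  choose! φ hφ1 hφ2 using hinv
  have hlip : LipschitzOnWith C.toNNReal φ T := by
    refine LipschitzOnWith.of_dist_le_mul fun Y hY Z hZ => ?_
    have := hL (φ Y) (X (φ Y)) (φ Z) (X (φ Z)) (hX _ (hφ1 Y hY)) (hX _ (hφ1 Z hZ))
    rw [hφ2 Y hY, hφ2 Z hZ] at this
    refine this.trans ?_
    gcongr
    exact Real.le_coe_toNNReal C
  have himg : ball (0 : EE n × EE n) δ ⊆ φ '' T := by
    intro q hq
    refine ⟨X q, ⟨q, hq, rfl⟩, ?_⟩
    have h2 := hL (φ (X q)) (X (φ (X q))) q (X q) (hX _ (hφ1 _ ⟨q, hq, rfl⟩)) (hX q hq)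
    rw [hφ2 _ ⟨q, hq, rfl⟩, dist_self, mul_zero] at h2
    exact dist_le_zero.mp h2
  set d : ℝ := (Module.finrank ℝ (EE n × EE n) : ℝ) with hd
  have hH : (μH[d] : Measure (EE n × EE n)).IsAddHaarMeasure := isAddHaarMeasure_hausdorffMeasure
  have hac : (μH[d] : Measure (EE n × EE n)) ≪ volume := by
    rw [Measure.volume_eq_prod]
    exact Measure.absolutelyContinuous_isAddHaarMeasure _ _
  have h3 : (μH[d] : Measure (EE n × EE n)) (φ '' T) = 0 := by
    have := hlip.hausdorffMeasure_image_le (d := d) (by positivity)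
    rw [hac hvol, mul_zero] at this
    exact le_antisymm this (zero_le)
  have h4 := measure_mono_null himg h3
  exact (isOpen_ball.measure_pos (μH[d] : Measure (EE n × EE n)) ⟨0, mem_ball_self hδ⟩).ne' h4

lemma eq_zero_of_quad {d : EE n} {C : ℝ} (h : ∀ x, ⟪d, x⟫ ≤ C * ‖x‖ ^ 2) : d = 0 := by
  by_contra hd
  have hd' : 0 < ‖d‖ := norm_pos_iff.mpr hd
  have h1 := h ((1 / (|C| + 1)) • d)
  have hc : 0 < |C| + 1 := by positivity
  rw [inner_smul_right, real_inner_self_eq_norm_sq, norm_smul, mul_pow, Real.norm_of_nonneg (by positivity)] at h1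
  have h2 : 1 / (|C| + 1) ≤ C * (1 / (|C| + 1)) ^ 2 := by
    have : 0 < ‖d‖ ^ 2 := by positivity
    rw [← mul_le_mul_iff_left₀ this]; linarith
  have h3 : C < |C| + 1 := by linarith [le_abs_self C]
  have h4 : C * (1 / (|C| + 1)) ^ 2 < (|C| + 1) * (1 / (|C| + 1)) ^ 2 := by gcongr
  have h5 : (|C| + 1) * (1 / (|C| + 1)) ^ 2 = 1 / (|C| + 1) := by field_simp
  linarith

/-- inf-convolution -/
noncomputable def ic (a : ℝ) (v : EE n → ℝ) (x : EE n) : ℝ := ⨅ w, (v w + a * ‖w - x‖ ^ 2)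

section ic
variable {a C0 : ℝ} {v : EE n → ℝ}

lemma ic_bdd (ha : 0 ≤ a) (hv : ∀ x, -C0 ≤ v x) (x : EE n) :
    BddBelow (range fun w => v w + a * ‖w - x‖ ^ 2) := by
  refine ⟨-C0, ?_⟩
  rintro _ ⟨w, rfl⟩
  have : 0 ≤ a * ‖w - x‖ ^ 2 := by positivity
  simp only; linarith [hv w]

lemma ic_le (ha : 0 ≤ a) (hv : ∀ x, -C0 ≤ v x) (x w : EE n) : ic a v x ≤ v w + a * ‖w - x‖ ^ 2 :=
  ciInf_le (ic_bdd ha hv x) w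

lemma le_ic {x : EE n} {c : ℝ} (h : ∀ w, c ≤ v w + a * ‖w - x‖ ^ 2) : c ≤ ic a v x := le_ciInf h

lemma par (x h : EE n) : ‖x + h‖ ^ 2 = ‖x‖ ^ 2 + 2 * ⟪x, h⟫ + ‖h‖ ^ 2 := norm_add_sq_real x h

lemma ic_hull (ha : 0 < a) (hv : ∀ x, -C0 ≤ v x) :
    ∃ (F : EE n → ℝ) (l : EE n → EE n), (∀ x, F x ≤ ic a v x + a / 2 * ‖x‖ ^ 2) ∧
      (∀ x y, F x + ⟪l x, y - x⟫ ≤ F y) ∧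
      (∀ x g s, (∀ y, s + ⟪g, y - x⟫ ≤ ic a v y + a / 2 * ‖y‖ ^ 2) → s ≤ F x) ∧
      (∀ x h, F (x + h) ≤ F x + ⟪l x, h⟫ + 3 * a * ‖h‖ ^ 2) ∧
      (∀ x y, ‖l x - l y‖ ≤ 6 * a * ‖x - y‖) := by
  have := hull_exists (f := fun x => ic a v x + a / 2 * ‖x‖ ^ 2) (A := 3 / 2 * a) (by positivity)
    ⟨0, -C0, fun y => by
      have h1 : -C0 ≤ ic a v y := le_ic fun w => by
        have : 0 ≤ a * ‖w - y‖ ^ 2 := by positivity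
        linarith [hv w]
      have : 0 ≤ a / 2 * ‖y‖ ^ 2 := by positivity
      rw [inner_zero_left]; linarith⟩
    (fun x => ⟨v x + a * 1 ^ 2 + a / 2 * (‖x‖ + 1) ^ 2, fun y hy => by
      have h1 := ic_le ha.le hv y x
      rw [mem_closedBall, dist_eq_norm] at hy
      have h2 : ‖x - y‖ ≤ 1 := by rw [norm_sub_rev]; exact hy
      have h3 : ‖y‖ ≤ ‖x‖ + 1 := by
        have := norm_add_le x (y - x); rw [add_sub_cancel] at this; linarith
      have h4 : a * ‖x - y‖ ^ 2 ≤ a * 1 ^ 2 := by gcongr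
      have h5 : a / 2 * ‖y‖ ^ 2 ≤ a / 2 * (‖x‖ + 1) ^ 2 := by gcongr
      linarith⟩)
    (fun x h => by
      have h1 : (ic a v (x + h) + ic a v (x - h)) / 2 - a * ‖h‖ ^ 2 ≤ ic a v x := le_ic fun w => by
        have a1 := ic_le ha.le hv (x + h) w
        have a2 := ic_le ha.le hv (x - h) w
        have e1 : ‖w - (x + h)‖ ^ 2 = ‖w - x‖ ^ 2 - 2 * ⟪w - x, h⟫ + ‖h‖ ^ 2 := by
          rw [← sub_sub, norm_sub_sq_real]
        have e2 : ‖w - (x - h)‖ ^ 2 = ‖w - x‖ ^ 2 + 2 * ⟪w - x, h⟫ + ‖h‖ ^ 2 := by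
          rw [sub_sub_eq_add_sub, add_sub_right_comm, norm_add_sq_real]
        rw [e1] at a1; rw [e2] at a2
        linarith
      have e3 := norm_add_sq_real x h
      have e4 := norm_sub_sq_real x h
      simp only [e3, e4]
      linarith)
  have e1 : 2 * (3 / 2 * a) = 3 * a := by ring
  have e2 : 4 * (3 / 2 * a) = 6 * a := by ring
  rw [e1, e2] at this
  exact this

end ic

end PB

end SPartE2

section SPartE3
open MeasureTheory Metric Set Filter
open scoped RealInnerProductSpace Pointwise Topology ENNReal NNReal
namespace PB
set_option linter.unusedSectionVars false

variable {n : ℕ} {p : ℝ}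

/-- doubled functional -/
noncomputable def NN (a : ℝ) (v0 v1 V : EE n → ℝ) (q0 q1 x0 x1 w w0 w1 : EE n) : ℝ :=
  v0 w0 + a * ‖w0 - x0‖ ^ 2 + (v1 w1 + a * ‖w1 - x1‖ ^ 2) + (2 * ⟪q0, x0⟫ + 2 * ⟪q1, x1⟫) +
    (-V w + -V w) + 2 * a * ‖w - (1 / 2 : ℝ) • (x0 + x1)‖ ^ 2

lemma quad_aux (x w : EE n) : ‖w‖ ^ 2 / 4 + ‖x‖ ^ 2 / 6 ≤ ‖w‖ ^ 2 / 2 + ‖w - x‖ ^ 2 := by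
  have h1 := norm_sub_sq_real w x
  have h2 : ‖(3:ℝ) • w - (2:ℝ) • x‖ ^ 2 = 9 * ‖w‖ ^ 2 - 12 * ⟪w, x⟫ + 4 * ‖x‖ ^ 2 := by
    rw [norm_sub_sq_real, norm_smul, norm_smul, inner_smul_left, inner_smul_right]
    norm_num; ring
  have h3 : 0 ≤ ‖(3:ℝ) • w - (2:ℝ) • x‖ ^ 2 := by positivity
  nlinarith [sq_nonneg ‖w‖, sq_nonneg ‖x‖]

lemma NN_bound {a C0 B N0 : ℝ} {v0 v1 V : EE n → ℝ} {q0 q1 x0 x1 w w0 w1 : EE n} (ha : 1 ≤ a)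
    (h0 : ∀ x, ‖x‖ ^ 2 / 2 - C0 ≤ v0 x) (h1 : ∀ x, ‖x‖ ^ 2 / 2 - C0 ≤ v1 x) (hB : ∀ x, V x ≤ B)
    (hq0 : ‖q0‖ ≤ 1) (hq1 : ‖q1‖ ≤ 1) (hN : NN a v0 v1 V q0 q1 x0 x1 w w0 w1 ≤ N0) :
    ‖w0‖ ^ 2 / 4 + ‖x0‖ ^ 2 / 12 + ‖w1‖ ^ 2 / 4 + ‖x1‖ ^ 2 / 12 +
    (a - 1) * ‖w0 - x0‖ ^ 2 + (a - 1) * ‖w1 - x1‖ ^ 2 + a * ‖w - (1 / 2 : ℝ) • (x0 + x1)‖ ^ 2 ≤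
      N0 + 2 * C0 + 2 * B + 24 := by
  unfold NN at hN
  have a1 := quad_aux x0 w0
  have a2 := quad_aux x1 w1
  have a3 := h0 w0
  have a4 := h1 w1
  have a5 := hB w
  have a6 : -‖x0‖ ≤ ⟪q0, x0⟫ := by
    have := neg_le_of_abs_le (abs_real_inner_le_norm q0 x0)
    nlinarith [norm_nonneg x0]
  have a7 : -‖x1‖ ≤ ⟪q1, x1⟫ := by
    have := neg_le_of_abs_le (abs_real_inner_le_norm q1 x1)
    nlinarith [norm_nonneg x1]
  have a8 : 0 ≤ a * ‖w - (1 / 2 : ℝ) • (x0 + x1)‖ ^ 2 := by positivity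
  nlinarith [sq_nonneg (‖x0‖ - 12), sq_nonneg (‖x1‖ - 12)]

lemma le_of_sq_bd {t M : ℝ} (h : t ^ 2 ≤ M) : t ≤ M + 1 := by nlinarith [sq_nonneg (t - 1)]

lemma NN_bound' {a C0 B N0 : ℝ} {v0 v1 V : EE n → ℝ} {q0 q1 x0 x1 w w0 w1 : EE n} (ha : 1 ≤ a)
    (h0 : ∀ x, ‖x‖ ^ 2 / 2 - C0 ≤ v0 x) (h1 : ∀ x, ‖x‖ ^ 2 / 2 - C0 ≤ v1 x) (hB : ∀ x, V x ≤ B)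
    (hq0 : ‖q0‖ ≤ 1) (hq1 : ‖q1‖ ≤ 1) (hN : NN a v0 v1 V q0 q1 x0 x1 w w0 w1 ≤ N0) :
    let M := 24 * (N0 + 2 * C0 + 2 * B + 24) + 2
    ‖x0‖ ≤ M ∧ ‖x1‖ ≤ M ∧ ‖w‖ ≤ M ∧ ‖w0‖ ≤ M ∧ ‖w1‖ ≤ M ∧ (a - 1) * ‖w0 - x0‖ ^ 2 ≤ M ∧
      (a - 1) * ‖w1 - x1‖ ^ 2 ≤ M ∧ (a - 1) * ‖w - (1 / 2 : ℝ) • (x0 + x1)‖ ^ 2 ≤ M := by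
  have h := NN_bound ha h0 h1 hB hq0 hq1 hN
  set D := N0 + 2 * C0 + 2 * B + 24 with hD
  intro M
  have b1 : 0 ≤ (a - 1) * ‖w0 - x0‖ ^ 2 := mul_nonneg (by linarith) (by positivity)
  have b2 : 0 ≤ (a - 1) * ‖w1 - x1‖ ^ 2 := mul_nonneg (by linarith) (by positivity)
  have b3 : 0 ≤ (a - 1) * ‖w - (1 / 2 : ℝ) • (x0 + x1)‖ ^ 2 := mul_nonneg (by linarith) (by positivity)
  have c1 := sq_nonneg ‖w0‖
  have c2 := sq_nonneg ‖w1‖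
  have c3 := sq_nonneg ‖x0‖
  have c4 := sq_nonneg ‖x1‖
  have c5 := sq_nonneg ‖w - (1 / 2 : ℝ) • (x0 + x1)‖
  have e1 : ‖x0‖ ≤ 12 * D + 1 := le_of_sq_bd (by linarith)
  have e2 : ‖x1‖ ≤ 12 * D + 1 := le_of_sq_bd (by linarith)
  have e3 : ‖w - (1 / 2 : ℝ) • (x0 + x1)‖ ≤ D + 1 := le_of_sq_bd (by linarith)
  have hD0 : 0 ≤ D := by linarith
  have e4 : ‖w‖ ≤ (D + 1) + (12 * D + 1) := by
    have f1 : ‖w‖ ≤ ‖w - (1 / 2 : ℝ) • (x0 + x1)‖ + ‖(1 / 2 : ℝ) • (x0 + x1)‖ := by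
      simpa using norm_add_le (w - (1 / 2 : ℝ) • (x0 + x1)) ((1 / 2 : ℝ) • (x0 + x1))
    have f2 := norm_add_le x0 x1
    rw [norm_smul, Real.norm_of_nonneg (by norm_num : (0:ℝ) ≤ 1 / 2)] at f1
    linarith
  have e5 : ‖w0‖ ≤ 12 * D + 1 := le_of_sq_bd (by linarith)
  have e6 : ‖w1‖ ≤ 12 * D + 1 := le_of_sq_bd (by linarith)
  refine ⟨?_, ?_, ?_, ?_, ?_, ?_, ?_, ?_⟩ <;> simp only [M] <;> linarith

def Contact (a : ℝ) (v0 v1 V : EE n → ℝ) (q0 q1 x0 x1 w w0 w1 : EE n) : Prop :=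
  ∀ X0 X1 W W0 W1, NN a v0 v1 V q0 q1 x0 x1 w w0 w1 ≤ NN a v0 v1 V q0 q1 X0 X1 W W0 W1

lemma exists_contact {a C0 B : ℝ} {v0 v1 V : EE n → ℝ} {q0 q1 : EE n} (ha : 1 ≤ a)
    (hl0 : LowerSemicontinuous v0) (hl1 : LowerSemicontinuous v1) (hV : UpperSemicontinuous V)
    (h0 : ∀ x, ‖x‖ ^ 2 / 2 - C0 ≤ v0 x) (h1 : ∀ x, ‖x‖ ^ 2 / 2 - C0 ≤ v1 x) (hB : ∀ x, V x ≤ B)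
    (hq0 : ‖q0‖ ≤ 1) (hq1 : ‖q1‖ ≤ 1) :
    ∃ x0 x1 w w0 w1, Contact a v0 v1 V q0 q1 x0 x1 w w0 w1 := by
  let φ : EE n × EE n × EE n × EE n × EE n → ℝ := fun z =>
    NN a v0 v1 V q0 q1 z.1 z.2.1 z.2.2.1 z.2.2.2.1 z.2.2.2.2
  have hφ : LowerSemicontinuous φ := by
    have hn : LowerSemicontinuous (fun x => -V x) := by
      intro x y hy
      filter_upwards [hV x (-y) (by simp only at hy; linarith)] with z hz
      linarith
    have d0 : LowerSemicontinuous fun z : EE n × EE n × EE n × EE n × EE n => v0 z.2.2.2.1 :=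
      hl0.comp (f := v0) (g := fun z : EE n × EE n × EE n × EE n × EE n => z.2.2.2.1) (by fun_prop)
    have d1 : LowerSemicontinuous fun z : EE n × EE n × EE n × EE n × EE n => v1 z.2.2.2.2 :=
      hl1.comp (f := v1) (g := fun z : EE n × EE n × EE n × EE n × EE n => z.2.2.2.2) (by fun_prop)
    have d2 : LowerSemicontinuous fun z : EE n × EE n × EE n × EE n × EE n => -V z.2.2.1 :=
      hn.comp (g := fun z : EE n × EE n × EE n × EE n × EE n => z.2.2.1) (by fun_prop)
    have c0 : Continuous fun z : EE n × EE n × EE n × EE n × EE n => a * ‖z.2.2.2.1 - z.1‖ ^ 2 := by fun_prop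
    have c1 : Continuous fun z : EE n × EE n × EE n × EE n × EE n => a * ‖z.2.2.2.2 - z.2.1‖ ^ 2 := by fun_prop
    have c2 : Continuous fun z : EE n × EE n × EE n × EE n × EE n => 2 * ⟪q0, z.1⟫ + 2 * ⟪q1, z.2.1⟫ := by fun_prop
    have c3 : Continuous fun z : EE n × EE n × EE n × EE n × EE n =>
      2 * a * ‖z.2.2.1 - (1 / 2 : ℝ) • (z.1 + z.2.1)‖ ^ 2 := by fun_prop
    exact ((((d0.add c0.lowerSemicontinuous).add (d1.add c1.lowerSemicontinuous)).add
      c2.lowerSemicontinuous).add (d2.add d2)).add c3.lowerSemicontinuous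
  obtain ⟨z, hz⟩ := exists_min_of_lsc hφ 0 (by
    set M := 24 * (φ 0 + 2 * C0 + 2 * B + 24) + 2 with hM
    refine (Metric.isBounded_closedBall (x := (0 : EE n × EE n × EE n × EE n × EE n)) (r := M)).subset ?_
    intro z hz
    obtain ⟨b1, b2, b3, b4, b5, -⟩ := NN_bound' ha h0 h1 hB hq0 hq1 (show NN a v0 v1 V q0 q1 _ _ _ _ _ ≤ φ 0 from hz)
    rw [mem_closedBall_zero_iff]
    simp only [Prod.norm_def, max_le_iff]
    exact ⟨b1, b2, b3, b4, b5⟩)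
  exact ⟨z.1, z.2.1, z.2.2.1, z.2.2.2.1, z.2.2.2.2, fun X0 X1 W W0 W1 => hz (X0, X1, W, W0, W1)⟩

section contact
variable {a C0 m : ℝ} {v0 v1 V : EE n → ℝ} {q0 q1 x0 x1 w w0 w1 : EE n}

/-- value of inf-convolutions at a contact tuple -/
lemma Contact.ic0 (h : Contact a v0 v1 V q0 q1 x0 x1 w w0 w1) (ha : 0 ≤ a) (hv0 : ∀ x, -C0 ≤ v0 x) :
    ic a v0 x0 = v0 w0 + a * ‖w0 - x0‖ ^ 2 := by
  refine le_antisymm (ic_le ha hv0 _ _) (le_ic fun W => ?_)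
  have := h x0 x1 w W w1
  unfold NN at this; linarith

lemma Contact.ic1 (h : Contact a v0 v1 V q0 q1 x0 x1 w w0 w1) (ha : 0 ≤ a) (hv1 : ∀ x, -C0 ≤ v1 x) :
    ic a v1 x1 = v1 w1 + a * ‖w1 - x1‖ ^ 2 := by
  refine le_antisymm (ic_le ha hv1 _ _) (le_ic fun W => ?_)
  have := h x0 x1 w w0 W
  unfold NN at this; linarith

lemma Contact.ineq (h : Contact a v0 v1 V q0 q1 x0 x1 w w0 w1) (X0 X1 W : EE n) :
    NN a v0 v1 V q0 q1 x0 x1 w w0 w1 ≤ ic a v0 X0 + ic a v1 X1 + (2 * ⟪q0, X0⟫ + 2 * ⟪q1, X1⟫) - 2 * V W +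
      2 * a * ‖W - (1 / 2 : ℝ) • (X0 + X1)‖ ^ 2 := by
  set m := NN a v0 v1 V q0 q1 x0 x1 w w0 w1 with hm
  have h1 : ∀ W1, m - (2 * ⟪q0, X0⟫ + 2 * ⟪q1, X1⟫) + 2 * V W - 2 * a * ‖W - (1 / 2 : ℝ) • (X0 + X1)‖ ^ 2
      - (v1 W1 + a * ‖W1 - X1‖ ^ 2) ≤ ic a v0 X0 := fun W1 => le_ic fun W0 => by
    have := h X0 X1 W W0 W1
    rw [← hm] at this
    unfold NN at this; linarith
  have h2 : m - (2 * ⟪q0, X0⟫ + 2 * ⟪q1, X1⟫) + 2 * V W - 2 * a * ‖W - (1 / 2 : ℝ) • (X0 + X1)‖ ^ 2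
      - ic a v0 X0 ≤ ic a v1 X1 := le_ic fun W1 => by linarith [h1 W1]
  linarith

/-- the affine trick -/
lemma aff_trick {f : EE n → ℝ} {F : EE n → ℝ} {c : ℝ} {q X1 W : EE n}
    (hF : ∀ x g s, (∀ y, s + ⟪g, y - x⟫ ≤ f y + a / 2 * ‖y‖ ^ 2) → s ≤ F x)
    (h : ∀ X0, c - 2 * ⟪q, X0⟫ - 2 * a * ‖W - (1 / 2 : ℝ) • (X0 + X1)‖ ^ 2 ≤ f X0) (X0 : EE n) :
    c - 2 * ⟪q, X0⟫ - 2 * a * ‖W - (1 / 2 : ℝ) • (X0 + X1)‖ ^ 2 ≤ F X0 - a / 2 * ‖X0‖ ^ 2 := by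
  have e : ∀ Y : EE n, ‖W - (1 / 2 : ℝ) • (Y + X1)‖ ^ 2 =
      ‖W - (1 / 2 : ℝ) • X1‖ ^ 2 - ⟪W - (1 / 2 : ℝ) • X1, Y⟫ + 1 / 4 * ‖Y‖ ^ 2 := fun Y => by
    have : W - (1 / 2 : ℝ) • (Y + X1) = (W - (1 / 2 : ℝ) • X1) - (1 / 2 : ℝ) • Y := by
      rw [smul_add]; abel
    rw [this, norm_sub_sq_real, norm_smul, inner_smul_right]; norm_num; ring
  have := hF X0 ((2 * a) • (W - (1 / 2 : ℝ) • X1) - (2 : ℝ) • q)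
    (c - 2 * ⟪q, X0⟫ - 2 * a * ‖W - (1 / 2 : ℝ) • (X0 + X1)‖ ^ 2 + a / 2 * ‖X0‖ ^ 2) fun Y => by
      have h1 := h Y
      rw [e] at h1 ⊢
      simp only [inner_sub_left, inner_sub_right, inner_smul_left, conj_trivial] at h1 ⊢
      linarith
  linarith

/-- slope identification -/
lemma slope_id {F : EE n → ℝ} {l : EE n → EE n} {c : ℝ} {q X1 W X : EE n}
    (hF2 : ∀ x h, F (x + h) ≤ F x + ⟪l x, h⟫ + 3 * a * ‖h‖ ^ 2)
    (h : ∀ X0, c - 2 * ⟪q, X0⟫ - 2 * a * ‖W - (1 / 2 : ℝ) • (X0 + X1)‖ ^ 2 ≤ F X0 - a / 2 * ‖X0‖ ^ 2)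
    (heq : c - 2 * ⟪q, X⟫ - 2 * a * ‖W - (1 / 2 : ℝ) • (X + X1)‖ ^ 2 = F X - a / 2 * ‖X‖ ^ 2) :
    l X - a • X = (2 * a) • (W - (1 / 2 : ℝ) • (X + X1)) - (2 : ℝ) • q := by
  have e : ∀ Y : EE n, ‖W - (1 / 2 : ℝ) • (Y + X1)‖ ^ 2 =
      ‖W - (1 / 2 : ℝ) • X1‖ ^ 2 - ⟪W - (1 / 2 : ℝ) • X1, Y⟫ + 1 / 4 * ‖Y‖ ^ 2 := fun Y => by
    have : W - (1 / 2 : ℝ) • (Y + X1) = (W - (1 / 2 : ℝ) • X1) - (1 / 2 : ℝ) • Y := by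
      rw [smul_add]; abel
    rw [this, norm_sub_sq_real, norm_smul, inner_smul_right]; norm_num; ring
  have h0 : (2 * a) • (W - (1 / 2 : ℝ) • X1) - (2 : ℝ) • q - l X = 0 := by
    refine eq_zero_of_quad (C := 3 * a) fun y => ?_
    have h1 := h (X + y)
    have h2 := hF2 X y
    rw [e] at h1 heq
    rw [inner_add_right, inner_add_right] at h1
    rw [inner_sub_left, inner_sub_left, inner_smul_left, inner_smul_left]
    simp only [conj_trivial]
    linarith
  rw [← sub_eq_zero]
  have h3 : l X - a • X - ((2 * a) • (W - (1 / 2 : ℝ) • (X + X1)) - (2 : ℝ) • q) =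
    -((2 * a) • (W - (1 / 2 : ℝ) • X1) - (2 : ℝ) • q - l X) := by
    module
  rw [h3, h0, neg_zero]

end contact

end PB

end SPartE3

section SPartE4
open MeasureTheory Metric Set Filter
open scoped RealInnerProductSpace Pointwise Topology ENNReal NNReal
namespace PB
set_option linter.unusedSectionVars false

variable {n : ℕ} {p : ℝ}

structure Hull (a : ℝ) (v F : EE n → ℝ) (l : EE n → EE n) : Prop where
  le : ∀ x, F x ≤ ic a v x + a / 2 * ‖x‖ ^ 2
  sup : ∀ x y, F x + ⟪l x, y - x⟫ ≤ F y
  max : ∀ x g s, (∀ y, s + ⟪g, y - x⟫ ≤ ic a v y + a / 2 * ‖y‖ ^ 2) → s ≤ F x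
  up : ∀ x h, F (x + h) ≤ F x + ⟪l x, h⟫ + 3 * a * ‖h‖ ^ 2
  lip : ∀ x y, ‖l x - l y‖ ≤ 6 * a * ‖x - y‖

lemma exists_hull {a C0 : ℝ} {v : EE n → ℝ} (ha : 0 < a) (hv : ∀ x, -C0 ≤ v x) :
    ∃ F l, Hull a v F l := by
  obtain ⟨F, l, h1, h2, h3, h4, h5⟩ := ic_hull ha hv
  exact ⟨F, l, h1, h2, h3, h4, h5⟩

section
variable {a C0 : ℝ} {v0 v1 V F0 F1 : EE n → ℝ} {l0 l1 : EE n → EE n} {q0 q1 x0 x1 w w0 w1 : EE n}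

lemma Contact.A (h : Contact a v0 v1 V q0 q1 x0 x1 w w0 w1) (H0 : Hull a v0 F0 l0) (H1 : Hull a v1 F1 l1)
    (X0 X1 W : EE n) :
    NN a v0 v1 V q0 q1 x0 x1 w w0 w1 ≤ (F0 X0 - a / 2 * ‖X0‖ ^ 2) + (F1 X1 - a / 2 * ‖X1‖ ^ 2) +
      (2 * ⟪q0, X0⟫ + 2 * ⟪q1, X1⟫) - 2 * V W + 2 * a * ‖W - (1 / 2 : ℝ) • (X0 + X1)‖ ^ 2 := by
  set m := NN a v0 v1 V q0 q1 x0 x1 w w0 w1 with hm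
  have s1 : ∀ X1, m - ic a v1 X1 - 2 * ⟪q1, X1⟫ + 2 * V W - 2 * ⟪q0, X0⟫ -
      2 * a * ‖W - (1 / 2 : ℝ) • (X0 + X1)‖ ^ 2 ≤ F0 X0 - a / 2 * ‖X0‖ ^ 2 := fun X1 =>
    aff_trick H0.max (c := m - ic a v1 X1 - 2 * ⟪q1, X1⟫ + 2 * V W) (q := q0) (X1 := X1) (W := W)
      (fun Y => by linarith [h.ineq Y X1 W]) X0
  have s2 := aff_trick H1.max (c := m - (F0 X0 - a / 2 * ‖X0‖ ^ 2) - 2 * ⟪q0, X0⟫ + 2 * V W) (q := q1)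
    (X1 := X0) (W := W) (fun Y => by
      have := s1 Y
      rw [add_comm Y X0]; linarith) X1
  rw [add_comm X1 X0] at s2
  linarith

lemma Contact.val (h : Contact a v0 v1 V q0 q1 x0 x1 w w0 w1) (ha : 0 ≤ a) (hv0 : ∀ x, -C0 ≤ v0 x)
    (hv1 : ∀ x, -C0 ≤ v1 x) :
    NN a v0 v1 V q0 q1 x0 x1 w w0 w1 = ic a v0 x0 + ic a v1 x1 +
      (2 * ⟪q0, x0⟫ + 2 * ⟪q1, x1⟫) - 2 * V w + 2 * a * ‖w - (1 / 2 : ℝ) • (x0 + x1)‖ ^ 2 := by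
  rw [h.ic0 ha hv0, h.ic1 ha hv1]; unfold NN; ring

lemma Contact.B (h : Contact a v0 v1 V q0 q1 x0 x1 w w0 w1) (ha : 0 ≤ a) (hv0 : ∀ x, -C0 ≤ v0 x)
    (hv1 : ∀ x, -C0 ≤ v1 x) (H0 : Hull a v0 F0 l0) (H1 : Hull a v1 F1 l1) :
    F0 x0 - a / 2 * ‖x0‖ ^ 2 = ic a v0 x0 ∧ F1 x1 - a / 2 * ‖x1‖ ^ 2 = ic a v1 x1 := by
  have h1 := h.A H0 H1 x0 x1 w
  rw [h.val ha hv0 hv1] at h1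
  have h2 := H0.le x0
  have h3 := H1.le x1
  constructor <;> linarith

lemma Contact.C (h : Contact a v0 v1 V q0 q1 x0 x1 w w0 w1) (ha : 0 ≤ a) (hv0 : ∀ x, -C0 ≤ v0 x)
    (hv1 : ∀ x, -C0 ≤ v1 x) (H0 : Hull a v0 F0 l0) (H1 : Hull a v1 F1 l1) :
    l0 x0 - a • x0 = (2 * a) • (w - (1 / 2 : ℝ) • (x0 + x1)) - (2 : ℝ) • q0 ∧
    l1 x1 - a • x1 = (2 * a) • (w - (1 / 2 : ℝ) • (x0 + x1)) - (2 : ℝ) • q1 := by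
  set m := NN a v0 v1 V q0 q1 x0 x1 w w0 w1 with hm
  have hv := h.val ha hv0 hv1
  obtain ⟨b0, b1⟩ := h.B ha hv0 hv1 H0 H1
  constructor
  · refine slope_id (c := m - (F1 x1 - a / 2 * ‖x1‖ ^ 2) - 2 * ⟪q1, x1⟫ + 2 * V w) H0.up (fun X0 => ?_) ?_
    · linarith [h.A H0 H1 X0 x1 w]
    · linarith
  · rw [add_comm x0 x1]
    refine slope_id (c := m - (F0 x0 - a / 2 * ‖x0‖ ^ 2) - 2 * ⟪q0, x0⟫ + 2 * V w) H1.up (fun X1 => ?_) ?_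
    · have := h.A H0 H1 x0 X1 w
      rw [add_comm X1 x0]; linarith
    · rw [add_comm x1 x0]; linarith

lemma Contact.lipg (h : Contact a v0 v1 V q0 q1 x0 x1 w w0 w1) (ha : 0 < a) (hv0 : ∀ x, -C0 ≤ v0 x)
    (hv1 : ∀ x, -C0 ≤ v1 x) (H0 : Hull a v0 F0 l0) (H1 : Hull a v1 F1 l1)
    {q0' q1' x0' x1' w' w0' w1' : EE n} (h' : Contact a v0 v1 V q0' q1' x0' x1' w' w0' w1') :
    ‖(2 * a) • (w - (1 / 2 : ℝ) • (x0 + x1)) - (2 * a) • (w' - (1 / 2 : ℝ) • (x0' + x1'))‖ ≤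
      14 * a * ‖(1 / 2 : ℝ) • (x0' + x1') - (1 / 2 : ℝ) • (x0 + x1)‖ := by
  set z := (1 / 2 : ℝ) • (x0 + x1) with hz
  set z' := (1 / 2 : ℝ) • (x0' + x1') with hz'
  set d := z' - z with hd
  set g := (2 * a) • (w - z) with hg
  set g' := (2 * a) • (w' - z') with hg'
  -- competitor w' at the first contact
  have k1 : 2 * V w' - 2 * a * ‖w' - z‖ ^ 2 ≤ 2 * V w - 2 * a * ‖w - z‖ ^ 2 := by
    have := h x0 x1 w' w0 w1
    unfold NN at this; rw [← hz] at this; linarith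
  obtain ⟨b0, b1⟩ := h'.B ha.le hv0 hv1 H0 H1
  obtain ⟨c0, c1⟩ := h'.C ha.le hv0 hv1 H0 H1
  have hv := h'.val ha.le hv0 hv1
  rw [← hz'] at c0 c1 hv
  have k2 : ∀ y : EE n, 2 * V w - 2 * a * ‖w - (z' + y)‖ ^ 2 ≤ 2 * V w' - 2 * a * ‖w' - z'‖ ^ 2 +
      2 * ⟪g', y⟫ + 6 * a * ‖y‖ ^ 2 := fun y => by
    have e0 := h'.A H0 H1 (x0' + y) (x1' + y) w
    have e1 : (1 / 2 : ℝ) • (x0' + y + (x1' + y)) = z' + y := by rw [hz']; module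
    rw [e1, hv, par, par, inner_add_right, inner_add_right] at e0
    have u0 := H0.up x0' y
    have u1 := H1.up x1' y
    have f0 : ⟪l0 x0', y⟫ = a * ⟪x0', y⟫ + ⟪g', y⟫ - 2 * ⟪q0', y⟫ := by
      have : l0 x0' = a • x0' + (g' - (2 : ℝ) • q0') := by rw [← c0]; abel
      have e2 : ⟪(2 : ℝ) • q0', y⟫ = 2 * ⟪q0', y⟫ := by rw [inner_smul_left]; simp
      have e3 : ⟪a • x0', y⟫ = a * ⟪x0', y⟫ := by rw [inner_smul_left]; simp
      rw [this, inner_add_left, inner_sub_left, e2, e3]; ring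
    have f1 : ⟪l1 x1', y⟫ = a * ⟪x1', y⟫ + ⟪g', y⟫ - 2 * ⟪q1', y⟫ := by
      have : l1 x1' = a • x1' + (g' - (2 : ℝ) • q1') := by rw [← c1]; abel
      have e2 : ⟪(2 : ℝ) • q1', y⟫ = 2 * ⟪q1', y⟫ := by rw [inner_smul_left]; simp
      have e3 : ⟪a • x1', y⟫ = a * ⟪x1', y⟫ := by rw [inner_smul_left]; simp
      rw [this, inner_add_left, inner_sub_left, e2, e3]; ring
    have : 0 ≤ a * ‖y‖ ^ 2 := by positivity
    linarith
  have k3 : ∀ e : EE n, ⟪g - g', e⟫ ≤ a * ‖e‖ ^ 2 + a * ‖d‖ ^ 2 + 3 * a * ‖e - d‖ ^ 2 := fun e => by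
    have e0 := k2 (e - d)
    have e1 : w - (z' + (e - d)) = (w - z) - e := by rw [hd]; abel
    have e2 : w' - z = (w' - z') + d := by rw [hd]; abel
    rw [e2, par] at k1
    rw [e1, norm_sub_sq_real, inner_sub_right] at e0
    have f1 : ⟪g - g', e⟫ = 2 * a * ⟪w - z, e⟫ - ⟪g', e⟫ := by
      rw [inner_sub_left, hg, inner_smul_left]; simp
    have f2 : ⟪g', d⟫ = 2 * a * ⟪w' - z', d⟫ := by rw [hg', inner_smul_left]; simp
    rw [f1]; rw [f2] at e0
    linarith
  refine le_of_forall_pos_le_add fun ε hε => ?_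
  by_cases hgg : g - g' = 0
  · rw [hgg, norm_zero]; positivity
  have hgp : 0 < ‖g - g'‖ := norm_pos_iff.mpr hgg
  set t := ‖d‖ + ε / (14 * a) with ht
  have ht0 : 0 < t := by positivity
  set e := (t * ‖g - g'‖⁻¹) • (g - g') with he
  have hen : ‖e‖ = t := by
    rw [he, norm_smul, norm_mul, norm_inv, norm_norm, Real.norm_of_nonneg ht0.le, mul_assoc,
      inv_mul_cancel₀ hgp.ne', mul_one]
  have hin : ⟪g - g', e⟫ = t * ‖g - g'‖ := by
    rw [he, inner_smul_right, real_inner_self_eq_norm_sq]; field_simp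
  have hdt : ‖d‖ ≤ t := by rw [ht]; have : 0 ≤ ε / (14 * a) := by positivity
                           linarith
  have b4 := k3 e
  have b5 : ‖e - d‖ ≤ 2 * t := (norm_sub_le _ _).trans (by linarith)
  have b6 : ‖e - d‖ ^ 2 ≤ (2 * t) ^ 2 := by gcongr
  have b7 : ‖d‖ ^ 2 ≤ t ^ 2 := by gcongr
  rw [hin, hen] at b4
  have b8 : t * ‖g - g'‖ ≤ t * (14 * a * t) := by nlinarith
  refine (le_of_mul_le_mul_left b8 ht0).trans_eq ?_
  rw [ht]; field_simp

lemma Contact.lipq (h : Contact a v0 v1 V q0 q1 x0 x1 w w0 w1) (ha : 0 < a) (hv0 : ∀ x, -C0 ≤ v0 x)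
    (hv1 : ∀ x, -C0 ≤ v1 x) (H0 : Hull a v0 F0 l0) (H1 : Hull a v1 F1 l1)
    {q0' q1' x0' x1' w' w0' w1' : EE n} (h' : Contact a v0 v1 V q0' q1' x0' x1' w' w0' w1') :
    dist (q0, q1) (q0', q1') ≤ 11 * a * dist (x0, x1) (x0', x1') := by
  have hg := h.lipg ha hv0 hv1 H0 H1 h'
  obtain ⟨c0, c1⟩ := h.C ha.le hv0 hv1 H0 H1
  obtain ⟨c0', c1'⟩ := h'.C ha.le hv0 hv1 H0 H1
  set g := (2 * a) • (w - (1 / 2 : ℝ) • (x0 + x1))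
  set g' := (2 * a) • (w' - (1 / 2 : ℝ) • (x0' + x1'))
  set D := dist (x0, x1) (x0', x1') with hD
  have d0 : ‖x0 - x0'‖ ≤ D := by rw [hD, Prod.dist_eq, ← dist_eq_norm]; exact le_max_left _ _
  have d1 : ‖x1 - x1'‖ ≤ D := by rw [hD, Prod.dist_eq, ← dist_eq_norm]; exact le_max_right _ _
  have dz : ‖(1 / 2 : ℝ) • (x0' + x1') - (1 / 2 : ℝ) • (x0 + x1)‖ ≤ D := by
    have : (1 / 2 : ℝ) • (x0' + x1') - (1 / 2 : ℝ) • (x0 + x1) = -((1 / 2 : ℝ) • ((x0 - x0') + (x1 - x1'))) := by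
      module
    rw [this, norm_neg, norm_smul, Real.norm_of_nonneg (by norm_num : (0:ℝ) ≤ 1 / 2)]
    have := norm_add_le (x0 - x0') (x1 - x1')
    linarith
  have gD : ‖g - g'‖ ≤ 14 * a * D := hg.trans (by gcongr)
  have key : ∀ (l : EE n → EE n) (x x' q q' : EE n), ‖l x - l x'‖ ≤ 6 * a * ‖x - x'‖ → ‖x - x'‖ ≤ D →
      l x - a • x = g - (2 : ℝ) • q → l x' - a • x' = g' - (2 : ℝ) • q' → ‖q - q'‖ ≤ 11 * a * D := by
    intro l x x' q q' hl hx e e'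
    have e2 : (2 : ℝ) • (q - q') = (g - g') - ((l x - l x') - a • (x - x')) := by
      rw [smul_sub, smul_sub, eq_sub_of_add_eq (show (2 : ℝ) • q + (l x - a • x) = g by rw [e]; abel),
        eq_sub_of_add_eq (show (2 : ℝ) • q' + (l x' - a • x') = g' by rw [e']; abel)]
      abel
    have e3 : ‖(2 : ℝ) • (q - q')‖ ≤ 14 * a * D + (6 * a * D + a * D) := by
      rw [e2]
      refine (norm_sub_le _ _).trans (add_le_add gD ((norm_sub_le _ _).trans (add_le_add ?_ ?_)))
      · exact hl.trans (by gcongr)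
      · rw [norm_smul, Real.norm_of_nonneg ha.le]; gcongr
    rw [norm_smul, Real.norm_of_nonneg (by norm_num : (0:ℝ) ≤ 2)] at e3
    have : 0 ≤ a * D := mul_nonneg ha.le dist_nonneg
    linarith
  rw [Prod.dist_eq, dist_eq_norm, dist_eq_norm]
  exact max_le (key l0 _ _ _ _ (H0.lip _ _) d0 c0 c0') (key l1 _ _ _ _ (H1.lip _ _) d1 c1 c1')

end

end PB

end SPartE4

section SPartE5
open MeasureTheory Metric Set Filter
open scoped RealInnerProductSpace Pointwise Topology ENNReal NNReal
namespace PB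
set_option linter.unusedSectionVars false

variable {n : ℕ} {p : ℝ}

def Sym (Q : EE n →L[ℝ] EE n) : Prop := ∀ x y, ⟪Q x, y⟫ = ⟪x, Q y⟫

lemma exists_sym {a : ℝ} (ha : 0 < a) {l : EE n → EE n} {x : EE n}
    (hl : ∀ x y, ‖l x - l y‖ ≤ 6 * a * ‖x - y‖) {D : EE n →L[ℝ] EE n} (hD : HasFDerivAt l D x) :
    ∃ Q : EE n →L[ℝ] EE n, Sym Q ∧ ‖Q‖ ≤ 7 * a ∧ ∀ h, ⟪Q h, h⟫ = ⟪D h, h⟫ - a * ‖h‖ ^ 2 := by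
  have hDn : ‖D‖ ≤ 6 * a := by
    have hL : LipschitzWith ⟨6 * a, by positivity⟩ l := LipschitzWith.of_dist_le_mul fun x y => by
      rw [dist_eq_norm, dist_eq_norm]; exact hl x y
    exact hD.le_of_lipschitz hL
  refine ⟨(1 / 2 : ℝ) • (D + ContinuousLinearMap.adjoint D) - a • ContinuousLinearMap.id ℝ (EE n), ?_, ?_, ?_⟩
  · intro x y
    simp only [sub_apply, _root_.smul_apply, add_apply, ContinuousLinearMap.id_apply, inner_sub_left,
      inner_sub_right, inner_smul_left, inner_smul_right, inner_add_left, inner_add_right, conj_trivial,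
      ContinuousLinearMap.adjoint_inner_left, ContinuousLinearMap.adjoint_inner_right]
    ring
  · have h1 : ‖D + ContinuousLinearMap.adjoint D‖ ≤ 12 * a := by
      refine (norm_add_le _ _).trans ?_
      rw [LinearIsometryEquiv.norm_map]; linarith
    have h2 : ‖a • ContinuousLinearMap.id ℝ (EE n)‖ ≤ a := by
      rw [norm_smul, Real.norm_of_nonneg ha.le]
      exact mul_le_of_le_one_right ha.le ContinuousLinearMap.norm_id_le
    have h3 : ‖(1 / 2 : ℝ) • (D + ContinuousLinearMap.adjoint D)‖ ≤ 6 * a := by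
      rw [norm_smul]; norm_num; linarith
    refine (norm_sub_le _ _).trans ?_
    linarith
  · intro h
    simp only [sub_apply, _root_.smul_apply, add_apply, ContinuousLinearMap.id_apply, inner_sub_left,
      inner_smul_left, inner_add_left, conj_trivial, ContinuousLinearMap.adjoint_inner_left,
      real_inner_self_eq_norm_sq]
    rw [real_inner_comm (D h) h]
    ring

structure Good (a δ : ℝ) (v0 v1 V : EE n → ℝ) (q0 q1 x0 x1 w w0 w1 : EE n) (Q0 Q1 : EE n →L[ℝ] EE n) (g : EE n) : Prop where
  hq0 : ‖q0‖ < δ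
  hq1 : ‖q1‖ < δ
  ct : Contact a v0 v1 V q0 q1 x0 x1 w w0 w1
  s0 : Sym Q0
  s1 : Sym Q1
  n0 : ‖Q0‖ ≤ 7 * a
  n1 : ‖Q1‖ ≤ 7 * a
  t0 : ∀ ι > 0, ∀ᶠ h in 𝓝 (0 : EE n), v0 w0 + ⟪g - (2 : ℝ) • q0, h⟫ + 1 / 2 * ⟪Q0 h, h⟫ - ι * ‖h‖ ^ 2 ≤ v0 (w0 + h)
  t1 : ∀ ι > 0, ∀ᶠ h in 𝓝 (0 : EE n), v1 w1 + ⟪g - (2 : ℝ) • q1, h⟫ + 1 / 2 * ⟪Q1 h, h⟫ - ι * ‖h‖ ^ 2 ≤ v1 (w1 + h)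
  t : ∀ m0 m1 : ℝ, m0 + m1 = 2 → ∀ ι > 0, ∀ᶠ h in 𝓝 (0 : EE n), V (w + h) ≤ V w + ⟪g, h⟫ +
    1 / 4 * (m0 ^ 2 * ⟪Q0 h, h⟫ + m1 ^ 2 * ⟪Q1 h, h⟫) + ι * ‖h‖ ^ 2

lemma test_aux {a C0 : ℝ} {v F : EE n → ℝ} {l : EE n → EE n} (ha : 0 < a) (hv : ∀ x, -C0 ≤ v x)
    (H : Hull a v F l) {x w G : EE n} {Q D : EE n →L[ℝ] EE n} (hD : HasFDerivAt l D x)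
    (hQ : ∀ h, ⟪Q h, h⟫ = ⟪D h, h⟫ - a * ‖h‖ ^ 2) (hG : l x - a • x = G)
    (hF : F x - a / 2 * ‖x‖ ^ 2 = v w + a * ‖w - x‖ ^ 2) {ι : ℝ} (hι : 0 < ι) :
    ∀ᶠ h in 𝓝 (0 : EE n), v w + ⟪G, h⟫ + 1 / 2 * ⟪Q h, h⟫ - ι * ‖h‖ ^ 2 ≤ v (w + h) := by
  filter_upwards [taylor_two (A := 3 * a / 2) H.sup (fun x h => by have := H.up x h; linarith) hD hι] with h hh
  have h1 := H.le (x + h)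
  have h2 := ic_le ha.le hv (x + h) (w + h)
  have h3 : w + h - (x + h) = w - x := by abel
  rw [h3] at h2
  rw [par] at h1
  have h4 := (abs_le.1 hh).1
  have h5 : ⟪G, h⟫ = ⟪l x, h⟫ - a * ⟪x, h⟫ := by
    rw [← hG, inner_sub_left, inner_smul_left]; simp
  rw [h5, hQ]
  linarith

lemma exists_good {a C0 B δ : ℝ} {v0 v1 V : EE n → ℝ} (ha : 1 ≤ a) (hδ : 0 < δ) (hδ1 : δ ≤ 1)
    (hl0 : LowerSemicontinuous v0) (hl1 : LowerSemicontinuous v1) (hV : UpperSemicontinuous V)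
    (h0 : ∀ x, ‖x‖ ^ 2 / 2 - C0 ≤ v0 x) (h1 : ∀ x, ‖x‖ ^ 2 / 2 - C0 ≤ v1 x) (hB : ∀ x, V x ≤ B) :
    ∃ q0 q1 x0 x1 w w0 w1 Q0 Q1 g, Good a δ v0 v1 V q0 q1 x0 x1 w w0 w1 Q0 Q1 g := by
  have ha0 : 0 < a := by linarith
  have h0' : ∀ x, -C0 ≤ v0 x := fun x => by nlinarith [h0 x, sq_nonneg ‖x‖]
  have h1' : ∀ x, -C0 ≤ v1 x := fun x => by nlinarith [h1 x, sq_nonneg ‖x‖]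
  obtain ⟨F0, l0, H0⟩ := exists_hull ha0 h0'
  obtain ⟨F1, l1, H1⟩ := exists_hull ha0 h1'
  have hN : ∀ {l : EE n → EE n}, (∀ x y, ‖l x - l y‖ ≤ 6 * a * ‖x - y‖) →
      volume {x | ¬ DifferentiableAt ℝ l x} = 0 := fun {l} hl => by
    have hL : LipschitzWith ⟨6 * a, by positivity⟩ l := LipschitzWith.of_dist_le_mul fun x y => by
      rw [dist_eq_norm, dist_eq_norm]; exact hl x y
    exact hL.ae_differentiableAt (μ := volume)
  obtain ⟨⟨q0, q1⟩, hq, ⟨x0, x1⟩, ⟨w, w0, w1, hc⟩, hx0, hx1⟩ := null_contact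
    (S := fun q X => ∃ w w0 w1, Contact a v0 v1 V q.1 q.2 X.1 X.2 w w0 w1) (C := 11 * a) hδ
    (fun q hq => by
      rw [mem_ball_zero_iff, Prod.norm_def, max_lt_iff] at hq
      obtain ⟨x0, x1, w, w0, w1, h⟩ := exists_contact (q0 := q.1) (q1 := q.2) ha hl0 hl1 hV h0 h1 hB
        (hq.1.le.trans hδ1) (hq.2.le.trans hδ1)
      exact ⟨(x0, x1), w, w0, w1, h⟩)
    (fun q X q' X' h h' => by
      obtain ⟨w, w0, w1, h⟩ := h
      obtain ⟨w', w0', w1', h'⟩ := h'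
      exact h.lipq ha0 h0' h1' H0 H1 h')
    (hN H0.lip) (hN H1.lip)
  rw [mem_ball_zero_iff, Prod.norm_def, max_lt_iff] at hq
  simp only [mem_ofPred_eq, not_not] at hx0 hx1
  obtain ⟨D0, hD0⟩ := hx0
  obtain ⟨D1, hD1⟩ := hx1
  obtain ⟨Q0, s0, n0, e0⟩ := exists_sym ha0 H0.lip hD0
  obtain ⟨Q1, s1, n1, e1⟩ := exists_sym ha0 H1.lip hD1
  obtain ⟨c0, c1⟩ := hc.C ha0.le h0' h1' H0 H1
  obtain ⟨b0, b1⟩ := hc.B ha0.le h0' h1' H0 H1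
  refine ⟨q0, q1, x0, x1, w, w0, w1, Q0, Q1, _, hq.1, hq.2, hc, s0, s1, n0, n1,
    fun ι hι => test_aux ha0 h0' H0 hD0 e0 c0 (by rw [b0, hc.ic0 ha0.le h0']) hι,
    fun ι hι => test_aux ha0 h1' H1 hD1 e1 c1 (by rw [b1, hc.ic1 ha0.le h1']) hι, ?_⟩
  intro m0 m1 hm ι hι
  set g := (2 * a) • (w - (1 / 2 : ℝ) • (x0 + x1)) with hg
  have key : ∀ m : ℝ, ∃ ε > 0, ε * m ^ 2 ≤ ι := fun m =>
    ⟨ι / (m ^ 2 + 1), by positivity, by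
      rw [div_mul_eq_mul_div, div_le_iff₀ (by positivity)]; nlinarith [sq_nonneg m]⟩
  obtain ⟨ε0, hε0, k0⟩ := key m0
  obtain ⟨ε1, hε1, k1⟩ := key m1
  have tend : ∀ m : ℝ, Tendsto (fun h : EE n => m • h) (𝓝 0) (𝓝 0) := fun m => by
    have : Continuous (fun h : EE n => m • h) := by fun_prop
    simpa using this.tendsto 0
  filter_upwards [(tend m0).eventually (taylor_two (A := 3 * a / 2) H0.sup (fun x h => by have := H0.up x h; linarith) hD0 hε0),
    (tend m1).eventually (taylor_two (A := 3 * a / 2) H1.sup (fun x h => by have := H1.up x h; linarith) hD1 hε1)] with h f0 f1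
  have hA := hc.A H0 H1 (x0 + m0 • h) (x1 + m1 • h) (w + h)
  have hmid : w + h - (1 / 2 : ℝ) • (x0 + m0 • h + (x1 + m1 • h)) = w - (1 / 2 : ℝ) • (x0 + x1) := by
    have : m1 = 2 - m0 := by linarith
    rw [this]; module
  rw [hmid, hc.val ha0.le h0' h1', ← b0, ← b1, par, par] at hA
  have g0 := (abs_le.1 f0).2
  have g1 := (abs_le.1 f1).2
  have i0 : ⟪g, h⟫ = ⟪l0 x0, h⟫ - a * ⟪x0, h⟫ + 2 * ⟪q0, h⟫ := by
    have : g = l0 x0 - a • x0 + (2 : ℝ) • q0 := by rw [c0]; abel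
    rw [this]; simp only [inner_add_left, inner_sub_left, inner_smul_left, conj_trivial]
  have i1 : ⟪g, h⟫ = ⟪l1 x1, h⟫ - a * ⟪x1, h⟫ + 2 * ⟪q1, h⟫ := by
    have : g = l1 x1 - a • x1 + (2 : ℝ) • q1 := by rw [c1]; abel
    rw [this]; simp only [inner_add_left, inner_sub_left, inner_smul_left, conj_trivial]
  simp only [map_smul, inner_smul_left, inner_smul_right, conj_trivial, norm_smul, mul_pow, Real.norm_eq_abs,
    sq_abs, inner_add_right] at hA g0 g1
  rw [e0, e1]
  have j0 : ε0 * (m0 ^ 2 * ‖h‖ ^ 2) ≤ ι * ‖h‖ ^ 2 := by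
    rw [← mul_assoc]; exact mul_le_mul_of_nonneg_right k0 (sq_nonneg _)
  have j1 : ε1 * (m1 ^ 2 * ‖h‖ ^ 2) ≤ ι * ‖h‖ ^ 2 := by
    rw [← mul_assoc]; exact mul_le_mul_of_nonneg_right k1 (sq_nonneg _)
  have z0 : m0 * ⟪l0 x0, h⟫ = m0 * (⟪g, h⟫ + a * ⟪x0, h⟫ - 2 * ⟪q0, h⟫) := by rw [i0]; ring
  have z1 : m1 * ⟪l1 x1, h⟫ = (2 - m0) * ⟪g, h⟫ + m1 * (a * ⟪x1, h⟫ - 2 * ⟪q1, h⟫) := by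
    rw [i1]; have : m1 = 2 - m0 := by linarith
    rw [this]; ring
  rw [z0] at g0; rw [z1] at g1
  linarith

end PB

end SPartE5

section SPartE6
open MeasureTheory Metric Set Filter
open scoped RealInnerProductSpace Pointwise Topology ENNReal NNReal
namespace PB
set_option linter.unusedSectionVars false

variable {n : ℕ} {p : ℝ}

/-- the operator `tr Q + (p-2) ⟪Q g, g⟫ / |g|^2` -/
noncomputable def LL (p : ℝ) (g : EE n) (Q : EE n →L[ℝ] EE n) : ℝ :=
  ∑ i, ⟪Q (EuclideanSpace.single i 1), (EuclideanSpace.single i 1 : EE n)⟫ + (p - 2) * (⟪Q g, g⟫ / ‖g‖ ^ 2)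

lemma LL_lin (g : EE n) (Q Q' : EE n →L[ℝ] EE n) (s t : ℝ) :
    LL p g (s • Q + t • Q') = s * LL p g Q + t * LL p g Q' := by
  unfold LL
  simp only [add_apply, _root_.smul_apply, inner_add_left, inner_smul_left, conj_trivial,
    Finset.sum_add_distrib, ← Finset.mul_sum]
  ring

lemma LL_id {g : EE n} (hg : g ≠ 0) : LL p g (ContinuousLinearMap.id ℝ (EE n)) = n + (p - 2) := by
  unfold LL
  have : ‖g‖ ≠ 0 := norm_ne_zero_iff.mpr hg
  simp only [ContinuousLinearMap.id_apply, real_inner_self_eq_norm_sq]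
  simp [this]

lemma LL_scale {g : EE n} {t : ℝ} (ht : t ≠ 0) (Q : EE n →L[ℝ] EE n) : LL p (t • g) Q = LL p g Q := by
  unfold LL
  congr 2
  rw [map_smul, inner_smul_left, inner_smul_right, norm_smul, mul_pow, Real.norm_eq_abs, sq_abs]
  simp only [conj_trivial]
  rw [← mul_assoc, ← sq, mul_div_mul_left _ _ (by positivity)]

lemma LL_diff {g G : EE n} (hg : g ≠ 0) (hG : G ≠ 0) (Q : EE n →L[ℝ] EE n) :
    |LL p g Q - LL p G Q| ≤ |p - 2| * (4 * ‖Q‖ * (‖g - G‖ / ‖g‖)) := by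
  have hgn : 0 < ‖g‖ := norm_pos_iff.mpr hg
  have hGn : 0 < ‖G‖ := norm_pos_iff.mpr hG
  set e := ‖g‖⁻¹ • g with he
  set f := ‖G‖⁻¹ • G with hf
  have e1 : ‖e‖ = 1 := by rw [he, norm_smul, norm_inv, norm_norm, inv_mul_cancel₀ hgn.ne']
  have f1 : ‖f‖ = 1 := by rw [hf, norm_smul, norm_inv, norm_norm, inv_mul_cancel₀ hGn.ne']
  rw [← LL_scale (g := g) (inv_ne_zero hgn.ne'), ← LL_scale (g := G) (inv_ne_zero hGn.ne'), ← he, ← hf]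
  unfold LL
  rw [e1, f1]
  have h1 : ‖e - f‖ ≤ 2 * (‖g - G‖ / ‖g‖) := by
    have : e - f = ‖g‖⁻¹ • (g - G) + (‖g‖⁻¹ - ‖G‖⁻¹) • G := by rw [he, hf]; module
    rw [this]
    refine (norm_add_le _ _).trans ?_
    rw [norm_smul, norm_smul, norm_inv, norm_norm]
    have h2 : ‖‖g‖⁻¹ - ‖G‖⁻¹‖ * ‖G‖ = |‖G‖ - ‖g‖| / ‖g‖ := by
      rw [inv_sub_inv hgn.ne' hGn.ne', Real.norm_eq_abs, abs_div, abs_of_pos (mul_pos hgn hGn)]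
      field_simp
    rw [h2]
    have h3 : |‖G‖ - ‖g‖| ≤ ‖g - G‖ := by
      rw [norm_sub_rev]; exact abs_norm_sub_norm_le G g
    have h4 : |‖G‖ - ‖g‖| / ‖g‖ ≤ ‖g - G‖ / ‖g‖ := by gcongr
    rw [inv_mul_eq_div]; linarith
  have h5 : |⟪Q e, e⟫ - ⟪Q f, f⟫| ≤ 2 * ‖Q‖ * ‖e - f‖ := by
    have : ⟪Q e, e⟫ - ⟪Q f, f⟫ = ⟪Q e, e - f⟫ + ⟪Q (e - f), f⟫ := by
      rw [map_sub, inner_sub_left, inner_sub_right]; ring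
    rw [this]
    refine (abs_add_le _ _).trans ?_
    have a1 := abs_real_inner_le_norm (Q e) (e - f)
    have a2 := abs_real_inner_le_norm (Q (e - f)) f
    have a3 := Q.le_opNorm e
    have a4 := Q.le_opNorm (e - f)
    rw [e1] at a3; rw [f1] at a2
    have a5 : ‖Q e‖ * ‖e - f‖ ≤ ‖Q‖ * 1 * ‖e - f‖ := by gcongr
    linarith
  have h6 : ∀ S a b c : ℝ, S + c * (a / 1 ^ 2) - (S + c * (b / 1 ^ 2)) = c * (a - b) := by intros; ring
  rw [h6, abs_mul]
  refine mul_le_mul_of_nonneg_left (h5.trans ?_) (abs_nonneg _)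
  have := mul_le_mul_of_nonneg_left h1 (show 0 ≤ 2 * ‖Q‖ by positivity)
  linarith

/-- `v` is touched below at `y` by the quadratic with gradient `g`, Hessian `Q` -/
def TB (v : EE n → ℝ) (y g : EE n) (Q : EE n →L[ℝ] EE n) : Prop :=
  ∀ᶠ h in 𝓝 (0 : EE n), v y + ⟪g, h⟫ + 1 / 2 * ⟪Q h, h⟫ ≤ v (y + h)

def SupV (p c : ℝ) (v : EE n → ℝ) (y : EE n) : Prop :=
  ∀ g Q, g ≠ 0 → Sym Q → TB v y g Q → v y * LL p g Q ≤ c * ‖g‖ ^ 2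

def SubV (p c : ℝ) (v : EE n → ℝ) (y : EE n) : Prop :=
  ∀ g Q, g ≠ 0 → Sym Q → (∀ᶠ h in 𝓝 (0 : EE n), v (y + h) ≤ v y + ⟪g, h⟫ + 1 / 2 * ⟪Q h, h⟫) →
    c * ‖g‖ ^ 2 ≤ v y * LL p g Q

lemma Sym.lin {Q Q' : EE n →L[ℝ] EE n} (h : Sym Q) (h' : Sym Q') (s t : ℝ) : Sym (s • Q + t • Q') := by
  intro x y
  simp only [add_apply, _root_.smul_apply, inner_add_left, inner_add_right, inner_smul_left,
    inner_smul_right, conj_trivial, h x y, h' x y]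

lemma Sym.id : Sym (ContinuousLinearMap.id ℝ (EE n)) := fun _ _ => rfl

lemma pert (Q : EE n →L[ℝ] EE n) (s : ℝ) (h : EE n) :
    ⟪((1 : ℝ) • Q + s • ContinuousLinearMap.id ℝ (EE n)) h, h⟫ = ⟪Q h, h⟫ + s * ‖h‖ ^ 2 := by
  simp only [add_apply, _root_.smul_apply, ContinuousLinearMap.id_apply, inner_add_left, inner_smul_left,
    conj_trivial, real_inner_self_eq_norm_sq, one_mul]

lemma le_of_small {A B C : ℝ} (h : ∀ ι > 0, A ≤ B + ι * C) : A ≤ B := by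
  by_contra hc
  push Not at hc
  have h1 := h ((A - B) / (2 * (|C| + 1))) (by have := abs_nonneg C; apply div_pos <;> linarith)
  have h2 : (A - B) / (2 * (|C| + 1)) * C ≤ (A - B) / (2 * (|C| + 1)) * (|C| + 1) := by
    have := abs_nonneg C
    apply mul_le_mul_of_nonneg_left (by linarith [le_abs_self C])
    apply div_nonneg <;> linarith
  have h3 : (A - B) / (2 * (|C| + 1)) * (|C| + 1) = (A - B) / 2 := by
    have := abs_nonneg C
    field_simp
  linarith

lemma SupV.lim {c : ℝ} {v : EE n → ℝ} {y : EE n} (h : SupV p c v y) {g : EE n} (hg : g ≠ 0)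
    {Q : EE n →L[ℝ] EE n} (hQ : Sym Q)
    (ht : ∀ ι > 0, ∀ᶠ h in 𝓝 (0 : EE n), v y + ⟪g, h⟫ + 1 / 2 * ⟪Q h, h⟫ - ι * ‖h‖ ^ 2 ≤ v (y + h)) :
    v y * LL p g Q ≤ c * ‖g‖ ^ 2 := by
  refine le_of_small (C := 2 * v y * (n + (p - 2))) fun ι hι => ?_
  have := h g ((1 : ℝ) • Q + (-(2 * ι)) • ContinuousLinearMap.id ℝ (EE n)) hg (hQ.lin Sym.id _ _) (by
    filter_upwards [ht ι hι] with h hh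
    rw [pert]; linarith)
  rw [LL_lin, LL_id hg] at this
  linarith

lemma SubV.lim {c : ℝ} {v : EE n → ℝ} {y : EE n} (h : SubV p c v y) {g : EE n} (hg : g ≠ 0)
    {Q : EE n →L[ℝ] EE n} (hQ : Sym Q)
    (ht : ∀ ι > 0, ∀ᶠ h in 𝓝 (0 : EE n), v (y + h) ≤ v y + ⟪g, h⟫ + 1 / 2 * ⟪Q h, h⟫ + ι * ‖h‖ ^ 2) :
    c * ‖g‖ ^ 2 ≤ v y * LL p g Q := by
  refine le_of_small (C := 2 * v y * (n + (p - 2))) fun ι hι => ?_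
  have := h g ((1 : ℝ) • Q + (2 * ι) • ContinuousLinearMap.id ℝ (EE n)) hg (hQ.lin Sym.id _ _) (by
    filter_upwards [ht ι hι] with h hh
    rw [pert]; linarith)
  rw [LL_lin, LL_id hg] at this
  linarith

set_option maxHeartbeats 1000000 in
lemma Good.step {a δ c c' b0 B γ ε : ℝ} {v0 v1 V : EE n → ℝ} {q0 q1 x0 x1 w w0 w1 : EE n}
    {Q0 Q1 : EE n →L[ℝ] EE n} {g : EE n} (hG : Good a δ v0 v1 V q0 q1 x0 x1 w w0 w1 Q0 Q1 g) (ha : 0 < a)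
    (hδ : 0 < δ)
    (hc : 0 ≤ c) (hb : 0 < b0) (hb0 : b0 ≤ v0 w0) (hb1 : b0 ≤ v1 w1) (hV0 : 0 ≤ V w) (hVB : V w ≤ B)
    (S0 : SupV p c v0 w0) (S1 : SupV p c v1 w1) (SV : SubV p c' V w) (hγ : 0 < γ)
    (hg : ∀ g Q, Sym Q → TB v0 w0 g Q → γ ≤ ‖g‖) (hδγ : 8 * δ ≤ γ) (hε : 0 ≤ ε)
    (hVv : V w ≤ (1 + ε) * (1 / 2 * (v0 w0 + v1 w1))) :
    c' ≤ c * (1 + ε) * (1 + 4 * δ / γ) ^ 2 + (1792 * B * |p - 2| / γ ^ 3) * (a * δ) := by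
  have d0 : ‖g - (g - (2 : ℝ) • q0)‖ ≤ 2 * δ := by
    rw [sub_sub_cancel, norm_smul]; norm_num; exact hG.hq0.le
  have d1 : ‖g - (g - (2 : ℝ) • q1)‖ ≤ 2 * δ := by
    rw [sub_sub_cancel, norm_smul]; norm_num; exact hG.hq1.le
  set G0 := g - (2 : ℝ) • q0 with hG0
  set G1 := g - (2 : ℝ) • q1 with hG1
  have g0 : γ ≤ ‖G0‖ := hg G0 ((1 : ℝ) • Q0 + (-2 : ℝ) • ContinuousLinearMap.id ℝ (EE n))
    (hG.s0.lin Sym.id _ _) (by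
      filter_upwards [hG.t0 1 one_pos] with h hh
      rw [pert]; linarith)
  have gn : γ / 2 ≤ ‖g‖ := by
    have := norm_sub_norm_le G0 g
    rw [norm_sub_rev G0 g] at this; linarith
  have g1 : 0 < ‖G1‖ := by
    have := norm_sub_norm_le g G1
    linarith
  have gp : 0 < ‖g‖ := by linarith
  have g0ne : G0 ≠ 0 := norm_pos_iff.mp (by linarith)
  have g1ne : G1 ≠ 0 := norm_pos_iff.mp g1
  have gne : g ≠ 0 := norm_pos_iff.mp gp
  set E := |p - 2| * (56 * (a * δ) / ‖g‖) with hE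
  have hE0 : 0 ≤ E := by positivity
  have key : ∀ {G : EE n} {Q : EE n →L[ℝ] EE n}, G ≠ 0 → ‖Q‖ ≤ 7 * a → ‖g - G‖ ≤ 2 * δ →
      LL p g Q ≤ LL p G Q + E := fun {G Q} h1 h2 h3 => by
    have := (le_abs_self _).trans (LL_diff (p := p) gne h1 Q)
    have h4 : |p - 2| * (4 * ‖Q‖ * (‖g - G‖ / ‖g‖)) ≤ |p - 2| * (4 * (7 * a) * ((2 * δ) / ‖g‖)) := by
      gcongr
    have h5 : |p - 2| * (4 * (7 * a) * ((2 * δ) / ‖g‖)) = E := by rw [hE]; ring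
    linarith
  have k0 := key g0ne hG.n0 d0
  have k1 := key g1ne hG.n1 d1
  have l0 := S0.lim g0ne hG.s0 hG.t0
  have l1 := S1.lim g1ne hG.s1 hG.t1
  set A0 := v0 w0
  set A1 := v1 w1
  set m := 1 / 2 * (A0 + A1) with hm
  have hm0 : 0 < m := by rw [hm]; linarith
  have lV := SV.lim gne ((hG.s0.lin hG.s1 (1 / 2 * (A0 / m) ^ 2) (1 / 2 * (A1 / m) ^ 2))) (fun ι hι => by
    filter_upwards [hG.t (A0 / m) (A1 / m) (by rw [← add_div, div_eq_iff hm0.ne', hm]; ring) ι hι] with h hh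
    simp only [add_apply, _root_.smul_apply, inner_add_left, inner_smul_left, conj_trivial]
    linarith)
  rw [LL_lin] at lV
  have N0 : ‖G0‖ ≤ ‖g‖ + 2 * δ := by
    have := norm_sub_norm_le G0 g
    rw [norm_sub_rev G0 g] at this; linarith
  have N1 : ‖G1‖ ≤ ‖g‖ + 2 * δ := by
    have := norm_sub_norm_le G1 g
    rw [norm_sub_rev G1 g] at this; linarith
  have r : ∀ {A L L' N : ℝ}, 0 < A → A ≤ 2 * m → L ≤ L' + E → A * L' ≤ c * N ^ 2 → 0 ≤ N → N ≤ ‖g‖ + 2 * δ →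
      (A / m) ^ 2 * L ≤ A / m ^ 2 * (c * (‖g‖ + 2 * δ) ^ 2) + 4 * E := fun {A L L' N} a1 a2 a3 a4 a5 a6 => by
    have b1 : (A / m) ^ 2 * L ≤ (A / m) ^ 2 * (L' + E) := by gcongr
    have b2 : (A / m) ^ 2 * (L' + E) = A / m ^ 2 * (A * L') + (A / m) ^ 2 * E := by ring
    have b3 : A / m ^ 2 * (A * L') ≤ A / m ^ 2 * (c * (‖g‖ + 2 * δ) ^ 2) := by
      refine mul_le_mul_of_nonneg_left (a4.trans ?_) (by positivity)
      gcongr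
    have b4 : A / m ≤ 2 := by rw [div_le_iff₀ hm0]; exact a2
    have b5 : (A / m) ^ 2 ≤ 2 ^ 2 := by gcongr
    have b6 : (A / m) ^ 2 * E ≤ 2 ^ 2 * E := by gcongr
    linarith
  have r0 := r (by linarith) (by rw [hm]; linarith) k0 l0 (norm_nonneg _) N0
  have r1 := r (by linarith) (by rw [hm]; linarith) k1 l1 (norm_nonneg _) N1
  have s1 : c' * ‖g‖ ^ 2 ≤ V w * (1 / m * (c * (‖g‖ + 2 * δ) ^ 2) + 4 * E) := by
    refine lV.trans (mul_le_mul_of_nonneg_left ?_ hV0)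
    have : 1 / m = 1 / 2 * (A0 / m ^ 2 + A1 / m ^ 2) := by
      rw [← add_div]; have : A0 + A1 = 2 * m := by rw [hm]; ring
      rw [this]; field_simp
    rw [this]; linarith
  have s2 : V w * (1 / m) ≤ 1 + ε := by rw [mul_one_div, div_le_iff₀ hm0]; exact hVv
  have s3 : c' * ‖g‖ ^ 2 ≤ (1 + ε) * (c * (‖g‖ + 2 * δ) ^ 2) + B * (4 * E) := by
    have t1 : V w * (1 / m) * (c * (‖g‖ + 2 * δ) ^ 2) ≤ (1 + ε) * (c * (‖g‖ + 2 * δ) ^ 2) := by gcongr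
    have t2 : V w * (4 * E) ≤ B * (4 * E) := by gcongr
    linarith
  have s4 : c' ≤ (1 + ε) * (c * (1 + 2 * δ / ‖g‖) ^ 2) + B * (4 * E) / ‖g‖ ^ 2 := by
    have : (1 + ε) * (c * (1 + 2 * δ / ‖g‖) ^ 2) + B * (4 * E) / ‖g‖ ^ 2 =
      ((1 + ε) * (c * (‖g‖ + 2 * δ) ^ 2) + B * (4 * E)) / ‖g‖ ^ 2 := by field_simp
    rw [this, le_div_iff₀ (by positivity)]; exact s3
  refine s4.trans (add_le_add ?_ ?_)
  · rw [mul_comm c (1 + ε), mul_assoc]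
    have : 2 * δ / ‖g‖ ≤ 4 * δ / γ := by
      rw [div_le_div_iff₀ gp hγ]
      have := mul_le_mul_of_nonneg_left gn (show 0 ≤ 4 * δ by positivity)
      linarith
    have : 0 ≤ 2 * δ / ‖g‖ := by positivity
    gcongr
  · have hB : 0 ≤ B := hV0.trans hVB
    have e1 : B * (4 * E) / ‖g‖ ^ 2 = 224 * B * |p - 2| * (a * δ) / ‖g‖ ^ 3 := by
      rw [hE]; field_simp; ring
    have e2 : (1792 * B * |p - 2| / γ ^ 3) * (a * δ) = 224 * B * |p - 2| * (a * δ) / (γ / 2) ^ 3 := by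
      field_simp; ring
    rw [e1, e2]
    gcongr

end PB

end SPartE6

section SPartE7
open MeasureTheory Metric Set Filter
open scoped RealInnerProductSpace Pointwise Topology ENNReal NNReal
namespace PB
set_option linter.unusedSectionVars false

variable {n : ℕ} {p : ℝ}

lemma tendsto_of_sq {M : ℝ} {x y : ℕ → EE n} {X : EE n} (h : ∀ j : ℕ, ((j : ℝ) + 2 - 1) * ‖y j - x j‖ ^ 2 ≤ M)
    {φ : ℕ → ℕ} (hφ : StrictMono φ) (hx : Tendsto (fun j => x (φ j)) atTop (𝓝 X)) :
    Tendsto (fun j => y (φ j)) atTop (𝓝 X) := by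
  have h1 : Tendsto (fun j : ℕ => ‖y j - x j‖ ^ 2) atTop (𝓝 0) := by
    have h2 : Tendsto (fun j : ℕ => M * (1 / ((j : ℝ) + 1))) atTop (𝓝 (M * 0)) :=
      tendsto_one_div_add_atTop_nhds_zero_nat.const_mul M
    rw [mul_zero] at h2
    refine squeeze_zero (fun j => by positivity) (fun j => ?_) h2
    rw [mul_one_div, le_div_iff₀ (by positivity)]
    have := h j
    linarith
  have h3 : Tendsto (fun j : ℕ => y j - x j) atTop (𝓝 0) := by
    rw [tendsto_zero_iff_norm_tendsto_zero]
    have := h1.sqrt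
    simpa using this
  have h4 := (h3.comp hφ.tendsto_atTop).add hx
  simpa using h4

set_option maxHeartbeats 1000000 in
theorem abstract_compare {c c' b0 C0 B γ : ℝ} {v0 v1 V : EE n → ℝ} {O0 O1 : Set (EE n)}
    (hl0 : LowerSemicontinuous v0) (hl1 : LowerSemicontinuous v1) (hV : UpperSemicontinuous V)
    (h0 : ∀ x, ‖x‖ ^ 2 / 2 - C0 ≤ v0 x) (h1 : ∀ x, ‖x‖ ^ 2 / 2 - C0 ≤ v1 x) (hB : ∀ x, V x ≤ B)
    (hV0 : ∀ x, 0 ≤ V x) (hb : 0 < b0) (hb0 : ∀ x, b0 ≤ v0 x) (hb1 : ∀ x, b0 ≤ v1 x)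
    (hO0 : IsOpen O0) (hO1 : IsOpen O1)
    (hle : ∀ x0 x1, 2 * V ((1 / 2 : ℝ) • (x0 + x1)) ≤ v0 x0 + v1 x1)
    (heq : ∃ x0 x1, 2 * V ((1 / 2 : ℝ) • (x0 + x1)) = v0 x0 + v1 x1)
    (hO : ∀ x0 x1, 2 * V ((1 / 2 : ℝ) • (x0 + x1)) = v0 x0 + v1 x1 → x0 ∈ O0 ∧ x1 ∈ O1)
    (S0 : ∀ y ∈ O0, SupV p c v0 y) (S1 : ∀ y ∈ O1, SupV p c v1 y) (SV : ∀ y, SubV p c' V y)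
    (hγ : 0 < γ) (hg : ∀ y ∈ O0, ∀ g Q, Sym Q → TB v0 y g Q → γ ≤ ‖g‖)
    (hc : 0 ≤ c) (hcc : c < c') : False := by
  obtain ⟨X0, X1, hX⟩ := heq
  set a : ℕ → ℝ := fun j => (j : ℝ) + 2 with ha
  set δ : ℕ → ℝ := fun j => 1 / ((j : ℝ) + 2) ^ 2 with hδ
  have ha1 : ∀ j, 1 ≤ a j := fun j => by simp only [ha]; linarith [(Nat.cast_nonneg j : (0 : ℝ) ≤ j)]
  have hδ0 : ∀ j, 0 < δ j := fun j => by simp only [hδ]; positivity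
  have hδ1 : ∀ j, δ j ≤ 1 := fun j => by
    simp only [hδ]; rw [div_le_one (by positivity)]
    nlinarith [(Nat.cast_nonneg j : (0 : ℝ) ≤ j)]
  have hex := fun j => exists_good (ha1 j) (hδ0 j) (hδ1 j) hl0 hl1 hV h0 h1 hB
  choose q0 q1 x0 x1 w w0 w1 Q0 Q1 g hG using hex
  set N0 := 2 * (‖X0‖ + ‖X1‖) with hN0
  have hNN : ∀ j, NN (a j) v0 v1 V (q0 j) (q1 j) (x0 j) (x1 j) (w j) (w0 j) (w1 j) ≤ N0 * δ j := fun j => by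
    refine ((hG j).ct X0 X1 ((1 / 2 : ℝ) • (X0 + X1)) X0 X1).trans ?_
    unfold NN
    simp only [sub_self, norm_zero]
    have e0 := (real_inner_le_norm (q0 j) X0).trans (mul_le_mul_of_nonneg_right (hG j).hq0.le (norm_nonneg X0))
    have e1 := (real_inner_le_norm (q1 j) X1).trans (mul_le_mul_of_nonneg_right (hG j).hq1.le (norm_nonneg X1))
    rw [hN0]; nlinarith
  have hN00 : 0 ≤ N0 := by positivity
  set M := 24 * (N0 + 2 * C0 + 2 * B + 24) + 2 with hM
  have hbd := fun j => NN_bound' (ha1 j) h0 h1 hB ((hG j).hq0.le.trans (hδ1 j)) ((hG j).hq1.le.trans (hδ1 j))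
    ((hNN j).trans (mul_le_of_le_one_right hN00 (hδ1 j)))
  simp only [← hM] at hbd
  obtain ⟨⟨Y0, Y1⟩, -, φ, hφ, hlim⟩ := tendsto_subseq_of_bounded (x := fun j => (x0 j, x1 j))
    (s := closedBall 0 M) isBounded_closedBall (fun j => by
      rw [mem_closedBall_zero_iff, Prod.norm_def]; exact max_le (hbd j).1 (hbd j).2.1)
  have lx0 : Tendsto (fun j => x0 (φ j)) atTop (𝓝 Y0) := (continuous_fst.tendsto _).comp hlim
  have lx1 : Tendsto (fun j => x1 (φ j)) atTop (𝓝 Y1) := (continuous_snd.tendsto _).comp hlim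
  have lw0 : Tendsto (fun j => w0 (φ j)) atTop (𝓝 Y0) := tendsto_of_sq (fun j => (hbd j).2.2.2.2.2.1) hφ lx0
  have lw1 : Tendsto (fun j => w1 (φ j)) atTop (𝓝 Y1) := tendsto_of_sq (fun j => (hbd j).2.2.2.2.2.2.1) hφ lx1
  have lw : Tendsto (fun j => w (φ j)) atTop (𝓝 ((1 / 2 : ℝ) • (Y0 + Y1))) :=
    tendsto_of_sq (fun j => (hbd j).2.2.2.2.2.2.2) hφ ((lx0.add lx1).const_smul (1 / 2 : ℝ))
  have lδ' : Tendsto (fun j : ℕ => 1 / ((j : ℝ) + 2)) atTop (𝓝 0) := by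
    have := (tendsto_add_atTop_iff_nat 1).2 (tendsto_one_div_add_atTop_nhds_zero_nat (𝕜 := ℝ))
    refine this.congr fun j => ?_
    push_cast; ring_nf
  have lδ : Tendsto δ atTop (𝓝 0) := by
    have := lδ'.mul lδ'
    rw [mul_zero] at this
    refine this.congr fun j => ?_
    simp only [hδ]; rw [div_mul_div_comm, one_mul, sq]
  have laδ : Tendsto (fun j => a j * δ j) atTop (𝓝 0) := by
    refine lδ'.congr fun j => ?_
    simp only [hδ, ha]; have : (j : ℝ) + 2 ≠ 0 := by positivity
    field_simp
  have Lδ := lδ.comp hφ.tendsto_atTop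
  have Laδ := laδ.comp hφ.tendsto_atTop
  set z := (1 / 2 : ℝ) • (Y0 + Y1) with hz
  have hΦ : ∀ j, v0 (w0 j) + v1 (w1 j) - 2 * V (w j) ≤ (N0 + 4 * M) * δ j := fun j => by
    have h := hNN j
    unfold NN at h
    obtain ⟨b1, b2, -⟩ := hbd j
    have e0 := (neg_le_of_abs_le (abs_real_inner_le_norm (q0 j) (x0 j)))
    have e1 := (neg_le_of_abs_le (abs_real_inner_le_norm (q1 j) (x1 j)))
    have f0 := mul_le_mul (hG j).hq0.le b1 (norm_nonneg _) (hδ0 j).le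
    have f1 := mul_le_mul (hG j).hq1.le b2 (norm_nonneg _) (hδ0 j).le
    have c1 : 0 ≤ a j * ‖w0 j - x0 j‖ ^ 2 := by have := ha1 j; positivity
    have c2 : 0 ≤ a j * ‖w1 j - x1 j‖ ^ 2 := by have := ha1 j; positivity
    have c3 : 0 ≤ 2 * a j * ‖w j - (1 / 2 : ℝ) • (x0 j + x1 j)‖ ^ 2 := by have := ha1 j; positivity
    linarith
  have hev : ∀ ε > 0, ∀ᶠ j in atTop, v0 Y0 - ε < v0 (w0 (φ j)) ∧ v1 Y1 - ε < v1 (w1 (φ j)) ∧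
      V (w (φ j)) < V z + ε := fun ε hε =>
    (lw0.eventually (hl0 Y0 _ (by linarith))).and ((lw1.eventually (hl1 Y1 _ (by linarith))).and
      (lw.eventually (hV z _ (by linarith))))
  have hY : 2 * V z = v0 Y0 + v1 Y1 := by
    refine le_antisymm (hle Y0 Y1) (le_of_forall_pos_le_add fun ε hε => ?_)
    have hT : Tendsto (fun j => (N0 + 4 * M) * δ (φ j)) atTop (𝓝 ((N0 + 4 * M) * 0)) := Lδ.const_mul _
    rw [mul_zero] at hT
    obtain ⟨j, ⟨h1, h2, h3⟩, h4⟩ := ((hev (ε / 8) (by linarith)).and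
      (hT.eventually (gt_mem_nhds (show (0 : ℝ) < ε / 8 by linarith)))).exists
    have := hΦ (φ j)
    linarith
  obtain ⟨m0, m1⟩ := hO Y0 Y1 hY
  -- choose epsilon
  obtain ⟨ε, hε, hεc⟩ : ∃ ε > 0, c * (1 + ε) < c' := by
    refine ⟨(c' - c) / (2 * (c + 1)), by apply div_pos <;> linarith, ?_⟩
    have : c * ((c' - c) / (2 * (c + 1))) ≤ (c' - c) / 2 := by
      rw [mul_div_assoc', div_le_div_iff₀ (by linarith) (by norm_num)]; nlinarith
    nlinarith
  have hfin : ∀ᶠ j in atTop, c' ≤ c * (1 + ε) * (1 + 4 * δ (φ j) / γ) ^ 2 +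
      (1792 * B * |p - 2| / γ ^ 3) * (a (φ j) * δ (φ j)) := by
    filter_upwards [hev (ε * b0 / 4) (by positivity), lw0.eventually (hO0.mem_nhds m0),
      lw1.eventually (hO1.mem_nhds m1), Lδ.eventually (gt_mem_nhds (show (0 : ℝ) < γ / 8 by linarith))]
      with j h1 h2 h3 h4
    refine (hG (φ j)).step (by linarith [ha1 (φ j)]) (hδ0 _) hc hb (hb0 _) (hb1 _) (hV0 _) (hB _) (S0 _ h2) (S1 _ h3)
      (SV _) hγ (hg _ h2) (by simp only [Function.comp] at h4; linarith) hε.le ?_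
    obtain ⟨k1, k2, k3⟩ := h1
    have k4 := hb0 (w0 (φ j))
    have k5 := hb1 (w1 (φ j))
    have k6 : ε * b0 ≤ ε * (1 / 2 * (v0 (w0 (φ j)) + v1 (w1 (φ j)))) := by
      apply mul_le_mul_of_nonneg_left _ hε.le; linarith
    have k7 : 0 < ε * b0 := by positivity
    linarith
  have hT : Tendsto (fun j => c * (1 + ε) * (1 + 4 * δ (φ j) / γ) ^ 2 +
      (1792 * B * |p - 2| / γ ^ 3) * (a (φ j) * δ (φ j))) atTop (𝓝 (c * (1 + ε) * (1 + 4 * 0 / γ) ^ 2 +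
      (1792 * B * |p - 2| / γ ^ 3) * 0)) :=
    ((((Lδ.const_mul 4).div_const γ).const_add 1).pow 2 |>.const_mul _).add (Laδ.const_mul _)
  have := ge_of_tendsto hT hfin
  simp only [mul_zero, zero_div, add_zero, one_pow, mul_one] at this
  linarith

end PB

end SPartE7

section SPartF1
open MeasureTheory Metric Set Filter
open scoped RealInnerProductSpace Pointwise Topology ENNReal NNReal
namespace PB
set_option linter.unusedSectionVars false

variable {n : ℕ} {p : ℝ}

lemma exists_density {A : Set (EE n)} (hA : NullMeasurableSet A) (h0 : volume A ≠ 0) :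
    ∃ a ∈ A, Tendsto (fun r => volume (A ∩ closedBall a r) / volume (closedBall a r)) (𝓝[>] 0) (𝓝 1) := by
  have h1 := Besicovitch.ae_tendsto_measure_inter_div (volume : Measure (EE n)) A
  have h2 := ae_restrict_mem₀ hA
  have : NeBot (ae (volume.restrict A)) := by
    rw [ae_neBot]
    simpa using h0
  obtain ⟨a, ha, hb⟩ := (h2.and h1).exists
  exact ⟨a, ha, hb⟩

lemma density {A B : Set (EE n)} (hA : NullMeasurableSet A) (hB : NullMeasurableSet B)
    (hA0 : volume A ≠ 0) (hB0 : volume B ≠ 0) :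
    ∃ a ∈ A, ∃ b ∈ B, ∀ (c : EE n) (s : ℝ) (O : EE n ≃ₗᵢ[ℝ] EE n), 0 < s → Tm c s O b = a →
      ∀ ε > 0, volume (B ∩ Tm c s O ⁻¹' A ∩ ball b ε) ≠ 0 := by
  obtain ⟨a, ha, da⟩ := exists_density hA hA0
  obtain ⟨b, hb, db⟩ := exists_density hB hB0
  refine ⟨a, ha, b, hb, fun c s O hs hT ε hε h0 => ?_⟩
  have hvol : ∀ S : Set (EE n), NullMeasurableSet S →
      volume (Tm c s O ⁻¹' S) = ENNReal.ofReal ((s ^ n)⁻¹) * volume S := by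
    intro S hS
    have : NullMeasurableSet S (Measure.map (Tm c s O) volume) := by
      rw [Tm_map hs]; exact hS.mono_ac Measure.smul_absolutelyContinuous
    rw [← Measure.map_apply₀ Tm_cont.aemeasurable this, Tm_map hs]; rfl
  have hpre : ∀ r : ℝ, Tm c s O ⁻¹' (closedBall a (s * r)) = closedBall b r := by
    intro r; ext x
    rw [mem_preimage, mem_closedBall, mem_closedBall, ← hT, Tm_dist hs]
    exact mul_le_mul_iff_right₀ hs
  have hmap : Tendsto (fun r : ℝ => s * r) (𝓝[>] 0) (𝓝[>] 0) := by
    refine tendsto_nhdsWithin_iff.mpr ⟨?_, ?_⟩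
    · have : Tendsto (fun r : ℝ => s * r) (𝓝 0) (𝓝 (s * 0)) := (continuous_const.mul continuous_id).tendsto 0
      rw [mul_zero] at this
      exact this.mono_left nhdsWithin_le_nhds
    · filter_upwards [self_mem_nhdsWithin] with r hr using mul_pos hs hr
  have da' := da.comp hmap
  have half : (2⁻¹ : ℝ≥0∞) < 1 := ENNReal.inv_lt_one.mpr (by norm_num)
  obtain ⟨r, ⟨h1, h2⟩, hr, hrε⟩ := (((da'.eventually (lt_mem_nhds half)).and
    (db.eventually (lt_mem_nhds half))).and (Ioo_mem_nhdsGT hε)).exists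
  have hr : 0 < r := hr
  set m := volume (closedBall b r) with hm
  have m0 : m ≠ 0 := (measure_closedBall_pos volume b hr).ne'
  have mt : m ≠ ⊤ := measure_closedBall_lt_top.ne
  have hk0 : ENNReal.ofReal ((s ^ n)⁻¹) ≠ 0 := by
    rw [Ne, ENNReal.ofReal_eq_zero, not_le]; positivity
  have hnA : NullMeasurableSet (A ∩ closedBall a (s * r)) := hA.inter measurableSet_closedBall.nullMeasurableSet
  have e1 : 2⁻¹ * m < volume (Tm c s O ⁻¹' (A ∩ closedBall a (s * r))) := by
    rw [hvol _ hnA, hm, ← hpre r, hvol _ measurableSet_closedBall.nullMeasurableSet]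
    simp only [Function.comp] at h1
    rw [ENNReal.lt_div_iff_mul_lt (Or.inl (measure_closedBall_pos volume a (mul_pos hs hr)).ne')
      (Or.inl measure_closedBall_lt_top.ne)] at h1
    rw [mul_left_comm]
    exact ENNReal.mul_lt_mul_right hk0 ENNReal.ofReal_ne_top h1
  have e2 : 2⁻¹ * m < volume (B ∩ closedBall b r) := by
    rwa [ENNReal.lt_div_iff_mul_lt (Or.inl m0) (Or.inl mt)] at h2
  have hd : AEDisjoint volume (B ∩ closedBall b r) (Tm c s O ⁻¹' (A ∩ closedBall a (s * r))) := by
    refine measure_mono_null ?_ h0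
    rintro x ⟨⟨hx1, hx3⟩, hx2, _⟩
    exact ⟨⟨hx1, hx2⟩, lt_of_le_of_lt hx3 hrε⟩
  have e3 := measure_union₀ (hnA.preimage (Tm_qmp (b := c) (O := O) hs)) hd
  have e4 : volume ((B ∩ closedBall b r) ∪ Tm c s O ⁻¹' (A ∩ closedBall a (s * r))) ≤ m := by
    refine measure_mono ?_
    rintro x (⟨_, hx⟩ | hx)
    · exact hx
    · rw [← hpre r]; exact hx.2
  rw [e3] at e4
  have e5 : m < m := by
    calc m = 2⁻¹ * m + 2⁻¹ * m := by rw [← add_mul, ENNReal.inv_two_add_inv_two, one_mul]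
      _ < _ := ENNReal.add_lt_add e2 e1
      _ ≤ m := e4
  exact lt_irrefl _ e5

/-- upper essential envelope -/
noncomputable def us (u : EE n → ℝ) (x : EE n) : ℝ :=
  sInf {s | ∃ r > 0, ∀ᵐ y, y ∈ ball x r → u y ≤ s}

/-- lower essential envelope -/
noncomputable def ul (u : EE n → ℝ) (x : EE n) : ℝ := - us (fun y => - u y) x

/-- essentially bounded -/
def EB (u : EE n → ℝ) : Prop := ∃ M, ∀ᵐ y, |u y| ≤ M

lemma EB.neg {u : EE n → ℝ} (h : EB u) : EB (fun y => - u y) := by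
  obtain ⟨M, hM⟩ := h
  exact ⟨M, by simpa using hM⟩

lemma us_nonempty {u : EE n → ℝ} (h : EB u) (x : EE n) :
    {s | ∃ r > 0, ∀ᵐ y, y ∈ ball x r → u y ≤ s}.Nonempty := by
  obtain ⟨M, hM⟩ := h
  exact ⟨M, 1, one_pos, by filter_upwards [hM] with y hy _ using (abs_le.mp hy).2⟩

lemma exists_in_ball {P : EE n → Prop} (h : ∀ᵐ y, P y) (x : EE n) {r : ℝ} (hr : 0 < r) :
    ∃ y ∈ ball x r, P y := by
  by_contra hc
  push Not at hc
  have : volume (ball x r) = 0 := measure_mono_null (fun y hy => hc y hy) h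
  exact (measure_ball_pos volume x hr).ne' this

lemma us_bdd {u : EE n → ℝ} (h : EB u) (x : EE n) :
    BddBelow {s | ∃ r > 0, ∀ᵐ y, y ∈ ball x r → u y ≤ s} := by
  obtain ⟨M, hM⟩ := h
  refine ⟨-M, ?_⟩
  rintro s ⟨r, hr, h1⟩
  obtain ⟨y, hy, h2, h3⟩ := exists_in_ball (hM.and h1) x hr
  linarith [h3 hy, (abs_le.mp h2).1]

lemma us_lt {u : EE n → ℝ} (h : EB u) {x : EE n} {s : ℝ} (hs : us u x < s) :
    ∃ r > 0, ∀ᵐ y, y ∈ ball x r → u y ≤ s := by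
  obtain ⟨t, ⟨r, hr, h1⟩, ht⟩ := exists_lt_of_csInf_lt (us_nonempty h x) hs
  exact ⟨r, hr, by filter_upwards [h1] with y hy hb using (hy hb).trans ht.le⟩

lemma us_le {u : EE n → ℝ} (h : EB u) {x : EE n} {s r : ℝ} (hr : 0 < r)
    (h1 : ∀ᵐ y, y ∈ ball x r → u y ≤ s) : us u x ≤ s :=
  csInf_le (us_bdd h x) ⟨r, hr, h1⟩

lemma us_le_ball {u : EE n → ℝ} (h : EB u) {x y : EE n} {s r : ℝ} (hy : y ∈ ball x r)
    (h1 : ∀ᵐ y, y ∈ ball x r → u y ≤ s) : us u y ≤ s := by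
  have hd : 0 < r - dist y x := by rw [mem_ball] at hy; linarith
  refine us_le h hd ?_
  filter_upwards [h1] with z hz hb
  apply hz
  rw [mem_ball] at *
  linarith [dist_triangle z y x]

lemma us_usc {u : EE n → ℝ} (h : EB u) : UpperSemicontinuous (us u) := by
  intro x s hs
  obtain ⟨t, h1, h2⟩ := exists_between hs
  obtain ⟨r, hr, h3⟩ := us_lt h h1
  filter_upwards [ball_mem_nhds x hr] with y hy
  exact (us_le_ball h hy h3).trans_lt h2

lemma us_pos_meas {u : EE n → ℝ} (h : EB u) {x : EE n} {s r : ℝ} (hs : s < us u x) (hr : 0 < r) :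
    volume {y | y ∈ ball x r ∧ s < u y} ≠ 0 := by
  intro h0
  refine not_le.mpr hs (us_le h hr ?_)
  have := measure_eq_zero_iff_ae_notMem.mp h0
  filter_upwards [this] with y hy hb
  by_contra hc
  exact hy ⟨hb, not_le.mp hc⟩

lemma ae_le_of_us {u g : EE n → ℝ} (h : EB u) {U : Set (EE n)} (hU : IsOpen U) (hg : ContinuousOn g U)
    (h1 : ∀ x ∈ U, us u x ≤ g x) : ∀ᵐ x, x ∈ U → u x ≤ g x := by
  have key : ∀ k : ℕ, ∀ᵐ x, x ∈ U → u x ≤ g x + 1 / (k + 1 : ℝ) := by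
    intro k
    have hk : (0 : ℝ) < 1 / (k + 1 : ℝ) := by positivity
    rw [← ae_restrict_iff' hU.measurableSet]
    refine ae_iff.mpr ?_
    rw [Measure.restrict_apply' hU.measurableSet]
    refine measure_null_of_locally_null _ fun x hx => ?_
    have hxU := hx.2
    obtain ⟨r, hr, h2⟩ := us_lt h (show us u x < g x + (1 / (k + 1 : ℝ)) / 2 by linarith [h1 x hxU])
    have hc := (hg.continuousAt (hU.mem_nhds hxU)).eventually (lt_mem_nhds (show g x - (1 / (k + 1 : ℝ)) / 2 < g x by linarith))
    have hm : ball x r ∩ {y | g x - (1 / (k + 1 : ℝ)) / 2 < g y} ∈ 𝓝 x := inter_mem (ball_mem_nhds x hr) hc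
    refine ⟨_, inter_mem_nhdsWithin _ hm, ?_⟩
    refine measure_mono_null ?_ h2
    rintro y ⟨⟨hy1, hy2⟩, hy3, hy4⟩ hc
    apply hy1
    have h5 := hc hy3
    have hy4 : g x - (1 / (k + 1 : ℝ)) / 2 < g y := hy4
    show u y ≤ g y + 1 / (k + 1 : ℝ)
    linarith
  filter_upwards [ae_all_iff.mpr key] with x hx hU
  have hl : Tendsto (fun k : ℕ => g x + 1 / (k + 1 : ℝ)) atTop (𝓝 (g x)) := by
    have := (tendsto_one_div_add_atTop_nhds_zero_nat (𝕜 := ℝ)).const_add (g x)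
    simpa using this
  exact ge_of_tendsto' hl fun k => hx k hU

lemma ul_lsc {u : EE n → ℝ} (h : EB u) : LowerSemicontinuous (ul u) := by
  intro x s hs
  have := us_usc h.neg x (-s) (by unfold ul at hs; linarith)
  filter_upwards [this] with y hy
  unfold ul; linarith

lemma us_mono {u v : EE n → ℝ} (h : EB u) (h' : EB v) (huv : ∀ᵐ y, u y ≤ v y) (x : EE n) : us u x ≤ us v x := by
  refine le_of_forall_gt fun s hs => ?_
  obtain ⟨t, h1, h2⟩ := exists_between hs
  obtain ⟨r, hr, h3⟩ := us_lt h' h1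
  refine lt_of_le_of_lt (us_le h hr ?_) h2
  filter_upwards [h3, huv] with y a b c using b.trans (a c)

lemma us_congr {u v : EE n → ℝ} (huv : ∀ᵐ y, u y = v y) (x : EE n) : us u x = us v x := by
  unfold us
  congr 1; ext s
  constructor
  · rintro ⟨r, hr, h⟩
    exact ⟨r, hr, by filter_upwards [h, huv] with y a b using b ▸ a⟩
  · rintro ⟨r, hr, h⟩
    exact ⟨r, hr, by filter_upwards [h, huv] with y a b using b ▸ a⟩

lemma us_bounds {u : EE n → ℝ} {a b : ℝ} (h : ∀ᵐ y, a ≤ u y ∧ u y ≤ b) (x : EE n) :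
    a ≤ us u x ∧ us u x ≤ b := by
  have he : EB u := ⟨max |a| |b|, by
    filter_upwards [h] with y hy
    exact abs_le_max_abs_abs hy.1 hy.2⟩
  refine ⟨?_, us_le he one_pos (by filter_upwards [h] with y hy _ using hy.2)⟩
  refine le_csInf (us_nonempty he x) ?_
  rintro s ⟨r, hr, h1⟩
  obtain ⟨y, hy, h2, h3⟩ := exists_in_ball (h.and h1) x hr
  linarith [h3 hy]

/-- translation/scale comparison passes to envelopes with different base points -/
lemma us_le_ul {u v : EE n → ℝ} (hu : EB u) (hv : EB v) (mu : AEStronglyMeasurable u volume)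
    (mv : AEStronglyMeasurable v volume) {x y : EE n} {s ρ : ℝ} (hs : 0 < s) (hρ : 0 < ρ)
    (h : ∀ c : EE n, dist c (y - s • x) < ρ → ∀ᵐ z, u z ≤ v (c + s • z)) : us u x ≤ ul v y := by
  by_contra hc
  push Not at hc
  obtain ⟨t, h1, h2⟩ := exists_between hc
  set r := ρ / (2 * (1 + s)) with hr
  have hr0 : 0 < r := by positivity
  have hrs : r + s * r < ρ := by
    have : r + s * r = ρ / 2 := by rw [hr]; field_simp
    rw [this]; linarith
  have p1 := us_pos_meas hu h2 hr0
  have p2 := us_pos_meas hv.neg (s := -t) (x := y) (r := r) (by unfold ul at h1; linarith) hr0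
  have m1 : NullMeasurableSet {z | z ∈ ball x r ∧ t < u z} volume :=
    measurableSet_ball.nullMeasurableSet.inter (nullMeasurableSet_lt aemeasurable_const mu.aemeasurable)
  have m2 : NullMeasurableSet {z | z ∈ ball y r ∧ -t < - v z} volume :=
    measurableSet_ball.nullMeasurableSet.inter (nullMeasurableSet_lt aemeasurable_const mv.neg.aemeasurable)
  obtain ⟨a, ha, b, hb, H⟩ := density m2 m1 p2 p1
  have ha1 : dist a y < r := ha.1
  have hb1 : dist b x < r := hb.1
  have hcd : dist (a - s • b) (y - s • x) < ρ := by
    refine lt_of_le_of_lt (dist_sub_sub_le a (s • b) y (s • x)) ?_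
    rw [dist_smul₀, Real.norm_of_nonneg hs.le]
    have := mul_lt_mul_of_pos_left hb1 hs
    linarith
  have h3 := h (a - s • b) hcd
  refine H (a - s • b) s (LinearIsometryEquiv.refl ℝ _) hs (by simp [Tm]) 1 one_pos ?_
  refine measure_mono_null ?_ h3
  rintro z ⟨⟨hz1, hz2⟩, _⟩ hz3
  have a1 : t < u z := hz1.2
  have a2 : -t < - v (a - s • b + s • z) := hz2.2
  have a3 : u z ≤ v (a - s • b + s • z) := hz3
  linarith

lemma us_tr (u : EE n → ℝ) {c : EE n} {s : ℝ} {O : EE n ≃ₗᵢ[ℝ] EE n} (hs : 0 < s) (x : EE n) :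
    us (fun z => u (Tm c s O z)) x = us u (Tm c s O x) := by
  have h1 : ∀ (u : EE n → ℝ) (c : EE n) (s : ℝ) (O : EE n ≃ₗᵢ[ℝ] EE n) (hs : 0 < s) (x : EE n) (t : ℝ),
      (∃ r > 0, ∀ᵐ y, y ∈ ball (Tm c s O x) r → u y ≤ t) →
      (∃ r > 0, ∀ᵐ y, y ∈ ball x r → u (Tm c s O y) ≤ t) := by
    rintro u c s O hs x t ⟨r, hr, h⟩
    refine ⟨r / s, by positivity, ?_⟩
    filter_upwards [(Tm_qmp (b := c) (O := O) hs).ae h] with y hy hb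
    apply hy
    rw [mem_ball, Tm_dist hs, ← lt_div_iff₀' hs]
    exact hb
  unfold us
  congr 1; ext t
  refine ⟨fun h => ?_, h1 u c s O hs x t⟩
  have := h1 (fun z => u (Tm c s O z)) (-(s⁻¹ • O.symm c)) s⁻¹ O.symm (inv_pos.mpr hs) (Tm c s O x) t
  rw [Tm_inv hs.ne'] at this
  have h2 := this h
  simp only [Tm_inv' hs.ne'] at h2
  exact h2

/-- truncated difference on an open set -/
lemma grad_ind {H : Set (EE n)} (hH : IsOpen H) {w : EE n → ℝ} (hw : C1c w)
    (h0 : ∀ x ∈ frontier H, w x = 0) (x : EE n) :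
    HasFDerivAt (H.indicator fun x => th (w x)) (InnerProductSpace.toDual ℝ (EE n)
      (H.indicator (fun x => deriv th (w x) • gradient w x) x)) x := by
  have hth : ∀ y, HasFDerivAt (fun x => th (w x)) (InnerProductSpace.toDual ℝ (EE n) (deriv th (w y) • gradient w y)) y := by
    intro y
    have d1 : DifferentiableAt ℝ (fun x => th (w x)) y :=
      ((contDiff_th.differentiable one_ne_zero) _).comp y (hw.diff y)
    have := d1.hasGradientAt
    rw [grad_comp (hw.diff y) ((contDiff_th.differentiable one_ne_zero) _)] at this
    exact this.hasFDerivAt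
  by_cases hx : x ∈ H
  · rw [indicator_of_mem hx]
    refine (hth x).congr_of_eventuallyEq ?_
    filter_upwards [hH.mem_nhds hx] with y hy
    rw [indicator_of_mem hy]
  · rw [indicator_of_notMem hx, map_zero]
    by_cases hx2 : x ∈ closure H
    · have hf : x ∈ frontier H := ⟨hx2, by rwa [hH.interior_eq]⟩
      have hx0 := h0 x hf
      have h1 := hth x
      rw [hx0, deriv_th_of_nonpos le_rfl, zero_smul, map_zero] at h1
      rw [hasFDerivAt_iff_isLittleO_nhds_zero] at h1 ⊢
      refine Asymptotics.IsBigO.trans_isLittleO (Asymptotics.IsBigO.of_bound 1 (Eventually.of_forall fun h => ?_)) h1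
      rw [indicator_of_notMem hx, hx0, th_zero, one_mul]
      simp only [_root_.zero_apply, sub_zero]
      by_cases hy : x + h ∈ H
      · rw [indicator_of_mem hy]
      · rw [indicator_of_notMem hy]; simp
    · refine (hasFDerivAt_const (0 : ℝ) x).congr_of_eventuallyEq ?_
      filter_upwards [isClosed_closure.isOpen_compl.mem_nhds hx2] with y hy
      rw [indicator_of_notMem fun h => hy (subset_closure h)]

lemma C1c_ind {H : Set (EE n)} (hH : IsOpen H) {w : EE n → ℝ} (hw : C1c w)
    (h0 : ∀ x ∈ frontier H, w x = 0) : C1c (H.indicator fun x => th (w x)) := by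
  refine ⟨?_, ?_⟩
  · refine contDiff_one_iff_hasFDerivAt.mpr ⟨_, ?_, grad_ind hH hw h0⟩
    refine (InnerProductSpace.toDual ℝ (EE n)).continuous.comp ?_
    refine continuous_indicator (fun x hx => ?_) (Continuous.continuousOn ?_)
    · rw [h0 x hx, deriv_th_of_nonpos le_rfl, zero_smul]
    · exact ((contDiff_th.continuous_deriv le_rfl).comp hw.cont).smul hw.contg
  · refine hw.cs.mono fun x hx => ?_
    contrapose! hx
    have hx : w x = 0 := by simpa using hx
    simp only [Function.mem_support, not_not]
    by_cases h : x ∈ H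
    · rw [indicator_of_mem h, hx, th_zero]
    · rw [indicator_of_notMem h]

/-- reflection comparison -/
lemma Pot.refl (hp : 1 < p) (hpn : p < n) {K : Set (EE n)} {f : ℕ → EE n → ℝ} {u : EE n → ℝ}
    {G : EE n → EE n} (h : Pot p K f u G) (hK : Bornology.IsBounded K) {a b : EE n} {c : EE n}
    {O : EE n ≃ₗᵢ[ℝ] EE n} (hab : Tm c 1 O a = b) (hba : Tm c 1 O b = a)
    (hfix : ∀ x, dist x a = dist x b → Tm c 1 O x = x) (hKH : ∀ x ∈ K, dist x a < dist x b) :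
    ∀ᵐ x, dist x a < dist x b → u (Tm c 1 O x) ≤ u x := by
  set H : Set (EE n) := {x | dist x a < dist x b} with hHdef
  have hH : IsOpen H := isOpen_lt (continuous_id.dist continuous_const) (continuous_id.dist continuous_const)
  have hfr : ∀ x ∈ frontier H, dist x a = dist x b := fun x hx => by
    have := frontier_lt_subset_eq (continuous_id.dist continuous_const) (continuous_id.dist continuous_const) hx
    exact this
  have hw : ∀ k, C1c (fun x => f k (Tm c 1 O x) - f k x) := fun k => ((h.ds.c1 k).tr one_pos).sub (h.ds.c1 k)
  have h0 : ∀ k, ∀ x ∈ frontier H, f k (Tm c 1 O x) - f k x = 0 := fun k x hx => by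
    rw [hfix x (hfr x hx), sub_self]
  suffices key : ∀ᵐ x, x ∈ H → u (Tm c 1 O x) ≤ u x from key
  refine compareH (H := H) hp hpn (h.tr (b := c) (O := O) hK one_pos) h hH.measurableSet
    (fun k => C1c_ind hH (hw k) (h0 k)) (fun k x => ?_) ?_
  · have := (hasFDerivAt_iff_hasGradientAt.mp (grad_ind hH (hw k) (h0 k) x)).gradient
    rw [this, LinearIsometryEquiv.symm_apply_apply]
    by_cases hx : x ∈ H
    · simp only [indicator_of_mem hx]
      rw [grad_sub (((h.ds.c1 k).tr one_pos).diff x) ((h.ds.c1 k).diff x)]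
    · simp only [indicator_of_notMem hx]
  · rintro x ⟨hx1, hx2⟩
    exfalso
    have e1 := hKH _ hx1
    have e2 := Tm_dist (b := c) (O := O) one_pos x a
    have e3 := Tm_dist (b := c) (O := O) one_pos x b
    rw [hab, one_mul] at e2
    rw [hba, one_mul] at e3
    have hx2 : dist x a < dist x b := hx2
    linarith

lemma exists_refl (a b : EE n) : ∃ (c : EE n) (O : EE n ≃ₗᵢ[ℝ] EE n),
    Tm c 1 O a = b ∧ Tm c 1 O b = a ∧ (∀ x, dist x a = dist x b → Tm c 1 O x = x) ∧
    ∀ x, Tm c 1 O (Tm c 1 O x) = x := by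
  set O := (ℝ ∙ (a - b))ᗮ.reflection with hO
  obtain ⟨m, hm⟩ : ∃ m, m = (2⁻¹ : ℝ) • (a + b) := ⟨_, rfl⟩
  have hOd : O (a - b) = -(a - b) := Submodule.reflection_orthogonalComplement_singleton_eq_neg _
  have e1 : a = m + (2⁻¹ : ℝ) • (a - b) := by rw [hm]; module
  have e2 : b = m - (2⁻¹ : ℝ) • (a - b) := by rw [hm]; module
  refine ⟨m - O m, O, ?_, ?_, fun x hx => ?_, fun x => ?_⟩
  · have : O a = O m - (2⁻¹ : ℝ) • (a - b) := by
      conv_lhs => rw [e1]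
      rw [map_add, map_smul, hOd]; module
    unfold Tm
    rw [this, one_smul]
    conv_rhs => rw [e2]
    abel
  · have : O b = O m + (2⁻¹ : ℝ) • (a - b) := by
      conv_lhs => rw [e2]
      rw [map_sub, map_smul, hOd]; module
    unfold Tm
    rw [this, one_smul]
    conv_rhs => rw [e1]
    abel
  · have h1 : O (x - m) = x - m := by
      refine Submodule.reflection_mem_subspace_eq_self ?_
      rw [Submodule.mem_orthogonal_singleton_iff_inner_right]
      rw [dist_eq_norm, dist_eq_norm] at hx
      have e : ‖x - a‖ ^ 2 = ‖x - b‖ ^ 2 := by rw [hx]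
      rw [norm_sub_sq_real, norm_sub_sq_real] at e
      rw [hm]
      simp only [inner_sub_left, inner_sub_right, inner_smul_right, inner_add_right, real_inner_self_eq_norm_sq]
      rw [real_inner_comm x a, real_inner_comm x b, real_inner_comm b a] at *
      linarith
    unfold Tm
    rw [map_sub] at h1
    rw [one_smul]
    have : O x = x - m + O m := by rw [← h1]; abel
    rw [this]; abel
  · unfold Tm
    have h2 : ∀ y, O (O y) = y := fun y => Submodule.reflection_reflection _ y
    rw [one_smul, one_smul, map_add, map_sub, h2, h2]; abel

lemma Pot.levels (hp : 1 < p) (hpn : p < n) {K : Set (EE n)} {f : ℕ → EE n → ℝ} {u : EE n → ℝ}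
    {G : EE n → EE n} (h : Pot p K f u G) {R ρ t : ℝ} (hK : K ⊆ closedBall 0 R)
    (hA : volume {z | z ∈ ball (0 : EE n) ρ ∧ u z < t} ≠ 0)
    (hB : volume {z | z ∈ (closedBall (0 : EE n) (ρ + 2 * R))ᶜ ∧ t ≤ u z} ≠ 0) (hR : 0 ≤ R) : False := by
  have mu : AEMeasurable u volume := h.ds.aesm.aemeasurable
  have mA : NullMeasurableSet {z | z ∈ ball (0 : EE n) ρ ∧ u z < t} volume :=
    measurableSet_ball.nullMeasurableSet.inter (nullMeasurableSet_lt mu aemeasurable_const)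
  have mB : NullMeasurableSet {z | z ∈ (closedBall (0 : EE n) (ρ + 2 * R))ᶜ ∧ t ≤ u z} volume :=
    measurableSet_closedBall.compl.nullMeasurableSet.inter (nullMeasurableSet_le aemeasurable_const mu)
  obtain ⟨a, ⟨ha, _⟩, b, ⟨hb, _⟩, H⟩ := density mA mB hA hB
  rw [mem_ball_zero_iff] at ha
  rw [mem_compl_iff, mem_closedBall_zero_iff, not_le] at hb
  have hne : 0 < dist a b := by
    rw [dist_pos]; rintro rfl; linarith
  obtain ⟨c, O, h1, h2, h3, h4⟩ := exists_refl a b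
  have hr := h.refl hp hpn (isBounded_closedBall.subset hK) h1 h2 h3 (fun x hx => by
    have := hK hx
    rw [mem_closedBall_zero_iff] at this
    have e1 : dist x a ≤ ‖x‖ + ‖a‖ := by rw [dist_eq_norm]; exact norm_sub_le _ _
    have e2 : ‖b‖ - ‖x‖ ≤ dist x b := by rw [dist_comm, dist_eq_norm]; exact norm_sub_norm_le _ _
    linarith)
  have hr2 := (Tm_qmp (b := c) (O := O) one_pos).ae hr
  refine H c 1 O one_pos h2 (dist a b / 2) (by linarith) ?_
  refine measure_mono_null ?_ (ae_iff.mp hr2)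
  rintro z ⟨⟨⟨_, hz1⟩, ⟨_, hz2⟩⟩, hz3⟩ hz4
  have invol : Tm c 1 O (Tm c 1 O z) = z := h4 z
  rw [invol] at hz4
  have e2 := Tm_dist (b := c) (O := O) one_pos z a
  have e3 := Tm_dist (b := c) (O := O) one_pos z b
  rw [h1, one_mul] at e2
  rw [h2, one_mul] at e3
  rw [mem_ball] at hz3
  have := hz4 (by rw [e2, e3]; linarith [dist_triangle a z b, dist_comm a z])
  linarith

end PB

end SPartF1

section SPartF2
open MeasureTheory Metric Set Filter
open scoped RealInnerProductSpace Pointwise Topology ENNReal NNReal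
namespace PB
set_option linter.unusedSectionVars false

variable {n : ℕ} {p : ℝ}

section
variable {K L : Set (EE n)} {f g : ℕ → EE n → ℝ} {u w : EE n → ℝ} {G W : EE n → EE n}

lemma Pot.bds (hp : 1 < p) (hpn : p < n) (h : Pot p K f u G) : ∀ᵐ x, 0 ≤ u x ∧ u x ≤ 1 :=
  (h.nonneg hp hpn).and (h.le_one hp hpn)

lemma Pot.EB (hp : 1 < p) (hpn : p < n) (h : Pot p K f u G) : EB u :=
  ⟨1, by filter_upwards [h.bds hp hpn] with x hx using abs_le.mpr ⟨by linarith [hx.1], hx.2⟩⟩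

lemma Pot.us_bds (hp : 1 < p) (hpn : p < n) (h : Pot p K f u G) (x : EE n) : 0 ≤ us u x ∧ us u x ≤ 1 :=
  us_bounds (h.bds hp hpn) x

lemma Pot.ul_bds (hp : 1 < p) (hpn : p < n) (h : Pot p K f u G) (x : EE n) : 0 ≤ ul u x ∧ ul u x ≤ 1 := by
  have := us_bounds (u := fun y => - u y) (a := -1) (b := 0)
    (by filter_upwards [h.bds hp hpn] with x hx using ⟨by linarith [hx.2], by linarith [hx.1]⟩) x
  unfold ul
  constructor <;> linarith [this.1, this.2]

lemma Pot.Z (hp : 1 < p) (hpn : p < n) (h : Pot p K f u G) (h' : Pot p L g w W) (hL : Bornology.IsBounded L)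
    {c0 : EE n} {s ρ : ℝ} (hs : 0 < s) (hρ : 0 < ρ)
    (hc : ∀ c, dist c c0 < ρ → ∀ k ∈ K, c + s • k ∈ L) (x : EE n) : us u x ≤ ul w (c0 + s • x) := by
  refine us_le_ul (h.EB hp hpn) (h'.EB hp hpn) h.ds.aesm h'.ds.aesm hs hρ fun c hcd => ?_
  rw [add_sub_cancel_right] at hcd
  have := h.mono hp hpn (h'.tr (b := c) (O := LinearIsometryEquiv.refl ℝ _) hL hs)
    (fun k hk => by simpa [Tm] using hc c hcd k hk)
  simpa [Tm] using this

lemma Pot.star (hp : 1 < p) (hpn : p < n) (h : Pot p K f u G) (hK : Bornology.IsBounded K)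
    (hst : ∀ k ∈ K, ∀ s : ℝ, 0 ≤ s → s ≤ 1 → s • k ∈ K) {t : ℝ} (ht : 1 ≤ t) (x : EE n) :
    us u (t • x) ≤ us u x := by
  have ht0 : 0 < t := by linarith
  have h1 := (h.tr (b := 0) (O := LinearIsometryEquiv.refl ℝ _) hK ht0).mono hp hpn h
    (fun k hk => by
      have hk : t • k ∈ K := by simpa [Tm] using hk
      have := hst _ hk t⁻¹ (by positivity) (inv_le_one_of_one_le₀ ht)
      rwa [smul_smul, inv_mul_cancel₀ ht0.ne', one_smul] at this)
  have h2 := us_mono (h.tr (b := 0) (O := LinearIsometryEquiv.refl ℝ _) hK ht0 |>.EB hp hpn) (h.EB hp hpn) h1 x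
  rw [us_tr _ ht0] at h2
  simpa [Tm] using h2

/-- ramp -/
noncomputable def rmp (δ s : ℝ) : ℝ := (max s 0 ^ 2 - max (s - δ) 0 ^ 2) / (2 * δ)

lemma hasDerivAt_rmp {δ : ℝ} (hδ : 0 < δ) (s : ℝ) :
    HasDerivAt (rmp δ) ((max s 0 - max (s - δ) 0) / δ) s := by
  have h1 := hasDerivAt_mp2 s
  have h2 := (hasDerivAt_mp2 (s - δ)).comp s ((hasDerivAt_id s).sub_const δ)
  have h3 := (h1.sub h2).div_const (2 * δ)
  refine HasDerivAt.congr_deriv (f := rmp δ) h3 ?_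
  field_simp

lemma deriv_rmp {δ : ℝ} (hδ : 0 < δ) (s : ℝ) : deriv (rmp δ) s = (max s 0 - max (s - δ) 0) / δ :=
  (hasDerivAt_rmp hδ s).deriv

lemma contDiff_rmp (δ : ℝ) : ContDiff ℝ 1 (rmp δ) := by
  have h2 : ContDiff ℝ 1 (fun s : ℝ => max (s - δ) 0 ^ 2) :=
    contDiff_mp2.comp (contDiff_id.sub contDiff_const)
  exact (contDiff_mp2.sub h2).div_const _

lemma rmp_neg {δ s : ℝ} (hδ : 0 < δ) (hs : s ≤ 0) : rmp δ s = 0 := by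
  unfold rmp; rw [max_eq_right hs, max_eq_right (by linarith)]; simp

lemma rmp_big {δ s : ℝ} (hδ : 0 < δ) (hs : δ ≤ s) : rmp δ s = s - δ / 2 := by
  unfold rmp; rw [max_eq_left (by linarith), max_eq_left (by linarith)]; field_simp; ring

lemma drmp_mono {δ : ℝ} (hδ : 0 < δ) {s t : ℝ} (h : s ≤ t) : deriv (rmp δ) s ≤ deriv (rmp δ) t := by
  rw [deriv_rmp hδ, deriv_rmp hδ]
  refine div_le_div_of_nonneg_right ?_ hδ.le
  rcases max_cases s 0 with ⟨a1, a2⟩ | ⟨a1, a2⟩ <;> rcases max_cases t 0 with ⟨b1, b2⟩ | ⟨b1, b2⟩ <;>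
  rcases max_cases (s - δ) 0 with ⟨c1, c2⟩ | ⟨c1, c2⟩ <;> rcases max_cases (t - δ) 0 with ⟨d1, d2⟩ | ⟨d1, d2⟩ <;>
  linarith

lemma drmp_neg {δ s : ℝ} (hδ : 0 < δ) (hs : s ≤ 0) : deriv (rmp δ) s = 0 := by
  rw [deriv_rmp hδ, max_eq_right hs, max_eq_right (by linarith)]; simp

lemma drmp_nonneg {δ : ℝ} (hδ : 0 < δ) (s : ℝ) : 0 ≤ deriv (rmp δ) s := by
  rw [deriv_rmp hδ]
  refine div_nonneg ?_ hδ.le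
  exact sub_nonneg.mpr (max_le_max (by linarith) le_rfl)

lemma drmp_le {δ : ℝ} (hδ : 0 < δ) (s : ℝ) : deriv (rmp δ) s ≤ 1 := by
  rw [deriv_rmp hδ, div_le_one hδ]
  rcases max_cases s 0 with ⟨a1, a2⟩ | ⟨a1, a2⟩ <;>
  rcases max_cases (s - δ) 0 with ⟨c1, c2⟩ | ⟨c1, c2⟩ <;> linarith

/-- truncation at level `t` -/
noncomputable def trc (t δ s : ℝ) : ℝ := (rmp δ s - rmp δ (s - (t - δ))) / (t - δ)

lemma hasDerivAt_trc {t δ : ℝ} (hδ : 0 < δ) (s : ℝ) :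
    HasDerivAt (trc t δ) ((deriv (rmp δ) s - deriv (rmp δ) (s - (t - δ))) / (t - δ)) s := by
  have h1 := hasDerivAt_rmp hδ s
  have h2 := (hasDerivAt_rmp hδ (s - (t - δ))).comp s ((hasDerivAt_id s).sub_const (t - δ))
  have h3 := (h1.sub h2).div_const (t - δ)
  refine HasDerivAt.congr_deriv (f := trc t δ) h3 ?_
  rw [deriv_rmp hδ, deriv_rmp hδ, mul_one]

lemma contDiff_trc (t δ : ℝ) : ContDiff ℝ 1 (trc t δ) := by
  have h2 : ContDiff ℝ 1 (fun s : ℝ => rmp δ (s - (t - δ))) :=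
    (contDiff_rmp δ).comp (contDiff_id.sub contDiff_const)
  exact ((contDiff_rmp δ).sub h2).div_const _

lemma dtrc_nonneg {t δ : ℝ} (hδ : 0 < δ) (ht : δ < t) (s : ℝ) : 0 ≤ deriv (trc t δ) s := by
  rw [(hasDerivAt_trc hδ s).deriv]
  exact div_nonneg (sub_nonneg.mpr (drmp_mono hδ (by linarith))) (by linarith)

lemma dtrc_le {t δ : ℝ} (hδ : 0 < δ) (ht : δ < t) (s : ℝ) : deriv (trc t δ) s ≤ (t - δ)⁻¹ := by
  rw [(hasDerivAt_trc hδ s).deriv, ← one_div]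
  exact div_le_div_of_nonneg_right (by linarith [drmp_le hδ s, drmp_nonneg hδ (s - (t - δ))]) (by linarith)

lemma abs_dtrc {t δ : ℝ} (hδ : 0 < δ) (ht : δ < t) (s : ℝ) : |deriv (trc t δ) s| ≤ (t - δ)⁻¹ := by
  rw [abs_of_nonneg (dtrc_nonneg hδ ht s)]; exact dtrc_le hδ ht s

lemma trc_neg {t δ s : ℝ} (hδ : 0 < δ) (ht : δ < t) (hs : s ≤ 0) : trc t δ s = 0 := by
  unfold trc; rw [rmp_neg hδ hs, rmp_neg hδ (by linarith)]; simp

lemma trc_big {t δ s : ℝ} (hδ : 0 < δ) (ht : δ < t) (hs : t ≤ s) : trc t δ s = 1 := by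
  unfold trc
  rw [rmp_big hδ (by linarith), rmp_big hδ (by linarith), div_eq_one_iff_eq (by linarith)]; ring

lemma trc_mono {t δ : ℝ} (hδ : 0 < δ) (ht : δ < t) : Monotone (trc t δ) :=
  monotone_of_deriv_nonneg ((contDiff_trc t δ).differentiable one_ne_zero) (dtrc_nonneg hδ ht)

lemma trc_nonneg {t δ : ℝ} (hδ : 0 < δ) (ht : δ < t) (s : ℝ) : 0 ≤ trc t δ s := by
  rcases le_total s 0 with h | h
  · rw [trc_neg hδ ht h]
  · rw [← trc_neg hδ ht (le_refl (0:ℝ))]; exact trc_mono hδ ht h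

lemma trc_le {t δ : ℝ} (hδ : 0 < δ) (ht : δ < t) (s : ℝ) : trc t δ s ≤ 1 := by
  rcases le_total t s with h | h
  · rw [trc_big hδ ht h]
  · rw [← trc_big hδ ht (le_refl t)]; exact trc_mono hδ ht h

/-- flux identity -/
lemma Pot.flux (hp : 1 < p) (h : Pot p K f u G) {θ : ℝ → ℝ} (hθ : ContDiff ℝ 1 θ) (h0 : θ 0 = 0) {M κ : ℝ}
    (hM : ∀ s, |deriv θ s| ≤ M) (hκ : ∀ s, 1 ≤ s → θ s = κ) :
    Integrable (fun x => deriv θ (u x) * ‖G x‖ ^ p) ∧ ∫ x, deriv θ (u x) * ‖G x‖ ^ p = κ * cap p K := by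
  have hd := h.ds.comp hp hθ h0 hM
  have hd2 := hd.sub hp (h.ds.const_mul κ)
  have hs : 0 < 1 / (1 + |κ|) := by positivity
  have hsk : |1 / (1 + |κ|) * κ| ≤ 1 := by
    rw [abs_mul, abs_of_pos hs, one_div, inv_mul_le_iff₀ (by positivity)]; linarith
  have hsk := abs_le.mp hsk
  have e1 := h.EL hp hd2 hs fun k x hx => by
    have := h.ge k x hx
    rw [hκ _ this]
    nlinarith
  have e2 := h.EL hp (hd2.const_mul (-1)) hs fun k x hx => by
    have := h.ge k x hx
    rw [hκ _ this]
    nlinarith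
  simp only [inner_smul_right, neg_mul, one_mul, integral_neg] at e2
  have i1 := int_AA hp h.ds.mem hd.mem
  have i2 := int_AA hp h.ds.mem (h.ds.const_mul κ).mem
  have e3 : ∫ x, ⟪AA p (G x), deriv θ (u x) • G x - κ • G x⟫ = 0 := le_antisymm (by linarith) e1
  simp only [inner_sub_right] at e3
  rw [integral_sub i1 i2] at e3
  simp only [inner_smul_right, AA_inner_self hp] at e3 i1
  rw [integral_const_mul, h.en] at e3
  exact ⟨i1, by linarith⟩

/-- capacity bound from a limit function equal to one near a ball -/
lemma cap_ball_le (hp : 1 < p) (hd : DSeq p f u G) (hf : ∀ k x, |f k x| ≤ 1) {r r' : ℝ} (hr' : 0 < r') (hr : r' < r)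
    (h1 : ∀ᵐ x, x ∈ ball (0 : EE n) r → u x = 1) : cap p (closedBall (0 : EE n) r') ≤ ∫ x, ‖G x‖ ^ p := by
  obtain ⟨r'', ha, hb⟩ := exists_between hr
  obtain ⟨ζ, -, hζ, z0, z1, z2, z3, -, z4⟩ := exists_cutoff (0 : EE n) hr' ha
  have hD := (hd.add hp (DSeq.const p hζ)).sub hp (hd.mul_bdd hp hf hζ)
  have hG : (fun x => G x + gradient ζ x - (ζ x • G x + u x • gradient ζ x)) =ᵐ[volume] fun x => (1 - ζ x) • G x := by
    filter_upwards [h1] with x hx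
    by_cases hxr : x ∈ ball (0 : EE n) r
    · rw [hx hxr]; module
    · have hz : ∀ᶠ y in 𝓝 x, ζ y = 0 := by
        have : x ∉ tsupport ζ := by
          rw [z4, mem_closedBall]; rw [mem_ball] at hxr; linarith
        exact notMem_tsupport_iff_eventuallyEq.mp this
      have hg : gradient ζ x = 0 := by
        unfold gradient
        have : fderiv ℝ ζ x = 0 := by
          rw [Filter.EventuallyEq.fderiv_eq (f := fun _ => (0 : ℝ)) hz]; simp
        rw [this, map_zero]
      rw [hz.self_of_nhds, hg]; module
  have hD := hD.congr (Filter.EventuallyEq.refl _ _) hG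
  have hlim := hD.energy hp
  have : cap p (closedBall (0 : EE n) r') ≤ ∫ x, ‖(1 - ζ x) • G x‖ ^ p := by
    refine ge_of_tendsto' hlim fun k => cap_le (hD.c1 k) fun x hx => ?_
    rw [z2 x hx]; linarith
  refine this.trans (integral_mono (int_rpow hp hD.mem) (int_rpow hp hd.mem) fun x => ?_)
  simp only [norm_smul]
  refine Real.rpow_le_rpow (by positivity) ?_ (by linarith)
  refine mul_le_of_le_one_left (norm_nonneg _) ?_
  rw [Real.norm_eq_abs, abs_le]; constructor <;> linarith [z0 x, z1 x]

lemma Pot.level_upper (hp : 1 < p) (h : Pot p K f u G) {r r' t : ℝ} (hr' : 0 < r') (hr : r' < r) (ht : 0 < t)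
    (ht1 : t ≤ 1) (h1 : ∀ᵐ x, x ∈ ball (0 : EE n) r → t ≤ u x) :
    cap p (closedBall (0 : EE n) r') ≤ t ^ (1 - p) * cap p K := by
  have key : ∀ δ, 0 < δ → δ < t → cap p (closedBall (0 : EE n) r') ≤ (t - δ) ^ (1 - p) * cap p K := by
    intro δ hδ hδt
    have htd : 0 < t - δ := by linarith
    have h0 := trc_neg hδ hδt (le_refl (0:ℝ))
    have hd := h.ds.comp hp (contDiff_trc t δ) h0 (abs_dtrc hδ hδt)
    obtain ⟨i1, fl⟩ := h.flux hp (contDiff_trc t δ) h0 (abs_dtrc hδ hδt) (fun s hs => trc_big hδ hδt (ht1.trans hs))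
    have c1 := cap_ball_le hp hd (fun k x => abs_le.mpr ⟨by linarith [trc_nonneg hδ hδt (f k x)], trc_le hδ hδt _⟩)
      hr' hr (by filter_upwards [h1] with x hx hb using trc_big hδ hδt (hx hb))
    refine c1.trans ?_
    have : ∫ x, ‖deriv (trc t δ) (u x) • G x‖ ^ p ≤ ∫ x, (t - δ) ^ (1 - p) * (deriv (trc t δ) (u x) * ‖G x‖ ^ p) := by
      refine integral_mono (int_rpow hp hd.mem) (i1.const_mul _) fun x => ?_
      have a0 := dtrc_nonneg hδ hδt (u x)
      have a1 := dtrc_le hδ hδt (u x)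
      simp only [norm_smul]
      rw [Real.mul_rpow (norm_nonneg _) (norm_nonneg _), Real.norm_of_nonneg a0, ← mul_assoc]
      refine mul_le_mul_of_nonneg_right ?_ (by positivity)
      have e : deriv (trc t δ) (u x) ^ p = deriv (trc t δ) (u x) ^ (p - 1) * deriv (trc t δ) (u x) := by
        rcases a0.eq_or_lt with h | h
        · rw [← h, Real.zero_rpow (by linarith), mul_zero]
        · rw [← Real.rpow_add_one h.ne']; ring_nf
      rw [e]
      refine mul_le_mul_of_nonneg_right ?_ a0
      have := Real.rpow_le_rpow a0 a1 (show 0 ≤ p - 1 by linarith)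
      rwa [Real.inv_rpow htd.le, ← Real.rpow_neg htd.le, neg_sub] at this
    rw [integral_const_mul, fl, one_mul] at this
    exact this
  have hlim : Tendsto (fun δ : ℝ => (t - δ) ^ (1 - p) * cap p K) (𝓝[>] 0) (𝓝 ((t - 0) ^ (1 - p) * cap p K)) := by
    refine Tendsto.mul_const _ ?_
    refine Tendsto.mono_left ?_ nhdsWithin_le_nhds
    have : ContinuousAt (fun δ : ℝ => (t - δ) ^ (1 - p)) 0 := by
      refine ContinuousAt.rpow_const (by fun_prop) (Or.inl ?_)
      simp [ht.ne']
    exact this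
  rw [sub_zero] at hlim
  refine ge_of_tendsto hlim ?_
  filter_upwards [Ioo_mem_nhdsGT ht] with δ hδ using key δ hδ.1 hδ.2

lemma Pot.level_lower (hp : 1 < p) (h : Pot p K f u G) {ρ ρ' t : ℝ} (hρ : ρ < ρ')
    (hK : K ⊆ closedBall 0 ρ) (ht : 0 < t)
    (ht1 : t < 1) (h1 : ∀ᵐ x, x ∉ closedBall (0 : EE n) ρ → u x < t) :
    t ^ (1 - p) * cap p K ≤ cap p (closedBall (0 : EE n) ρ') := by
  have hC := cap_nonneg (p := p) K
  set C := cap p K with hCd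
  -- first for test functions equal to one
  have key : ∀ φ : EE n → ℝ, C1c φ → (∀ x, x ∈ closedBall (0 : EE n) ρ' → φ x = 1) →
      t ^ (1 - p) * C ≤ ∫ x, ‖gradient φ x‖ ^ p := by
    intro φ hφ hφ1
    have e1 : C ≤ ∫ x, ⟪AA p (G x), gradient φ x⟫ := by
      have := h.EL hp ((DSeq.const p hφ).sub hp h.ds) one_pos fun k x hx => by
        rw [hφ1 x (closedBall_subset_closedBall hρ.le (hK hx))]; linarith
      simp only [inner_sub_right] at this
      rw [integral_sub (int_AA hp h.ds.mem (hφ.memLpg _)) (int_AA hp h.ds.mem h.ds.mem)] at this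
      simp only [AA_inner_self hp] at this
      rw [h.en] at this
      linarith
    have key2 : ∀ δ, 0 < δ → δ < 1 - t → p * (t * C) ≤ (p - 1) * ((t + δ / 2) * C) + t ^ p * ∫ x, ‖gradient φ x‖ ^ p := by
      intro δ hδ hδt
      set θ : ℝ → ℝ := fun s => s - rmp δ (s - t) with hθ
      have dθ : ∀ s, HasDerivAt θ (1 - deriv (rmp δ) (s - t)) s := by
        intro s
        have h2 := (hasDerivAt_rmp hδ (s - t)).comp s ((hasDerivAt_id s).sub_const t)
        refine HasDerivAt.congr_deriv (f := θ) ((hasDerivAt_id s).sub h2) ?_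
        rw [deriv_rmp hδ, mul_one]
      have cθ : ContDiff ℝ 1 θ := contDiff_id.sub ((contDiff_rmp δ).comp (contDiff_id.sub contDiff_const))
      have θ0 : θ 0 = 0 := by simp only [hθ]; rw [rmp_neg hδ (by linarith)]; simp
      have nn : ∀ s, 0 ≤ deriv θ s := fun s => by rw [(dθ s).deriv]; linarith [drmp_le hδ (s - t)]
      obtain ⟨i1, fl⟩ := h.flux hp cθ θ0 (M := 1) (κ := t + δ / 2)
        (fun s => by rw [abs_of_nonneg (nn s), (dθ s).deriv]; linarith [drmp_nonneg hδ (s - t)])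
        (fun s hs => by simp only [hθ]; rw [rmp_big hδ (by linarith)]; ring)
      have iφ := int_rpow hp (hφ.memLpg (ENNReal.ofReal p))
      have iA := int_AA hp h.ds.mem (hφ.memLpg (ENNReal.ofReal p))
      have : ∫ x, p * (t * ⟪AA p (G x), gradient φ x⟫) ≤
          ∫ x, ((p - 1) * (deriv θ (u x) * ‖G x‖ ^ p) + t ^ p * ‖gradient φ x‖ ^ p) := by
        refine integral_mono_ae ((iA.const_mul t).const_mul p) ((i1.const_mul _).add (iφ.const_mul _)) ?_
        filter_upwards [h1] with x hx
        by_cases hxb : x ∈ ball (0 : EE n) ρ'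
        · have hg : gradient φ x = 0 := by
            unfold gradient
            have : fderiv ℝ φ x = 0 := by
              rw [Filter.EventuallyEq.fderiv_eq (f := fun _ => (1 : ℝ))]
              · simp
              · filter_upwards [isOpen_ball.mem_nhds hxb] with y hy using hφ1 y (ball_subset_closedBall hy)
            rw [this, map_zero]
          simp only [hg, inner_zero_right, norm_zero, mul_zero]
          have := nn (u x)
          have h2 : 0 ≤ (0:ℝ) ^ p := by positivity
          have h3 : 0 ≤ p - 1 := by linarith
          positivity
        · have hut := hx fun hb => hxb (by
            rw [mem_closedBall] at hb; rw [mem_ball]; linarith)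
          have y1 := AA_young hp (G x) (t • gradient φ x)
          rw [inner_smul_right, norm_smul, Real.mul_rpow (norm_nonneg _) (norm_nonneg _), Real.norm_of_nonneg ht.le] at y1
          have : deriv θ (u x) = 1 := by rw [(dθ _).deriv, drmp_neg hδ (by linarith)]; simp
          simp only [this, one_mul]
          exact y1
      rw [integral_add (i1.const_mul _) (iφ.const_mul _), integral_const_mul, integral_const_mul,
        integral_const_mul, integral_const_mul, fl] at this
      refine le_trans ?_ this
      have := mul_le_mul_of_nonneg_left e1 ht.le
      exact mul_le_mul_of_nonneg_left this (by linarith)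
    have e2 : p * (t * C) ≤ (p - 1) * (t * C) + t ^ p * ∫ x, ‖gradient φ x‖ ^ p := by
      have hl : Tendsto (fun δ : ℝ => (p - 1) * ((t + δ / 2) * C) + t ^ p * ∫ x, ‖gradient φ x‖ ^ p) (𝓝[>] 0)
          (𝓝 ((p - 1) * ((t + 0 / 2) * C) + t ^ p * ∫ x, ‖gradient φ x‖ ^ p)) := by
        refine Tendsto.mono_left ?_ nhdsWithin_le_nhds
        exact Continuous.tendsto (by fun_prop) 0
      rw [zero_div, add_zero] at hl
      refine ge_of_tendsto hl ?_
      filter_upwards [Ioo_mem_nhdsGT (show 0 < 1 - t by linarith)] with δ hδ using key2 δ hδ.1 hδ.2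
    have e3 : t * C ≤ t ^ p * ∫ x, ‖gradient φ x‖ ^ p := by linarith
    have e4 : t ^ (1 - p) * C = (t ^ p)⁻¹ * (t * C) := by
      rw [Real.rpow_sub ht, Real.rpow_one]; field_simp
    rw [e4, inv_mul_le_iff₀ (by positivity)]
    exact e3
  have key3 : ∀ δ, 0 < δ → δ < 1 → ∀ ε, 0 < ε → t ^ (1 - p) * C ≤ ((1 - δ)⁻¹) ^ p * (cap p (closedBall (0 : EE n) ρ') + ε) := by
    intro δ hδ hδ1 ε hε
    obtain ⟨φ, hφ, hφ1, hφ2⟩ := exists_near_cap (p := p) (K := closedBall (0 : EE n) ρ') isBounded_closedBall hε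
    have h0 := trc_neg hδ hδ1 (le_refl (0:ℝ))
    have hψ := hφ.comp (contDiff_trc 1 δ) h0
    refine (key _ hψ fun x hx => trc_big hδ hδ1 (hφ1 x hx)).trans ?_
    have hd0 : 0 < (1 - δ)⁻¹ := inv_pos.mpr (by linarith)
    have : ∫ x, ‖gradient (fun x => trc 1 δ (φ x)) x‖ ^ p ≤ ∫ x, ((1 - δ)⁻¹) ^ p * ‖gradient φ x‖ ^ p := by
      refine integral_mono (int_rpow hp (hψ.memLpg _)) ((int_rpow hp (hφ.memLpg _)).const_mul _) fun x => ?_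
      simp only []
      rw [grad_comp (hφ.diff x) (((contDiff_trc 1 δ).differentiable one_ne_zero) _), norm_smul,
        ← Real.mul_rpow hd0.le (norm_nonneg _)]
      refine Real.rpow_le_rpow (by positivity) ?_ (by linarith)
      exact mul_le_mul_of_nonneg_right (abs_dtrc hδ hδ1 _) (norm_nonneg _)
    rw [integral_const_mul] at this
    exact this.trans (mul_le_mul_of_nonneg_left hφ2.le (by positivity))
  have key4 : ∀ ε, 0 < ε → t ^ (1 - p) * C ≤ cap p (closedBall (0 : EE n) ρ') + ε := by
    intro ε hε
    have hl : Tendsto (fun δ : ℝ => ((1 - δ)⁻¹) ^ p * (cap p (closedBall (0 : EE n) ρ') + ε)) (𝓝[>] 0)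
        (𝓝 (((1 - 0)⁻¹) ^ p * (cap p (closedBall (0 : EE n) ρ') + ε))) := by
      refine Tendsto.mul_const _ (Tendsto.mono_left ?_ nhdsWithin_le_nhds)
      have : ContinuousAt (fun δ : ℝ => ((1 - δ)⁻¹) ^ p) 0 := by
        refine ContinuousAt.rpow_const (ContinuousAt.inv₀ (by fun_prop) (by simp)) (Or.inl (by simp))
      exact this
    rw [sub_zero, inv_one, Real.one_rpow, one_mul] at hl
    refine ge_of_tendsto hl ?_
    filter_upwards [Ioo_mem_nhdsGT one_pos] with δ hδ using key3 δ hδ.1 hδ.2 ε hε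
  exact le_of_forall_pos_le_add key4

end
end PB

end SPartF2

section SPartF3
open MeasureTheory Metric Set Filter
open scoped RealInnerProductSpace Pointwise Topology ENNReal NNReal
namespace PB
set_option linter.unusedSectionVars false

variable {n : ℕ} {p : ℝ}

lemma cap_ball (p : ℝ) {r : ℝ} (hr : 0 < r) :
    cap p (closedBall (0 : EE n) r) = r ^ ((n : ℝ) - p) * cap p (closedBall (0 : EE n) 1) := by
  have h := cap_tr (p := p) (b := 0) (O := LinearIsometryEquiv.refl ℝ (EE n)) (inv_pos.mpr hr)
    (K := closedBall (0 : EE n) 1) isBounded_closedBall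
  have e : Tm 0 r⁻¹ (LinearIsometryEquiv.refl ℝ (EE n)) ⁻¹' closedBall (0 : EE n) 1 = closedBall (0 : EE n) r := by
    ext x
    simp only [Tm, mem_preimage, mem_closedBall, dist_zero_right, LinearIsometryEquiv.coe_refl, id, zero_add, norm_smul]
    rw [Real.norm_of_nonneg (by positivity), inv_mul_le_iff₀ hr, mul_one]
  rw [e] at h
  rw [h]
  congr 1
  rw [Real.rpow_sub hr, Real.rpow_natCast, Real.inv_rpow hr.le, inv_pow, inv_inv]
  field_simp

lemma cap_ball_pos (hp : 1 < p) (hpn : p < n) {r : ℝ} (hr : 0 < r) : 0 < cap p (closedBall (0 : EE n) r) := by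
  refine lt_of_le_of_ne (cap_nonneg _) fun h0 => ?_
  obtain ⟨f, u, G, h⟩ := exists_pot (p := p) hp hpn (K := closedBall (0 : EE n) r) isBounded_closedBall
  have hen := h.en
  rw [← h0] at hen
  have h1 := ae_zero_of_int (int_rpow hp h.ds.mem) (Eventually.of_forall fun x => by positivity) hen.le
  have h2 : G =ᵐ[volume] 0 := by
    filter_upwards [h1] with x hx
    rw [Real.rpow_eq_zero (norm_nonneg _) (by linarith), norm_eq_zero] at hx
    exact hx
  have h3 := h.ds.eq_zero hp hpn h2
  obtain ⟨y, hy, h4, h5⟩ := exists_in_ball (h3.and h.ds.ae) 0 hr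
  have : 1 ≤ u y := ge_of_tendsto' h5 fun k => h.ge k y (ball_subset_closedBall hy)
  have h4 : u y = 0 := h4
  linarith

section
variable {K L : Set (EE n)} {f g : ℕ → EE n → ℝ} {u w : EE n → ℝ} {G W : EE n → EE n}

lemma Pot.lower (hp : 1 < p) (hpn : p < n) (h : Pot p K f u G) {R r t : ℝ} (hR : 0 ≤ R) (hr : 0 ≤ r)
    (hK : K ⊆ closedBall 0 R) (ht : 0 < t) (ht1 : t < 1)
    (hc : cap p (closedBall (0 : EE n) (r + 2 * R + 1)) < t ^ (1 - p) * cap p K) :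
    ∀ᵐ x, x ∈ ball (0 : EE n) r → t ≤ u x := by
  by_contra hcon
  have hA : volume {z | z ∈ ball (0 : EE n) r ∧ u z < t} ≠ 0 := by
    intro h0
    apply hcon
    rw [ae_iff]
    convert h0 using 3
    ext z; simp
  have hB : volume {z | z ∈ (closedBall (0 : EE n) (r + 2 * R))ᶜ ∧ t ≤ u z} = 0 := by
    by_contra hB
    exact h.levels hp hpn hK hA hB hR
  have hB := measure_eq_zero_iff_ae_notMem.mp hB
  have := h.level_lower hp (ρ := r + 2 * R) (ρ' := r + 2 * R + 1) (by linarith)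
    (hK.trans (closedBall_subset_closedBall (by linarith))) ht ht1 (by
      filter_upwards [hB] with x hx hxb
      by_contra hc
      exact hx ⟨hxb, not_lt.mp hc⟩)
  linarith

lemma Pot.upper (hp : 1 < p) (hpn : p < n) (h : Pot p K f u G) {R ρ t : ℝ} (hR : 0 ≤ R) (hρ : 0 < ρ)
    (hK : K ⊆ closedBall 0 R) (ht : 0 < t) (ht1 : t ≤ 1)
    (hc : t ^ (1 - p) * cap p K < cap p (closedBall (0 : EE n) (ρ / 2))) :
    ∀ᵐ x, x ∉ closedBall (0 : EE n) (ρ + 2 * R) → u x < t := by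
  by_contra hcon
  have hB : volume {z | z ∈ (closedBall (0 : EE n) (ρ + 2 * R))ᶜ ∧ t ≤ u z} ≠ 0 := by
    intro h0
    apply hcon
    rw [ae_iff]
    convert h0 using 3
    ext z; simp
  have hA : volume {z | z ∈ ball (0 : EE n) ρ ∧ u z < t} = 0 := by
    by_contra hA
    exact h.levels hp hpn hK hA hB hR
  have hA := measure_eq_zero_iff_ae_notMem.mp hA
  have := h.level_upper hp (r := ρ) (r' := ρ / 2) (by linarith) (by linarith) ht ht1 (by
      filter_upwards [hA] with x hx hxb
      by_contra hc
      exact hx ⟨hxb, not_le.mp hc⟩)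
  linarith

lemma us_ge {u : EE n → ℝ} (h : EB u) {x : EE n} {t r : ℝ} (hx : x ∈ ball (0 : EE n) r)
    (h1 : ∀ᵐ y, y ∈ ball (0 : EE n) r → t ≤ u y) : t ≤ us u x := by
  refine le_csInf (us_nonempty h x) ?_
  rintro s ⟨r', hr', h2⟩
  have hd : 0 < min r' (r - dist x 0) := lt_min hr' (by rw [mem_ball] at hx; linarith)
  obtain ⟨y, hy, h3, h4⟩ := exists_in_ball (h1.and h2) x hd
  rw [mem_ball, lt_min_iff] at hy
  have a := h3 (by rw [mem_ball]; linarith [dist_triangle y x 0])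
  have b := h4 hy.1
  linarith

lemma ae_ge_of_ul {u : EE n → ℝ} (h : EB u) {t r : ℝ}
    (h1 : ∀ x ∈ ball (0 : EE n) r, t ≤ ul u x) : ∀ᵐ x, x ∈ ball (0 : EE n) r → t ≤ u x := by
  have := ae_le_of_us h.neg (g := fun _ => -t) isOpen_ball continuousOn_const
    (fun x hx => by have := h1 x hx; unfold ul at this; linarith)
  filter_upwards [this] with x hx hb
  linarith [hx hb]

/-- uniform positive lower bound on balls -/
lemma Pot.exists_lower (hp : 1 < p) (hpn : p < n) (h : Pot p K f u G) (hK : Bornology.IsBounded K)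
    (hC : 0 < cap p K) (r : ℝ) : ∃ c > 0, ∀ x ∈ closedBall (0 : EE n) r, c ≤ us u x := by
  obtain ⟨R, hR⟩ := hK.subset_closedBall 0
  have hR' : K ⊆ closedBall 0 (max R 0) := hR.trans (closedBall_subset_closedBall (le_max_left _ _))
  have hR0 : 0 ≤ max R 0 := le_max_right _ _
  set B := cap p (closedBall (0 : EE n) (max r 0 + 1 + 2 * max R 0 + 1)) with hB
  have hB0 : 0 ≤ B := cap_nonneg _
  have hl : Tendsto (fun t : ℝ => t ^ (1 - p)) (𝓝[>] 0) atTop := by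
    have := tendsto_rpow_neg_nhdsGT_zero (y := 1 - p) (by linarith)
    exact this
  obtain ⟨t, h1, h2⟩ := ((hl.eventually_gt_atTop (B / cap p K)).and (Ioo_mem_nhdsGT one_pos)).exists
  rw [div_lt_iff₀ hC] at h1
  have h3 := h.lower hp hpn hR0 (r := max r 0 + 1) (by positivity) hR' h2.1 h2.2 h1
  refine ⟨t, h2.1, fun x hx => us_ge (h.EB hp hpn) (closedBall_subset_ball ?_ hx) h3⟩
  linarith [le_max_left r 0]

/-- decay -/
lemma Pot.decay (hp : 1 < p) (hpn : p < n) (h : Pot p K f u G) (hK : Bornology.IsBounded K) :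
    ∃ A > 0, ∃ R1 > 0, ∀ x, R1 ≤ ‖x‖ → us u x ≤ A * ‖x‖ ^ (-(((n : ℝ) - p) / (p - 1))) := by
  obtain ⟨R, hR⟩ := hK.subset_closedBall 0
  have hR' : K ⊆ closedBall 0 (max R 0) := hR.trans (closedBall_subset_closedBall (le_max_left _ _))
  have hR0 : 0 ≤ max R 0 := le_max_right _ _
  set S := max R 0 with hS
  set cB := cap p (closedBall (0 : EE n) 1) with hcB
  have hcB0 : 0 < cB := cap_ball_pos hp hpn one_pos
  have hC := cap_nonneg (p := p) K
  set C := cap p K with hCd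
  set b := ((n : ℝ) - p) / (p - 1) with hb
  have hb0 : 0 < b := div_pos (by linarith) (by linarith)
  -- level t = A |x|^{-b}, ball radius |x|/2 - 2 S ≥ |x|/4
  obtain ⟨D, hD0, hD⟩ : ∃ D : ℝ, 0 < D ∧ D ^ (1 - p) * (C + 1) = cB * (8⁻¹ : ℝ) ^ ((n : ℝ) - p) := by
    refine ⟨(cB * (8⁻¹ : ℝ) ^ ((n : ℝ) - p) / (C + 1)) ^ ((1 - p)⁻¹), by positivity, ?_⟩
    rw [← Real.rpow_mul (by positivity), inv_mul_cancel₀ (by linarith), Real.rpow_one]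
    field_simp
  refine ⟨D, hD0, 8 * S + 1, by positivity, fun x hx => ?_⟩
  have hx0 : 0 < ‖x‖ := by linarith
  set t := D * ‖x‖ ^ (-b) with ht
  have ht0 : 0 < t := by positivity
  rcases lt_or_ge 1 t with h1 | h1
  · exact (h.us_bds hp hpn x).2.trans h1.le
  have hub := h.upper hp hpn hR0 (ρ := ‖x‖ / 4) (by linarith) hR' ht0 h1 (by
    rw [cap_ball p (by linarith), ht, Real.mul_rpow hD0.le (by positivity), ← Real.rpow_mul hx0.le]
    have e1 : -b * (1 - p) = (n : ℝ) - p := by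
      rw [hb]; have : p - 1 ≠ 0 := by linarith
      field_simp; ring
    rw [e1, show ‖x‖ / 4 / 2 = ‖x‖ * 8⁻¹ by ring, Real.mul_rpow hx0.le (by norm_num)]
    have e2 : D ^ (1 - p) * C < cB * (8⁻¹ : ℝ) ^ ((n : ℝ) - p) := by
      rw [← hD]; exact mul_lt_mul_of_pos_left (by linarith) (by positivity)
    have e3 : 0 < ‖x‖ ^ ((n : ℝ) - p) := by positivity
    have := mul_lt_mul_of_pos_left e2 e3
    calc _ = ‖x‖ ^ ((n : ℝ) - p) * (D ^ (1 - p) * C) := by ring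
      _ < _ := this
      _ = _ := by ring)
  refine us_le (h.EB hp hpn) (r := ‖x‖ / 4) (by linarith) ?_
  filter_upwards [hub] with y hy hyb
  refine (hy fun hc => ?_).le
  rw [mem_ball, dist_comm, dist_eq_norm] at hyb
  rw [mem_closedBall_zero_iff] at hc
  have := norm_sub_norm_le x y
  linarith

/-- capacity comparison from pointwise comparison of potentials -/
theorem cap_of_le (hp : 1 < p) (hpn : p < n) {K0 K1 L : Set (EE n)} {f0 f1 g : ℕ → EE n → ℝ} {u0 u1 w : EE n → ℝ}
    {G0 G1 W : EE n → EE n} (h0 : Pot p K0 f0 u0 G0) (h1 : Pot p K1 f1 u1 G1) (h : Pot p L g w W)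
    (hK0 : Bornology.IsBounded K0) (hK1 : Bornology.IsBounded K1)
    {M : ℝ} (hM : 0 < M) (hM0 : M ≤ cap p K0) (hM1 : M ≤ cap p K1)
    (hle : ∀ x, min (us u0 x) (us u1 x) ≤ ul w x) : M ≤ cap p L := by
  obtain ⟨R, hR⟩ := (hK0.union hK1).subset_closedBall 0
  have hR' : K0 ∪ K1 ⊆ closedBall 0 (max R 0) := hR.trans (closedBall_subset_closedBall (le_max_left _ _))
  have hR0 : 0 ≤ max R 0 := le_max_right _ _
  set S := max R 0 with hS
  have hcB0 : 0 < cap p (closedBall (0 : EE n) 1) := cap_ball_pos hp hpn one_pos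
  set cB := cap p (closedBall (0 : EE n) 1) with hcB
  have ha : 0 < (n : ℝ) - p := by linarith
  have key : ∀ᶠ r : ℝ in atTop, M * ((r - 1) / (r + 2 * S + 2)) ^ ((n : ℝ) - p) ≤ cap p L := by
    have hl : Tendsto (fun r : ℝ => cB * (r + 2 * S + 2) ^ ((n : ℝ) - p)) atTop atTop := by
      refine Tendsto.const_mul_atTop hcB0 ((tendsto_rpow_atTop ha).comp ?_)
      exact tendsto_atTop_add_const_right _ _ (tendsto_atTop_add_const_right _ _ tendsto_id)
    filter_upwards [hl.eventually_gt_atTop M, eventually_gt_atTop 1] with r hr1 hr2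
    have hq : 1 < cB * (r + 2 * S + 2) ^ ((n : ℝ) - p) / M := by rwa [one_lt_div hM]
    set Q := cB * (r + 2 * S + 2) ^ ((n : ℝ) - p) / M with hQ
    obtain ⟨t, ht0, ht1, htQ⟩ : ∃ t : ℝ, 0 < t ∧ t < 1 ∧ t ^ (1 - p) = Q := by
      refine ⟨Q ^ ((1 - p)⁻¹), by positivity, Real.rpow_lt_one_of_one_lt_of_neg hq (inv_lt_zero.mpr (by linarith)), ?_⟩
      rw [← Real.rpow_mul (by positivity), inv_mul_cancel₀ (by linarith), Real.rpow_one]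
    have hlow : cap p (closedBall (0 : EE n) (r + 2 * S + 1)) < t ^ (1 - p) * M := by
      rw [htQ, hQ, div_mul_cancel₀ _ hM.ne', cap_ball p (by linarith), mul_comm]
      exact mul_lt_mul_of_pos_left (Real.rpow_lt_rpow (by linarith) (by linarith) ha) hcB0
    have tp : 0 < t ^ (1 - p) := by positivity
    have a0 := h0.lower hp hpn hR0 (r := r) (by linarith) (subset_union_left.trans hR') ht0 ht1
      (hlow.trans_le (mul_le_mul_of_nonneg_left hM0 tp.le))
    have a1 := h1.lower hp hpn hR0 (r := r) (by linarith) (subset_union_right.trans hR') ht0 ht1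
      (hlow.trans_le (mul_le_mul_of_nonneg_left hM1 tp.le))
    have a2 := ae_ge_of_ul (h.EB hp hpn) (t := t) (r := r) (fun x hx =>
      (le_min (us_ge (h0.EB hp hpn) hx a0) (us_ge (h1.EB hp hpn) hx a1)).trans (hle x))
    have a3 := h.level_upper hp (r := r) (r' := r - 1) (by linarith) (by linarith) ht0 ht1.le a2
    rw [cap_ball p (by linarith), htQ, hQ] at a3
    rw [Real.div_rpow (by linarith) (by linarith)]
    have e1 : 0 < (r + 2 * S + 2) ^ ((n : ℝ) - p) := Real.rpow_pos_of_pos (by linarith) _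
    rw [← mul_div_assoc, div_le_iff₀ e1]
    have a4 : (r - 1) ^ ((n : ℝ) - p) * cB * M ≤ cB * (r + 2 * S + 2) ^ ((n : ℝ) - p) * cap p L := by
      have := mul_le_mul_of_nonneg_right a3 hM.le
      calc _ ≤ _ := this
        _ = _ := by field_simp
    have a5 : cB * (M * (r - 1) ^ ((n : ℝ) - p)) ≤ cB * (cap p L * (r + 2 * S + 2) ^ ((n : ℝ) - p)) := by linarith
    exact le_of_mul_le_mul_left a5 hcB0
  have hl2 : Tendsto (fun r : ℝ => M * ((r - 1) / (r + 2 * S + 2)) ^ ((n : ℝ) - p)) atTop (𝓝 (M * 1 ^ ((n : ℝ) - p))) := by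
    refine Tendsto.const_mul M (Tendsto.rpow_const ?_ (Or.inr ha.le))
    have e : ∀ᶠ r : ℝ in atTop, 1 - (2 * S + 3) / (r + (2 * S + 2)) = (r - 1) / (r + 2 * S + 2) := by
      filter_upwards [eventually_gt_atTop 0] with r hr
      have : r + 2 * S + 2 ≠ 0 := by positivity
      have : r + (2 * S + 2) ≠ 0 := by positivity
      field_simp; ring
    refine Tendsto.congr' e ?_
    have : Tendsto (fun r : ℝ => (2 * S + 3) / (r + (2 * S + 2))) atTop (𝓝 0) :=
      tendsto_const_nhds.div_atTop (tendsto_atTop_add_const_right _ _ tendsto_id)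
    simpa using this.const_sub 1
  rw [Real.one_rpow, mul_one] at hl2
  exact le_of_tendsto hl2 key

end
end PB

end SPartF3

section SPartG1
open MeasureTheory Metric Set Filter
open scoped RealInnerProductSpace Pointwise Topology ENNReal NNReal
namespace PB
set_option linter.unusedSectionVars false

variable {n : ℕ} {p : ℝ}

lemma grad_eq_zero_of_ev {ζ : EE n → ℝ} {x : EE n} {a : ℝ} (h : ∀ᶠ y in 𝓝 x, ζ y = a) : gradient ζ x = 0 := by
  unfold gradient
  have : fderiv ℝ ζ x = 0 := by
    rw [Filter.EventuallyEq.fderiv_eq (f := fun _ => a) h]; simp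
  rw [this, map_zero]

/-- local comparison -/
lemma local_compare (hp : 1 < p) (hpn : p < n) {f : ℕ → EE n → ℝ} {u g : EE n → ℝ} {G : EE n → EE n}
    {x0 : EE n} {r : ℝ} (hr : 0 < r) (hd : DSeq p f u G)
    (hsub : ∀ (φ : ℕ → EE n → ℝ) (v : EE n → ℝ) (Φ : EE n → EE n), DSeq p φ v Φ → (∀ k x, 0 ≤ φ k x) →
      (∀ k, ∀ x ∉ ball x0 r, φ k x = 0) → ∫ x, ⟪AA p (G x), Φ x⟫ ≤ 0)
    (hg : C1c g)
    (hsup : ∀ φ : EE n → ℝ, C1c φ → (∀ x, 0 ≤ φ x) → (∀ x ∉ ball x0 r, φ x = 0) →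
      0 ≤ ∫ x, ⟪AA p (gradient g x), gradient φ x⟫)
    (hann : ∀ᵐ x, x ∈ ball x0 r → x ∉ ball x0 (r / 2) → u x ≤ g x) :
    ∀ᵐ x, x ∈ ball x0 (r / 2) → u x ≤ g x := by
  obtain ⟨ζ, -, hζ, z0, z1, z2, z3, -, z4⟩ := exists_cutoff x0 (r := r / 2) (R := 3 * r / 4) (by linarith) (by linarith)
  have hd1 := (hd.sub hp (DSeq.const p hg)).comp hp contDiff_th th_zero abs_deriv_th
  have hd2 := hd1.mul_bdd hp (M := 1) (fun k x => abs_le.mpr ⟨by linarith [th_nonneg (f k x - g x)], th_le_one _⟩) hζ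
  have hG : (fun x => ζ x • deriv th (u x - g x) • (G x - gradient g x) + th (u x - g x) • gradient ζ x) =ᵐ[volume]
      fun x => (ζ x * deriv th (u x - g x)) • (G x - gradient g x) := by
    filter_upwards [hann] with x hx
    have : th (u x - g x) • gradient ζ x = 0 := by
      by_cases h1 : x ∈ ball x0 (r / 2)
      · rw [grad_eq_zero_of_ev (a := 1), smul_zero]
        filter_upwards [isOpen_ball.mem_nhds h1] with y hy using z2 y (le_of_lt hy)
      · by_cases h2 : x ∈ ball x0 r
        · rw [th_of_nonpos (by linarith [hx h2 h1]), zero_smul]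
        · rw [grad_eq_zero_of_ev (a := 0), smul_zero]
          refine notMem_tsupport_iff_eventuallyEq.mp ?_
          rw [z4, mem_closedBall]; rw [mem_ball] at h2; linarith
    rw [this, add_zero, smul_smul]
  have hD := hd2.congr (Filter.EventuallyEq.refl _ _) hG
  have nn : ∀ k x, 0 ≤ ζ x * th (f k x - g x) := fun k x => mul_nonneg (z0 x) (th_nonneg _)
  have van : ∀ k, ∀ x ∉ ball x0 r, ζ x * th (f k x - g x) = 0 := fun k x hx => by
    rw [z3 x (by rw [mem_ball] at hx; linarith), zero_mul]
  have e1 := hsub _ _ _ hD nn van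
  have e2 : 0 ≤ ∫ x, ⟪AA p (gradient g x), (ζ x * deriv th (u x - g x)) • (G x - gradient g x)⟫ := by
    have hl := hD.tendsto_AA hp (hg.memLpg _)
    exact ge_of_tendsto' hl fun k => hsup _ (hD.c1 k) (nn k) (van k)
  have i1 := int_AA hp hd.mem hD.mem
  have i2 := int_AA hp (hg.memLpg _) hD.mem
  have i3 : Integrable (fun x => ⟪AA p (G x) - AA p (gradient g x), (ζ x * deriv th (u x - g x)) • (G x - gradient g x)⟫) := by
    simp only [inner_sub_left]; exact i1.sub i2
  have e3 : ∫ x, ⟪AA p (G x) - AA p (gradient g x), (ζ x * deriv th (u x - g x)) • (G x - gradient g x)⟫ ≤ 0 := by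
    simp only [inner_sub_left]
    rw [integral_sub i1 i2]; linarith
  have cn : ∀ x, 0 ≤ ζ x * deriv th (u x - g x) := fun x => mul_nonneg (z0 x) (deriv_th_nonneg _)
  have e4 := ae_zero_of_int i3 (Eventually.of_forall fun x => by
    rw [inner_smul_right]
    exact mul_nonneg (cn x) (AA_mono hp _ _)) e3
  have e5 : (fun x => (ζ x * deriv th (u x - g x)) • (G x - gradient g x)) =ᵐ[volume] 0 := by
    filter_upwards [e4] with x hx
    rw [inner_smul_right] at hx
    rcases mul_eq_zero.mp hx with h | h
    · simp [h]
    · have : G x = gradient g x := by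
        by_contra hne
        exact hne (AA_strict hp _ _ h.le)
      simp [this]
  have e6 := hD.eq_zero hp hpn e5
  filter_upwards [e6] with x hx hb
  have hx : ζ x * th (u x - g x) = 0 := hx
  rw [z2 x (le_of_lt hb), one_mul] at hx
  linarith [nonpos_of_th hx]

/-- divergence of compactly supported field, one component -/
lemma integral_line_zero {F D : EE n → ℝ} {e : EE n} (h : ∀ x, HasLineDerivAt ℝ F (D x) x e)
    (hF : Integrable F) (hD : Integrable D) : ∫ x, D x = 0 := by
  have := integral_bilinear_hasLineDerivAt_right_eq_neg_left_of_integrable (μ := (volume : Measure (EE n)))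
    (f := fun _ => (1 : ℝ)) (f' := fun _ => 0) (g := F) (g' := D) (v := e)
    (B := ContinuousLinearMap.mul ℝ ℝ) (by simp) (by simpa using hD) (by simpa using hF)
    (fun x _ => hasDerivAt_const _ _) (fun x _ => h x)
  simpa using this

end PB

end SPartG1

section SPartG2
open MeasureTheory Metric Set Filter
open scoped RealInnerProductSpace Pointwise Topology ENNReal NNReal
namespace PB
set_option linter.unusedSectionVars false

variable {n : ℕ} {p : ℝ}

noncomputable def PP (P0 : ℝ) (g : EE n) (Q : EE n →L[ℝ] EE n) (x y : EE n) : ℝ :=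
  P0 + ⟪g, y - x⟫ + 1 / 2 * ⟪Q (y - x), y - x⟫
noncomputable def Nv (g : EE n) (Q : EE n →L[ℝ] EE n) (x y : EE n) : EE n := g + Q (y - x)

lemma PP_contDiff (P0 : ℝ) (g : EE n) (Q : EE n →L[ℝ] EE n) (x : EE n) : ContDiff ℝ 1 (PP P0 g Q x) := by
  have h0 : ContDiff ℝ 1 (fun y : EE n => y - x) := by fun_prop
  exact (contDiff_const.add (contDiff_const.inner ℝ h0)).add (contDiff_const.mul ((Q.contDiff.comp h0).inner ℝ h0))

lemma Nv_cont (g : EE n) (Q : EE n →L[ℝ] EE n) (x : EE n) : Continuous (Nv g Q x) := by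
  unfold Nv; fun_prop

lemma PP_grad (P0 : ℝ) (g : EE n) {Q : EE n →L[ℝ] EE n} (hQ : Sym Q) (x y : EE n) :
    gradient (PP P0 g Q x) y = Nv g Q x y := by
  have h0 : HasFDerivAt (fun y : EE n => y - x) (ContinuousLinearMap.id ℝ (EE n)) y := (hasFDerivAt_id y).sub_const x
  have h1 : HasFDerivAt (fun y : EE n => Q (y - x)) (Q.comp (ContinuousLinearMap.id ℝ (EE n))) y := Q.hasFDerivAt.comp y h0
  have h2 := (h1.inner ℝ h0).const_mul (1 / 2)
  have h3 := ((hasFDerivAt_const g y).inner ℝ h0).const_add P0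
  refine grad_of_hasFDerivAt (h3.add h2) fun z => ?_
  simp [Nv, fderivInnerCLM_apply, inner_add_left]
  have := hQ (y - x) z
  have := real_inner_comm (Q z) (y - x)
  simp only [inner_add_left, inner_sub_left, inner_sub_right, map_sub] at *
  linarith

noncomputable def ZZ (p c P0 : ℝ) (g : EE n) (Q : EE n →L[ℝ] EE n) (x e y : EE n) : ℝ :=
  PP P0 g Q x y ^ (-c) * ((⟪Nv g Q x y, Nv g Q x y⟫) ^ ((p - 2) / 2) * ⟪Nv g Q x y, e⟫)

noncomputable def DZ (p c P0 : ℝ) (g : EE n) (Q : EE n →L[ℝ] EE n) (x e y : EE n) : ℝ :=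
  (⟪Nv g Q x y, e⟫ * (-c) * PP P0 g Q x y ^ (-c - 1)) * ((⟪Nv g Q x y, Nv g Q x y⟫) ^ ((p - 2) / 2) * ⟪Nv g Q x y, e⟫)
  + PP P0 g Q x y ^ (-c) * (((2 * ⟪Q e, Nv g Q x y⟫) * ((p - 2) / 2) * (⟪Nv g Q x y, Nv g Q x y⟫) ^ ((p - 2) / 2 - 1)) * ⟪Nv g Q x y, e⟫
    + (⟪Nv g Q x y, Nv g Q x y⟫) ^ ((p - 2) / 2) * ⟪Q e, e⟫)

lemma ZZ_line (c P0 : ℝ) (g : EE n) {Q : EE n →L[ℝ] EE n} (hQ : Sym Q) (x e y : EE n)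
    (hP : 0 < PP P0 g Q x y) (hN : Nv g Q x y ≠ 0) :
    HasLineDerivAt ℝ (ZZ p c P0 g Q x e) (DZ p c P0 g Q x e y) y e := by
  have e0 : y + (0 : ℝ) • e = y := by simp
  have hl : HasDerivAt (fun t : ℝ => y + t • e) e 0 := by
    simpa using ((hasDerivAt_id (0 : ℝ)).smul_const e).const_add y
  have hPd : HasDerivAt (fun t : ℝ => PP P0 g Q x (y + t • e)) ⟪Nv g Q x y, e⟫ 0 := by
    have := ((PP_contDiff P0 g Q x).differentiable one_ne_zero (y + (0:ℝ) • e)).hasFDerivAt.comp_hasDerivAt 0 hl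
    rw [e0, ← inner_gradient_left, PP_grad P0 g hQ] at this
    exact this
  have hNd : HasDerivAt (fun t : ℝ => Nv g Q x (y + t • e)) (Q e) 0 := by
    have := (Q.hasFDerivAt.comp_hasDerivAt (0:ℝ) (hl.sub_const x)).const_add g
    exact this
  have hs : HasDerivAt (fun t : ℝ => ⟪Nv g Q x (y + t • e), Nv g Q x (y + t • e)⟫) (2 * ⟪Q e, Nv g Q x y⟫) 0 := by
    have := hNd.inner ℝ hNd
    rw [e0] at this
    refine this.congr_deriv ?_
    rw [real_inner_comm]; ring
  have hie : HasDerivAt (fun t : ℝ => ⟪Nv g Q x (y + t • e), e⟫) ⟪Q e, e⟫ 0 := by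
    simpa using hNd.inner ℝ (hasDerivAt_const (0:ℝ) e)
  have a1 := hPd.rpow_const (p := -c) (Or.inl (by rw [e0]; exact hP.ne'))
  have a2 := hs.rpow_const (p := (p - 2) / 2) (Or.inl (by rw [e0]; exact (inner_self_ne_zero (𝕜 := ℝ)).mpr hN))
  have := a1.mul (a2.mul hie)
  unfold HasLineDerivAt
  refine HasDerivAt.congr_deriv (f := fun t : ℝ => ZZ p c P0 g Q x e (y + t • e)) this ?_
  simp only [e0, DZ, Pi.mul_apply]

lemma ZZ_contOn (c P0 : ℝ) (g : EE n) (Q : EE n →L[ℝ] EE n) (x e : EE n) {U : Set (EE n)}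
    (h : ∀ y ∈ U, 0 < PP P0 g Q x y ∧ Nv g Q x y ≠ 0) :
    ContinuousOn (ZZ p c P0 g Q x e) U ∧ ContinuousOn (DZ p c P0 g Q x e) U := by
  have hP : ContinuousOn (PP P0 g Q x) U := (PP_contDiff P0 g Q x).continuous.continuousOn
  have hN : ContinuousOn (Nv g Q x) U := (Nv_cont g Q x).continuousOn
  have r1 : ∀ c : ℝ, ContinuousOn (fun y => PP P0 g Q x y ^ c) U := fun c =>
    hP.rpow_const fun y hy => Or.inl (h y hy).1.ne'
  have r2 : ∀ c : ℝ, ContinuousOn (fun y => (⟪Nv g Q x y, Nv g Q x y⟫) ^ c) U := fun c =>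
    (hN.inner hN).rpow_const fun y hy => Or.inl ((inner_self_ne_zero (𝕜 := ℝ)).mpr (h y hy).2)
  have r3 : ∀ e : EE n, ContinuousOn (fun y => ⟪Nv g Q x y, e⟫) U := fun e => hN.inner continuousOn_const
  have r4 : ∀ e : EE n, ContinuousOn (fun y => ⟪e, Nv g Q x y⟫) U := fun e => continuousOn_const.inner hN
  constructor
  · exact (r1 _).mul ((r2 _).mul (r3 _))
  · unfold DZ
    exact ((((r3 _).mul continuousOn_const).mul (r1 _)).mul ((r2 _).mul (r3 _))).add
      ((r1 _).mul (((((continuousOn_const.mul (r4 _)).mul continuousOn_const).mul (r2 _)).mul (r3 _)).add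
        ((r2 _).mul continuousOn_const)))

lemma div_zero_loc {Z D φ : EE n → ℝ} {x e : EE n} {r : ℝ} (hr : 0 < r)
    (hl : ∀ y ∈ ball x (2 * r), HasLineDerivAt ℝ Z (D y) y e)
    (hZ : ContinuousOn Z (ball x (2 * r))) (hD : ContinuousOn D (ball x (2 * r)))
    (hφ : C1c φ) (h0 : ∀ y ∉ ball x r, φ y = 0) :
    Integrable (fun y => ⟪gradient φ y, e⟫ * Z y + φ y * D y) ∧ ∫ y, (⟪gradient φ y, e⟫ * Z y + φ y * D y) = 0 := by
  have ts : tsupport φ ⊆ closedBall x r := by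
    refine closure_minimal (fun y hy => ?_) isClosed_closedBall
    by_contra hc
    exact hy (h0 y fun hb => hc (ball_subset_closedBall hb))
  have cb : closedBall x r ⊆ ball x (2 * r) := closedBall_subset_ball (by linarith)
  have tg : tsupport (gradient φ) ⊆ tsupport φ := by
    refine closure_minimal (fun y hy => ?_) (isClosed_tsupport _)
    by_contra hc
    exact hy (grad_eq_zero_of_ev (notMem_tsupport_iff_eventuallyEq.mp hc))
  have supp : ∀ {A B : EE n → ℝ}, (∀ y, y ∉ tsupport φ → A y = 0) → tsupport A ⊆ closedBall x r := fun {A B} hA => by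
    refine closure_minimal (fun y hy => ?_) isClosed_closedBall
    by_contra hc
    exact hy (hA y fun h => hc (ts h))
  have z1 : ∀ y, y ∉ tsupport φ → φ y = 0 := fun y hy => image_eq_zero_of_notMem_tsupport hy
  have z2 : ∀ y, y ∉ tsupport φ → gradient φ y = 0 := fun y hy =>
    grad_eq_zero_of_ev (notMem_tsupport_iff_eventuallyEq.mp hy)
  have zF : ∀ y, y ∉ tsupport φ → φ y * Z y = 0 := fun y hy => by rw [z1 y hy, zero_mul]
  have zD : ∀ y, y ∉ tsupport φ → ⟪gradient φ y, e⟫ * Z y + φ y * D y = 0 := fun y hy => by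
    rw [z1 y hy, z2 y hy]; simp
  have cF : Continuous (fun y => φ y * Z y) :=
    ContinuousOn.continuous_of_tsupport_subset (hφ.cont.continuousOn.mul hZ) isOpen_ball ((supp (B := φ) zF).trans cb)
  have cD : Continuous (fun y => ⟪gradient φ y, e⟫ * Z y + φ y * D y) :=
    ContinuousOn.continuous_of_tsupport_subset
      (((hφ.contg.continuousOn.inner continuousOn_const).mul hZ).add (hφ.cont.continuousOn.mul hD)) isOpen_ball
      ((supp (B := φ) zD).trans cb)
  have kF : HasCompactSupport (fun y => φ y * Z y) := HasCompactSupport.of_support_subset_isCompact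
    (isCompact_closedBall x r) ((subset_tsupport _).trans (supp (B := φ) zF))
  have kD : HasCompactSupport (fun y => ⟪gradient φ y, e⟫ * Z y + φ y * D y) := HasCompactSupport.of_support_subset_isCompact
    (isCompact_closedBall x r) ((subset_tsupport _).trans (supp (B := φ) zD))
  have iD := cD.integrable_of_hasCompactSupport (μ := volume) kD
  refine ⟨iD, integral_line_zero (F := fun y => φ y * Z y) (e := e) (fun y => ?_)
    (cF.integrable_of_hasCompactSupport kF) iD⟩
  by_cases hy : y ∈ tsupport φ
  · have h1 : HasLineDerivAt ℝ φ ⟪gradient φ y, e⟫ y e := by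
      rw [inner_gradient_left]
      exact (hφ.diff y).hasFDerivAt.hasLineDerivAt e
    have := HasDerivAt.mul h1 (hl y (cb (ts hy)))
    unfold HasLineDerivAt
    refine HasDerivAt.congr_deriv (f := fun t : ℝ => φ (y + t • e) * Z (y + t • e)) this ?_
    simp
  · rw [zD y hy]
    have he : ∀ᶠ z in 𝓝 y, φ z = 0 := notMem_tsupport_iff_eventuallyEq.mp hy
    have ht : Tendsto (fun t : ℝ => y + t • e) (𝓝 0) (𝓝 y) := by
      have : Continuous (fun t : ℝ => y + t • e) := by fun_prop
      simpa using this.tendsto 0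
    have : (fun t : ℝ => φ (y + t • e) * Z (y + t • e)) =ᶠ[𝓝 0] fun _ => 0 := by
      filter_upwards [ht.eventually he] with t h using by rw [h, zero_mul]
    exact (hasDerivAt_const (0:ℝ) (0:ℝ)).congr_of_eventuallyEq this

lemma sum_inner_sq (a b : EE n) : ∑ i, ⟪a, EuclideanSpace.single i 1⟫ * ⟪b, (EuclideanSpace.single i 1 : EE n)⟫ = ⟪a, b⟫ := by
  simp [EuclideanSpace.inner_single_right, PiLp.inner_apply, mul_comm]

lemma DZ_sum (c P0 : ℝ) (g : EE n) {Q : EE n →L[ℝ] EE n} (hQ : Sym Q) (x y : EE n)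
    (hP : 0 < PP P0 g Q x y) (hN : Nv g Q x y ≠ 0) :
    ∑ i, DZ p c P0 g Q x (EuclideanSpace.single i 1) y =
      PP P0 g Q x y ^ (-c - 1) * (⟪Nv g Q x y, Nv g Q x y⟫) ^ ((p - 2) / 2) *
        (PP P0 g Q x y * LL p (Nv g Q x y) Q - c * ‖Nv g Q x y‖ ^ 2) := by
  unfold DZ LL
  obtain ⟨N, hNe⟩ : ∃ N, N = Nv g Q x y := ⟨_, rfl⟩
  obtain ⟨P, hPe⟩ : ∃ P, P = PP P0 g Q x y := ⟨_, rfl⟩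
  rw [← hNe, ← hPe]; rw [← hNe] at hN; rw [← hPe] at hP
  have s0 : 0 < ⟪N, N⟫ := by rw [real_inner_self_eq_norm_sq]; exact pow_pos (norm_pos_iff.mpr hN) 2
  have e1 : P ^ (-c) = P ^ (-c - 1) * P := by
    rw [Real.rpow_sub_one hP.ne']; field_simp
  have e2 : (⟪N, N⟫) ^ ((p - 2) / 2 - 1) = (⟪N, N⟫) ^ ((p - 2) / 2) / ⟪N, N⟫ := Real.rpow_sub_one s0.ne' _
  have t1 := sum_inner_sq N N
  have t2 := sum_inner_sq (Q N) N
  have e3 : ∀ i, ⟪Q (EuclideanSpace.single i 1), N⟫ = ⟪Q N, (EuclideanSpace.single i 1 : EE n)⟫ := fun i => by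
    rw [hQ, real_inner_comm]
  rw [e1, e2, ← real_inner_self_eq_norm_sq N]
  obtain ⟨w, hw⟩ : ∃ w, w = (⟪N, N⟫) ^ ((p - 2) / 2) := ⟨_, rfl⟩
  rw [← hw]
  simp only [e3]
  have : ∀ i : Fin n, ⟪N, EuclideanSpace.single i 1⟫ * -c * P ^ (-c - 1) * (w * ⟪N, EuclideanSpace.single i 1⟫) +
        P ^ (-c - 1) * P *
          (2 * ⟪Q N, EuclideanSpace.single i 1⟫ * ((p - 2) / 2) * (w / ⟪N, N⟫) * ⟪N, EuclideanSpace.single i 1⟫ +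
            w * ⟪Q (EuclideanSpace.single i 1), (EuclideanSpace.single i 1 : EE n)⟫) =
      (-c * P ^ (-c - 1) * w) * (⟪N, EuclideanSpace.single i 1⟫ * ⟪N, EuclideanSpace.single i 1⟫)
      + (P ^ (-c - 1) * P * (p - 2) * (w / ⟪N, N⟫)) * (⟪Q N, EuclideanSpace.single i 1⟫ * ⟪N, EuclideanSpace.single i 1⟫)
      + (P ^ (-c - 1) * P * w) * ⟪Q (EuclideanSpace.single i 1), (EuclideanSpace.single i 1 : EE n)⟫ := fun i => by ring
  simp only [this]
  rw [Finset.sum_add_distrib, Finset.sum_add_distrib, ← Finset.mul_sum, ← Finset.mul_sum, ← Finset.mul_sum, t1, t2]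
  ring

end PB

end SPartG2

section SPartG3
open MeasureTheory Metric Set Filter
open scoped RealInnerProductSpace Pointwise Topology ENNReal NNReal
namespace PB
set_option linter.unusedSectionVars false

variable {n : ℕ} {p : ℝ}

lemma AA_sign {σ t : ℝ} (hσ : σ = 1 ∨ σ = -1) (ht : 0 ≤ t) (hp : 1 < p) (a : EE n) :
    AA p ((-σ * t) • a) = (-σ * t ^ (p - 1)) • AA p a := by
  rcases hσ with h | h
  · rw [h, show (-1 * t) • a = - (t • a) by simp, AA_neg, AA_smul t ht hp]; simp
  · rw [h, show (- -1 * t) • a = t • a by simp, AA_smul t ht hp]; simp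

set_option maxHeartbeats 1000000 in
lemma psi_super (hp : 1 < p) {σ q c P0 η r : ℝ} (hσ : σ = 1 ∨ σ = -1) (hq : 0 < q) (hr : 0 < r)
    (hc : c = (p - 1) * (1 + 1 / q)) {g : EE n} {Q : EE n →L[ℝ] EE n} (hQ : Sym Q) {x : EE n}
    (hU : ∀ y ∈ ball x (2 * r), 0 < PP P0 g Q x y ∧ Nv g Q x y ≠ 0 ∧
      0 ≤ σ * (PP P0 g Q x y * LL p (Nv g Q x y) Q - c * ‖Nv g Q x y‖ ^ 2)) :
    ∃ gg : EE n → ℝ, C1c gg ∧ (∀ y ∈ ball x (3 / 2 * r), gg y = σ * (PP P0 g Q x y ^ (-(1 / q)) - η)) ∧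
      ∀ φ : EE n → ℝ, C1c φ → (∀ x, 0 ≤ φ x) → (∀ y ∉ ball x r, φ y = 0) →
      0 ≤ ∫ y, ⟪AA p (gradient gg y), gradient φ y⟫ := by
  obtain ⟨ζ, -, hζ, z0, z1, z2, z3, -, z4⟩ := exists_cutoff x (r := 3 / 2 * r) (R := 7 / 4 * r) (by linarith) (by linarith)
  have cb : closedBall x (7 / 4 * r) ⊆ ball x (2 * r) := closedBall_subset_ball (by linarith)
  obtain ⟨ψ, hψ⟩ : ∃ ψ : EE n → ℝ, ψ = fun y => σ * (PP P0 g Q x y ^ (-(1 / q)) - η) := ⟨_, rfl⟩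
  have hψd : ∀ y ∈ ball x (2 * r), ContDiffAt ℝ 1 ψ y := fun y hy => by
    rw [hψ]
    exact contDiffAt_const.mul (((PP_contDiff P0 g Q x).contDiffAt.rpow_const_of_ne (hU y hy).1.ne').sub contDiffAt_const)
  have hgg : C1c (fun y => ζ y * ψ y) := by
    refine ⟨?_, hζ.cs.mul_right⟩
    rw [contDiff_iff_contDiffAt]
    intro y
    by_cases hy : y ∈ tsupport ζ
    · rw [z4] at hy
      exact hζ.cd.contDiffAt.mul (hψd y (cb hy))
    · have he : ∀ᶠ z in 𝓝 y, ζ z = 0 := notMem_tsupport_iff_eventuallyEq.mp hy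
      refine ContDiffAt.congr_of_eventuallyEq (contDiffAt_const (c := (0:ℝ))) ?_
      filter_upwards [he] with z hz using by rw [hz, zero_mul]
  have hone : ∀ y ∈ ball x (3 / 2 * r), ζ y * ψ y = ψ y := fun y hy => by rw [z2 y (le_of_lt hy), one_mul]
  refine ⟨fun y => ζ y * ψ y, hgg, fun y hy => (hone y hy).trans (by rw [hψ]), fun φ hφ hφ0 hφv => ?_⟩
  have hgr : ∀ y ∈ ball x (3 / 2 * r), gradient (fun y => ζ y * ψ y) y =
      (-σ * (1 / q * PP P0 g Q x y ^ (-(1 / q) - 1))) • Nv g Q x y := fun y hy => by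
    have hy2 : y ∈ ball x (2 * r) := ball_subset_ball (by linarith) hy
    have e1 : gradient (fun y => ζ y * ψ y) y = gradient ψ y := by
      unfold gradient
      rw [Filter.EventuallyEq.fderiv_eq (f := ψ)]
      filter_upwards [isOpen_ball.mem_nhds hy] with z hz using hone z hz
    rw [e1, hψ]
    have hθ : HasDerivAt (fun t : ℝ => σ * (t ^ (-(1 / q)) - η)) (σ * (-(1 / q) * PP P0 g Q x y ^ (-(1 / q) - 1))) (PP P0 g Q x y) :=
      ((Real.hasDerivAt_rpow_const (Or.inl (hU y hy2).1.ne')).sub_const η).const_mul σ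
    rw [grad_comp (θ := fun t : ℝ => σ * (t ^ (-(1 / q)) - η)) ((PP_contDiff P0 g Q x).differentiable one_ne_zero y) hθ.differentiableAt,
      hθ.deriv, PP_grad P0 g hQ]
    congr 1; ring
  obtain ⟨k, hk⟩ : ∃ k : ℝ, k = σ * (1 / q) ^ (p - 1) := ⟨_, rfl⟩
  have hdz := fun i : Fin n => div_zero_loc (x := x) (e := EuclideanSpace.single i 1) (Z := ZZ p c P0 g Q x (EuclideanSpace.single i 1))
    (D := DZ p c P0 g Q x (EuclideanSpace.single i 1)) hr
    (fun y hy => ZZ_line c P0 g hQ x _ y (hU y hy).1 (hU y hy).2.1)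
    (ZZ_contOn c P0 g Q x _ fun y hy => ⟨(hU y hy).1, (hU y hy).2.1⟩).1
    (ZZ_contOn c P0 g Q x _ fun y hy => ⟨(hU y hy).1, (hU y hy).2.1⟩).2 hφ hφv
  have i1 := int_AA hp (hgg.memLpg _) (hφ.memLpg _)
  have i2 : Integrable (fun y => k * ∑ i, (⟪gradient φ y, EuclideanSpace.single i 1⟫ * ZZ p c P0 g Q x (EuclideanSpace.single i 1) y
      + φ y * DZ p c P0 g Q x (EuclideanSpace.single i 1) y)) :=
    (integrable_finset_sum _ fun i _ => (hdz i).1).const_mul k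
  have e0 : ∫ y, k * ∑ i, (⟪gradient φ y, EuclideanSpace.single i 1⟫ * ZZ p c P0 g Q x (EuclideanSpace.single i 1) y
      + φ y * DZ p c P0 g Q x (EuclideanSpace.single i 1) y) = 0 := by
    rw [integral_const_mul, integral_finset_sum _ fun i _ => (hdz i).1]
    rw [Finset.sum_eq_zero fun i _ => (hdz i).2, mul_zero]
  have e1 : 0 ≤ ∫ y, (⟪AA p (gradient (fun y => ζ y * ψ y) y), gradient φ y⟫ +
      k * ∑ i, (⟪gradient φ y, EuclideanSpace.single i 1⟫ * ZZ p c P0 g Q x (EuclideanSpace.single i 1) y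
      + φ y * DZ p c P0 g Q x (EuclideanSpace.single i 1) y)) := by
    refine integral_nonneg fun y => ?_
    show 0 ≤ _ + _
    by_cases hy : y ∈ ball x (3 / 2 * r)
    · have hy2 : y ∈ ball x (2 * r) := ball_subset_ball (by linarith) hy
      obtain ⟨hP, hN, hσP⟩ := hU y hy2
      rw [Finset.sum_add_distrib, ← Finset.mul_sum, DZ_sum c P0 g hQ x y hP hN, hgr y hy,
        AA_sign hσ (by positivity) hp, Real.mul_rpow (by positivity) (by positivity), ← Real.rpow_mul hP.le,
        show (-(1 / q) - 1) * (p - 1) = -c by rw [hc]; ring]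
      have s1 : ∑ i, ⟪gradient φ y, EuclideanSpace.single i 1⟫ * ZZ p c P0 g Q x (EuclideanSpace.single i 1) y =
          PP P0 g Q x y ^ (-c) * ⟪AA p (Nv g Q x y), gradient φ y⟫ := by
        have hAA : AA p (Nv g Q x y) = (⟪Nv g Q x y, Nv g Q x y⟫) ^ ((p - 2) / 2) • Nv g Q x y := by
          unfold AA
          rw [real_inner_self_eq_norm_sq, ← Real.rpow_natCast, ← Real.rpow_mul (norm_nonneg _)]
          congr 2; push_cast; ring
        rw [hAA, inner_smul_left, conj_trivial, ← sum_inner_sq (Nv g Q x y) (gradient φ y), Finset.mul_sum, Finset.mul_sum]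
        refine Finset.sum_congr rfl fun i _ => ?_
        unfold ZZ; ring
      rw [s1, inner_smul_left, conj_trivial, hk]
      have s0 : 0 ≤ ⟪Nv g Q x y, Nv g Q x y⟫ := real_inner_self_nonneg
      have : 0 ≤ (1 / q) ^ (p - 1) * (φ y * (PP P0 g Q x y ^ (-c - 1) * (⟪Nv g Q x y, Nv g Q x y⟫) ^ ((p - 2) / 2)
        * (σ * (PP P0 g Q x y * LL p (Nv g Q x y) Q - c * ‖Nv g Q x y‖ ^ 2)))) := by
        have := hφ0 y
        positivity
      refine this.trans (le_of_eq ?_)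
      ring
    · have hz : ∀ᶠ z in 𝓝 y, φ z = 0 := by
        have : y ∈ (closedBall x r)ᶜ := fun h => hy (closedBall_subset_ball (by linarith) h)
        filter_upwards [isClosed_closedBall.isOpen_compl.mem_nhds this] with z hz
        exact hφv z fun h => hz (ball_subset_closedBall h)
      rw [grad_eq_zero_of_ev hz, hz.self_of_nhds]
      simp
  rw [integral_add i1 i2, e0, add_zero] at e1
  exact e1

set_option maxHeartbeats 1000000 in
theorem visc_core (hp : 1 < p) (hpn : p < n) {σ q c P0 η r0 : ℝ} (hσ : σ = 1 ∨ σ = -1) (hq : 0 < q) (hr0 : 0 < r0)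
    (hc : c = (p - 1) * (1 + 1 / q)) {g : EE n} {Q : EE n →L[ℝ] EE n} (hQ : Sym Q) {x : EE n} (hg : g ≠ 0) (hP0 : 0 < P0)
    {f : ℕ → EE n → ℝ} {U : EE n → ℝ} {G : EE n → EE n} (hd : DSeq p f U G) (hEB : EB U)
    (hsub : ∀ (φ : ℕ → EE n → ℝ) (v : EE n → ℝ) (Φ : EE n → EE n), DSeq p φ v Φ → (∀ k x, 0 ≤ φ k x) →
      (∀ k, ∀ y ∉ ball x r0, φ k y = 0) → ∫ x, ⟪AA p (G x), Φ x⟫ ≤ 0)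
    (hpos : 0 < σ * (P0 * LL p g Q - c * ‖g‖ ^ 2))
    (hle : ∀ᶠ y in 𝓝 x, us U y ≤ σ * (PP P0 g Q x y ^ (-(1 / q)) - η))
    (heq : us U x = σ * (P0 ^ (-(1 / q)) - η)) : False := by
  have hσ2 : σ * σ = 1 := by rcases hσ with h | h <;> rw [h] <;> norm_num
  -- continuity
  have cN : Continuous (fun z : EE n × ℝ => g + Q z.1 + (-2 * σ * z.2) • z.1) := by fun_prop
  have cP : Continuous (fun z : EE n × ℝ => P0 + ⟪g, z.1⟫ + 1 / 2 * ⟪Q z.1, z.1⟫ - σ * z.2 * ‖z.1‖ ^ 2 + σ * z.2 ^ 3 / 8) := by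
    have a1 : Continuous (fun z : EE n × ℝ => ⟪g, z.1⟫) := continuous_const.inner continuous_fst
    have a2 : Continuous (fun z : EE n × ℝ => ⟪Q z.1, z.1⟫) := (Q.continuous.comp continuous_fst).inner continuous_fst
    fun_prop
  have cP' : Continuous (fun z : EE n × ℝ => P0 + ⟪g, z.1⟫ + 1 / 2 * ⟪Q z.1, z.1⟫) := by
    have a1 : Continuous (fun z : EE n × ℝ => ⟪g, z.1⟫) := continuous_const.inner continuous_fst
    have a2 : Continuous (fun z : EE n × ℝ => ⟪Q z.1, z.1⟫) := (Q.continuous.comp continuous_fst).inner continuous_fst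
    fun_prop
  have cL : ContinuousAt (fun z : EE n × ℝ => LL p (g + Q z.1 + (-2 * σ * z.2) • z.1) Q) (0, 0) := by
    unfold LL
    refine continuousAt_const.add (continuousAt_const.mul (ContinuousAt.div ?_ ?_ ?_))
    · exact ((Q.continuous.comp cN).inner cN).continuousAt
    · exact (cN.norm.pow 2).continuousAt
    · simpa using hg
  have cH : ContinuousAt (fun z : EE n × ℝ => σ * ((P0 + ⟪g, z.1⟫ + 1 / 2 * ⟪Q z.1, z.1⟫ - σ * z.2 * ‖z.1‖ ^ 2 + σ * z.2 ^ 3 / 8)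
      * (LL p (g + Q z.1 + (-2 * σ * z.2) • z.1) Q + (-2 * σ * z.2) * (n + (p - 2))) -
        c * ‖g + Q z.1 + (-2 * σ * z.2) • z.1‖ ^ 2)) (0, 0) := by
    refine continuousAt_const.mul ((cP.continuousAt.mul (cL.add ?_)).sub (continuousAt_const.mul (cN.norm.pow 2).continuousAt))
    have : Continuous (fun z : EE n × ℝ => (-2 * σ * z.2) * (n + (p - 2))) := by fun_prop
    exact this.continuousAt
  have k1 := cH.eventually (lt_mem_nhds (a := 0) (by simpa using hpos))
  have k2 := (cN.continuousAt (x := ((0 : EE n), (0 : ℝ)))).eventually_ne (y := 0) (by simpa using hg)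
  have k3 := (cP.continuousAt (x := (0, 0))).eventually (lt_mem_nhds (a := 0) (by simpa using hP0))
  have k3' := (cP'.continuousAt (x := (0, 0))).eventually (lt_mem_nhds (a := 0) (by simpa using hP0))
  obtain ⟨ε, hε, hk⟩ := Metric.eventually_nhds_iff.mp (k1.and (k2.and (k3.and k3')))
  obtain ⟨ε', hε', hk'⟩ := Metric.eventually_nhds_iff.mp hle
  obtain ⟨r, hr, hr1, hr2, hr3⟩ : ∃ r > 0, 2 * r < ε ∧ r < ε' ∧ r < r0 :=
    ⟨min (ε / 4) (min (ε' / 2) (r0 / 2)), by positivity, by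
      have := min_le_left (ε / 4) (min (ε' / 2) (r0 / 2)); linarith, by
      have := (min_le_right (ε / 4) (min (ε' / 2) (r0 / 2))).trans (min_le_left _ _); linarith, by
      have := (min_le_right (ε / 4) (min (ε' / 2) (r0 / 2))).trans (min_le_right _ _); linarith⟩
  obtain ⟨Q', hQ'⟩ : ∃ Q' : EE n →L[ℝ] EE n, Q' = (1 : ℝ) • Q + (-2 * σ * r) • ContinuousLinearMap.id ℝ (EE n) := ⟨_, rfl⟩
  have sQ' : Sym Q' := by rw [hQ']; exact hQ.lin Sym.id _ _
  have pe : ∀ y, PP (P0 + σ * r ^ 3 / 8) g Q' x y = PP P0 g Q x y - σ * r * ‖y - x‖ ^ 2 + σ * r ^ 3 / 8 := fun y => by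
    unfold PP; rw [hQ', pert]; ring
  have ne : ∀ y, Nv g Q' x y = g + Q (y - x) + (-2 * σ * r) • (y - x) := fun y => by
    unfold Nv; rw [hQ']; simp [add_assoc]
  have hb : ∀ y ∈ ball x (2 * r), 0 < PP (P0 + σ * r ^ 3 / 8) g Q' x y ∧ Nv g Q' x y ≠ 0 ∧
      0 ≤ σ * (PP (P0 + σ * r ^ 3 / 8) g Q' x y * LL p (Nv g Q' x y) Q' - c * ‖Nv g Q' x y‖ ^ 2) ∧ 0 < PP P0 g Q x y := by
    intro y hy
    have : dist (y - x, r) ((0 : EE n), (0:ℝ)) < ε := by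
      rw [Prod.dist_eq, dist_zero_right, dist_zero_right, Real.norm_of_nonneg hr.le, ← dist_eq_norm]
      exact max_lt (lt_trans hy hr1) (by linarith)
    obtain ⟨m1, m2, m3, m4⟩ := hk this
    rw [pe, ne]
    refine ⟨m3, m2, ?_, m4⟩
    rw [hQ', LL_lin, LL_id m2, one_mul]
    exact m1.le
  obtain ⟨gg, hgg, hg1, hg2⟩ := psi_super hp (η := η) hσ hq hr hc sQ' (fun y hy => ⟨(hb y hy).1, (hb y hy).2.1, (hb y hy).2.2.1⟩)
  have hq' : -(1 / q) < 0 := by have : 0 < 1 / q := by positivity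
                                linarith
  have hann1 : ∀ y ∈ ball x r ∩ (closedBall x (r / 2 - r / 100))ᶜ, us U y ≤ gg y := by
    rintro y ⟨hy1, hy2⟩
    have hyb : y ∈ ball x (2 * r) := ball_subset_ball (by linarith) hy1
    rw [hg1 y (ball_subset_ball (by linarith) hy1)]
    refine (hk' (lt_trans hy1 hr2)).trans ?_
    have hn : r / 2 - r / 100 < ‖y - x‖ := by rw [← dist_eq_norm]; simpa using hy2
    have hn2 : r ^ 3 / 8 ≤ r * ‖y - x‖ ^ 2 := by
      have : (r / 2 - r / 100) ^ 2 ≤ ‖y - x‖ ^ 2 := pow_le_pow_left₀ (by linarith) hn.le 2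
      have h2 : r * (r / 2 - r / 100) ^ 2 ≤ r * ‖y - x‖ ^ 2 := mul_le_mul_of_nonneg_left this hr.le
      have h3 : 0 < r ^ 3 := by positivity
      have h4 : r * (r / 2 - r / 100) ^ 2 = r ^ 3 * (49 / 100) ^ 2 := by ring
      linarith
    obtain ⟨b1, -, -, b4⟩ := hb y hyb
    rcases hσ with h | h
    · rw [h] at b1 pe ⊢
      have := Real.rpow_le_rpow_of_nonpos b1 (y := PP P0 g Q x y) (by rw [pe]; linarith) hq'.le
      linarith
    · rw [h] at b1 pe ⊢
      have := Real.rpow_le_rpow_of_nonpos b4 (y := PP (P0 + (-1) * r ^ 3 / 8) g Q' x y) (by rw [pe]; linarith) hq'.le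
      linarith
  have hann2 := ae_le_of_us hEB (isOpen_ball.inter isClosed_closedBall.isOpen_compl) hgg.cont.continuousOn hann1
  have hfin := local_compare hp hpn hr hd (fun φ v Φ h1 h2 h3 => hsub φ v Φ h1 h2 fun k y hy => h3 k y fun h => hy (ball_subset_ball hr3.le h))
    hgg hg2 (by
      filter_upwards [hann2] with y hy h1 h2
      refine hy ⟨h1, fun h => h2 ?_⟩
      rw [mem_closedBall] at h; rw [mem_ball]; linarith)
  have hx : gg x < us U x := by
    rw [heq, hg1 x (mem_ball_self (by positivity)), pe]
    have e1 : PP P0 g Q x x = P0 := by simp [PP]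
    have b1 := (hb x (mem_ball_self (by positivity))).1
    rw [pe] at b1
    rw [e1, sub_self, norm_zero] at b1
    rw [e1, sub_self, norm_zero]
    have h3 : 0 < r ^ 3 := by positivity
    rcases hσ with h | h
    · rw [h] at b1 ⊢
      have := Real.rpow_lt_rpow_of_neg (z := -(1/q)) hP0 (y := P0 - 1 * r * 0 ^ 2 + 1 * r ^ 3 / 8) (by linarith) hq'
      linarith
    · rw [h] at b1 ⊢
      have := Real.rpow_lt_rpow_of_neg (z := -(1/q)) b1 (y := P0) (by linarith) hq'
      linarith
  obtain ⟨s, hs1, hs2⟩ := exists_between hx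
  obtain ⟨δ, hδ, hδ1⟩ := Metric.continuousAt_iff.mp (hgg.cont.continuousAt (x := x)) (s - gg x) (by linarith)
  have : us U x ≤ s := by
    refine us_le hEB (r := min δ (r / 2)) (by positivity) ?_
    filter_upwards [hfin] with y hy h1
    have h2 := hy (ball_subset_ball (min_le_right _ _) h1)
    have h3 := hδ1 (lt_of_lt_of_le h1 (min_le_left _ _))
    rw [Real.dist_eq] at h3
    linarith [(abs_lt.mp h3).2]
  linarith

lemma rpow_inv_neg {a q : ℝ} (ha : 0 < a) (hq : 0 < q) : (a ^ (-q)) ^ (-(1 / q)) = a := by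
  rw [← Real.rpow_mul ha.le, show -q * -(1 / q) = 1 by field_simp, Real.rpow_one]

lemma ev_shift {R : EE n → Prop} {y : EE n} (h : ∀ᶠ h in 𝓝 (0 : EE n), R h) : ∀ᶠ z in 𝓝 y, R (z - y) := by
  have : Tendsto (fun z : EE n => z - y) (𝓝 y) (𝓝 0) := by
    have : Continuous (fun z : EE n => z - y) := by fun_prop
    simpa using this.tendsto y
  exact this.eventually h

theorem Pot.supV (hp : 1 < p) (hpn : p < n) {K : Set (EE n)} {f : ℕ → EE n → ℝ} {u : EE n → ℝ} {G : EE n → EE n}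
    (h : Pot p K f u G) (hK : IsClosed K) {q η : ℝ} (hq : 0 < q) (hη : 0 < η) {y : EE n} (hy : y ∉ K) :
    SupV p ((p - 1) * (1 + 1 / q)) (fun x => (us u x + η) ^ (-q)) y := by
  intro g Q hg hQ hT
  by_contra hc
  push Not at hc
  obtain ⟨r0, hr0, hr⟩ := Metric.isOpen_iff.mp hK.isOpen_compl y hy
  have pos : ∀ x, 0 < us u x + η := fun x => by linarith [(h.us_bds hp hpn x).1]
  have hP0 : 0 < (us u y + η) ^ (-q) := Real.rpow_pos_of_pos (pos y) _
  refine visc_core hp hpn (σ := 1) (η := η) (Or.inl rfl) hq hr0 rfl hQ hg hP0 h.ds (h.EB hp hpn)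
    (fun φ v Φ h1 h2 h3 => h.sub hp h1 fun k x hx => h3 k x fun hb => hr hb hx) (by linarith) ?_ ?_
  · have e1 := ev_shift (y := y) hT
    have e2 : ∀ᶠ z in 𝓝 y, 0 < PP ((us u y + η) ^ (-q)) g Q y z :=
      (PP_contDiff _ g Q y).continuous.continuousAt.eventually (lt_mem_nhds (by simpa [PP] using hP0))
    filter_upwards [e1, e2] with z h1 h2
    rw [add_sub_cancel] at h1
    have := Real.rpow_le_rpow_of_nonpos (z := -(1 / q)) h2 h1 (by
      have : 0 < 1 / q := by positivity
      linarith)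
    rw [rpow_inv_neg (pos z) hq] at this
    linarith
  · rw [rpow_inv_neg (pos y) hq]; ring

theorem Pot.subV (hp : 1 < p) (hpn : p < n) {K : Set (EE n)} {f : ℕ → EE n → ℝ} {u : EE n → ℝ} {G : EE n → EE n}
    (h : Pot p K f u G) {q η : ℝ} (hq : 0 < q) (hη : 0 < η) (y : EE n) :
    SubV p ((p - 1) * (1 + 1 / q)) (fun x => (ul u x + η) ^ (-q)) y := by
  intro g Q hg hQ hT
  by_contra hc
  push Not at hc
  have pos : ∀ x, 0 < ul u x + η := fun x => by linarith [(h.ul_bds hp hpn x).1]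
  have hP0 : 0 < (ul u y + η) ^ (-q) := Real.rpow_pos_of_pos (pos y) _
  have hd : DSeq p (fun k x => - f k x) (fun x => - u x) (fun x => - G x) := by
    have := h.ds.const_mul (-1)
    simpa using this
  have hU : ∀ z, us (fun x => - u x) z = - ul u z := fun z => by unfold ul; ring
  refine visc_core hp hpn (x := y) (σ := -1) (η := η) (Or.inr rfl) hq one_pos rfl hQ hg hP0 hd (h.EB hp hpn).neg
    (fun φ v Φ h1 h2 h3 => ?_) (by linarith) ?_ ?_
  · have := h.super hp h1 h2
    simp only [AA_neg, inner_neg_left]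
    rw [integral_neg]; linarith
  · filter_upwards [ev_shift (y := y) hT] with z h1
    rw [add_sub_cancel] at h1
    have h1 : (ul u z + η) ^ (-q) ≤ PP ((ul u y + η) ^ (-q)) g Q y z := h1
    have := Real.rpow_le_rpow_of_nonpos (z := -(1 / q)) (Real.rpow_pos_of_pos (pos z) _) h1 (by
      have : 0 < 1 / q := by positivity
      linarith)
    rw [rpow_inv_neg (pos z) hq] at this
    rw [hU]; linarith
  · rw [rpow_inv_neg (pos y) hq, hU]; ring

end PB

end SPartG3

section SPartH1
open MeasureTheory Metric Set Filter
open scoped RealInnerProductSpace Pointwise Topology ENNReal NNReal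
namespace PB
set_option linter.unusedSectionVars false

variable {n : ℕ} {p : ℝ}

lemma anti_aux {η q : ℝ} (hη : 0 < η) (hq : 0 < q) :
    Continuous (fun t : ℝ => (max t 0 + η) ^ (-q)) ∧ Antitone (fun t : ℝ => (max t 0 + η) ^ (-q)) := by
  have pos : ∀ t : ℝ, 0 < max t 0 + η := fun t => by linarith [le_max_right t 0]
  constructor
  · exact ((continuous_id.max continuous_const).add continuous_const).rpow_const fun t => Or.inl (pos t).ne'
  · intro s t hst
    exact Real.rpow_le_rpow_of_nonpos (pos s) (by linarith [max_le_max_right 0 hst]) (by linarith)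

lemma lsc_neg_pow {a : EE n → ℝ} (ha : UpperSemicontinuous a) (h0 : ∀ x, 0 ≤ a x) {η q : ℝ} (hη : 0 < η) (hq : 0 < q) :
    LowerSemicontinuous (fun x => (a x + η) ^ (-q)) := by
  have := (anti_aux hη hq).1.comp_upperSemicontinuous_antitone ha (anti_aux hη hq).2
  refine (congrArg LowerSemicontinuous (funext fun x => ?_)).mp this
  simp [max_eq_left (h0 x)]

lemma usc_neg_pow {a : EE n → ℝ} (ha : LowerSemicontinuous a) (h0 : ∀ x, 0 ≤ a x) {η q : ℝ} (hη : 0 < η) (hq : 0 < q) :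
    UpperSemicontinuous (fun x => (a x + η) ^ (-q)) := by
  have := (anti_aux hη hq).1.comp_lowerSemicontinuous_antitone ha (anti_aux hη hq).2
  refine (congrArg UpperSemicontinuous (funext fun x => ?_)).mp this
  simp [max_eq_left (h0 x)]

/-- radial regularization -/
noncomputable def UU (a : EE n → ℝ) (T κ : ℝ) (x : EE n) : ℝ := sSup ((fun t : ℝ => t ^ κ * a (t • x)) '' Icc 1 T)

lemma rad_usc {a : EE n → ℝ} (ha : UpperSemicontinuous a) (κ : ℝ) {x : EE n} {t s : ℝ} (ht : 1 ≤ t)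
    (hs : t ^ κ * a (t • x) < s) : ∀ᶠ z : EE n × ℝ in 𝓝 (x, t), z.2 ^ κ * a (z.2 • z.1) < s := by
  have t0 : 0 < t := by linarith
  have h1 : a (t • x) - s * t ^ (-κ) < 0 := by
    rw [Real.rpow_neg t0.le]
    have := Real.rpow_pos_of_pos t0 κ
    rw [sub_neg, lt_mul_inv_iff₀ this]; linarith
  obtain ⟨m, hm1, hm2⟩ : ∃ m, a (t • x) < m ∧ m < s * t ^ (-κ) := exists_between (by linarith)
  have c1 : Continuous (fun z : EE n × ℝ => z.2 • z.1) := by fun_prop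
  have e1 : ∀ᶠ z : EE n × ℝ in 𝓝 (x, t), a (z.2 • z.1) < m := (c1.tendsto (x, t)).eventually (ha (t • x) m hm1)
  have c2 : ContinuousAt (fun z : EE n × ℝ => s * z.2 ^ (-κ)) (x, t) :=
    continuousAt_const.mul (continuousAt_snd.rpow_const (Or.inl t0.ne'))
  have e2 := c2.eventually (lt_mem_nhds hm2)
  have e3 : ∀ᶠ z : EE n × ℝ in 𝓝 (x, t), 0 < z.2 := continuousAt_snd.eventually (lt_mem_nhds t0)
  filter_upwards [e1, e2, e3] with z h1 h2 h3
  have := Real.rpow_pos_of_pos h3 κ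
  rw [Real.rpow_neg h3.le] at h2
  have h4 := h1.trans h2
  rw [lt_mul_inv_iff₀ this] at h4; linarith

lemma UU_att {a : EE n → ℝ} (ha : UpperSemicontinuous a) {T : ℝ} (hT : 1 ≤ T) (κ : ℝ) (x : EE n) :
    ∃ t ∈ Icc 1 T, UU a T κ x = t ^ κ * a (t • x) ∧ ∀ t' ∈ Icc 1 T, t' ^ κ * a (t' • x) ≤ UU a T κ x := by
  have hu : UpperSemicontinuousOn (fun t : ℝ => t ^ κ * a (t • x)) (Icc 1 T) := by
    intro t ht s hs
    have c : ContinuousAt (fun t : ℝ => (x, t)) t := by fun_prop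
    exact (c.eventually (rad_usc ha κ ht.1 hs)).filter_mono nhdsWithin_le_nhds
  obtain ⟨t, ht, hm⟩ := UpperSemicontinuousOn.exists_isMaxOn (nonempty_Icc.mpr hT) isCompact_Icc hu
  have hg : IsGreatest ((fun t : ℝ => t ^ κ * a (t • x)) '' Icc 1 T) (t ^ κ * a (t • x)) :=
    ⟨⟨t, ht, rfl⟩, by rintro _ ⟨t', ht', rfl⟩; exact hm ht'⟩
  have he : UU a T κ x = t ^ κ * a (t • x) := hg.csSup_eq
  exact ⟨t, ht, he, fun t' ht' => he ▸ hm ht'⟩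

lemma UU_usc {a : EE n → ℝ} (ha : UpperSemicontinuous a) {T : ℝ} (hT : 1 ≤ T) (κ : ℝ) : UpperSemicontinuous (UU a T κ) := by
  intro x s hs
  obtain ⟨t, ht, -, hmax⟩ := UU_att ha hT κ x
  have := (isCompact_Icc (a := (1:ℝ)) (b := T)).eventually_forall_of_forall_eventually (x₀ := x)
    (P := fun x t => t ^ κ * a (t • x) < s) fun t ht => rad_usc ha κ ht.1 (lt_of_le_of_lt (hmax t ht) hs)
  filter_upwards [this] with z hz
  obtain ⟨t, ht, he, -⟩ := UU_att ha hT κ z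
  rw [he]; exact hz t ht

lemma SupV.scale {c k t : ℝ} (hk : 0 < k) (ht : 0 < t) {ω : EE n → ℝ} {y : EE n} (h : SupV p c ω (t • y)) :
    SupV p c (fun x => k * ω (t • x)) y := by
  intro g Q hg hQ hT
  have h1 := h ((1 / (k * t)) • g) ((1 / (k * t ^ 2)) • Q + (0 : ℝ) • Q) (smul_ne_zero (by positivity) hg) (hQ.lin hQ _ _) (by
    have ht' : Tendsto (fun h : EE n => (1 / t) • h) (𝓝 0) (𝓝 0) := by
      have : Continuous (fun h : EE n => (1 / t) • h) := by fun_prop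
      simpa using this.tendsto 0
    filter_upwards [ht'.eventually hT] with h hh
    rw [smul_add, smul_smul, mul_one_div_cancel ht.ne', one_smul] at hh
    simp only [add_apply, zero_mul, _root_.smul_apply, inner_add_left, add_zero, inner_smul_left, inner_smul_right, map_smul, conj_trivial] at hh ⊢
    have : k * (ω (t • y) + 1 / (k * t) * ⟪g, h⟫ + 1 / 2 * (1 / (k * t ^ 2) * ⟪Q h, h⟫)) ≤ k * ω (t • y + h) := by
      refine le_trans (le_of_eq ?_) hh
      field_simp
    exact le_of_mul_le_mul_left this hk)
  rw [LL_scale (by positivity), LL_lin, norm_smul, Real.norm_of_nonneg (by positivity), zero_mul, add_zero] at h1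
  have h2 := mul_le_mul_of_nonneg_left h1 (show 0 ≤ k ^ 2 * t ^ 2 by positivity)
  have e1 : k ^ 2 * t ^ 2 * (ω (t • y) * (1 / (k * t ^ 2) * LL p g Q)) = k * ω (t • y) * LL p g Q := by field_simp
  have e2 : k ^ 2 * t ^ 2 * (c * (1 / (k * t) * ‖g‖) ^ 2) = c * ‖g‖ ^ 2 := by field_simp
  rw [e1, e2] at h2
  exact h2

lemma SupV.congr_le {c : ℝ} {v W : EE n → ℝ} {y : EE n} (h : SupV p c W y) (hle : ∀ᶠ z in 𝓝 y, v z ≤ W z) (he : v y = W y) :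
    SupV p c v y := by
  intro g Q hg hQ hT
  rw [he]
  refine h g Q hg hQ ?_
  have ht' : Tendsto (fun h : EE n => y + h) (𝓝 0) (𝓝 y) := by
    have : Continuous (fun h : EE n => y + h) := by fun_prop
    simpa using this.tendsto 0
  filter_upwards [hT, ht'.eventually hle] with h h1 h2
  rw [← he]; exact h1.trans h2

lemma SubV.scale {c k : ℝ} (hk : 0 < k) {V : EE n → ℝ} {y : EE n} (h : SubV p c V y) :
    SubV p c (fun x => k * V x) y := by
  intro g Q hg hQ hT
  have h1 := h ((1 / k) • g) ((1 / k) • Q + (0 : ℝ) • Q) (smul_ne_zero (by positivity) hg) (hQ.lin hQ _ _) (by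
    filter_upwards [hT] with h hh
    simp only [add_apply, zero_mul, _root_.smul_apply, inner_add_left, add_zero, inner_smul_left, conj_trivial] at hh ⊢
    have : k * V (y + h) ≤ k * (V y + 1 / k * ⟪g, h⟫ + 1 / 2 * (1 / k * ⟪Q h, h⟫)) := by
      refine hh.trans (le_of_eq ?_)
      field_simp
    exact le_of_mul_le_mul_left this hk)
  rw [LL_scale (by positivity), LL_lin, norm_smul, Real.norm_of_nonneg (by positivity), zero_mul, add_zero] at h1
  have h2 := mul_le_mul_of_nonneg_left h1 (show 0 ≤ k ^ 2 by positivity)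
  have e1 : k ^ 2 * (V y * (1 / k * LL p g Q)) = k * V y * LL p g Q := by field_simp
  have e2 : k ^ 2 * (c * (1 / k * ‖g‖) ^ 2) = c * ‖g‖ ^ 2 := by field_simp
  rw [e1, e2] at h2
  exact h2

lemma deriv_left_nonpos {D : ℝ → ℝ} {d : ℝ} (h : HasDerivAt D d 1) (h1 : D 1 = 0) (h2 : ∀ᶠ s in 𝓝[<] (1:ℝ), 0 ≤ D s) : d ≤ 0 := by
  refine le_of_tendsto (hasDerivAt_iff_tendsto_slope_left_right.mp h).1 ?_
  filter_upwards [h2, self_mem_nhdsWithin] with s hs hs1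
  have hs1 : s < 1 := hs1
  rw [slope_def_field, h1, sub_zero]
  exact div_nonpos_of_nonneg_of_nonpos hs (by linarith)

/-- gradient lower bound for the regularized function -/
lemma UU_grad {a : EE n → ℝ} (ha : UpperSemicontinuous a) (h0 : ∀ x, 0 ≤ a x) {T κ q η c0 R : ℝ} (hT : 1 ≤ T)
    (hq : 0 < q) (hη : 0 < η) (hκ : 0 < κ) (hR : 0 < R) (hη1 : η ≤ 1) (hc0 : 0 < c0) {y : EE n} (hy : ‖y‖ ≤ R)
    (hT1 : T ^ κ * a (T • y) < a y) (hcy : c0 ≤ a y) (hU2 : UU a T κ y ≤ 2)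
    {g : EE n} {Q : EE n →L[ℝ] EE n} (hTB : TB (fun x => (UU a T κ x + η) ^ (-q)) y g Q) :
    q * κ * c0 * (3 : ℝ) ^ (-q - 1) / R ≤ ‖g‖ := by
  obtain ⟨t, ht, he, hmax⟩ := UU_att ha hT κ y
  have hay : a y ≤ UU a T κ y := by simpa using hmax 1 ⟨le_rfl, hT⟩
  have htT : t < T := by
    rcases ht.2.eq_or_lt with h | h
    · rw [h] at he; linarith
    · exact h
  have t0 : 0 < t := by linarith [ht.1]
  obtain ⟨u, hu⟩ : ∃ u, u = UU a T κ y := ⟨_, rfl⟩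
  have hu0 : 0 < u := by rw [hu]; linarith
  -- comparison along the ray
  have key : ∀ᶠ s in 𝓝[<] (1:ℝ), (UU a T κ (s • y) + η) ^ (-q) ≤ (s ^ (-κ) * u + η) ^ (-q) := by
    have e1 : ∀ᶠ s in 𝓝 (1:ℝ), t < T * s := by
      have : Continuous (fun s : ℝ => T * s) := by fun_prop
      exact this.continuousAt.eventually (lt_mem_nhds (by simpa using htT))
    have e2 : ∀ᶠ s in 𝓝 (1:ℝ), 0 < s := lt_mem_nhds one_pos
    filter_upwards [nhdsWithin_le_nhds e1, nhdsWithin_le_nhds e2, self_mem_nhdsWithin] with s h1 h2 h3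
    have h3 : s < 1 := h3
    obtain ⟨-, -, -, hm⟩ := UU_att ha hT κ (s • y)
    have h4 := hm (t / s) ⟨by rw [le_div_iff₀ h2]; nlinarith [ht.1], by rw [div_le_iff₀ h2]; exact h1.le⟩
    rw [smul_smul, div_mul_cancel₀ _ h2.ne', Real.div_rpow t0.le h2.le] at h4
    have h5 : s ^ (-κ) * u ≤ UU a T κ (s • y) := by
      refine le_trans (le_of_eq ?_) h4
      rw [hu, he, Real.rpow_neg h2.le]; ring
    refine Real.rpow_le_rpow_of_nonpos ?_ (by linarith) (by linarith)
    have := Real.rpow_pos_of_pos h2 (-κ)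
    positivity
  have hd1 : HasDerivAt (fun s : ℝ => (s ^ (-κ) * u + η) ^ (-q))
      ((-κ * 1 ^ (-κ - 1) * u) * (-q) * ((1:ℝ) ^ (-κ) * u + η) ^ (-q - 1)) 1 :=
    (((Real.hasDerivAt_rpow_const (x := (1:ℝ)) (p := -κ) (Or.inl one_ne_zero)).mul_const u).add_const η).rpow_const
      (Or.inl (by simp; positivity))
  have hd2 : HasDerivAt (fun s : ℝ => (u + η) ^ (-q) + (s - 1) * ⟪g, y⟫ + 1 / 2 * ((s - 1) ^ 2 * ⟪Q y, y⟫)) ⟪g, y⟫ 1 := by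
    have a1 : HasDerivAt (fun s : ℝ => s - 1) 1 1 := (hasDerivAt_id (1:ℝ)).sub_const 1
    have a2 := ((a1.mul_const ⟪g, y⟫).const_add ((u + η) ^ (-q))).add (((a1.pow 2).mul_const ⟪Q y, y⟫).const_mul (1 / 2))
    refine HasDerivAt.congr_deriv (f := fun s : ℝ => (u + η) ^ (-q) + (s - 1) * ⟪g, y⟫ + 1 / 2 * ((s - 1) ^ 2 * ⟪Q y, y⟫)) a2 ?_
    simp
  have hfin := deriv_left_nonpos (hd1.sub hd2) (by simp) (by
    have ht' : Tendsto (fun s : ℝ => (s - 1) • y) (𝓝[<] 1) (𝓝 0) := by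
      have : Continuous (fun s : ℝ => (s - 1) • y) := by fun_prop
      have := this.tendsto 1
      simp only [sub_self, zero_smul] at this
      exact this.mono_left nhdsWithin_le_nhds
    filter_upwards [key, ht'.eventually hTB] with s h1 h2
    have e1 : y + (s - 1) • y = s • y := by rw [sub_smul, one_smul]; abel
    rw [e1, map_smul, inner_smul_left, inner_smul_right, inner_smul_right, conj_trivial] at h2
    rw [← hu] at h2
    show (0:ℝ) ≤ _ - _
    have e2 : (s - 1) * ((s - 1) * ⟪Q y, y⟫) = (s - 1) ^ 2 * ⟪Q y, y⟫ := by ring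
    rw [e2] at h2
    linarith)
  simp only [Real.one_rpow, one_mul, mul_one] at hfin
  have h1 := real_inner_le_norm g y
  have h2 : ‖g‖ * ‖y‖ ≤ ‖g‖ * R := mul_le_mul_of_nonneg_left hy (norm_nonneg _)
  rw [div_le_iff₀ hR]
  have h3 : (3 : ℝ) ^ (-q - 1) ≤ (u + η) ^ (-q - 1) :=
    Real.rpow_le_rpow_of_nonpos (by linarith) (by rw [hu]; linarith) (by linarith)
  have h4 : q * κ * c0 ≤ q * κ * u := mul_le_mul_of_nonneg_left (by rw [hu]; linarith) (by positivity)
  have h5 : q * κ * c0 * (3 : ℝ) ^ (-q - 1) ≤ q * κ * u * (u + η) ^ (-q - 1) :=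
    mul_le_mul h4 h3 (by positivity) (by positivity)
  have h6 : -κ * u * -q * (u + η) ^ (-q - 1) = q * κ * u * (u + η) ^ (-q - 1) := by ring
  linarith

end PB

end SPartH1

section SPartH2
open MeasureTheory Metric Set Filter
open scoped RealInnerProductSpace Pointwise Topology ENNReal NNReal
namespace PB
set_option linter.unusedSectionVars false

variable {n : ℕ} {p : ℝ}

noncomputable def hat (R : ℝ) (x : EE n) : ℝ := max (‖x‖ - R) 0 ^ 2

lemma hat_nonneg (R : ℝ) (x : EE n) : 0 ≤ hat R x := sq_nonneg _
lemma hat_zero {R : ℝ} {x : EE n} (h : ‖x‖ ≤ R) : hat R x = 0 := by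
  unfold hat; rw [max_eq_right (by linarith)]; norm_num
lemma hat_cont (R : ℝ) : Continuous (hat R : EE n → ℝ) := by unfold hat; fun_prop
lemma hat_ge {R : ℝ} (x : EE n) : ‖x‖ ^ 2 / 2 - R ^ 2 ≤ hat R x := by
  by_cases h : ‖x‖ ≤ R
  · rw [hat_zero h]; nlinarith [norm_nonneg x]
  · unfold hat; rw [max_eq_left (by push Not at h; linarith)]; nlinarith [sq_nonneg (‖x‖ - 2 * R)]

lemma usc_quot {X : Type*} [TopologicalSpace X] {V v : X → ℝ} (hV : UpperSemicontinuous V) (hv : LowerSemicontinuous v)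
    (h0 : ∀ x, 0 ≤ V x) (h1 : ∀ x, 0 < v x) : UpperSemicontinuous (fun x => V x / v x) := by
  intro x s hs
  have hs : V x / v x < s := hs
  have s0 : 0 < s := lt_of_le_of_lt (div_nonneg (h0 x) (h1 x).le) hs
  rw [div_lt_iff₀ (h1 x)] at hs
  obtain ⟨m, m1, m2⟩ := exists_between hs
  have e2 : m / s < v x := by rw [div_lt_iff₀ s0]; linarith
  filter_upwards [hV x m m1, hv x (m / s) e2] with z z1 z2
  have z2 : m / s < v z := z2
  rw [div_lt_iff₀ s0] at z2
  rw [div_lt_iff₀ (h1 z)]; linarith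

set_option maxHeartbeats 2000000 in
theorem key_abs (hp : 1 < p) {a0 a1 b : EE n → ℝ} {K0 D0 D1 : Set (EE n)} {ρ q η : ℝ}
    (hu0 : UpperSemicontinuous a0) (hu1 : UpperSemicontinuous a1) (hlb : LowerSemicontinuous b)
    (a00 : ∀ x, 0 ≤ a0 x ∧ a0 x ≤ 1) (a11 : ∀ x, 0 ≤ a1 x ∧ a1 x ≤ 1) (b01 : ∀ x, 0 ≤ b x)
    (star : ∀ t : ℝ, 1 ≤ t → ∀ x, a0 (t • x) ≤ a0 x)
    (hD0 : IsClosed D0) (hD1 : IsClosed D1)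
    (Z0 : ∀ x0 ∈ D0, ∀ x1, a1 x1 ≤ b ((1 / 2 : ℝ) • (x0 + x1)))
    (Z1 : ∀ x1 ∈ D1, ∀ x0, a0 x0 ≤ b ((1 / 2 : ℝ) • (x0 + x1)))
    (hKD : K0 ⊆ D0) (hst : ∀ t : ℝ, 1 ≤ t → ∀ y, t • y ∈ K0 → y ∈ K0)
    (S0 : ∀ q η : ℝ, 0 < q → 0 < η → ∀ y ∉ K0, SupV p ((p - 1) * (1 + 1 / q)) (fun x => (a0 x + η) ^ (-q)) y)
    (S1 : ∀ q η : ℝ, 0 < q → 0 < η → ∀ y ∉ D1, SupV p ((p - 1) * (1 + 1 / q)) (fun x => (a1 x + η) ^ (-q)) y)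
    (SV : ∀ q η : ℝ, 0 < q → 0 < η → ∀ y, SubV p ((p - 1) * (1 + 1 / q)) (fun x => (b x + η) ^ (-q)) y)
    (hρ : 0 < ρ) (hρD : ∀ y ∉ D0, ρ ≤ ‖y‖)
    (dec0 : ∀ ε > 0, ∃ R, ∀ x, R ≤ ‖x‖ → a0 x ≤ ε) (dec1 : ∀ ε > 0, ∃ R, ∀ x, R ≤ ‖x‖ → a1 x ≤ ε)
    (low : ∀ R : ℝ, ∃ c > 0, ∀ x, ‖x‖ ≤ R → c ≤ a0 x) (hq : 1 < q) (hη : 0 < η) (hη1 : η ≤ 1) (y0 y1 : EE n) :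
    (b ((1 / 2 : ℝ) • (y0 + y1)) + η) ^ (-(q - 1)) ≤ 4 * ((a0 y0 + η / 3) ^ (-q) + (a1 y1 + η / 3) ^ (-q)) := by
  by_contra hcon
  push Not at hcon
  have hη0 : 0 < η / 3 := by positivity
  have q0 : 0 < q := by linarith
  obtain ⟨R0, hR0, hR00, hR01⟩ : ∃ R0 > 0, (∀ x, R0 ≤ ‖x‖ → a0 x ≤ η / 3) ∧ (∀ x, R0 ≤ ‖x‖ → a1 x ≤ η / 3) := by
    obtain ⟨r0, h0⟩ := dec0 _ hη0
    obtain ⟨r1, h1⟩ := dec1 _ hη0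
    exact ⟨max 1 (max r0 r1), by positivity, fun x hx => h0 x (le_trans (by simp) hx), fun x hx => h1 x (le_trans (by simp) hx)⟩
  obtain ⟨c0, hc0, hlow⟩ := low R0
  obtain ⟨R', hR'⟩ := dec0 (c0 / 4) (by positivity)
  obtain ⟨T, hT2, hTR⟩ : ∃ T : ℝ, 2 ≤ T ∧ R' ≤ T * ρ := ⟨max 2 (R' / ρ), le_max_left _ _, by
    rw [← div_le_iff₀ hρ]; exact le_max_right _ _⟩
  have hT1 : 1 ≤ T := by linarith
  have T0 : 0 < T := by linarith
  have hlT : 0 < Real.log T := Real.log_pos (by linarith)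
  have hl2 : 0 < Real.log 2 := Real.log_pos (by norm_num)
  obtain ⟨κ, hκ⟩ : ∃ κ, κ = Real.log 2 / (q * Real.log T) := ⟨_, rfl⟩
  have hκ0 : 0 < κ := by rw [hκ]; positivity
  have hTκq : T ^ (κ * q) = 2 := by
    rw [Real.rpow_def_of_pos T0, show Real.log T * (κ * q) = Real.log 2 by rw [hκ]; field_simp, Real.exp_log (by norm_num)]
  have hTκ : T ^ κ ≤ 2 := by
    rw [← hTκq]; exact Real.rpow_le_rpow_of_exponent_le hT1 (by nlinarith)
  obtain ⟨U, hU⟩ : ∃ U : EE n → ℝ, U = UU a0 T κ := ⟨_, rfl⟩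
  have Ulo : ∀ x, a0 x ≤ U x := fun x => by
    obtain ⟨-, -, -, hm⟩ := UU_att hu0 hT1 κ x
    rw [hU]; simpa using hm 1 ⟨le_rfl, hT1⟩
  have Uhi : ∀ x, U x ≤ T ^ κ * a0 x := fun x => by
    obtain ⟨t, ht, he, -⟩ := UU_att hu0 hT1 κ x
    rw [hU, he]
    exact mul_le_mul (Real.rpow_le_rpow (by linarith [ht.1]) ht.2 hκ0.le) (star t ht.1 x) (a00 _).1 (by positivity)
  have Uhi2 : ∀ x, U x ≤ 2 * a0 x := fun x => (Uhi x).trans (mul_le_mul_of_nonneg_right hTκ (a00 x).1)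
  have U0 : ∀ x, 0 ≤ U x := fun x => (a00 x).1.trans (Ulo x)
  have Uusc : UpperSemicontinuous U := by rw [hU]; exact UU_usc hu0 hT1 κ
  obtain ⟨v0, hv0⟩ : ∃ v : EE n → ℝ, v = fun x => (U x + η / 3) ^ (-q) := ⟨_, rfl⟩
  obtain ⟨v1, hv1⟩ : ∃ v : EE n → ℝ, v = fun x => (a1 x + η / 3) ^ (-q) := ⟨_, rfl⟩
  obtain ⟨V, hV⟩ : ∃ v : EE n → ℝ, v = fun x => (b x + η) ^ (-(q - 1)) := ⟨_, rfl⟩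
  have v0l : LowerSemicontinuous v0 := by rw [hv0]; exact lsc_neg_pow Uusc U0 hη0 q0
  have v1l : LowerSemicontinuous v1 := by rw [hv1]; exact lsc_neg_pow hu1 (fun x => (a11 x).1) hη0 q0
  have Vu : UpperSemicontinuous V := by rw [hV]; exact usc_neg_pow hlb b01 hη (by linarith)
  have V0 : ∀ x, 0 ≤ V x := fun x => by rw [hV]; exact Real.rpow_nonneg (by linarith [b01 x]) _
  have VB : ∀ x, V x ≤ η ^ (-(q - 1)) := fun x => by
    rw [hV]; exact Real.rpow_le_rpow_of_nonpos hη (by linarith [b01 x]) (by linarith)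
  have VB' : ∀ x, V x ≤ η ^ (-q) := fun x =>
    (VB x).trans (Real.rpow_le_rpow_of_exponent_ge hη hη1 (by linarith))
  have b0p : (0:ℝ) < 3 ^ (-q) := by positivity
  have v0b : ∀ x, (3:ℝ) ^ (-q) ≤ v0 x := fun x => by
    rw [hv0]; exact Real.rpow_le_rpow_of_nonpos (by linarith [U0 x]) (by linarith [Uhi2 x, (a00 x).2]) (by linarith)
  have v1b : ∀ x, (3:ℝ) ^ (-q) ≤ v1 x := fun x => by
    rw [hv1]; exact Real.rpow_le_rpow_of_nonpos (by linarith [(a11 x).1]) (by linarith [(a11 x).2]) (by linarith)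
  have v0p : ∀ x, 0 < v0 x := fun x => b0p.trans_le (v0b x)
  have v1p : ∀ x, 0 < v1 x := fun x => b0p.trans_le (v1b x)
  have far0 : ∀ x0 x, R0 ≤ ‖x0‖ → V x ≤ v0 x0 := fun x0 x h => by
    refine (VB' x).trans ?_
    rw [hv0]
    exact Real.rpow_le_rpow_of_nonpos (by linarith [U0 x0]) (by linarith [Uhi2 x0, hR00 x0 h]) (by linarith)
  have far1 : ∀ x1 x, R0 ≤ ‖x1‖ → V x ≤ v1 x1 := fun x1 x h => by
    refine (VB' x).trans ?_
    rw [hv1]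
    exact Real.rpow_le_rpow_of_nonpos (by linarith [(a11 x1).1]) (by linarith [hR01 x1 h]) (by linarith)
  have red : ∀ a x, 0 ≤ a → a ≤ 1 → a ≤ b x → V x ≤ 2 * (a + η / 3) ^ (-q) := fun a x h1 h2 h3 => by
    have pos : 0 < a + η / 3 := by linarith
    have e1 : V x ≤ (a + η / 3) ^ (-(q - 1)) := by
      rw [hV]; exact Real.rpow_le_rpow_of_nonpos pos (by linarith) (by linarith)
    refine e1.trans ?_
    rw [show -(q - 1) = 1 + -q by ring, Real.rpow_add pos, Real.rpow_one]
    exact mul_le_mul_of_nonneg_right (by linarith) (by positivity)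
  have bad0 : ∀ x0 x1, x0 ∈ D0 → V ((1 / 2 : ℝ) • (x0 + x1)) ≤ 2 * v1 x1 := fun x0 x1 h => by
    rw [hv1]; exact red _ _ (a11 x1).1 (a11 x1).2 (Z0 x0 h x1)
  have half : ∀ x, (a0 x + η / 3) ^ (-q) ≤ 2 * v0 x := fun x => by
    have pos : 0 < a0 x + η / 3 := by linarith [(a00 x).1]
    have T1 : 1 ≤ T ^ κ := Real.one_le_rpow hT1 hκ0.le
    have : (T ^ κ * (a0 x + η / 3)) ^ (-q) ≤ v0 x := by
      rw [hv0]
      refine Real.rpow_le_rpow_of_nonpos (by linarith [U0 x]) ?_ (by linarith)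
      have := Uhi x
      nlinarith
    rw [Real.mul_rpow (by positivity) pos.le, ← Real.rpow_mul T0.le, show κ * -q = -(κ * q) by ring,
      Real.rpow_neg T0.le, hTκq] at this
    linarith
  have bad1 : ∀ x0 x1, x1 ∈ D1 → V ((1 / 2 : ℝ) • (x0 + x1)) ≤ 4 * v0 x0 := fun x0 x1 h => by
    have := red _ _ (a00 x0).1 (a00 x0).2 (Z1 x1 h x0)
    linarith [half x0]
  -- good points
  have good : ∀ x0 x1, 4 * (v0 x0 + v1 x1) < V ((1 / 2 : ℝ) • (x0 + x1)) →
      (x0 ∈ ball 0 R0 ∩ D0ᶜ) ∧ (x1 ∈ ball 0 R0 ∩ D1ᶜ) := fun x0 x1 h => by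
    have p0 := v0p x0
    have p1 := v1p x1
    refine ⟨⟨?_, fun hh => ?_⟩, ⟨?_, fun hh => ?_⟩⟩
    · rw [mem_ball_zero_iff]; by_contra hh
      linarith [far0 x0 ((1 / 2 : ℝ) • (x0 + x1)) (by linarith)]
    · linarith [bad0 x0 x1 hh]
    · rw [mem_ball_zero_iff]; by_contra hh
      linarith [far1 x1 ((1 / 2 : ℝ) • (x0 + x1)) (by linarith)]
    · linarith [bad1 x0 x1 hh]
  have viol : 4 * (v0 y0 + v1 y1) < V ((1 / 2 : ℝ) • (y0 + y1)) := by
    refine lt_of_le_of_lt ?_ (by rw [hV]; exact hcon)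
    have : v0 y0 ≤ (a0 y0 + η / 3) ^ (-q) := by
      rw [hv0]; exact Real.rpow_le_rpow_of_nonpos (by linarith [(a00 y0).1]) (by linarith [Ulo y0]) (by linarith)
    rw [hv1] at *
    linarith
  -- hats
  obtain ⟨w0, hw0⟩ : ∃ v : EE n → ℝ, v = fun x => v0 x + hat R0 x := ⟨_, rfl⟩
  obtain ⟨w1, hw1⟩ : ∃ v : EE n → ℝ, v = fun x => v1 x + hat R0 x := ⟨_, rfl⟩
  have w0l : LowerSemicontinuous w0 := by rw [hw0]; exact v0l.add (hat_cont R0).lowerSemicontinuous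
  have w1l : LowerSemicontinuous w1 := by rw [hw1]; exact v1l.add (hat_cont R0).lowerSemicontinuous
  have w0v : ∀ x, v0 x ≤ w0 x := fun x => by rw [hw0]; linarith [hat_nonneg R0 x]
  have w1v : ∀ x, v1 x ≤ w1 x := fun x => by rw [hw1]; linarith [hat_nonneg R0 x]
  have w0e : ∀ x, ‖x‖ ≤ R0 → w0 x = v0 x := fun x h => by rw [hw0]; simp [hat_zero h]
  have w1e : ∀ x, ‖x‖ ≤ R0 → w1 x = v1 x := fun x h => by rw [hw1]; simp [hat_zero h]
  obtain ⟨F, hF⟩ : ∃ F : EE n × EE n → ℝ, F = fun z => V ((1 / 2 : ℝ) • (z.1 + z.2)) / (w0 z.1 + w1 z.2) := ⟨_, rfl⟩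
  have wp : ∀ z : EE n × EE n, 0 < w0 z.1 + w1 z.2 := fun z => by linarith [w0v z.1, w1v z.2, v0p z.1, v1p z.2]
  have Fu : UpperSemicontinuous F := by
    rw [hF]
    have c1 : Continuous (fun z : EE n × EE n => (1 / 2 : ℝ) • (z.1 + z.2)) := by fun_prop
    exact usc_quot (Vu.comp c1) ((w0l.comp continuous_fst).add (w1l.comp continuous_snd)) (fun z => V0 _) wp
  have FV : ∀ z, V ((1 / 2 : ℝ) • (z.1 + z.2)) = F z * (w0 z.1 + w1 z.2) := fun z => by
    rw [hF]; exact (div_mul_cancel₀ _ (wp z).ne').symm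
  have gy := good y0 y1 viol
  have Fy : 4 < F (y0, y1) := by
    rw [hF]
    show 4 < _ / _
    rw [lt_div_iff₀ (wp (y0, y1)), w0e y0 ((mem_ball_zero_iff.mp gy.1.1).le), w1e y1 ((mem_ball_zero_iff.mp gy.2.1).le)]
    exact viol
  obtain ⟨z, hz, hmax⟩ := UpperSemicontinuousOn.exists_isMaxOn (f := F) (s := closedBall (0 : EE n) R0 ×ˢ closedBall (0 : EE n) R0)
    ⟨(y0, y1), ⟨ball_subset_closedBall gy.1.1, ball_subset_closedBall gy.2.1⟩⟩
    ((isCompact_closedBall _ _).prod (isCompact_closedBall _ _)) (Fu.upperSemicontinuousOn _)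
  have Fz : 4 < F z := Fy.trans_le (hmax (show (y0, y1) ∈ _ from ⟨ball_subset_closedBall gy.1.1, ball_subset_closedBall gy.2.1⟩))
  have gmax : ∀ z', F z' ≤ F z := fun z' => by
    by_cases hz' : z' ∈ closedBall (0 : EE n) R0 ×ˢ closedBall (0 : EE n) R0
    · exact hmax hz'
    · refine le_trans ?_ (show (4:ℝ) ≤ F z from Fz.le)
      by_contra hc
      push Not at hc
      have e1 := FV z'
      have e2 := wp z'
      have := good z'.1 z'.2 (by rw [e1]; nlinarith [w0v z'.1, w1v z'.2])
      exact hz' ⟨ball_subset_closedBall this.1.1, ball_subset_closedBall this.2.1⟩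
  obtain ⟨k, hk⟩ : ∃ k, k = 1 / (2 * F z) := ⟨_, rfl⟩
  have Fz0 : 0 < F z := by linarith
  have k0 : 0 < k := by rw [hk]; positivity
  have kF : 2 * k * F z = 1 := by rw [hk]; field_simp
  refine abstract_compare (p := p) (c := (p - 1) * (1 + 1 / q)) (c' := (p - 1) * (1 + 1 / (q - 1))) (b0 := 3 ^ (-q))
    (C0 := R0 ^ 2) (B := k * η ^ (-(q - 1))) (γ := q * κ * c0 * (3 : ℝ) ^ (-q - 1) / R0) (v0 := w0) (v1 := w1)
    (V := fun x => k * V x) (O0 := ball 0 R0 ∩ D0ᶜ) (O1 := ball 0 R0 ∩ D1ᶜ) w0l w1l ?_ ?_ ?_ ?_ ?_ b0p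
    (fun x => (v0b x).trans (w0v x)) (fun x => (v1b x).trans (w1v x)) (isOpen_ball.inter hD0.isOpen_compl)
    (isOpen_ball.inter hD1.isOpen_compl) ?_ ?_ ?_ ?_ ?_ ?_ (by positivity) ?_ ?_ ?_
  · have : Continuous (fun t : ℝ => k * t) := by fun_prop
    exact this.comp_upperSemicontinuous Vu (fun s t h => mul_le_mul_of_nonneg_left h k0.le)
  · intro x; rw [hw0]; linarith [hat_ge (R := R0) x, v0p x]
  · intro x; rw [hw1]; linarith [hat_ge (R := R0) x, v1p x]
  · exact fun x => mul_le_mul_of_nonneg_left (VB x) k0.le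
  · exact fun x => mul_nonneg k0.le (V0 x)
  · intro x0 x1
    have e1 := FV (x0, x1)
    have e2 : F (x0, x1) * (w0 x0 + w1 x1) ≤ F z * (w0 x0 + w1 x1) := mul_le_mul_of_nonneg_right (gmax _) (wp (x0, x1)).le
    have e3 : V ((1 / 2 : ℝ) • (x0 + x1)) ≤ F z * (w0 x0 + w1 x1) := e1.le.trans e2
    have e4 := mul_le_mul_of_nonneg_left e3 (show 0 ≤ 2 * k by positivity)
    have e5 : 2 * k * (F z * (w0 x0 + w1 x1)) = w0 x0 + w1 x1 := by rw [← mul_assoc, kF, one_mul]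
    linarith
  · refine ⟨z.1, z.2, ?_⟩
    have e5 : 2 * k * (F z * (w0 z.1 + w1 z.2)) = w0 z.1 + w1 z.2 := by rw [← mul_assoc, kF, one_mul]
    rw [FV z]; linarith
  · intro x0 x1 h
    have e5 : F z * (2 * (k * V ((1 / 2 : ℝ) • (x0 + x1)))) = V ((1 / 2 : ℝ) • (x0 + x1)) := by
      have : F z * (2 * (k * V ((1 / 2 : ℝ) • (x0 + x1)))) = 2 * k * F z * V ((1 / 2 : ℝ) • (x0 + x1)) := by ring
      rw [this, kF, one_mul]
    rw [h] at e5
    refine good x0 x1 ?_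
    have e2 := wp (x0, x1)
    rw [← e5]
    have e3 : 4 * (w0 x0 + w1 x1) < F z * (w0 x0 + w1 x1) := mul_lt_mul_of_pos_right Fz e2
    linarith [w0v x0, w1v x1]
  · intro y hy
    obtain ⟨t, ht, he, -⟩ := UU_att hu0 hT1 κ y
    have t0 : 0 < t := by linarith [ht.1]
    have tk : 0 < t ^ κ := Real.rpow_pos_of_pos t0 κ
    have h1 := (S0 q (η / 3 / t ^ κ) q0 (by positivity) (t • y) (fun h => hy.2 (hKD (hst t ht.1 y h)))).scale
      (k := (t ^ κ) ^ (-q)) (by positivity) t0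
    have eW : ∀ x, (t ^ κ) ^ (-q) * (a0 (t • x) + η / 3 / t ^ κ) ^ (-q) = (t ^ κ * a0 (t • x) + η / 3) ^ (-q) := fun x => by
      rw [← Real.mul_rpow tk.le (by have := (a00 (t • x)).1; positivity)]
      congr 1; field_simp
    refine h1.congr_le ?_ ?_
    · filter_upwards [isOpen_ball.mem_nhds hy.1] with x hx
      rw [eW, w0e x ((mem_ball_zero_iff.mp hx).le), hv0]
      obtain ⟨-, -, -, hm⟩ := UU_att hu0 hT1 κ x
      refine Real.rpow_le_rpow_of_nonpos (by have := (a00 (t • x)).1; positivity) ?_ (by linarith)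
      rw [hU]; linarith [hm t ht]
    · rw [eW, w0e y ((mem_ball_zero_iff.mp hy.1).le), hv0, hU]
      show (UU a0 T κ y + η / 3) ^ (-q) = _
      rw [he]
  · intro y hy
    have h1 := S1 q (η / 3) q0 hη0 y hy.2
    rw [← hv1] at h1
    refine h1.congr_le ?_ (w1e y ((mem_ball_zero_iff.mp hy.1).le))
    filter_upwards [isOpen_ball.mem_nhds hy.1] with x hx
    exact (w1e x ((mem_ball_zero_iff.mp hx).le)).le
  · intro y
    have := (SV (q - 1) η (by linarith) hη y).scale k0
    rw [hV]; exact this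
  · intro y hy g Q hQ hTB
    have hyR : ‖y‖ ≤ R0 := (mem_ball_zero_iff.mp hy.1).le
    have hay := hlow y hyR
    have hTy : a0 (T • y) ≤ c0 / 4 := hR' _ (by
      rw [norm_smul, Real.norm_of_nonneg T0.le]
      exact hTR.trans (mul_le_mul_of_nonneg_left (hρD y hy.2) T0.le))
    refine UU_grad hu0 (fun x => (a00 x).1) hT1 q0 hη0 hκ0 hR0 (by linarith) hc0 hyR ?_ hay ?_ (Q := Q) ?_
    · have := mul_le_mul hTκ hTy (a00 _).1 (by norm_num)
      linarith
    · rw [← hU]; linarith [Uhi2 y, (a00 y).2]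
    · have ht' : Tendsto (fun h : EE n => y + h) (𝓝 0) (𝓝 y) := by
        have : Continuous (fun h : EE n => y + h) := by fun_prop
        simpa using this.tendsto 0
      filter_upwards [hTB, ht'.eventually (isOpen_ball.mem_nhds hy.1)] with h h1 h2
      rw [w0e _ hyR, w0e _ (by have := mem_ball_zero_iff.mp h2; exact this.le), hv0, hU] at h1
      exact h1
  · have : 0 < 1 / q := by positivity
    have : 0 < p - 1 := by linarith
    positivity
  · have : 1 / q < 1 / (q - 1) := one_div_lt_one_div_of_lt (by linarith) (by linarith)
    have : 0 < p - 1 := by linarith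
    nlinarith

end PB

end SPartH2

section SPartH3
open MeasureTheory Metric Set Filter
open scoped RealInnerProductSpace Pointwise Topology ENNReal NNReal
namespace PB
set_option linter.unusedSectionVars false

variable {n : ℕ} {p : ℝ}

lemma Pot.dec (hp : 1 < p) (hpn : p < n) {K : Set (EE n)} {f : ℕ → EE n → ℝ} {u : EE n → ℝ} {G : EE n → EE n}
    (h : Pot p K f u G) (hK : Bornology.IsBounded K) : ∀ ε > 0, ∃ R, ∀ x, R ≤ ‖x‖ → us u x ≤ ε := by
  intro ε hε
  obtain ⟨A, hA, R1, hR1, hd⟩ := h.decay hp hpn hK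
  have hb : 0 < ((n : ℝ) - p) / (p - 1) := div_pos (by linarith) (by linarith)
  have ht : Tendsto (fun r : ℝ => A * r ^ (-(((n : ℝ) - p) / (p - 1)))) atTop (𝓝 0) := by
    simpa using (tendsto_rpow_neg_atTop hb).const_mul A
  obtain ⟨R, hR⟩ := eventually_atTop.mp (ht.eventually (Iic_mem_nhds hε))
  exact ⟨max R1 R, fun x hx => (hd x ((le_max_left _ _).trans hx)).trans (hR _ ((le_max_right _ _).trans hx))⟩

lemma lim_abs {m B : ℝ} (hB : 0 < B) (hm : B < m)
    (h : ∀ q : ℝ, 1 < q → B ^ (-(q - 1)) ≤ 8 * m ^ (-q)) : False := by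
  have hm0 : 0 < m := hB.trans hm
  have h1 : 1 < m / B := by rw [one_lt_div hB]; exact hm
  obtain ⟨N, hN⟩ := pow_unbounded_of_one_lt (8 / m) h1
  have h2 : (m / B) ^ N < (m / B) ^ (N + 1) := pow_lt_pow_right₀ h1 (by omega)
  have h3 := h ((N + 1 : ℕ) + 1 : ℝ) (by have : (0:ℝ) < (N + 1 : ℕ) := by positivity
                                         linarith)
  rw [add_sub_cancel_right, Real.rpow_neg hB.le, Real.rpow_neg hm0.le, Real.rpow_add hm0, Real.rpow_natCast,
    Real.rpow_natCast, Real.rpow_one] at h3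
  have h4 : (m / B) ^ (N + 1) ≤ 8 / m := by
    rw [div_pow, div_eq_mul_inv]
    calc m ^ (N + 1) * (B ^ (N + 1))⁻¹ ≤ m ^ (N + 1) * (8 * (m ^ (N + 1) * m)⁻¹) :=
          mul_le_mul_of_nonneg_left h3 (by positivity)
      _ = 8 / m := by field_simp
  linarith

lemma min_le_ul (hp : 1 < p) (hpn : p < n) {K0 K1 L : Set (EE n)} {f0 f1 g : ℕ → EE n → ℝ} {u0 u1 w : EE n → ℝ}
    {G0 G1 W : EE n → EE n} (h0 : Pot p K0 f0 u0 G0) (h1 : Pot p K1 f1 u1 G1) (hw : Pot p L g w W)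
    (hK0 : IsCompact K0) (hK1 : IsCompact K1) (hL : Bornology.IsBounded L) (z0 : (0 : EE n) ∈ K0)
    (hst : ∀ k ∈ K0, ∀ s : ℝ, 0 ≤ s → s ≤ 1 → s • k ∈ K0) {ρ : ℝ} (hρ : 0 < ρ)
    (hin : ∀ k0 ∈ K0, ∀ k1 ∈ K1, ∀ c : EE n, ‖c‖ ≤ ρ → (1 / 2 : ℝ) • k0 + (1 / 2 : ℝ) • k1 + c ∈ L)
    (hC : 0 < cap p K0) (x : EE n) : min (us u0 x) (us u1 x) ≤ ul w x := by
  by_contra hcon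
  push Not at hcon
  have b0 := (hw.ul_bds hp hpn x).1
  obtain ⟨η, hη, hη1⟩ : ∃ η, 0 < η ∧ η < min 1 (min (us u0 x) (us u1 x) - ul w x) :=
    exists_between (lt_min one_pos (by linarith))
  have e1 := hη1.trans_le (min_le_left _ _)
  have e2 := hη1.trans_le (min_le_right _ _)
  have near : ∀ K : Set (EE n), IsCompact K → ∀ y ∈ cthickening ρ K, ∃ k ∈ K, dist y k ≤ ρ := fun K hK y hy => by
    rw [hK.cthickening_eq_biUnion_closedBall hρ.le] at hy
    simpa using hy
  refine lim_abs (B := ul w x + η) (m := min (us u0 x) (us u1 x)) (by linarith) (by linarith) fun q hq => ?_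
  have key := key_abs (p := p) (a0 := us u0) (a1 := us u1) (b := ul w) (K0 := K0) (D0 := cthickening ρ K0)
    (D1 := cthickening ρ K1) (ρ := ρ) (q := q) (η := η) hp (us_usc (h0.EB hp hpn)) (us_usc (h1.EB hp hpn))
    (ul_lsc (hw.EB hp hpn)) (h0.us_bds hp hpn) (h1.us_bds hp hpn) (fun x => (hw.ul_bds hp hpn x).1)
    (fun t ht x => h0.star hp hpn hK0.isBounded hst ht x) isClosed_cthickening isClosed_cthickening
    ?_ ?_ (self_subset_cthickening _) ?_ (fun q η hq hη y hy => h0.supV hp hpn hK0.isClosed hq hη hy)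
    (fun q η hq hη y hy => h1.supV hp hpn hK1.isClosed hq hη (fun h => hy (self_subset_cthickening _ h)))
    (fun q η hq hη y => hw.subV hp hpn hq hη y) hρ ?_ (h0.dec hp hpn hK0.isBounded) (h1.dec hp hpn hK1.isBounded)
    ?_ hq hη e1.le x x
  · have ex : (1 / 2 : ℝ) • (x + x) = x := by rw [← two_smul ℝ, smul_smul]; norm_num
    rw [ex] at key
    have mp : 0 < min (us u0 x) (us u1 x) := by linarith
    have k0 : (us u0 x + η / 3) ^ (-q) ≤ min (us u0 x) (us u1 x) ^ (-q) :=
      Real.rpow_le_rpow_of_nonpos mp (by linarith [min_le_left (us u0 x) (us u1 x)]) (by linarith)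
    have k1 : (us u1 x + η / 3) ^ (-q) ≤ min (us u0 x) (us u1 x) ^ (-q) :=
      Real.rpow_le_rpow_of_nonpos mp (by linarith [min_le_right (us u0 x) (us u1 x)]) (by linarith)
    linarith
  · intro x0 hx0 x1
    obtain ⟨k, hk, hd⟩ := near K0 hK0 x0 hx0
    rw [smul_add]
    refine h1.Z hp hpn hw hL (by norm_num) (half_pos hρ) (fun c hc k1 hk1 => ?_) x1
    have := hin k hk k1 hk1 (c - (1 / 2 : ℝ) • k) (by
      have : c - (1 / 2 : ℝ) • k = (c - (1 / 2 : ℝ) • x0) + (1 / 2 : ℝ) • (x0 - k) := by rw [smul_sub]; abel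
      rw [this]
      refine (norm_add_le _ _).trans ?_
      rw [norm_smul, ← dist_eq_norm, ← dist_eq_norm]; norm_num; linarith)
    convert this using 1; abel
  · intro x1 hx1 x0
    obtain ⟨k, hk, hd⟩ := near K1 hK1 x1 hx1
    rw [smul_add, add_comm]
    refine h0.Z hp hpn hw hL (by norm_num) (half_pos hρ) (fun c hc k1 hk1 => ?_) x0
    have := hin k1 hk1 k hk (c - (1 / 2 : ℝ) • k) (by
      have : c - (1 / 2 : ℝ) • k = (c - (1 / 2 : ℝ) • x1) + (1 / 2 : ℝ) • (x1 - k) := by rw [smul_sub]; abel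
      rw [this]
      refine (norm_add_le _ _).trans ?_
      rw [norm_smul, ← dist_eq_norm, ← dist_eq_norm]; norm_num; linarith)
    convert this using 1; abel
  · intro t ht y hy
    have t0 : 0 < t := by linarith
    have := hst _ hy t⁻¹ (by positivity) (inv_le_one_of_one_le₀ ht)
    rwa [smul_smul, inv_mul_cancel₀ t0.ne', one_smul] at this
  · intro y hy
    by_contra hc
    push Not at hc
    exact hy (mem_cthickening_of_dist_le y 0 ρ K0 z0 (by rw [dist_zero_right]; exact hc.le))
  · intro R
    obtain ⟨c, hc, h⟩ := h0.exists_lower hp hpn hK0.isBounded hC R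
    exact ⟨c, hc, fun x hx => h x (mem_closedBall_zero_iff.mpr hx)⟩

/-- Brunn Minkowski type inequality with room. -/
lemma bm_room (hp : 1 < p) (hpn : p < n) {K0 K1 L : Set (EE n)} 
    (hK0 : IsCompact K0) (hK1 : IsCompact K1) (hL : Bornology.IsBounded L) (z0 : (0 : EE n) ∈ K0)
    (hst : ∀ k ∈ K0, ∀ s : ℝ, 0 ≤ s → s ≤ 1 → s • k ∈ K0) {ρ : ℝ} (hρ : 0 < ρ)
    (hin : ∀ k0 ∈ K0, ∀ k1 ∈ K1, ∀ c : EE n, ‖c‖ ≤ ρ → (1 / 2 : ℝ) • k0 + (1 / 2 : ℝ) • k1 + c ∈ L)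
    {M : ℝ} (hM : 0 < M) (hM0 : M ≤ cap p K0) (hM1 : M ≤ cap p K1) : M ≤ cap p L := by
  obtain ⟨f0, u0, G0, h0⟩ := exists_pot hp hpn hK0.isBounded
  obtain ⟨f1, u1, G1, h1⟩ := exists_pot hp hpn hK1.isBounded
  obtain ⟨g, w, W, hw⟩ := exists_pot hp hpn hL
  exact cap_of_le hp hpn h0 h1 hw hK0.isBounded hK1.isBounded hM hM0 hM1
    (min_le_ul hp hpn h0 h1 hw hK0 hK1 hL z0 hst hρ hin (hM.trans_le hM0))

end PB

end SPartH3

section SPartI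
open MeasureTheory Metric Set Filter
open scoped RealInnerProductSpace Pointwise Topology ENNReal NNReal
namespace PB
set_option linter.unusedSectionVars false

variable {n : ℕ} {p : ℝ}

lemma cap_outer (hp : 1 < p) {K : Set (EE n)} (hK : IsCompact K) {ε : ℝ} (hε : 0 < ε) :
    ∃ U : Set (EE n), IsOpen U ∧ K ⊆ U ∧ ∀ L ⊆ U, cap p L < cap p K + ε := by
  obtain ⟨u, hu, h1, h2⟩ := exists_near_cap (p := p) hK.isBounded hε
  have ht : Tendsto (fun s : ℝ => s ^ p * ∫ x, ‖gradient u x‖ ^ p) (𝓝[>] 1) (𝓝 ((1:ℝ) ^ p * ∫ x, ‖gradient u x‖ ^ p)) := by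
    have : ContinuousAt (fun s : ℝ => s ^ p * ∫ x, ‖gradient u x‖ ^ p) 1 :=
      (Real.continuousAt_rpow_const 1 p (Or.inl one_ne_zero)).mul continuousAt_const
    exact this.tendsto.mono_left nhdsWithin_le_nhds
  rw [Real.one_rpow, one_mul] at ht
  obtain ⟨s, hs1, hs2⟩ := ((ht.eventually (Iio_mem_nhds h2)).and self_mem_nhdsWithin).exists
  have hs1 : s ^ p * ∫ x, ‖gradient u x‖ ^ p < cap p K + ε := hs1
  have hs2 : 1 < s := hs2
  have s0 : 0 < s := by linarith
  refine ⟨{x | 1 < s * u x}, isOpen_lt continuous_const (hu.cont.const_mul s |>.congr fun x => rfl), fun x hx => ?_, fun L hL => ?_⟩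
  · have := h1 x hx
    show 1 < s * u x
    nlinarith
  · refine lt_of_le_of_lt (cap_le (hu.const_mul s) fun x hx => (show 1 < s * u x from hL hx).le) ?_
    refine lt_of_eq_of_lt ?_ hs1
    rw [← integral_const_mul]
    congr 1
    ext x
    rw [grad_const_mul (hu.diff x), norm_smul, Real.norm_of_nonneg s0.le, Real.mul_rpow s0.le (norm_nonneg _)]

/-- Brunn Minkowski type inequality. -/
lemma bm (hp : 1 < p) (hpn : p < n) {K0 K1 Q : Set (EE n)}
    (hK0 : IsCompact K0) (hK1 : IsCompact K1) (hQ : IsCompact Q) (z0 : (0 : EE n) ∈ K0)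
    (hst : ∀ k ∈ K0, ∀ s : ℝ, 0 ≤ s → s ≤ 1 → s • k ∈ K0)
    (hin : ∀ k0 ∈ K0, ∀ k1 ∈ K1, (1 / 2 : ℝ) • k0 + (1 / 2 : ℝ) • k1 ∈ Q)
    {M : ℝ} (hM : 0 < M) (hM0 : M ≤ cap p K0) (hM1 : M ≤ cap p K1) : M ≤ cap p Q := by
  refine le_of_forall_pos_le_add fun ε hε => ?_
  obtain ⟨U, hU, hQU, hc⟩ := cap_outer hp hQ hε
  obtain ⟨ρ, hρ, hρU⟩ := hQ.exists_cthickening_subset_open hU hQU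
  refine le_trans ?_ (hc _ hρU).le
  refine bm_room hp hpn hK0 hK1 (hQ.isBounded.cthickening) z0 hst hρ (fun k0 h0 k1 h1 c hcc => ?_) hM hM0 hM1
  refine mem_cthickening_of_dist_le _ _ ρ Q (hin k0 h0 k1 h1) ?_
  rw [dist_eq_norm, add_sub_cancel_left]; exact hcc

section poly
variable {m : ℕ} {ξ : Fin m → EE n}

lemma mem_polyP {y : Fin m → ℝ} {x : EE n} : x ∈ polyP ξ y ↔ ∀ i, ⟪x, ξ i⟫ ≤ y i := by
  simp [polyP]

lemma exists_kappa (hn : 2 ≤ n) (hhemi : ¬ ∃ v : EE n, ‖v‖ = 1 ∧ ∀ i, ⟪ξ i, v⟫ ≤ 0) :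
    0 < m ∧ ∃ κ > 0, ∀ y : Fin m → ℝ, polyP ξ y ⊆ closedBall 0 (‖y‖ / κ) := by
  haveI : Nonempty (Fin n) := ⟨⟨0, by omega⟩⟩
  haveI : Nontrivial (EE n) := inferInstance
  have hne : (sphere (0 : EE n) 1).Nonempty := NormedSpace.sphere_nonempty.mpr zero_le_one
  have hm : 0 < m := by
    rcases Nat.eq_zero_or_pos m with h | h
    · subst h
      obtain ⟨v, hv⟩ := hne
      exact (hhemi ⟨v, by simpa using hv, fun i => i.elim0⟩).elim
    · exact h
  refine ⟨hm, ?_⟩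
  haveI : Nonempty (Fin m) := ⟨⟨0, hm⟩⟩
  obtain ⟨v, hv, hmin⟩ := (isCompact_sphere (0 : EE n) 1).exists_isMinOn hne
    (f := fun v => Finset.univ.sup' Finset.univ_nonempty fun i => ⟪v, ξ i⟫)
    (Continuous.continuousOn (Continuous.finset_sup'_apply _ fun i _ => by fun_prop))
  obtain ⟨κ, hκ⟩ : ∃ κ, κ = Finset.univ.sup' Finset.univ_nonempty fun i => ⟪v, ξ i⟫ := ⟨_, rfl⟩
  have hκ0 : 0 < κ := by
    by_contra hc
    push Not at hc
    refine hhemi ⟨v, by simpa using hv, fun i => ?_⟩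
    rw [real_inner_comm]
    exact (Finset.le_sup' (fun i => ⟪v, ξ i⟫) (Finset.mem_univ i)).trans (hκ ▸ hc)
  refine ⟨κ, hκ0, fun y x hx => ?_⟩
  rw [mem_polyP] at hx
  rw [mem_closedBall_zero_iff, le_div_iff₀ hκ0]
  by_cases h0 : x = 0
  · subst h0; simp
  have hx0 : 0 < ‖x‖ := norm_pos_iff.mpr h0
  have h1 := hmin (show ‖x‖⁻¹ • x ∈ sphere (0 : EE n) 1 by simp [norm_smul, hx0.ne'])
  have h1 : κ ≤ Finset.univ.sup' Finset.univ_nonempty fun i => ⟪‖x‖⁻¹ • x, ξ i⟫ := by rw [hκ]; exact h1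
  obtain ⟨i, -, hi⟩ := Finset.exists_mem_eq_sup' (Finset.univ_nonempty (α := Fin m)) (fun i => ⟪‖x‖⁻¹ • x, ξ i⟫)
  rw [hi, real_inner_smul_left, ← div_eq_inv_mul, le_div_iff₀ hx0] at h1
  have h2 : y i ≤ ‖y‖ := (le_abs_self _).trans (norm_le_pi_norm y i)
  linarith [hx i]

lemma polyP_closed_graph : IsClosed {z : (Fin m → ℝ) × EE n | z.2 ∈ polyP ξ z.1} := by
  have : {z : (Fin m → ℝ) × EE n | z.2 ∈ polyP ξ z.1} = ⋂ i, {z : (Fin m → ℝ) × EE n | ⟪z.2, ξ i⟫ ≤ z.1 i} := by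
    ext z; simp [mem_polyP]
  rw [this]
  exact isClosed_iInter fun i => isClosed_le (by fun_prop) (by fun_prop)

lemma polyP_isCompact {κ : ℝ} (hκ : ∀ y : Fin m → ℝ, polyP ξ y ⊆ closedBall 0 (‖y‖ / κ)) (y : Fin m → ℝ) :
    IsCompact (polyP ξ y) := by
  refine Metric.isCompact_of_isClosed_isBounded ?_ (isBounded_closedBall.subset (hκ y))
  exact polyP_closed_graph.preimage (f := fun x : EE n => (y, x)) (by fun_prop)

lemma polyP_usc (hp : 1 < p) {κ : ℝ} (hκ0 : 0 < κ) (hκ : ∀ y : Fin m → ℝ, polyP ξ y ⊆ closedBall 0 (‖y‖ / κ)) :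
    UpperSemicontinuous (fun y => cap p (polyP ξ y)) := by
  intro y s hs
  have hs : cap p (polyP ξ y) < s := hs
  obtain ⟨U, hU, hPU, hc⟩ := cap_outer hp (polyP_isCompact hκ y) (ε := s - cap p (polyP ξ y)) (by linarith)
  have hC : IsCompact ({z : (Fin m → ℝ) × EE n | z.2 ∈ polyP ξ z.1} ∩ ((closedBall y 1) ×ˢ (closedBall 0 ((‖y‖ + 1) / κ) ∩ Uᶜ))) :=
    IsCompact.inter_left (((isCompact_closedBall _ _)).prod ((isCompact_closedBall _ _).inter_right hU.isClosed_compl)) polyP_closed_graph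
  have hO := (hC.image continuous_fst).isClosed.isOpen_compl
  have hy : y ∈ (Prod.fst '' ({z : (Fin m → ℝ) × EE n | z.2 ∈ polyP ξ z.1} ∩ ((closedBall y 1) ×ˢ (closedBall 0 ((‖y‖ + 1) / κ) ∩ Uᶜ))))ᶜ := by
    rintro ⟨⟨y', x⟩, ⟨h1, h2⟩, rfl⟩
    exact h2.2.2 (hPU h1)
  filter_upwards [hO.mem_nhds hy, closedBall_mem_nhds y one_pos] with z hz hz1
  have := hc (polyP ξ z) (fun x hx => by
    by_contra hxU
    refine hz ⟨(z, x), ⟨hx, hz1, ?_, hxU⟩, rfl⟩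
    refine closedBall_subset_closedBall ?_ (hκ z hx)
    have : ‖z‖ ≤ ‖y‖ + 1 := by
      have e : ‖z - y‖ ≤ 1 := by rw [← dist_eq_norm]; exact mem_closedBall.mp hz1
      have := norm_add_le (z - y) y
      rw [sub_add_cancel] at this
      linarith
    gcongr)
  linarith

lemma cap_polyP_smul {y : Fin m → ℝ} {t : ℝ} (ht : 0 < t) (hb : Bornology.IsBounded (polyP ξ (t • y))) :
    cap p (polyP ξ y) = t ^ p * (t ^ n)⁻¹ * cap p (polyP ξ (t • y)) := by
  rw [← cap_tr (b := 0) (O := LinearIsometryEquiv.refl ℝ _) ht hb]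
  congr 1
  ext x
  simp only [mem_preimage, Tm, mem_polyP, zero_add, LinearIsometryEquiv.coe_refl, id, real_inner_smul_left, Pi.smul_apply,
    smul_eq_mul]
  exact forall_congr' fun i => (mul_le_mul_iff_right₀ ht).symm

lemma constr_compact (hp : 1 < p) {a : ℝ} (ha : 0 < a) {c : Fin m → ℝ} (hc : ∀ i, 0 < c i) :
    IsCompact {y : Fin m → ℝ | (∀ i, 0 ≤ y i) ∧ a * ∑ i, c i * y i ^ p = 1} := by
  have hp0 : 0 < p := by linarith
  refine IsCompact.of_isClosed_subset (isCompact_univ_pi fun i => isCompact_Icc (a := (0:ℝ)) (b := (1 / (a * c i)) ^ (1 / p))) ?_ ?_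
  · refine IsClosed.inter (s₁ := {y : Fin m → ℝ | ∀ i, 0 ≤ y i}) (s₂ := {y : Fin m → ℝ | a * ∑ i, c i * y i ^ p = 1}) ?_ ?_
    · have : {y : Fin m → ℝ | ∀ i, 0 ≤ y i} = ⋂ i, {y | 0 ≤ y i} := by ext; simp
      rw [this]
      exact isClosed_iInter fun i => isClosed_le continuous_const (continuous_apply i)
    · refine isClosed_eq (continuous_const.mul (continuous_finsetSum _ fun i _ => continuous_const.mul ?_)) continuous_const
      exact (continuous_apply i).rpow_const fun x => Or.inr hp0.le
  · rintro y ⟨h0, h1⟩ i -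
    refine ⟨h0 i, ?_⟩
    have h2 : c i * y i ^ p ≤ ∑ i, c i * y i ^ p :=
      Finset.single_le_sum (f := fun i => c i * y i ^ p) (fun j _ => mul_nonneg (hc j).le (Real.rpow_nonneg (h0 j) p)) (Finset.mem_univ i)
    have h3 : y i ^ p ≤ 1 / (a * c i) := by
      rw [le_div_iff₀ (mul_pos ha (hc i))]
      have := mul_le_mul_of_nonneg_left h2 ha.le
      nlinarith
    have h4 := Real.rpow_le_rpow (Real.rpow_nonneg (h0 i) p) h3 (show 0 ≤ 1 / p by positivity)
    rwa [← Real.rpow_mul (h0 i), mul_one_div_cancel hp0.ne', Real.rpow_one] at h4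

lemma scale_constr {r a : ℝ} {c y : Fin m → ℝ} (hr : 1 < r) (h0 : ∀ i, 0 ≤ y i) {s : ℝ} (hs : 0 < s)
    (h : a * ∑ i, c i * y i ^ r = s) :
    a * ∑ i, c i * ((s ^ (-(1 / r))) • y) i ^ r = 1 := by
  have r0 : r ≠ 0 := by linarith
  have e : ∀ i, c i * ((s ^ (-(1 / r))) • y) i ^ r = s⁻¹ * (c i * y i ^ r) := fun i => by
    rw [Pi.smul_apply, smul_eq_mul, Real.mul_rpow (by positivity) (h0 i), ← Real.rpow_mul hs.le,
      show -(1 / r) * r = -1 by field_simp, Real.rpow_neg_one]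
    ring
  simp only [e]
  rw [← Finset.mul_sum, mul_left_comm, h, inv_mul_cancel₀ hs.ne']

theorem main (hn : 2 ≤ n) {r : ℝ} (hr : 1 < r) (hp : 1 < p) (hpn : p < n) (hξ : ∀ i, ‖ξ i‖ = 1)
    (hhemi : ¬ ∃ v : EE n, ‖v‖ = 1 ∧ ∀ i, ⟪ξ i, v⟫ ≤ 0) {a : ℝ} (ha : 0 < a) {c : Fin m → ℝ} (hc : ∀ i, 0 < c i) :
    ∃ y : Fin m → ℝ, ((∀ i, 0 ≤ y i) ∧ a * ∑ i, c i * y i ^ r = 1) ∧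
      ∀ z : Fin m → ℝ, (∀ i, 0 ≤ z i) → a * ∑ i, c i * z i ^ r = 1 →
        pCap n p (polyP ξ z) ≤ pCap n p (polyP ξ y) ∧ (pCap n p (polyP ξ z) = pCap n p (polyP ξ y) → z = y) := by
  obtain ⟨hm, κ, hκ0, hκ⟩ := exists_kappa hn hhemi
  haveI : Nonempty (Fin m) := ⟨⟨0, hm⟩⟩
  have hcomp := polyP_isCompact hκ
  have hS := constr_compact (p := r) hr ha hc
  have hcs : 0 < a * ∑ i, c i * (1 : Fin m → ℝ) i ^ r := by
    refine mul_pos ha (Finset.sum_pos (fun i _ => ?_) Finset.univ_nonempty)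
    simpa using hc i
  have h10 : ∀ i, 0 ≤ (1 : Fin m → ℝ) i := fun i => zero_le_one
  obtain ⟨t0, ht0, ht1⟩ : ∃ t0 : ℝ, 0 < t0 ∧ a * ∑ i, c i * (t0 • (1 : Fin m → ℝ)) i ^ r = 1 :=
    ⟨_, Real.rpow_pos_of_pos hcs _, scale_constr hr h10 hcs rfl⟩
  have hmem : t0 • (1 : Fin m → ℝ) ∈ {y : Fin m → ℝ | (∀ i, 0 ≤ y i) ∧ a * ∑ i, c i * y i ^ r = 1} :=
    ⟨fun i => by simp [ht0.le], ht1⟩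
  obtain ⟨y, hy, hmax⟩ := UpperSemicontinuousOn.exists_isMaxOn ⟨_, hmem⟩ hS ((polyP_usc (p := p) hp hκ0 hκ).upperSemicontinuousOn _)
  have hmax' : ∀ z : Fin m → ℝ, (∀ i, 0 ≤ z i) → a * ∑ i, c i * z i ^ r = 1 → cap p (polyP ξ z) ≤ cap p (polyP ξ y) :=
    fun z h1 h2 => hmax (show z ∈ {y : Fin m → ℝ | (∀ i, 0 ≤ y i) ∧ a * ∑ i, c i * y i ^ r = 1} from ⟨h1, h2⟩)
  have hM : 0 < cap p (polyP ξ y) := by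
    refine lt_of_lt_of_le (cap_ball_pos hp hpn ht0) ((cap_mono (hcomp _).isBounded ?_).trans (hmax' _ hmem.1 hmem.2))
    intro x hx
    rw [mem_polyP]
    intro i
    have h1 := real_inner_le_norm x (ξ i)
    rw [hξ i, mul_one] at h1
    have h2 := mem_closedBall_zero_iff.mp hx
    simpa using h1.trans h2
  refine ⟨y, hy, fun z hz0 hz1 => ?_⟩
  rw [pCap_eq_cap hp (hcomp z).isBounded, pCap_eq_cap hp (hcomp y).isBounded]
  refine ⟨hmax' z hz0 hz1, fun heq => ?_⟩
  by_contra hne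
  obtain ⟨w, hw⟩ : ∃ w : Fin m → ℝ, w = fun i => (1 / 2 : ℝ) * y i + (1 / 2 : ℝ) * z i := ⟨_, rfl⟩
  have hwi : ∀ i, w i = (1 / 2 : ℝ) * y i + (1 / 2 : ℝ) * z i := fun i => by rw [hw]
  have hw0 : ∀ i, 0 ≤ w i := fun i => by rw [hwi]; linarith [hy.1 i, hz0 i]
  have hcw : cap p (polyP ξ y) ≤ cap p (polyP ξ w) := by
    refine bm hp hpn (hcomp y) (hcomp z) (hcomp w) ?_ ?_ ?_ hM le_rfl heq.ge
    · rw [mem_polyP]; intro i; simpa using hy.1 i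
    · intro k hk s hs0 hs1
      rw [mem_polyP] at hk ⊢
      intro i
      rw [real_inner_smul_left]
      nlinarith [hk i, hy.1 i]
    · intro k0 hk0 k1 hk1
      rw [mem_polyP] at *
      intro i
      rw [inner_add_left, real_inner_smul_left, real_inner_smul_left, hwi]
      linarith [hk0 i, hk1 i]
  have hsc := strictConvexOn_rpow hr
  obtain ⟨j, hj⟩ : ∃ j, z j ≠ y j := by
    by_contra hcon
    push Not at hcon
    exact hne (funext hcon)
  have hlt : ∑ i, c i * w i ^ r < ∑ i, ((1 / 2 : ℝ) * (c i * y i ^ r) + (1 / 2 : ℝ) * (c i * z i ^ r)) := by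
    refine Finset.sum_lt_sum (fun i _ => ?_) ⟨j, Finset.mem_univ j, ?_⟩
    · have := hsc.convexOn.2 (hy.1 i) (hz0 i) (show (0:ℝ) ≤ 1 / 2 by norm_num) (show (0:ℝ) ≤ 1 / 2 by norm_num) (by norm_num)
      simp only [smul_eq_mul] at this
      rw [hwi]
      have := mul_le_mul_of_nonneg_left this (hc i).le
      linarith
    · have := hsc.2 (hy.1 j) (hz0 j) hj.symm (show (0:ℝ) < 1 / 2 by norm_num) (show (0:ℝ) < 1 / 2 by norm_num) (by norm_num)
      simp only [smul_eq_mul] at this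
      rw [hwi]
      have := mul_lt_mul_of_pos_left this (hc j)
      linarith
  rw [Finset.sum_add_distrib, ← Finset.mul_sum, ← Finset.mul_sum] at hlt
  obtain ⟨s, hs⟩ : ∃ s, a * ∑ i, c i * w i ^ r = s := ⟨_, rfl⟩
  have hs1 : s < 1 := by
    have h1 := mul_lt_mul_of_pos_left hlt ha
    have h2 := hy.2
    rw [hs] at h1
    have h3 : a * (1 / 2 * ∑ i, c i * y i ^ r + 1 / 2 * ∑ i, c i * z i ^ r) = 1 / 2 * (a * ∑ i, c i * y i ^ r) + 1 / 2 * (a * ∑ i, c i * z i ^ r) := by ring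
    rw [h3, h2, hz1] at h1
    linarith
  have hs0 : 0 < s := by
    rw [← hs]
    refine mul_pos ha (Finset.sum_pos' (fun i _ => mul_nonneg (hc i).le (Real.rpow_nonneg (hw0 i) r)) ⟨j, Finset.mem_univ j, ?_⟩)
    refine mul_pos (hc j) (Real.rpow_pos_of_pos ?_ r)
    rw [hwi]
    rcases lt_or_gt_of_ne hj with h | h
    · linarith [hz0 j]
    · linarith [hy.1 j]
  obtain ⟨t, ht⟩ : ∃ t : ℝ, t = s ^ (-(1 / r)) := ⟨_, rfl⟩
  have ht1 : 1 < t := by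
    have hr0 : 0 < 1 / r := by positivity
    rw [ht]; exact Real.one_lt_rpow_of_pos_of_lt_one_of_neg hs0 hs1 (by linarith)
  have htp : 0 < t := by linarith
  have hcon := scale_constr hr hw0 hs0 hs
  rw [← ht] at hcon
  have hle := hmax' (t • w) (fun i => by
    rw [Pi.smul_apply, smul_eq_mul]; exact mul_nonneg htp.le (hw0 i)) hcon
  have hsm := cap_polyP_smul (p := p) (y := w) htp (hcomp (t • w)).isBounded
  have hk : t ^ p * (t ^ n)⁻¹ < 1 := by
    rw [← div_eq_mul_inv, div_lt_one (by positivity), ← Real.rpow_natCast]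
    exact Real.rpow_lt_rpow_of_exponent_lt ht1 hpn
  have hk0 : 0 < t ^ p * (t ^ n)⁻¹ := by positivity
  nlinarith

end poly

end PB

end SPartI

theorem stmt7 (n m : ℕ) (hn : 2 ≤ n) (p 𝔭 : ℝ) (hp : 1 < p) (h𝔭1 : 1 < 𝔭) (h𝔭n : 𝔭 < (n : ℝ))
    (ξ : Fin m → EuclideanSpace ℝ (Fin n)) (hξ : ∀ i, ‖ξ i‖ = 1)
    (hdist : Function.Injective ξ)
    (hhemi : ¬ ∃ v : EuclideanSpace ℝ (Fin n), ‖v‖ = 1 ∧ ∀ i, ⟪ξ i, v⟫ ≤ 0)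
    (c : Fin m → ℝ) (hc : ∀ i, 0 < c i) :
    ∃! yt : Fin m → ℝ, (∀ i, 0 ≤ yt i) ∧
      (𝔭 - 1) / ((n : ℝ) - 𝔭) * ∑ i, c i * yt i ^ p = 1 ∧
      ∀ y : Fin m → ℝ, (∀ i, 0 ≤ y i) →
        (𝔭 - 1) / ((n : ℝ) - 𝔭) * ∑ i, c i * y i ^ p = 1 →
        pCap n 𝔭 (polyP ξ y) ≤ pCap n 𝔭 (polyP ξ yt) ∧
        (pCap n 𝔭 (polyP ξ y) = pCap n 𝔭 (polyP ξ yt) → y = yt) := by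
  have ha : 0 < (𝔭 - 1) / ((n : ℝ) - 𝔭) := div_pos (by linarith) (by linarith)
  obtain ⟨y, ⟨hy0, hy1⟩, hy2⟩ := PB.main hn hp h𝔭1 h𝔭n hξ hhemi ha hc
  refine ⟨y, ⟨hy0, hy1, hy2⟩, ?_⟩
  rintro z ⟨hz0, hz1, hz2⟩
  have h1 := hy2 z hz0 hz1
  have h2 := hz2 y hy0 hy1
  exact h1.2 (le_antisymm h1.1 h2.1)
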